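/- Let r := √2 − 1 and L' := 4·√(2r/(1 + 2r)). For every FM-tetrahedron T of type 111r (radii r_A = r_B = r_C = 1 and r_D = r) and every weighted tetrahedron T₀ with radii (1,1,1,r) and edge lengths dist(A,B) = L', dist(A,C) = dist(B,C) = 2, and dist(A,D) = dist(B,D) = dist(C,D) = 1 + r (five tight edges and one stretched edge of length L' ≈ 2.692 between two large spheres), one has δ(T) ≤ δ(T₀). -/

import Mathlib

open MeasureTheory Metric

noncomputable def tetra (A B C D : EuclideanSpace ℝ (Fin 3)) :
    Set (EuclideanSpace ℝ (Fin 3)) :=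
  convexHull ℝ {A, B, C, D}

noncomputable def density (A B C D : EuclideanSpace ℝ (Fin 3)) (rA rB rC rD : ℝ) : ℝ :=
  (volume (tetra A B C D ∩
    (closedBall A rA ∪ closedBall B rB ∪ closedBall C rC ∪ closedBall D rD))).toReal /
  (volume (tetra A B C D)).toReal


/-- half-edge contribution; `c`, `l`, `K` are parameters. -/
noncomputable def gg (c l K h d x : ℝ) : ℝ :=
  -Real.arctan (d / h) + c * Real.arctan (d * √(h^2 + d^2 + x^2) / (x * h))
    + l * Real.arctan (d / x) - K * h * d * x

theorem gg_neg (c l K h d x : ℝ) : gg c l K h (-d) x = -gg c l K h d x := by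
  unfold gg
  have e1 : -d / h = -(d / h) := by ring
  have e2 : -d / x = -(d / x) := by ring
  have e3 : -d * √(h^2 + (-d)^2 + x^2) / (x * h) = -(d * √(h^2 + d^2 + x^2) / (x * h)) := by
    rw [neg_sq]; ring
  rw [e1, e2, e3, Real.arctan_neg, Real.arctan_neg, Real.arctan_neg]; ring

theorem hasDerivAt_at3 {h d x h' d' x' : ℝ} {H D X : ℝ → ℝ} {t : ℝ}
    (hH : HasDerivAt H h' t) (hD : HasDerivAt D d' t) (hX : HasDerivAt X x' t)
    (eH : H t = h) (eD : D t = d) (eX : X t = x) (hh : 0 < h) (hx : 0 < x) :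
    HasDerivAt (fun t => Real.arctan (D t * √((H t)^2 + (D t)^2 + (X t)^2) / (X t * H t)))
      (-(d * x / ((h^2+d^2) * √(h^2 + d^2 + x^2))) * h'
        + (h * x / ((h^2+d^2) * √(h^2 + d^2 + x^2))
            + x * h / ((d^2+x^2) * √(h^2 + d^2 + x^2))) * d'
        - d * h / ((d^2+x^2) * √(h^2 + d^2 + x^2)) * x') t := by
  have hs0 : 0 < h^2 + d^2 + x^2 := by positivity
  have h1 : HasDerivAt (fun t => (H t)^2 + (D t)^2 + (X t)^2)
      (2 * h * h' + 2 * d * d' + 2 * x * x') t := by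
    have := ((hH.fun_pow 2).fun_add (hD.fun_pow 2)).fun_add (hX.fun_pow 2)
    refine this.congr_deriv ?_
    rw [eH, eD, eX]; push_cast; ring
  have h2 := h1.sqrt (by rw [eH, eD, eX]; exact hs0.ne')
  have h3 := ((hD.fun_mul h2).fun_div (hX.fun_mul hH) (by rw [eX, eH]; positivity)).arctan
  refine h3.congr_deriv ?_
  simp only [eH, eD, eX]
  set s := √(h^2 + d^2 + x^2) with hs
  have hsp : 0 < s := Real.sqrt_pos.mpr hs0
  have hss : s^2 = h^2 + d^2 + x^2 := Real.sq_sqrt hs0.le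
  have e0 : 1 + (d * s / (x * h))^2 = (h^2+d^2)*(d^2+x^2) / (x*h)^2 := by
    field_simp
    rw [hss]; ring
  have hw : 0 < h^2 + d^2 := by positivity
  have hr : 0 < d^2 + x^2 := by positivity
  rw [e0]
  clear_value s
  field_simp
  rw [hss]; ring

theorem hasDerivAt_gg {c l K h d x h' d' x' : ℝ} {H D X : ℝ → ℝ} {t : ℝ}
    (hH : HasDerivAt H h' t) (hD : HasDerivAt D d' t) (hX : HasDerivAt X x' t)
    (eH : H t = h) (eD : D t = d) (eX : X t = x) (hh : 0 < h) (hx : 0 < x) :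
    HasDerivAt (fun t => gg c l K (H t) (D t) (X t))
      ((d / (h^2+d^2) * (1 - c * x / √(h^2 + d^2 + x^2)) - K * d * x) * h'
        + (-(h / (h^2+d^2)) * (1 - c * x / √(h^2 + d^2 + x^2))
            + x / (d^2+x^2) * (c * h / √(h^2 + d^2 + x^2) + l) - K * h * x) * d'
        + (-(d / (d^2+x^2)) * (c * h / √(h^2 + d^2 + x^2) + l) - K * h * d) * x') t := by
  have hs0 : 0 < h^2 + d^2 + x^2 := by positivity
  have hsp : 0 < √(h^2 + d^2 + x^2) := Real.sqrt_pos.mpr hs0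
  have hw : 0 < h^2 + d^2 := by positivity
  have hr : 0 < d^2 + x^2 := by positivity
  have a1 := (hD.fun_div hH (by rw [eH]; positivity)).arctan
  have a3 := hasDerivAt_at3 hH hD hX eH eD eX hh hx
  have a2 := (hD.fun_div hX (by rw [eX]; positivity)).arctan
  have a4 := ((hH.const_mul K).fun_mul hD).fun_mul hX
  have a := ((a1.fun_neg.fun_add (a3.const_mul c)).fun_add (a2.const_mul l)).fun_sub a4
  refine a.congr_deriv ?_
  simp only [eH, eD, eX]
  have e1 : 1 + (d/h)^2 = (h^2+d^2)/h^2 := by field_simp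
  have e2 : 1 + (d/x)^2 = (d^2+x^2)/x^2 := by field_simp; ring
  rw [e1, e2]
  generalize √(h^2 + d^2 + x^2) = s at *
  field_simp
  ring

theorem at3_sub {h d s x : ℝ} (hh : 0 < h) (hx : 0 < x) (hxs : x ≤ s) :
    Real.arctan (d * s / (x * h)) =
      Real.arctan (d / h) + Real.arctan ((s - x) * ((d/h) / (x + (d/h)^2 * s))) := by
  have hs : 0 < s := hx.trans_le hxs
  have hp : 0 < x + (d/h)^2 * s := by positivity
  rw [Real.arctan_add]
  · congr 1
    have : 1 - d / h * ((s - x) * (d / h / (x + (d / h) ^ 2 * s))) = (x * (1 + (d/h)^2)) / (x + (d/h)^2 * s) := by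
      generalize d / h = τ at *
      field_simp; ring
    rw [this]
    have e : d * s / (x * h) = (d / h) * s / x := by field_simp
    rw [e]
    generalize d / h = τ at *
    have : 0 < 1 + τ^2 := by positivity
    field_simp
    ring
  · have e : d / h * ((s - x) * (d / h / (x + (d / h) ^ 2 * s))) = ((s-x) * (d/h)^2) / (x + (d/h)^2 * s) := by
      ring
    rw [e, div_lt_one hp]
    nlinarith [sq_nonneg (d/h)]

/-- the split form of `gg`. -/
theorem gg_split {c l K h d x : ℝ} (hh : 0 < h) (hx : 0 < x) :
    gg c l K h d x =
      Real.arctan ((√(h^2 + d^2 + x^2) - x) * ((d/h) / (x + (d/h)^2 * √(h^2 + d^2 + x^2))))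
      + (c - 1) * Real.arctan (d * √(h^2 + d^2 + x^2) / (x * h))
      + l * Real.arctan (d / x) - K * h * d * x := by
  have hxs : x ≤ √(h^2 + d^2 + x^2) := Real.le_sqrt_of_sq_le (by nlinarith)
  unfold gg
  rw [at3_sub hh hx hxs]; ring

theorem gg_anti {c l K h d S x y : ℝ} (hh : 0 < h) (hd : 0 ≤ d) (hx : 0 < x) (hxy : x ≤ y)
    (hc : 0 ≤ c) (hK : 0 ≤ K) (hS : 0 ≤ S) (hyS : h^2 + d^2 + y^2 ≤ S^2) (hl : -l * S ≤ c * h) :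
    gg c l K h d y ≤ gg c l K h d x := by
  have hder : ∀ z, 0 < z → HasDerivAt (fun z => gg c l K h d z)
      (-(d / (d^2+z^2)) * (c * h / √(h^2 + d^2 + z^2) + l) - K * h * d) z := by
    intro z hz
    refine (hasDerivAt_gg (hasDerivAt_const z h) (hasDerivAt_const z d) (hasDerivAt_id z)
      rfl rfl rfl hh hz).congr_deriv (by simp)
  have : AntitoneOn (fun z => gg c l K h d z) (Set.Icc x y) := by
    apply antitoneOn_of_deriv_nonpos (convex_Icc x y)
    · intro z hz
      exact (hder z (hx.trans_le hz.1)).continuousAt.continuousWithinAt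
    · intro z hz
      rw [interior_Icc] at hz
      exact (hder z (hx.trans hz.1)).differentiableAt.differentiableWithinAt
    · intro z hz
      rw [interior_Icc] at hz
      have hz0 := hx.trans hz.1
      rw [(hder z hz0).deriv]
      have hs : 0 < √(h^2+d^2+z^2) := Real.sqrt_pos.mpr (by positivity)
      have hsS : √(h^2+d^2+z^2) ≤ S := by
        apply Real.sqrt_le_iff.mpr ⟨hS, _⟩
        nlinarith [hz.2]
      have hq : 0 ≤ c * h / √(h^2 + d^2 + z^2) + l := by
        rw [div_add' _ _ _ hs.ne']
        apply div_nonneg _ hs.le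
        rcases le_total 0 l with h0 | h0
        · positivity
        · nlinarith
      have : 0 ≤ d / (d^2+z^2) * (c * h / √(h^2 + d^2 + z^2) + l) := by positivity
      have : 0 ≤ K * h * d := by positivity
      linarith
  exact this (Set.left_mem_Icc.mpr hxy) (Set.right_mem_Icc.mpr hxy) hxy

theorem gg_convex {c l K h d S x y : ℝ} (hh : 0 < h) (hd : 0 ≤ d) (hx : 0 < x)
    (hc : 0 ≤ c) (hS : 0 ≤ S) (hyS : h^2 + d^2 + y^2 ≤ S^2) (hl : -l * S ≤ c * h) :
    ConvexOn ℝ (Set.Icc x y) (fun z => gg c l K h d z) := by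
  have hder : ∀ z, 0 < z → HasDerivAt (fun z => gg c l K h d z)
      (-(d / (d^2+z^2)) * (c * h / √(h^2 + d^2 + z^2) + l) - K * h * d) z := by
    intro z hz
    refine (hasDerivAt_gg (hasDerivAt_const z h) (hasDerivAt_const z d) (hasDerivAt_id z)
      rfl rfl rfl hh hz).congr_deriv (by simp)
  apply MonotoneOn.convexOn_of_deriv (convex_Icc x y)
  · intro z hz
    exact (hder z (hx.trans_le hz.1)).continuousAt.continuousWithinAt
  · intro z hz
    rw [interior_Icc] at hz
    exact (hder z (hx.trans hz.1)).differentiableAt.differentiableWithinAt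
  · rw [interior_Icc]
    intro z hz z' hz' hzz
    have hz0 := hx.trans hz.1
    have hz0' := hx.trans hz'.1
    rw [(hder z hz0).deriv, (hder z' hz0').deriv]
    have hs : 0 < √(h^2+d^2+z^2) := Real.sqrt_pos.mpr (by positivity)
    have hs' : 0 < √(h^2+d^2+z'^2) := Real.sqrt_pos.mpr (by positivity)
    have hsS : √(h^2+d^2+z'^2) ≤ S := by
      apply Real.sqrt_le_iff.mpr ⟨hS, _⟩
      nlinarith [hz'.2]
    have hss : √(h^2+d^2+z^2) ≤ √(h^2+d^2+z'^2) := by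
      apply Real.sqrt_le_sqrt; nlinarith
    have hq : 0 ≤ c * h / √(h^2 + d^2 + z'^2) + l := by
      rw [div_add' _ _ _ hs'.ne']
      apply div_nonneg _ hs'.le
      rcases le_total 0 l with h0 | h0
      · positivity
      · nlinarith
    have h1 : c * h / √(h^2 + d^2 + z'^2) ≤ c * h / √(h^2 + d^2 + z^2) := by
      apply div_le_div_of_nonneg_left (by positivity) hs hss
    have h2 : d / (d^2+z'^2) ≤ d / (d^2+z^2) := by
      apply div_le_div_of_nonneg_left hd (by positivity) (by nlinarith)
    have h3 : d / (d^2+z'^2) * (c * h / √(h^2 + d^2 + z'^2) + l)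
        ≤ d / (d^2+z^2) * (c * h / √(h^2 + d^2 + z^2) + l) := by
      apply mul_le_mul h2 (by linarith) hq (by positivity)
    linarith

/-- two-point convexity with fixed larger sum -/
theorem convex_pair {f : ℝ → ℝ} {a b x y : ℝ} (hf : ConvexOn ℝ (Set.Icc a b) f)
    (hax : a ≤ x) (hxb : x ≤ b) (hs : x + y = a + b) : f x + f y ≤ f a + f b := by
  rcases eq_or_lt_of_le (hax.trans hxb) with hab | hab
  · have : x = a := le_antisymm (hab ▸ hxb) hax
    have : y = b := by linarith
    subst_vars; rfl
  set t := (b - x) / (b - a) with ht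
  have hba : 0 < b - a := by linarith
  have t0 : 0 ≤ t := div_nonneg (by linarith) hba.le
  have t1 : 0 ≤ 1 - t := by
    rw [ht, sub_nonneg, div_le_one hba]; linarith
  have ha : a ∈ Set.Icc a b := ⟨le_rfl, hab.le⟩
  have hb : b ∈ Set.Icc a b := ⟨hab.le, le_rfl⟩
  have e1 := hf.2 ha hb t0 t1 (by ring)
  have e2 := hf.2 ha hb t1 t0 (by ring)
  have htm : t * (b - a) = b - x := by rw [ht]; field_simp
  have x1 : t • a + (1 - t) • b = x := by simp only [smul_eq_mul]; linarith
  have x2 : (1 - t) • a + t • b = y := by simp only [smul_eq_mul]; linarith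
  rw [x1] at e1; rw [x2] at e2
  simp only [smul_eq_mul] at e1 e2
  linarith

theorem gg_pair {c l K h d S S2 xl x y : ℝ} (hh : 0 < h) (hd : 0 ≤ d) (hxl : 0 < xl)
    (hx : xl ≤ x) (hy : xl ≤ y) (hxy : 2 ≤ x + y)
    (hc : 0 ≤ c) (hK : 0 ≤ K) (hS : 0 ≤ S) (hxS : h^2 + d^2 + x^2 ≤ S^2)
    (hyS : h^2 + d^2 + y^2 ≤ S^2) (hl : -l * S ≤ c * h) (hx1 : xl ≤ 1)
    (hS2 : 0 ≤ S2) (hS2' : h^2 + d^2 + (2 - xl)^2 ≤ S2^2) (hl2 : -l * S2 ≤ c * h) :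
    gg c l K h d x + gg c l K h d y ≤ gg c l K h d xl + gg c l K h d (2 - xl) := by
  wlog hle : x ≤ y generalizing x y
  · have := this hy hx (by linarith) hyS hxS (by linarith)
    linarith
  rcases le_total (2 - xl) y with h1 | h1
  · have a1 := gg_anti (l := l) (K := K) hh hd hxl hx hc hK hS hxS hl
    have a2 := gg_anti (l := l) (K := K) hh hd (by linarith : 0 < 2 - xl) h1 hc hK hS hyS hl
    linarith
  · have a1 := gg_anti (l := l) (K := K) hh hd (by linarith : 0 < 2 - y) (by linarith : 2 - y ≤ x)
      hc hK hS hxS hl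
    have := convex_pair (gg_convex (l := l) (K := K) hh hd hxl hc hS2 hS2' hl2)
      (by linarith : xl ≤ 2 - y) (by linarith) (by ring : (2 - y) + y = xl + (2 - xl))
    linarith

theorem gg_negpair {c l K h d S S2 x y x' : ℝ} (hh : 0 < h) (hd : 0 ≤ d)
    (hx : 0 < x) (hy : 0 < y) (hxy : x + y ≤ 2 * x')
    (hc : 0 ≤ c) (hK : 0 ≤ K) (hS : 0 ≤ S) (hxS : h^2 + d^2 + x^2 ≤ S^2)
    (hyS : h^2 + d^2 + y^2 ≤ S^2) (hl : -l * S ≤ c * h)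
    (hS2 : 0 ≤ S2) (hS2' : h^2 + d^2 + x'^2 ≤ S2^2) (hl2 : -l * S2 ≤ c * h) :
    2 * gg c l K h d x' ≤ gg c l K h d x + gg c l K h d y := by
  wlog hle : x ≤ y generalizing x y
  · have := this hy hx (by linarith) hyS hxS (by linarith)
    linarith
  have h1 := (gg_convex (l := l) (K := K) hh hd hx hc hS hyS hl).2
    ⟨le_rfl, hle⟩ ⟨hle, le_rfl⟩ (by norm_num : (0:ℝ) ≤ 1/2) (by norm_num : (0:ℝ) ≤ 1/2) (by norm_num)
  simp only [smul_eq_mul] at h1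
  have h2 := gg_anti (l := l) (K := K) hh hd (by linarith : 0 < 1/2 * x + 1/2 * y)
    (by linarith : 1/2 * x + 1/2 * y ≤ x') hc hK hS2 hS2' hl2
  linarith

theorem gg_mono_param {c l K c' l' K' h d x : ℝ} (hh : 0 < h) (hd : 0 ≤ d) (hx : 0 < x)
    (hc : c ≤ c') (hl : l ≤ l') (hK : K' ≤ K) : gg c l K h d x ≤ gg c' l' K' h d x := by
  unfold gg
  have a1 : 0 ≤ Real.arctan (d * √(h^2 + d^2 + x^2) / (x * h)) := Real.arctan_nonneg.mpr (by positivity)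
  have a2 : 0 ≤ Real.arctan (d / x) := Real.arctan_nonneg.mpr (by positivity)
  have a3 : 0 ≤ h * d * x := by positivity
  nlinarith [mul_le_mul_of_nonneg_right hc a1, mul_le_mul_of_nonneg_right hl a2,
    mul_le_mul_of_nonneg_right hK a3]

/-! Directed-rounding fixed point arithmetic, scale 2^32. -/
noncomputable def vl (n : ℕ) : ℝ := (n : ℝ) / 4294967296

theorem vl_nonneg (n : ℕ) : 0 ≤ vl n := by unfold vl; positivity
theorem vl_add (a b : ℕ) : vl (Nat.add a b) = vl a + vl b := by
  unfold vl; rw [Nat.add_eq]; push_cast; ring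
theorem vl_mono {a b : ℕ} (h : a ≤ b) : vl a ≤ vl b := by
  unfold vl; gcongr
theorem vl_sub_le (a b : ℕ) : vl a - vl b ≤ vl (Nat.sub a b) := by
  unfold vl; rw [Nat.sub_eq, ← sub_div]; gcongr
  rw [sub_le_iff_le_add]; exact_mod_cast (by omega : a ≤ a - b + b)
theorem vl_sub {a b : ℕ} (h : b ≤ a) : vl (Nat.sub a b) = vl a - vl b := by
  unfold vl; rw [Nat.sub_eq, Nat.cast_sub h, sub_div]

def mL (a b : ℕ) : ℕ := Nat.div (Nat.mul a b) 4294967296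
def mU (a b : ℕ) : ℕ := Nat.succ (Nat.div (Nat.mul a b) 4294967296)
def dL (a b : ℕ) : ℕ := Nat.div (Nat.mul a 4294967296) b
def dU (a b : ℕ) : ℕ := Nat.succ (Nat.div (Nat.mul a 4294967296) b)

theorem div_le_real (a b : ℕ) : ((Nat.div a b : ℕ) : ℝ) ≤ (a : ℝ) / b := Nat.cast_div_le
theorem real_le_div (a b : ℕ) (hb : 0 < b) : (a : ℝ) / b ≤ (Nat.succ (Nat.div a b) : ℕ) := by
  rw [div_le_iff₀ (by exact_mod_cast hb)]
  have : a < (a / b + 1) * b := by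
    have := Nat.lt_div_mul_add hb (a := a); linarith
  have h2 : (a:ℝ) < ((a / b + 1 : ℕ) : ℝ) * b := by exact_mod_cast this
  exact h2.le

theorem mL_le (a b : ℕ) : vl (mL a b) ≤ vl a * vl b := by
  have := div_le_real (Nat.mul a b) 4294967296
  unfold vl mL
  rw [Nat.mul_eq] at *
  push_cast at *
  calc _ ≤ ((a:ℝ) * b / 4294967296) / 4294967296 := by gcongr
    _ = _ := by ring
theorem le_mU (a b : ℕ) : vl a * vl b ≤ vl (mU a b) := by
  have := real_le_div (Nat.mul a b) 4294967296 (by norm_num)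
  unfold vl mU
  rw [Nat.mul_eq] at *
  push_cast at *
  calc _ = ((a:ℝ) * b / 4294967296) / 4294967296 := by ring
    _ ≤ _ := by gcongr
theorem dL_le (a b : ℕ) : vl (dL a b) ≤ vl a / vl b := by
  have := div_le_real (Nat.mul a 4294967296) b
  unfold vl dL
  rw [Nat.mul_eq] at *
  push_cast at *
  calc _ ≤ ((a:ℝ) * 4294967296 / b) / 4294967296 := by gcongr
    _ = _ := by rw [div_div_div_cancel_right₀ (by norm_num)]; field_simp
theorem le_dU (a b : ℕ) (hb : 0 < b) : vl a / vl b ≤ vl (dU a b) := by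
  have := real_le_div (Nat.mul a 4294967296) b hb
  unfold vl dU
  rw [Nat.mul_eq] at *
  push_cast at *
  calc _ = ((a:ℝ) * 4294967296 / b) / 4294967296 := by
        rw [div_div_div_cancel_right₀ (by norm_num)]; field_simp
    _ ≤ _ := by gcongr

def newton (fuel n g : Nat) : Nat :=
  Nat.rec (motive := fun _ => Nat → Nat) (fun g => g)
    (fun _ ih g => (fun g' => cond (Nat.ble g g') g (ih g')) (Nat.div (Nat.add g (Nat.div n g)) 2)) fuel g
/-- argument at scale 2^64 -/
def sqL (n : Nat) : Nat :=
  (fun g => cond (Nat.ble (Nat.mul g g) n) g 0) (newton 14 n (Nat.add (Nat.div n 8589934592) 2147483648))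
def sqU (n : Nat) : Nat :=
  (fun g => cond (Nat.ble n (Nat.mul g g)) g (Nat.succ n)) (Nat.succ (newton 14 n (Nat.add (Nat.div n 8589934592) 2147483648)))

theorem sqL_aux (n g : ℕ) :
    (cond (Nat.ble (Nat.mul g g) n) g 0) * (cond (Nat.ble (Nat.mul g g) n) g 0) ≤ n := by
  cases h : Nat.ble (Nat.mul g g) n
  · simp
  · simpa using Nat.le_of_ble_eq_true h
theorem sqL_le (n : ℕ) : sqL n * sqL n ≤ n := sqL_aux n _
theorem sqU_aux (n g : ℕ) :
    n ≤ (cond (Nat.ble n (Nat.mul g g)) g (Nat.succ n)) * (cond (Nat.ble n (Nat.mul g g)) g (Nat.succ n)) := by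
  cases h : Nat.ble n (Nat.mul g g)
  · simp only [cond_false]; nlinarith [Nat.succ_eq_add_one n]
  · simpa using Nat.le_of_ble_eq_true h
theorem le_sqU (n : ℕ) : n ≤ sqU n * sqU n := sqU_aux n _

/-- square at scale 2^64 -/
noncomputable def v2 (n : ℕ) : ℝ := (n : ℝ) / 18446744073709551616
theorem v2_mul (a b : ℕ) : v2 (Nat.mul a b) = vl a * vl b := by
  unfold v2 vl; rw [Nat.mul_eq]; push_cast; ring
theorem v2_add (a b : ℕ) : v2 (Nat.add a b) = v2 a + v2 b := by
  unfold v2; rw [Nat.add_eq]; push_cast; ring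
theorem v2_mono {a b : ℕ} (h : a ≤ b) : v2 a ≤ v2 b := by
  unfold v2; gcongr
theorem v2_sub_cases (a b : ℕ) : v2 (Nat.sub a b) = 0 ∨ v2 (Nat.sub a b) = v2 a - v2 b := by
  rcases le_total a b with h | h
  · left; unfold v2; rw [Nat.sub_eq, Nat.sub_eq_zero_of_le h]; simp
  · right; unfold v2; rw [Nat.sub_eq, Nat.cast_sub h, sub_div]
theorem v2_sub_le (a b : ℕ) : v2 a - v2 b ≤ v2 (Nat.sub a b) := by
  unfold v2; rw [Nat.sub_eq, ← sub_div]; gcongr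
  rw [sub_le_iff_le_add]; exact_mod_cast (by omega : a ≤ a - b + b)
theorem sqL_v (n : ℕ) : vl (sqL n) ^ 2 ≤ v2 n := by
  rw [sq, ← v2_mul]; exact v2_mono (sqL_le n)
theorem sqU_v (n : ℕ) : v2 n ≤ vl (sqU n) ^ 2 := by
  rw [sq, ← v2_mul]; exact v2_mono (le_sqU n)

/-! arctangent -/
noncomputable def P13 (x : ℝ) : ℝ :=
  x * ((3465 * x^12 + 5005 * x^8 + 9009 * x^4 + 45045) - x^2 * (4095 * x^8 + 6435 * x^4 + 15015)) / 45045

theorem P13_bounds {x : ℝ} (hx : 0 ≤ x) :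
    Real.arctan x ≤ P13 x ∧ P13 x ≤ Real.arctan x + x^15/15 := by
  have hd : ∀ t : ℝ, HasDerivAt P13 (1 - t^2 + t^4 - t^6 + t^8 - t^10 + t^12) t := by
    intro t
    unfold P13
    have : HasDerivAt (fun x : ℝ => x - x^3/3 + x^5/5 - x^7/7 + x^9/9 - x^11/11 + x^13/13)
      (1 - t^2 + t^4 - t^6 + t^8 - t^10 + t^12) t := by
      have := ((((((hasDerivAt_id t).fun_sub ((hasDerivAt_pow 3 t).div_const 3)).fun_add
        ((hasDerivAt_pow 5 t).div_const 5)).fun_sub ((hasDerivAt_pow 7 t).div_const 7)).fun_add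
        ((hasDerivAt_pow 9 t).div_const 9)).fun_sub ((hasDerivAt_pow 11 t).div_const 11)).fun_add
        ((hasDerivAt_pow 13 t).div_const 13)
      refine this.congr_deriv ?_
      norm_num
    convert this using 1
    funext x; ring
  have key : ∀ f f' : ℝ → ℝ, (∀ t, HasDerivAt f (f' t) t) → f 0 = 0 → (∀ t, 0 ≤ f' t) → 0 ≤ f x := by
    intro f f' h1 h0 h2
    have : Monotone f := monotone_of_deriv_nonneg (fun t => (h1 t).differentiableAt)
      (fun t => by rw [(h1 t).deriv]; exact h2 t)
    have := this hx
    rwa [h0] at this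
  constructor
  · have := key (fun t => P13 t - Real.arctan t) _ (fun t => (hd t).fun_sub (Real.hasDerivAt_arctan t))
      (by simp [P13]) (fun t => by
        have : 1 - t^2 + t^4 - t^6 + t^8 - t^10 + t^12 - 1/(1+t^2) = t^14/(1+t^2) := by
          field_simp; ring
        rw [this]; positivity)
    linarith
  · have := key (fun t => Real.arctan t + t^15/15 - P13 t) _
      (fun t => ((Real.hasDerivAt_arctan t).fun_add ((hasDerivAt_pow 15 t).div_const 15)).fun_sub (hd t))
      (by simp [P13]) (fun t => by
        have : 1/(1+t^2) + (15:ℕ) * t^14/15 - (1 - t^2 + t^4 - t^6 + t^8 - t^10 + t^12) = t^16/(1+t^2) := by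
          field_simp; push_cast; ring
        rw [show (15-1) = 14 from rfl, this]; positivity)
    linarith

def atP (v : Nat) : Nat := Nat.add (Nat.mul (Nat.add (Nat.mul (Nat.add (Nat.mul 3465 v) 1703113246439297009634189910195999898337280) v) 1043170931938981604570951003943269361850109291852755841431473374327289384926183424) v) 1774863369116589316117109361310969083849816855438116045157730876394248537197091851991155623451291025040134557823370526720
def atQ (v : Nat) : Nat := Nat.add (Nat.mul (Nat.add (Nat.mul 4095 v) 2189717031136239012386815598823428440719360) v) 1738618219898302674284918339905448936416848819754593069052455623878815641543639040
/-- scaled Taylor polynomial of arctan -/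
def atT (u : Nat) : Nat :=
  (fun v => (fun vv => Nat.div (Nat.mul u (Nat.sub (atP vv) (Nat.mul (Nat.mul v 18446744073709551616) (atQ vv)))) 1774863369116589316117109361310969083849816855438116045157730876394248537197091851991155623451291025040134557823370526720) (Nat.mul v v)) (Nat.mul u u)

theorem P13_aux {x : ℝ} (hx0 : 0 ≤ x) (hb : x ≤ 0.4142137) :
    x^2 * (4095 * x^8 + 6435 * x^4 + 15015) ≤ 3465 * x^12 + 5005 * x^8 + 9009 * x^4 + 45045 := by
  have h2 : x^2 ≤ 0.18 := by nlinarith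
  have h0 : 0 ≤ x^2 := sq_nonneg x
  have h4 : x^4 ≤ 0.0324 := by nlinarith
  have h40 : 0 ≤ x^4 := by positivity
  have h8 : x^8 ≤ 0.0324 := by nlinarith
  have h80 : 0 ≤ x^8 := by positivity
  have : 0 ≤ x^12 := by positivity
  nlinarith

set_option exponentiation.threshold 600 in
theorem atT_bounds {u : ℕ} (hu : u ≤ 1779034000) :
    Real.arctan (vl u) - vl 1 ≤ vl (atT u) ∧ vl (atT u) ≤ Real.arctan (vl u) + vl 522 := by
  have hux : (u : ℝ) = vl u * 2^32 := by unfold vl; ring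
  have hb : vl u ≤ 0.4142137 := by
    have : (u:ℝ) ≤ 1779034000 := by exact_mod_cast hu
    unfold vl; linarith
  have hx0 := vl_nonneg u
  set x := vl u with hx
  obtain ⟨b1, b2⟩ := P13_bounds hx0
  set N := Nat.mul (Nat.mul u u) (Nat.mul u u) with hN
  set P := atP N with hP
  set Q := Nat.mul (Nat.mul (Nat.mul u u) 18446744073709551616) (atQ N) with hQ
  have hNr : (N : ℝ) = x^4 * 2^128 := by rw [hN]; simp only [Nat.mul_eq]; push_cast; rw [hux]; ring
  have hPr : (P : ℝ) = (3465 * x^12 + 5005 * x^8 + 9009 * x^4 + 45045) * 2^384 := by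
    rw [hP, atP]; simp only [Nat.mul_eq, Nat.add_eq]; push_cast; rw [hNr]; ring
  have hQr : (Q : ℝ) = x^2 * (4095 * x^8 + 6435 * x^4 + 15015) * 2^384 := by
    rw [hQ, atQ]; simp only [Nat.mul_eq, Nat.add_eq]; push_cast; rw [hNr, hux]; ring
  have hle : Q ≤ P := by
    have : (Q:ℝ) ≤ P := by
      rw [hPr, hQr]
      exact mul_le_mul_of_nonneg_right (P13_aux hx0 hb) (by positivity)
    exact_mod_cast this
  have hT : atT u = Nat.div (Nat.mul u (Nat.sub P Q)) 1774863369116589316117109361310969083849816855438116045157730876394248537197091851991155623451291025040134557823370526720 := rfl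
  have hsub : ((Nat.sub P Q : ℕ) : ℝ) = P - Q := by rw [Nat.sub_eq, Nat.cast_sub hle]
  have hval : ((Nat.mul u (Nat.sub P Q) : ℕ) : ℝ) / ((1774863369116589316117109361310969083849816855438116045157730876394248537197091851991155623451291025040134557823370526720 : ℕ) : ℝ) = P13 x * 2^32 := by
    rw [Nat.mul_eq, Nat.cast_mul, hsub, hPr, hQr, hux, P13]; push_cast
    rw [div_eq_iff (by positivity)]; ring
  have l1 := div_le_real (Nat.mul u (Nat.sub P Q)) 1774863369116589316117109361310969083849816855438116045157730876394248537197091851991155623451291025040134557823370526720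
  have l2 := real_le_div (Nat.mul u (Nat.sub P Q)) 1774863369116589316117109361310969083849816855438116045157730876394248537197091851991155623451291025040134557823370526720 (by norm_num)
  rw [hval, ← hT] at l1 l2
  rw [Nat.cast_succ] at l2
  have h15 : x^15 ≤ 0.4142137^15 := by gcongr
  constructor
  · unfold vl; push_cast
    rw [← sub_nonneg]
    have : 0 ≤ ((atT u : ℝ) + 1 - P13 x * 2^32) / 4294967296 := by
      apply div_nonneg _ (by norm_num); linarith
    linarith
  · unfold vl; push_cast
    have : 0 ≤ (P13 x * 2^32 - (atT u : ℝ)) / 4294967296 := by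
      apply div_nonneg _ (by norm_num); linarith
    have h6 : (0.4142137:ℝ)^15/15 ≤ 521/4294967296 := by norm_num
    linarith

def atG (Q A B P1 P2 Q2 u : Nat) : Nat :=
  cond (Nat.ble u A) (atT u)
   (cond (Nat.ble u B)
     (cond (Nat.ble u Q)
       (Nat.sub P1 (atT (Nat.div (Nat.mul (Nat.sub Q u) Q) (Nat.add Q u))))
       (Nat.add P1 (atT (Nat.div (Nat.mul (Nat.sub u Q) Q) (Nat.add Q u)))))
     (Nat.sub P2 (atT (Nat.div Q2 u))))
def atN (u : Nat) : Nat :=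
  atG 4294967296 1779033704 10368968600 3373259426 6746518852 18446744073709551616 u
def atU (u : ℕ) : ℕ := Nat.add (atN u) 530
def atL (u : ℕ) : ℕ := Nat.sub (atN u) 530

theorem arctan_lip {a b : ℝ} (h : a ≤ b) : Real.arctan b - Real.arctan a ≤ b - a := by
  have : Monotone (fun t : ℝ => t - Real.arctan t) := by
    apply monotone_of_deriv_nonneg (fun t => (differentiableAt_id.fun_sub (Real.differentiableAt_arctan t)))
    intro t
    have := ((hasDerivAt_id t).fun_sub (Real.hasDerivAt_arctan t)).deriv
    simp only [id] at this ⊢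
    rw [this, sub_nonneg, div_le_one (by positivity)]
    nlinarith [sq_nonneg t]
  have := this h
  simp only at this
  linarith

theorem atT_bounds' {n d : ℕ} {t : ℝ} (hd : 0 < d) (ht : (n : ℝ) / d = t * 4294967296) (hle : Nat.div n d ≤ 1779034000) :
    Real.arctan t - vl 2 ≤ vl (atT (Nat.div n d)) ∧ vl (atT (Nat.div n d)) ≤ Real.arctan t + vl 522 := by
  obtain ⟨a, b⟩ := atT_bounds hle
  have l1 := div_le_real n d
  have l2 := real_le_div n d hd
  rw [ht] at l1 l2
  rw [Nat.cast_succ] at l2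
  have e1 : vl (Nat.div n d) ≤ t := by unfold vl; linarith
  have e2 : t ≤ vl (Nat.div n d) + vl 1 := by unfold vl; push_cast; linarith
  have e3 := Real.arctan_strictMono.monotone e1
  have e4 := arctan_lip e1
  have e5 : vl 2 = vl 1 + vl 1 := by unfold vl; push_cast; norm_num
  constructor <;> linarith

theorem arctan_quot {a b : ℝ} (ha : 0 < a) (hb : 0 ≤ b) :
    Real.arctan ((a - b)/(a + b)) = Real.pi/4 - Real.arctan (b/a) := by
  have h : Real.arctan ((a - b)/(a + b)) + Real.arctan (b / a) = Real.arctan 1 := by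
    rw [Real.arctan_add]
    · congr 1
      have : a + b ≠ 0 := by positivity
      have h2 : 1 - (a - b)/(a+b) * (b/a) = (a^2+b^2)/((a+b)*a) := by field_simp; ring
      rw [h2]
      have : 0 < a^2+b^2 := by positivity
      field_simp
      ring
    · have hab : 0 < a + b := by positivity
      rw [div_mul_div_comm, div_lt_one (by positivity)]
      nlinarith [sq_nonneg b, mul_pos ha ha]
  rw [Real.arctan_one] at h
  linarith

theorem cond_elim {P : ℕ → Prop} (b : Bool) (x y : ℕ) (hx : b = true → P x) (hy : b = false → P y) :
    P (cond b x y) := by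
  cases b
  · exact hy rfl
  · exact hx rfl

theorem atG_bounds (Q A B P1 P2 Q2 u : ℕ) (eQ : Q = 4294967296) (eA : A = 1779033704) (eB : B = 10368968600) (eP1 : P1 = 3373259426) (eP2 : P2 = 6746518852) (eQ2 : Q2 = 18446744073709551616) :
    Real.arctan (vl u) - vl 530 ≤ vl (atG Q A B P1 P2 Q2 u) ∧ vl (atG Q A B P1 P2 Q2 u) ≤ Real.arctan (vl u) + vl 530 := by
  have hpi1 := Real.pi_gt_d20
  have hpi2 := Real.pi_lt_d20
  have rQ : (Q:ℝ) = 4294967296 := by rw [eQ]; norm_num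
  have rA : (A:ℝ) = 1779033704 := by rw [eA]; norm_num
  have rB : (B:ℝ) = 10368968600 := by rw [eB]; norm_num
  have rQ2 : (Q2:ℝ) = 18446744073709551616 := by rw [eQ2]; norm_num
  have rP1 : (P1:ℝ) = 3373259426 := by rw [eP1]; norm_num
  have rP2 : (P2:ℝ) = 6746518852 := by rw [eP2]; norm_num
  refine cond_elim (P := fun n => Real.arctan (vl u) - vl 530 ≤ vl n ∧ vl n ≤ Real.arctan (vl u) + vl 530) _ _ _ (fun h1 => ?_) (fun h1 => ?_)
  · have := atT_bounds (u := u) (by have := Nat.le_of_ble_eq_true h1; omega)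
    have e1 : vl 1 ≤ vl 530 := vl_mono (by norm_num)
    have e2 : vl 522 ≤ vl 530 := vl_mono (by norm_num)
    constructor <;> linarith
  have h1' : A < u := by
    by_contra hc; rw [Nat.ble_eq_true_of_le (not_lt.mp hc)] at h1; cases h1
  refine cond_elim (P := fun n => Real.arctan (vl u) - vl 530 ≤ vl n ∧ vl n ≤ Real.arctan (vl u) + vl 530) _ _ _ (fun h2 => ?_) (fun h2 => ?_)
  swap
  · have h2' : B < u := by
      by_contra hc; rw [Nat.ble_eq_true_of_le (not_lt.mp hc)] at h2; cases h2
    have hu : (B:ℝ) < u := by exact_mod_cast h2'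
    rw [rB] at hu
    have ht : (Q2 : ℝ) / u = (vl u)⁻¹ * 4294967296 := by
      rw [rQ2]; unfold vl; field_simp; norm_num
    have hle : Nat.div Q2 u ≤ 1779034000 := by
      have := div_le_real Q2 u
      have h4 : (Q2 : ℝ) / u < 1779034001 := by
        rw [div_lt_iff₀ (by linarith), rQ2]; linarith
      have h5 : ((Nat.div Q2 u : ℕ) : ℝ) < (1779034001 : ℕ) := by push_cast; linarith
      have := Nat.cast_lt.mp h5
      omega
    obtain ⟨a, b⟩ := atT_bounds' (by omega) ht hle
    have hup : 0 < vl u := by unfold vl; positivity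
    rw [Real.arctan_inv_of_pos hup] at a b
    have hT : atT (Nat.div Q2 u) ≤ P2 := by
      have : vl (atT (Nat.div Q2 u)) ≤ 1.57 := by
        have h9 : Real.pi/4 ≤ Real.arctan (vl u) := by
          rw [← Real.arctan_one]; apply Real.arctan_strictMono.monotone
          unfold vl; linarith
        have : vl 522 ≤ 0.001 := by unfold vl; norm_num
        linarith
      unfold vl at this
      have h8 : ((atT (Nat.div Q2 u) : ℕ) : ℝ) ≤ (P2 : ℕ) := by rw [rP2]; linarith
      exact Nat.cast_le.mp h8
    rw [vl_sub hT]
    have c1 : vl P2 = 6746518852/4294967296 := by unfold vl; rw [rP2]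
    have c2 : vl 530 = 530/4294967296 := by unfold vl; norm_num
    have c3 : vl 522 = 522/4294967296 := by unfold vl; norm_num
    have c4 : vl 2 = 2/4294967296 := by unfold vl; norm_num
    rw [c3] at b; rw [c4] at a
    rw [c1, c2]
    constructor <;> linarith
  have h2' := Nat.le_of_ble_eq_true h2
  have hu1 : (1779033704:ℝ) < u := by rw [← rA]; exact_mod_cast h1'
  have hu2 : (u:ℝ) ≤ B := by exact_mod_cast h2'
  rw [rB] at hu2
  have c1 : vl P1 = 3373259426/4294967296 := by unfold vl; rw [rP1]
  have c2 : vl 530 = 530/4294967296 := by unfold vl; norm_num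
  have c3 : vl 522 = 522/4294967296 := by unfold vl; norm_num
  have c4 : vl 2 = 2/4294967296 := by unfold vl; norm_num
  have c5 : (u:ℝ)/4294967296 = vl u := rfl
  refine cond_elim (P := fun n => Real.arctan (vl u) - vl 530 ≤ vl n ∧ vl n ≤ Real.arctan (vl u) + vl 530) _ _ _ (fun h3 => ?_) (fun h3 => ?_)
  swap
  · have h3' : Q < u := by
      by_contra hc; rw [Nat.ble_eq_true_of_le (not_lt.mp hc)] at h3; cases h3
    have hs : ((Nat.sub u Q : ℕ) : ℝ) = u - 4294967296 := by
      rw [Nat.sub_eq, Nat.cast_sub h3'.le, rQ]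
    have ht : ((Nat.mul (Nat.sub u Q) Q : ℕ) : ℝ) / (Nat.add Q u : ℕ)
        = ((u - 4294967296)/(u + 4294967296)) * 4294967296 := by
      rw [Nat.mul_eq, Nat.cast_mul, hs, Nat.add_eq, Nat.cast_add, rQ]; rw [add_comm]; ring
    have hle : Nat.div (Nat.mul (Nat.sub u Q) Q) (Nat.add Q u) ≤ 1779034000 := by
      have := div_le_real (Nat.mul (Nat.sub u Q) Q) (Nat.add Q u)
      rw [ht] at this
      have h4 : (((u:ℝ) - 4294967296)/(u + 4294967296)) * 4294967296 < 1779034001 := by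
        rw [div_mul_eq_mul_div, div_lt_iff₀ (by linarith)]; linarith
      have h5 := lt_of_le_of_lt this h4
      have h6 := Nat.cast_lt.mp (by exact_mod_cast h5 : ((Nat.div (Nat.mul (Nat.sub u Q) Q) (Nat.add Q u) : ℕ) : ℝ) < (1779034001 : ℕ))
      omega
    obtain ⟨a, b⟩ := atT_bounds' (by rw [Nat.add_eq]; omega) ht hle
    have e : Real.arctan (((u:ℝ) - 4294967296)/(u + 4294967296)) = Real.arctan (vl u) - Real.pi/4 := by
      have := arctan_quot (a := 4294967296) (b := u) (by norm_num) (by positivity)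
      rw [c5] at this
      rw [← neg_sub, neg_div, Real.arctan_neg, add_comm (u:ℝ), this]; ring
    rw [e] at a b
    rw [vl_add, c1, c2]; rw [c3] at b; rw [c4] at a
    constructor <;> linarith
  · have h3' := Nat.le_of_ble_eq_true h3
    have hs : ((Nat.sub Q u : ℕ) : ℝ) = 4294967296 - u := by
      rw [Nat.sub_eq, Nat.cast_sub h3', rQ]
    have ht : ((Nat.mul (Nat.sub Q u) Q : ℕ) : ℝ) / (Nat.add Q u : ℕ)
        = ((4294967296 - u)/(4294967296 + u)) * 4294967296 := by
      rw [Nat.mul_eq, Nat.cast_mul, hs, Nat.add_eq, Nat.cast_add, rQ]; ring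
    have hle : Nat.div (Nat.mul (Nat.sub Q u) Q) (Nat.add Q u) ≤ 1779034000 := by
      have := div_le_real (Nat.mul (Nat.sub Q u) Q) (Nat.add Q u)
      rw [ht] at this
      have h4 : ((4294967296 - (u:ℝ))/(4294967296 + u)) * 4294967296 < 1779034001 := by
        rw [div_mul_eq_mul_div, div_lt_iff₀ (by linarith)]; linarith
      have h5 := lt_of_le_of_lt this h4
      have h6 := Nat.cast_lt.mp (by exact_mod_cast h5 : ((Nat.div (Nat.mul (Nat.sub Q u) Q) (Nat.add Q u) : ℕ) : ℝ) < (1779034001 : ℕ))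
      omega
    obtain ⟨a, b⟩ := atT_bounds' (by rw [Nat.add_eq]; omega) ht hle
    have e : Real.arctan ((4294967296 - (u:ℝ))/(4294967296 + u)) = Real.pi/4 - Real.arctan (vl u) := by
      have := arctan_quot (a := 4294967296) (b := u) (by norm_num) (by positivity)
      rwa [c5] at this
    rw [e] at a b
    have hT : atT (Nat.div (Nat.mul (Nat.sub Q u) Q) (Nat.add Q u)) ≤ P1 := by
      have h7 : (0.4:ℝ) - 0.4^3 ≤ Real.arctan (vl u) := by
        have : Real.arctan 0.4 ≤ Real.arctan (vl u) := by
          apply Real.arctan_strictMono.monotone; unfold vl; linarith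
        have h8 := (P13_bounds (x := 0.4) (by norm_num)).2
        have : P13 0.4 ≥ 0.4 - 0.4^3 + 0.01 := by unfold P13; norm_num
        have : (0.4:ℝ)^15/15 ≤ 0.01 := by norm_num
        linarith
      have : vl (atT (Nat.div (Nat.mul (Nat.sub Q u) Q) (Nat.add Q u))) ≤ 0.7 := by
        rw [c3] at b
        linarith
      unfold vl at this
      have h8 : ((atT (Nat.div (Nat.mul (Nat.sub Q u) Q) (Nat.add Q u)) : ℕ) : ℝ) ≤ (P1 : ℕ) := by rw [rP1]; linarith
      exact Nat.cast_le.mp h8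
    rw [vl_sub hT, c1, c2]; rw [c3] at b; rw [c4] at a
    constructor <;> linarith

theorem atN_bounds (u : ℕ) :
    Real.arctan (vl u) - vl 530 ≤ vl (atN u) ∧ vl (atN u) ≤ Real.arctan (vl u) + vl 530 :=
  atG_bounds _ _ _ _ _ _ u rfl rfl rfl rfl rfl rfl

theorem le_atU {u : ℕ} {t : ℝ} (h : t ≤ vl u) : Real.arctan t ≤ vl (atU u) := by
  have := (atN_bounds u).1
  have := Real.arctan_strictMono.monotone h
  unfold atU; rw [vl_add]; linarith
theorem atL_le {u : ℕ} {t : ℝ} (h : vl u ≤ t) : vl (atL u) ≤ Real.arctan t := by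
  have h1 := (atN_bounds u).2
  have h2 := Real.arctan_strictMono.monotone h
  unfold atL
  rcases le_total 530 (atN u) with h3 | h3
  · rw [vl_sub h3]; linarith
  · rw [Nat.sub_eq, Nat.sub_eq_zero_of_le h3]
    have : vl 0 = 0 := by unfold vl; simp
    rw [this]
    exact Real.arctan_nonneg.mpr ((vl_nonneg u).trans h)

/-! Leaf tests. -/
def nmax (a b : ℕ) : ℕ := cond (Nat.ble a b) b a
def nmin (a b : ℕ) : ℕ := cond (Nat.ble a b) a b
theorem vl_nmax (a b : ℕ) : vl (nmax a b) = vl a ∨ vl (nmax a b) = vl b := by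
  unfold nmax; cases Nat.ble a b <;> simp
theorem v2_nmax (a b : ℕ) : v2 (nmax a b) = v2 a ∨ v2 (nmax a b) = v2 b := by
  unfold nmax; cases Nat.ble a b <;> simp
theorem nmax_elim {P : ℕ → Prop} {a b : ℕ} (ha : P a) (hb : P b) : P (nmax a b) :=
  cond_elim _ _ _ (fun _ => hb) (fun _ => ha)
theorem nmin_elim {P : ℕ → Prop} {a b : ℕ} (ha : P a) (hb : P b) : P (nmin a b) :=
  cond_elim _ _ _ (fun _ => ha) (fun _ => hb)
theorem vl_nmin_le (a b : ℕ) : vl (nmin a b) ≤ vl a ∧ vl (nmin a b) ≤ vl b := by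
  refine cond_elim (P := fun n => vl n ≤ vl a ∧ vl n ≤ vl b) _ _ _ (fun h => ?_) (fun h => ?_)
  · exact ⟨le_rfl, vl_mono (Nat.le_of_ble_eq_true h)⟩
  · refine ⟨vl_mono ?_, le_rfl⟩
    by_contra hc
    rw [Nat.ble_eq_true_of_le (by omega)] at h; cases h

def tV (tl th x s : ℕ) : ℕ :=
  (fun d => cond (Nat.ble (Nat.mul x 18446744073709551616) (Nat.mul (Nat.mul tl tl) s)) (dU tl d)
    (cond (Nat.ble (Nat.mul (Nat.mul th th) s) (Nat.mul x 18446744073709551616))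
      (dU th (Nat.add x (mL (mL th th) s))) (dU th d)))
  (Nat.add x (mL (mL tl tl) s))

theorem vl_pos {n : ℕ} (h : 0 < n) : 0 < vl n := by unfold vl; positivity

theorem den_le (x t s : ℕ) : vl (Nat.add x (mL (mL t t) s)) ≤ vl x + vl t ^ 2 * vl s := by
  rw [vl_add]
  have h1 := mL_le (mL t t) s
  have h2 := mL_le t t
  have h3 := vl_nonneg s
  nlinarith
theorem den_ge (x t s : ℕ) : vl x + vl t ^ 2 * vl s ≤ vl (Nat.add x (mU (mU t t) s)) := by
  rw [vl_add]
  have h1 := le_mU (mU t t) s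
  have h2 := le_mU t t
  have h3 := vl_nonneg s
  nlinarith

theorem frac_le_dU {x s t : ℕ} (hx : 0 < x) :
    vl t / (vl x + vl t ^ 2 * vl s) ≤ vl (dU t (Nat.add x (mL (mL t t) s))) := by
  have hp : 0 < Nat.add x (mL (mL t t) s) := by rw [Nat.add_eq]; omega
  refine le_trans ?_ (le_dU _ _ hp)
  exact div_le_div_of_nonneg_left (vl_nonneg t) (vl_pos hp) (den_le _ _ _)

theorem le_tV {tl th x s : ℕ} {t : ℝ} (hx : 0 < x) (h1 : vl tl ≤ t) (h2 : t ≤ vl th) :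
    t / (vl x + t^2 * vl s) ≤ vl (tV tl th x s) := by
  have hxp := vl_pos hx
  have hs := vl_nonneg s
  have ht0 := vl_nonneg tl
  have ht : 0 ≤ t := ht0.trans h1
  have p0 : 0 < vl x + t^2 * vl s := by positivity
  have p1 : 0 < vl x + vl tl^2 * vl s := by positivity
  have p2 : 0 < vl x + vl th^2 * vl s := by positivity
  refine cond_elim (P := fun n => t / (vl x + t^2 * vl s) ≤ vl n) _ _ _ (fun h => ?_) (fun h => ?_)
  · refine le_trans ?_ (frac_le_dU hx)
    have hle := Nat.le_of_ble_eq_true h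
    have : vl x ≤ vl tl ^ 2 * vl s := by
      have h3 : ((Nat.mul x 18446744073709551616 : ℕ) : ℝ) ≤ (Nat.mul (Nat.mul tl tl) s : ℕ) := by
        exact_mod_cast hle
      simp only [Nat.mul_eq] at h3; push_cast at h3
      unfold vl
      have : (x:ℝ) ≤ tl * tl * s / 18446744073709551616 := by
        rw [le_div_iff₀ (by norm_num)]; exact h3
      calc (x:ℝ) / 4294967296 ≤ (tl * tl * s / 18446744073709551616) / 4294967296 := by gcongr
        _ = _ := by ring
    rw [div_le_div_iff₀ p0 p1]
    have : 0 ≤ (t - vl tl) * (t * vl tl * vl s - vl x) := by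
      apply mul_nonneg (by linarith)
      nlinarith [mul_nonneg ht0 hs]
    nlinarith
  refine cond_elim (P := fun n => t / (vl x + t^2 * vl s) ≤ vl n) _ _ _ (fun h => ?_) (fun h => ?_)
  · refine le_trans ?_ (frac_le_dU hx)
    have hle := Nat.le_of_ble_eq_true h
    have : vl th ^ 2 * vl s ≤ vl x := by
      have h3 : (Nat.mul (Nat.mul th th) s : ℕ) ≤ ((Nat.mul x 18446744073709551616 : ℕ) : ℝ) := by
        exact_mod_cast hle
      simp only [Nat.mul_eq] at h3; push_cast at h3
      unfold vl
      have : th * th * s / 18446744073709551616 ≤ (x:ℝ) := by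
        rw [div_le_iff₀ (by norm_num)]; exact h3
      calc _ = (th * th * s / 18446744073709551616 : ℝ) / 4294967296 := by ring
        _ ≤ (x:ℝ) / 4294967296 := by gcongr
    rw [div_le_div_iff₀ p0 p2]
    have : 0 ≤ (vl th - t) * (vl x - t * vl th * vl s) := by
      apply mul_nonneg (by linarith)
      nlinarith [mul_nonneg (vl_nonneg th) hs]
    nlinarith
  · have hp : 0 < Nat.add x (mL (mL tl tl) s) := by rw [Nat.add_eq]; omega
    refine le_trans ?_ (le_dU _ _ hp)
    refine div_le_div₀ (vl_nonneg th) h2 (vl_pos hp) ((den_le _ _ _).trans ?_)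
    have : vl tl ^2 ≤ t^2 := by gcongr
    nlinarith

/-- upper bound, positive part -/
def gA (a lp db tl th x s : ℕ) : ℕ :=
  Nat.add (atU (mU (Nat.sub s x) (tV tl th x s)))
    (Nat.add (mU a (atU (dU (mU th s) x))) (cond (Nat.beq lp 0) 0 (mU lp (atU (dU db x)))))
/-- lower bound, negative part -/
def gB (K ln ha da x : ℕ) : ℕ :=
  Nat.add (mL (mL K ha) (mL da x)) (cond (Nat.beq ln 0) 0 (mL ln (atL (dL da x))))

theorem T1_mono {x t s s' : ℝ} (hx : 0 < x) (ht : 0 ≤ t) (hxs : x ≤ s) (hs : s ≤ s') :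
    (s - x) * (t / (x + t^2*s)) ≤ (s' - x) * (t / (x + t^2*s')) := by
  have h1 : 0 < x + t^2 * s := by
    have : 0 < s := hx.trans_le hxs
    positivity
  have h2 : 0 < x + t^2 * s' := by
    have : 0 < s' := hx.trans_le (hxs.trans hs)
    positivity
  rw [mul_div_assoc', mul_div_assoc', div_le_div_iff₀ h1 h2]
  have : 0 ≤ t * x * (1 + t^2) * (s' - s) := by
    have := sub_nonneg.mpr hs
    positivity
  nlinarith

theorem gg_le {a lp ln K ha hb da db tl th x s : ℕ} {h d : ℝ} (hha : 0 < ha) (hx : 0 < x)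
    (h1 : vl ha ≤ h) (h2 : h ≤ vl hb) (d1 : vl da ≤ d) (d2 : d ≤ vl db)
    (etl : vl tl ≤ vl da / vl hb) (eth : vl db / vl ha ≤ vl th)
    (es : vl hb ^2 + vl db^2 + vl x^2 ≤ vl s^2) :
    gg (1 + vl a) (vl lp - vl ln) (vl K) h d (vl x) ≤ vl (gA a lp db tl th x s) - vl (gB K ln ha da x) := by
  have hp := vl_pos hha
  have hxp := vl_pos hx
  have hh : 0 < h := hp.trans_le h1
  have hd : 0 ≤ d := (vl_nonneg da).trans d1
  have hs0 := vl_nonneg s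
  have hsle : √(h^2 + d^2 + vl x^2) ≤ vl s := by
    apply Real.sqrt_le_iff.mpr ⟨hs0, _⟩
    nlinarith
  have hxs : vl x ≤ √(h^2 + d^2 + vl x^2) := Real.le_sqrt_of_sq_le (by nlinarith)
  rw [gg_split hh hxp]
  set σ := √(h^2 + d^2 + vl x^2)
  have t1 : vl tl ≤ d / h := etl.trans (div_le_div₀ hd d1 hh h2)
  have t2 : d / h ≤ vl th := le_trans (div_le_div₀ (vl_nonneg db) d2 hp h1) eth
  have ht0 : 0 ≤ d / h := by positivity
  have A1 : Real.arctan ((σ - vl x) * ((d/h) / (vl x + (d/h)^2 * σ)))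
      ≤ vl (atU (mU (Nat.sub s x) (tV tl th x s))) := by
    apply le_atU
    refine (T1_mono hxp ht0 hxs hsle).trans (le_trans ?_ (le_mU _ _))
    refine mul_le_mul (vl_sub_le _ _) (le_tV hx t1 t2) ?_ (vl_nonneg _)
    positivity
  have A2 : vl a * Real.arctan (d * σ / (vl x * h)) ≤ vl (mU a (atU (dU (mU th s) x))) := by
    refine le_trans ?_ (le_mU _ _)
    refine mul_le_mul_of_nonneg_left (le_atU ?_) (vl_nonneg a)
    refine le_trans ?_ (le_dU _ _ hx)
    have e : d * σ / (vl x * h) = (d / h) * σ / vl x := by field_simp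
    rw [e]
    refine div_le_div_of_nonneg_right (le_trans ?_ (le_mU _ _)) hxp.le
    exact mul_le_mul t2 hsle (hxp.le.trans hxs) (vl_nonneg _)
  have z0 : vl 0 = 0 := by unfold vl; simp
  have A3 : vl lp * Real.arctan (d / vl x) ≤ vl (cond (Nat.beq lp 0) 0 (mU lp (atU (dU db x)))) := by
    refine cond_elim (P := fun n => vl lp * Real.arctan (d / vl x) ≤ vl n) _ _ _ (fun h => ?_) (fun h => ?_)
    · rw [Nat.eq_of_beq_eq_true h, z0]; simp
    · refine le_trans ?_ (le_mU _ _)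
      refine mul_le_mul_of_nonneg_left (le_atU ?_) (vl_nonneg _)
      exact le_trans (div_le_div_of_nonneg_right d2 hxp.le) (le_dU _ _ hx)
  have A4 : vl (cond (Nat.beq ln 0) 0 (mL ln (atL (dL da x)))) ≤ vl ln * Real.arctan (d / vl x) := by
    refine cond_elim (P := fun n => vl n ≤ vl ln * Real.arctan (d / vl x)) _ _ _ (fun h => ?_) (fun h => ?_)
    · rw [Nat.eq_of_beq_eq_true h, z0]; simp
    · refine le_trans (mL_le _ _) ?_
      refine mul_le_mul_of_nonneg_left (atL_le ?_) (vl_nonneg _)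
      exact le_trans (dL_le _ _) (div_le_div_of_nonneg_right d1 hxp.le)
  have A5 : vl (mL (mL K ha) (mL da x)) ≤ vl K * h * d * vl x := by
    refine le_trans (mL_le _ _) ?_
    have b1 : vl (mL K ha) ≤ vl K * h :=
      (mL_le _ _).trans (mul_le_mul_of_nonneg_left h1 (vl_nonneg _))
    have b2 : vl (mL da x) ≤ d * vl x :=
      (mL_le _ _).trans (mul_le_mul_of_nonneg_right d1 hxp.le)
    have := mul_le_mul b1 b2 (vl_nonneg _) (mul_nonneg (vl_nonneg K) hh.le)
    linarith
  unfold gA gB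
  rw [vl_add, vl_add, vl_add]
  have : (vl lp - vl ln) * Real.arctan (d / vl x) = vl lp * Real.arctan (d / vl x) - vl ln * Real.arctan (d / vl x) := by ring
  have e2 : (1 + vl a - 1) = vl a := by ring
  rw [this, e2]
  linarith

/-- lower bound -/
def gC (a lp da tl th x s : ℕ) : ℕ :=
  Nat.add (atL (mL (Nat.sub s x) (nmin (dL tl (Nat.add x (mU (mU tl tl) s))) (dL th (Nat.add x (mU (mU th th) s))))))
    (Nat.add (mL a (atL (dL (mL tl s) x))) (cond (Nat.beq lp 0) 0 (mL lp (atL (dL da x)))))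
def gD (K ln hb db x : ℕ) : ℕ :=
  Nat.add (mU (mU K hb) (mU db x)) (cond (Nat.beq ln 0) 0 (mU ln (atU (dU db x))))

theorem dL_le_frac {x s t : ℕ} (hx : 0 < x) :
    vl (dL t (Nat.add x (mU (mU t t) s))) ≤ vl t / (vl x + vl t ^ 2 * vl s) := by
  refine (dL_le _ _).trans ?_
  have := vl_pos hx
  have := vl_nonneg s
  exact div_le_div_of_nonneg_left (vl_nonneg t) (by positivity) (den_ge _ _ _)

theorem le_gg {a lp ln K ha hb da db tl th x s : ℕ} {h d : ℝ} (hha : 0 < ha) (hx : 0 < x)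
    (h1 : vl ha ≤ h) (h2 : h ≤ vl hb) (d1 : vl da ≤ d) (d2 : d ≤ vl db)
    (etl : vl tl ≤ vl da / vl hb) (eth : vl db / vl ha ≤ vl th)
    (es : vl s^2 ≤ vl ha ^2 + vl da^2 + vl x^2) :
    vl (gC a lp da tl th x s) - vl (gD K ln hb db x) ≤ gg (1 + vl a) (vl lp - vl ln) (vl K) h d (vl x) := by
  have hp := vl_pos hha
  have hxp := vl_pos hx
  have hh : 0 < h := hp.trans_le h1
  have hd : 0 ≤ d := (vl_nonneg da).trans d1
  have hs0 := vl_nonneg s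
  have hsle : vl s ≤ √(h^2 + d^2 + vl x^2) := by
    apply Real.le_sqrt_of_sq_le
    nlinarith [vl_nonneg da]
  have hxs : vl x ≤ √(h^2 + d^2 + vl x^2) := Real.le_sqrt_of_sq_le (by nlinarith)
  rw [gg_split hh hxp]
  set σ := √(h^2 + d^2 + vl x^2)
  have t1 : vl tl ≤ d / h := etl.trans (div_le_div₀ hd d1 hh h2)
  have t2 : d / h ≤ vl th := le_trans (div_le_div₀ (vl_nonneg db) d2 hp h1) eth
  have ht0 : 0 ≤ d / h := by positivity
  have A1 : vl (atL (mL (Nat.sub s x) (nmin (dL tl (Nat.add x (mU (mU tl tl) s))) (dL th (Nat.add x (mU (mU th th) s))))))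
     ≤ Real.arctan ((σ - vl x) * ((d/h) / (vl x + (d/h)^2 * σ))) := by
    apply atL_le
    have hnn : 0 ≤ (σ - vl x) * ((d/h) / (vl x + (d/h)^2 * σ)) := by
      have := sub_nonneg.mpr hxs
      have : 0 < σ := hxp.trans_le hxs
      positivity
    refine (mL_le _ _).trans ?_
    rcases le_total s x with hsx | hsx
    · rw [Nat.sub_eq, Nat.sub_eq_zero_of_le hsx]
      have : vl 0 = 0 := by unfold vl; simp
      rw [this]; linarith
    have hsx' := vl_mono hsx
    refine le_trans ?_ (T1_mono hxp ht0 hsx' hsle)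
    rw [vl_sub hsx]
    refine mul_le_mul_of_nonneg_left ?_ (sub_nonneg.mpr hsx')
    obtain ⟨m1, m2⟩ := vl_nmin_le (dL tl (Nat.add x (mU (mU tl tl) s))) (dL th (Nat.add x (mU (mU th th) s)))
    have hs : 0 < vl s := hxp.trans_le hsx'
    have htl := vl_nonneg tl
    generalize d / h = t at *
    have p0 : 0 < vl x + t^2 * vl s := by positivity
    have p1 : 0 < vl x + vl tl^2 * vl s := by positivity
    have p2 : 0 < vl x + vl th^2 * vl s := by positivity
    rcases le_total (t * vl tl * vl s) (vl x) with hc | hc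
    · refine m1.trans ((dL_le_frac hx).trans ?_)
      rw [div_le_div_iff₀ p1 p0]
      have : 0 ≤ (t - vl tl) * (vl x - t * vl tl * vl s) := mul_nonneg (by linarith) (by linarith)
      nlinarith
    · refine m2.trans ((dL_le_frac hx).trans ?_)
      rw [div_le_div_iff₀ p2 p0]
      have hc2 : t * vl tl * vl s ≤ t * vl th * vl s := by
        have : vl tl ≤ vl th := t1.trans t2
        gcongr
      have : 0 ≤ (vl th - t) * (t * vl th * vl s - vl x) := mul_nonneg (by linarith) (by linarith)
      nlinarith
  have A2 : vl (mL a (atL (dL (mL tl s) x))) ≤ vl a * Real.arctan (d * σ / (vl x * h)) := by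
    refine (mL_le _ _).trans ?_
    refine mul_le_mul_of_nonneg_left (atL_le ?_) (vl_nonneg a)
    refine (dL_le _ _).trans ?_
    have e : d * σ / (vl x * h) = (d / h) * σ / vl x := by field_simp
    rw [e]
    refine div_le_div_of_nonneg_right ((mL_le _ _).trans ?_) hxp.le
    exact mul_le_mul t1 hsle hs0 ht0
  have z0 : vl 0 = 0 := by unfold vl; simp
  have A3 : vl (cond (Nat.beq lp 0) 0 (mL lp (atL (dL da x)))) ≤ vl lp * Real.arctan (d / vl x) := by
    refine cond_elim (P := fun n => vl n ≤ vl lp * Real.arctan (d / vl x)) _ _ _ (fun h => ?_) (fun h => ?_)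
    · rw [Nat.eq_of_beq_eq_true h, z0]; simp
    · refine le_trans (mL_le _ _) ?_
      refine mul_le_mul_of_nonneg_left (atL_le ?_) (vl_nonneg _)
      exact le_trans (dL_le _ _) (div_le_div_of_nonneg_right d1 hxp.le)
  have A4 : vl ln * Real.arctan (d / vl x) ≤ vl (cond (Nat.beq ln 0) 0 (mU ln (atU (dU db x)))) := by
    refine cond_elim (P := fun n => vl ln * Real.arctan (d / vl x) ≤ vl n) _ _ _ (fun h => ?_) (fun h => ?_)
    · rw [Nat.eq_of_beq_eq_true h, z0]; simp
    · refine le_trans ?_ (le_mU _ _)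
      refine mul_le_mul_of_nonneg_left (le_atU ?_) (vl_nonneg _)
      exact le_trans (div_le_div_of_nonneg_right d2 hxp.le) (le_dU _ _ hx)
  have A5 : vl K * h * d * vl x ≤ vl (mU (mU K hb) (mU db x)) := by
    refine le_trans ?_ (le_mU _ _)
    have b1 : vl K * h ≤ vl (mU K hb) :=
      (mul_le_mul_of_nonneg_left h2 (vl_nonneg _)).trans (le_mU _ _)
    have b2 : d * vl x ≤ vl (mU db x) :=
      (mul_le_mul_of_nonneg_right d2 hxp.le).trans (le_mU _ _)
    have := mul_le_mul b1 b2 (mul_nonneg hd hxp.le) (vl_nonneg _)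
    linarith
  unfold gC gD
  rw [vl_add, vl_add, vl_add]
  have : (vl lp - vl ln) * Real.arctan (d / vl x) = vl lp * Real.arctan (d / vl x) - vl ln * Real.arctan (d / vl x) := by ring
  have e2 : (1 + vl a - 1) = vl a := by ring
  rw [this, e2]
  linarith

/-- lower bound for the abscissa -/
def xLow (B : ℕ) (f2 f3 : Bool) (ha hb da db : ℕ) : ℕ :=
  nmax (nmax 1138166333 (cond f2 da 0))
   (nmax (cond (Nat.ble 36893488147419103232 (Nat.add (Nat.mul ha ha) (Nat.mul da da)))
        (Nat.sub 8589934592 (sqU (Nat.sub 92776742707868768264 (Nat.add (Nat.mul ha ha) (Nat.mul da da))))) 0)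
    (sqL (Nat.sub (nmax (cond f3 ((fun b => Nat.mul b b) (Nat.sub 8589934592 (sqU (Nat.sub 36893488147419103232 (Nat.mul ha ha))))) B)
      (Nat.sub 36893488147419103232 (Nat.mul hb hb))) (Nat.mul db db))))

structure CX (B : ℕ) (f2 f3 : Bool) (h d x : ℝ) : Prop where
  x0 : 0.265 ≤ x
  s1 : 2 ≤ h^2 + d^2 + x^2
  s2 : h^2 + d^2 + x^2 ≤ 5.0294373
  b : v2 B ≤ d^2 + x^2
  f2 : f2 = true → d ≤ x
  f3 : f3 = true → (2 - √(2 - h^2))^2 ≤ d^2 + x^2 ∧ h^2 ≤ 2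

theorem xLow_le {B : ℕ} {f2 f3 : Bool} {ha hb da db : ℕ} {h d x y : ℝ}
    (h1 : vl ha ≤ h) (h2 : h ≤ vl hb) (d1 : vl da ≤ d) (d2 : d ≤ vl db)
    (hx : CX B f2 f3 h d x) (hy : CX B f2 f3 h d y) (hxy : 2 ≤ x + y) :
    vl (xLow B f2 f3 ha hb da db) ≤ x := by
  have ha0 := vl_nonneg ha
  have hda0 := vl_nonneg da
  have hh : 0 ≤ h := ha0.trans h1
  have hd : 0 ≤ d := hda0.trans d1
  have x0 : 0 ≤ x := by linarith [hx.x0]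
  have y0 : 0 ≤ y := by linarith [hy.x0]
  have z0 : vl 0 = 0 := by unfold vl; simp
  have two : vl 8589934592 = 2 := by unfold vl; norm_num
  have two2 : v2 36893488147419103232 = 2 := by unfold v2; norm_num
  refine nmax_elim (P := fun n => vl n ≤ x) (nmax_elim (P := fun n => vl n ≤ x) ?_ ?_)
    (nmax_elim (P := fun n => vl n ≤ x) ?_ ?_)
  · refine le_trans ?_ hx.x0
    unfold vl; norm_num
  · refine cond_elim (P := fun n => vl n ≤ x) _ _ _ (fun h => ?_) (fun _ => by rw [z0]; exact x0)
    exact d1.trans (hx.f2 h)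
  · refine cond_elim (P := fun n => vl n ≤ x) _ _ _ (fun _ => ?_) (fun _ => by rw [z0]; exact x0)
    have hq := sqU_v (Nat.sub 92776742707868768264 (Nat.add (Nat.mul ha ha) (Nat.mul da da)))
    have hq2 := v2_sub_le 92776742707868768264 (Nat.add (Nat.mul ha ha) (Nat.mul da da))
    rw [v2_add, v2_mul, v2_mul] at hq2
    have e : 5.0294373 ≤ v2 92776742707868768264 := by unfold v2; norm_num
    generalize sqU _ = w at *
    have hw := vl_nonneg w
    have hyw : y ≤ vl w := by
      have := hy.s2
      apply abs_le_of_sq_le_sq' _ hw |>.2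
      nlinarith
    rcases le_total w 8589934592 with hle | hle
    · rw [vl_sub hle, two]; linarith
    · rw [Nat.sub_eq, Nat.sub_eq_zero_of_le hle, z0]; exact x0
  · have hq := sqL_v (Nat.sub (nmax (cond f3 ((fun b => Nat.mul b b) (Nat.sub 8589934592 (sqU (Nat.sub 36893488147419103232 (Nat.mul ha ha))))) B)
      (Nat.sub 36893488147419103232 (Nat.mul hb hb))) (Nat.mul db db))
    generalize sqL _ = w at *
    have hw := vl_nonneg w
    apply abs_le_of_sq_le_sq' _ x0 |>.2
    refine hq.trans ?_
    have key : v2 (nmax (cond f3 ((fun b => Nat.mul b b) (Nat.sub 8589934592 (sqU (Nat.sub 36893488147419103232 (Nat.mul ha ha))))) B)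
      (Nat.sub 36893488147419103232 (Nat.mul hb hb))) ≤ d^2 + x^2 := by
      refine nmax_elim (P := fun n => v2 n ≤ d^2 + x^2) ?_ ?_
      · refine cond_elim (P := fun n => v2 n ≤ d^2 + x^2) _ _ _ (fun h3 => ?_) (fun _ => hx.b)
        obtain ⟨f, fh⟩ := hx.f3 h3
        refine le_trans ?_ f
        have g1 := sqU_v (Nat.sub 36893488147419103232 (Nat.mul ha ha))
        have g2 := v2_sub_le 36893488147419103232 (Nat.mul ha ha)
        rw [two2, v2_mul] at g2
        generalize sqU _ = u at *
        have hu := vl_nonneg u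
        have hr : √(2 - h^2) ≤ vl u := by
          apply Real.sqrt_le_iff.mpr ⟨hu, _⟩
          nlinarith
        have hr2 : √(2 - h^2) ≤ 2 := by
          apply Real.sqrt_le_iff.mpr ⟨by norm_num, _⟩
          nlinarith
        show v2 (Nat.mul _ _) ≤ _
        rw [v2_mul, ← sq]
        rcases le_total u 8589934592 with hle | hle
        · have hle2 := vl_mono hle
          rw [two] at hle2
          rw [vl_sub hle, two]
          have : 0 ≤ 2 - vl u := by linarith
          gcongr
        · rw [Nat.sub_eq, Nat.sub_eq_zero_of_le hle, z0]
          simp only [ne_eq, OfNat.ofNat_ne_zero, not_false_eq_true, zero_pow]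
          positivity
      · rcases v2_sub_cases 36893488147419103232 (Nat.mul hb hb) with e | e
        · rw [e]; positivity
        · rw [e, two2, v2_mul]
          have := hx.s1
          nlinarith
    rcases v2_sub_cases (nmax (cond f3 ((fun b => Nat.mul b b) (Nat.sub 8589934592 (sqU (Nat.sub 36893488147419103232 (Nat.mul ha ha))))) B)
      (Nat.sub 36893488147419103232 (Nat.mul hb hb))) (Nat.mul db db) with e | e
    · rw [e]; positivity
    · rw [e, v2_mul]; nlinarith

/-- task parameters: `gg (1+a) (lp-ln) K`, threshold `(p0 - n0) + (p1 - n1) h` -/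
structure Tk where
  a : ℕ
  lp : ℕ
  ln : ℕ
  K : ℕ
  p0 : ℕ
  n0 : ℕ
  p1 : ℕ
  n1 : ℕ
  B : ℕ
  f2 : Bool
  f3 : Bool

noncomputable def Tk.g (t : Tk) (h d x : ℝ) : ℝ := gg (1 + vl t.a) (vl t.lp - vl t.ln) (vl t.K) h d x
noncomputable def Tk.thr (t : Tk) (h : ℝ) : ℝ := vl t.p0 - vl t.n0 + (vl t.p1 - vl t.n1) * h

def leafQ (t : Tk) (ha hb da db x tl th w : ℕ) : Bool :=
    (fun s => cond (Nat.ble 4294967296 x)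
      (Nat.ble (Nat.add (Nat.mul 2 (gA t.a t.lp db tl th x s)) (Nat.add t.n0 (mU t.n1 hb)))
        (Nat.add (Nat.mul 2 (gB t.K t.ln ha da x)) (Nat.add t.p0 (mL t.p1 ha))))
      ((fun y => (fun s2 => 
        cond (Nat.ble (Nat.mul t.ln s2) (Nat.mul (Nat.add 4294967296 t.a) ha))
        (Nat.ble (Nat.add (Nat.add (gA t.a t.lp db tl th x s) (gA t.a t.lp db tl th y s2)) (Nat.add t.n0 (mU t.n1 hb)))
        (Nat.add (Nat.add (gB t.K t.ln ha da x) (gB t.K t.ln ha da y)) (Nat.add t.p0 (mL t.p1 ha)))) false)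
        (sqU (Nat.add w (Nat.mul y y)))) (Nat.sub 8589934592 x)))
    (sqU (Nat.add w (Nat.mul x x)))

def leafP (t : Tk) (ha hb da db : ℕ) : Bool :=
  cond (Nat.ble 1 ha)
   (leafQ t ha hb da db (xLow t.B t.f2 t.f3 ha hb da db) (dL da hb) (dU db ha) (Nat.add (Nat.mul hb hb) (Nat.mul db db)))
  false

theorem condB_true {b x : Bool} (h : cond b x false = true) : b = true ∧ x = true := by
  cases b
  · cases h
  · exact ⟨rfl, h⟩
theorem condB_elim {b x y : Bool} (h : cond b x y = true) : (b = true ∧ x = true) ∨ (b = false ∧ y = true) := by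
  cases b
  · exact Or.inr ⟨rfl, h⟩
  · exact Or.inl ⟨rfl, h⟩
theorem not_ble {a b : ℕ} (h : Nat.ble a b = false) : b < a := by
  by_contra hc
  rw [Nat.ble_eq_true_of_le (by omega)] at h; cases h

theorem nmax_pos (a b c : ℕ) (ha : 0 < a) : 0 < nmax (nmax a b) c := by
  unfold nmax
  cases e : Nat.ble a b
  · simp only [cond_false]
    cases e2 : Nat.ble a c
    · simpa using ha
    · have := Nat.le_of_ble_eq_true e2; simp only [cond_true]; omega
  · have := Nat.le_of_ble_eq_true e
    simp only [cond_true]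
    cases e2 : Nat.ble b c
    · simp only [cond_false]; omega
    · have := Nat.le_of_ble_eq_true e2; simp only [cond_true]; omega

theorem xLow_pos (B : ℕ) (f2 f3 : Bool) (ha hb da db : ℕ) : 0 < xLow B f2 f3 ha hb da db :=
  nmax_pos _ _ _ (by norm_num)

theorem leafP_sound (t : Tk) {ha hb da db : ℕ} (hl : leafP t ha hb da db = true) {h d x y : ℝ}
    (h1 : vl ha ≤ h) (h2 : h ≤ vl hb) (d1 : vl da ≤ d) (d2 : d ≤ vl db)
    (hg : -(vl t.lp - vl t.ln) * 2.24265 ≤ (1 + vl t.a) * h)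
    (hx : CX t.B t.f2 t.f3 h d x) (hy : CX t.B t.f2 t.f3 h d y) (hxy : 2 ≤ x + y) :
    t.g h d x + t.g h d y ≤ t.thr h := by
  obtain ⟨hh1, hl⟩ := condB_true hl
  have hha : 0 < ha := Nat.le_of_ble_eq_true hh1
  have hxl := xLow_le h1 h2 d1 d2 hx hy hxy
  have hyl := xLow_le h1 h2 d1 d2 hy hx (by linarith)
  have hxp : 0 < xLow t.B t.f2 t.f3 ha hb da db := xLow_pos _ _ _ _ _ _ _
  have etl := dL_le da hb
  have eth := le_dU db ha hha
  generalize xLow t.B t.f2 t.f3 ha hb da db = X at *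
  generalize dL da hb = tl at *
  generalize dU db ha = th at *
  have hXp := vl_pos hxp
  have hh : 0 < h := (vl_pos hha).trans_le h1
  have hd : 0 ≤ d := (vl_nonneg da).trans d1
  have ha0 := vl_nonneg t.a
  have hK0 := vl_nonneg t.K
  have es := sqU_v (Nat.add (Nat.add (Nat.mul hb hb) (Nat.mul db db)) (Nat.mul X X))
  rw [v2_add, v2_add, v2_mul, v2_mul, v2_mul, ← sq, ← sq, ← sq] at es
  have m2 : ∀ n, vl (Nat.mul 2 n) = 2 * vl n := by
    intro n; unfold vl; rw [Nat.mul_eq]; push_cast; ring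
  have tb1 : vl t.n1 * h ≤ vl (mU t.n1 hb) :=
    (mul_le_mul_of_nonneg_left h2 (vl_nonneg _)).trans (le_mU _ _)
  have tb2 : vl (mL t.p1 ha) ≤ vl t.p1 * h :=
    (mL_le _ _).trans (mul_le_mul_of_nonneg_left h1 (vl_nonneg _))
  unfold Tk.g Tk.thr
  have hxS : h^2 + d^2 + x^2 ≤ (2.24265:ℝ)^2 := hx.s2.trans (by norm_num)
  have hyS : h^2 + d^2 + y^2 ≤ (2.24265:ℝ)^2 := hy.s2.trans (by norm_num)
  rcases condB_elim hl with ⟨hc, hb'⟩ | ⟨hc, hb'⟩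
  · have hle := vl_mono (Nat.le_of_ble_eq_true hb')
    rw [vl_add, vl_add, vl_add, vl_add, m2, m2] at hle
    have hb1 := gg_le (a := t.a) (lp := t.lp) (ln := t.ln) (K := t.K) hha hxp h1 h2 d1 d2 etl eth es
    have hm1 := gg_anti (l := vl t.lp - vl t.ln) (K := vl t.K) hh hd hXp hxl (by linarith : 0 ≤ 1 + vl t.a) hK0 (by norm_num) hxS hg
    have hm2 := gg_anti (l := vl t.lp - vl t.ln) (K := vl t.K) hh hd hXp hyl (by linarith : 0 ≤ 1 + vl t.a) hK0 (by norm_num) hyS hg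
    linarith
  · have hX1 := (not_ble hc).le
    have hb'' := condB_true hb'
    clear hb'
    obtain ⟨hc2, hb'⟩ := hb''
    have hle := vl_mono (Nat.le_of_ble_eq_true hb')
    rw [vl_add, vl_add, vl_add, vl_add, vl_add, vl_add] at hle
    have hXr : vl X ≤ 1 := by
      have := vl_mono hX1
      refine this.trans ?_
      unfold vl; norm_num
    have hY : vl (Nat.sub 8589934592 X) = 2 - vl X := by
      rw [vl_sub (hX1.trans (by norm_num))]
      congr 1
      unfold vl; norm_num
    have hYp : 0 < Nat.sub 8589934592 X := by
      rw [Nat.sub_eq]; omega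
    have es2 := sqU_v (Nat.add (Nat.add (Nat.mul hb hb) (Nat.mul db db)) (Nat.mul (Nat.sub 8589934592 X) (Nat.sub 8589934592 X)))
    rw [v2_add, v2_add, v2_mul, v2_mul, v2_mul, ← sq, ← sq, ← sq] at es2
    have hc3 := v2_mono (Nat.le_of_ble_eq_true hc2)
    rw [v2_mul, v2_mul, vl_add] at hc3
    have one : vl 4294967296 = 1 := by unfold vl; norm_num
    rw [one] at hc3
    have hb1 := gg_le (a := t.a) (lp := t.lp) (ln := t.ln) (K := t.K) hha hxp h1 h2 d1 d2 etl eth es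
    have hb2 := gg_le (a := t.a) (lp := t.lp) (ln := t.ln) (K := t.K) hha hYp h1 h2 d1 d2 etl eth es2
    generalize sqU (Nat.add (Nat.add (Nat.mul hb hb) (Nat.mul db db)) (Nat.mul (Nat.sub 8589934592 X) (Nat.sub 8589934592 X))) = s2 at *
    rw [hY] at hb2 es2
    have hs2 := vl_nonneg s2
    have hm := gg_pair (l := vl t.lp - vl t.ln) (K := vl t.K) (S2 := vl s2) hh hd hXp hxl hyl hxy
      (by linarith : 0 ≤ 1 + vl t.a) hK0 (by norm_num) hxS hyS hg hXr hs2 (by nlinarith [vl_nonneg hb])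
      (by nlinarith [mul_nonneg (vl_nonneg t.lp) hs2, mul_le_mul_of_nonneg_left h1 (by linarith : 0 ≤ 1 + vl t.a)])
    linarith

def leafN (t : Tk) (ha hb da db : ℕ) : Bool :=
  cond (Nat.ble (Nat.add (Nat.mul hb hb) (Nat.mul db db)) 3164958000000000000) true
  (cond (Nat.ble 1 ha)
  (cond (Nat.ble (Nat.mul (Nat.mul t.ln t.ln) (Nat.add (Nat.add (Nat.mul hb hb) (Nat.mul db db)) 36893824041020822500))
      ((fun z => Nat.mul z z) (Nat.mul (Nat.add 4294967296 t.a) ha)))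
    ((fun tl th s => 
      Nat.ble (Nat.add (Nat.mul 2 (gD t.K t.ln hb db 6074028650)) (Nat.add t.n0 (mU t.n1 hb)))
        (Nat.add (Nat.mul 2 (gC t.a t.lp da tl th 6074028650 s)) (Nat.add t.p0 (mL t.p1 ha))))
      (dL da hb) (dU db ha) (sqL (Nat.add (Nat.add (Nat.mul ha ha) (Nat.mul da da)) 36893824041020822500)))
    false) false)

theorem leafN_sound (t : Tk) {ha hb da db : ℕ} (hl : leafN t ha hb da db = true) {h d x y : ℝ}
    (h1 : vl ha ≤ h) (h2 : h ≤ vl hb) (d1 : vl da ≤ d) (d2 : d ≤ vl db)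
    (hg : -(vl t.lp - vl t.ln) * 2.24265 ≤ (1 + vl t.a) * h)
    (hw : 0.1715728 ≤ h^2 + d^2) (hx : 0 < x) (hy : 0 < y) (hxS : h^2 + d^2 + x^2 ≤ 5.0294373)
    (hyS : h^2 + d^2 + y^2 ≤ 5.0294373) (hxy : x + y ≤ 2.82844) :
    -(t.g h d x + t.g h d y) ≤ t.thr h := by
  have hh0 : 0 ≤ h := (vl_nonneg ha).trans h1
  have hd : 0 ≤ d := (vl_nonneg da).trans d1
  rcases condB_elim hl with ⟨hc, -⟩ | ⟨-, hl⟩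
  · exfalso
    have := v2_mono (Nat.le_of_ble_eq_true hc)
    rw [v2_add, v2_mul, v2_mul] at this
    have e : v2 3164958000000000000 < 0.1715728 := by unfold v2; norm_num
    nlinarith
  obtain ⟨hh1, hl⟩ := condB_true hl
  obtain ⟨hc, hl⟩ := condB_true hl
  have hha : 0 < ha := Nat.le_of_ble_eq_true hh1
  have etl := dL_le da hb
  have eth := le_dU db ha hha
  have hh : 0 < h := (vl_pos hha).trans_le h1
  have ha0 := vl_nonneg t.a
  have hK0 := vl_nonneg t.K
  have hX2 : v2 36893824041020822500 = vl 6074028650 ^ 2 := by unfold v2 vl; norm_num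
  have es := sqL_v (Nat.add (Nat.add (Nat.mul ha ha) (Nat.mul da da)) 36893824041020822500)
  rw [v2_add, v2_add, v2_mul, v2_mul, ← sq, ← sq, hX2] at es
  have hle := vl_mono (Nat.le_of_ble_eq_true hl)
  have m2 : ∀ n, vl (Nat.mul 2 n) = 2 * vl n := by
    intro n; unfold vl; rw [Nat.mul_eq]; push_cast; ring
  rw [vl_add, vl_add, vl_add, vl_add, m2, m2] at hle
  have tb1 : vl t.n1 * h ≤ vl (mU t.n1 hb) :=
    (mul_le_mul_of_nonneg_left h2 (vl_nonneg _)).trans (le_mU _ _)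
  have tb2 : vl (mL t.p1 ha) ≤ vl t.p1 * h :=
    (mL_le _ _).trans (mul_le_mul_of_nonneg_left h1 (vl_nonneg _))
  have hb1 := le_gg (a := t.a) (lp := t.lp) (ln := t.ln) (K := t.K) hha (by norm_num) h1 h2 d1 d2 etl eth es
  have hmono : -(vl t.lp - vl t.ln) * √(h^2 + d^2 + vl 6074028650 ^2) ≤ (1 + vl t.a) * h := by
    have q1 : vl t.ln * √(h^2 + d^2 + vl 6074028650 ^2) ≤ (1 + vl t.a) * vl ha := by
      apply abs_le_of_sq_le_sq' _ (mul_nonneg (by linarith) (vl_nonneg _)) |>.2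
      rw [mul_pow, Real.sq_sqrt (by positivity)]
      have hcc := Nat.le_of_ble_eq_true hc
      have hcr : ((Nat.mul (Nat.mul t.ln t.ln) (Nat.add (Nat.add (Nat.mul hb hb) (Nat.mul db db)) 36893824041020822500) : ℕ) : ℝ)
        ≤ ((Nat.mul (Nat.mul (Nat.add 4294967296 t.a) ha) (Nat.mul (Nat.add 4294967296 t.a) ha) : ℕ) : ℝ) := Nat.cast_le.mpr hcc
      simp only [Nat.mul_eq, Nat.add_eq] at hcr
      push_cast at hcr
      have e1 : vl t.ln ^ 2 * (vl hb ^2 + vl db^2 + vl 6074028650 ^2) ≤ ((1 + vl t.a) * vl ha)^2 := by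
        have f1 : vl t.ln ^ 2 * (vl hb ^2 + vl db^2 + vl 6074028650 ^2) =
          ((t.ln:ℝ) * t.ln * (hb * hb + db * db + 36893824041020822500)) / 4294967296^4 := by
          unfold vl; push_cast; ring
        have f2 : ((1 + vl t.a) * vl ha)^2 =
          ((4294967296 + (t.a:ℝ)) * ha * ((4294967296 + t.a) * ha)) / 4294967296^4 := by
          unfold vl; ring
        rw [f1, f2]
        exact div_le_div_of_nonneg_right hcr (by norm_num)
      refine le_trans ?_ e1
      gcongr
    have : (1 + vl t.a) * vl ha ≤ (1 + vl t.a) * h := mul_le_mul_of_nonneg_left h1 (by linarith)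
    nlinarith [mul_nonneg (vl_nonneg t.lp) (Real.sqrt_nonneg (h^2 + d^2 + vl 6074028650 ^2))]
  have hxn : (2.82844:ℝ) ≤ 2 * vl 6074028650 := by unfold vl; norm_num
  have hm := gg_negpair (l := vl t.lp - vl t.ln) (K := vl t.K) hh hd hx hy (hxy.trans hxn)
    (by linarith : 0 ≤ 1 + vl t.a) hK0 (by norm_num) (hxS.trans (by norm_num : _ ≤ (2.24265:ℝ)^2))
    (hyS.trans (by norm_num)) hg (Real.sqrt_nonneg _) (Real.sq_sqrt (by positivity)).ge hmono
  unfold Tk.g Tk.thr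
  linarith

def go (leaf : ℕ → ℕ → ℕ → ℕ → Bool) (fuel : ℕ) : ℕ → ℕ → ℕ → ℕ → Bool :=
  Nat.rec (motive := fun _ => ℕ → ℕ → ℕ → ℕ → Bool) (fun _ _ _ _ => false)
    (fun _ ih ha hb da db => cond (leaf ha hb da db) true
      (cond (Nat.ble (Nat.sub db da) (Nat.sub hb ha))
        ((fun m => cond (ih ha m da db) (ih m hb da db) false) (Nat.div (Nat.add ha hb) 2))
        ((fun m => cond (ih ha hb da m) (ih ha hb m db) false) (Nat.div (Nat.add da db) 2)))) fuel

theorem go_sound {leaf : ℕ → ℕ → ℕ → ℕ → Bool} {P : ℝ → ℝ → Prop}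
    (hP : ∀ ha hb da db, leaf ha hb da db = true → ∀ h d, vl ha ≤ h → h ≤ vl hb → vl da ≤ d → d ≤ vl db → P h d)
    (fuel : ℕ) : ∀ ha hb da db, go leaf fuel ha hb da db = true →
      ∀ h d, vl ha ≤ h → h ≤ vl hb → vl da ≤ d → d ≤ vl db → P h d := by
  induction fuel with
  | zero => intro ha hb da db hf; cases hf
  | succ n ih =>
    intro ha hb da db hf h d h1 h2 d1 d2
    rcases condB_elim hf with ⟨hc, -⟩ | ⟨-, hf⟩
    · exact hP _ _ _ _ hc h d h1 h2 d1 d2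
    rcases condB_elim hf with ⟨-, hf⟩ | ⟨-, hf⟩
    · obtain ⟨e1, e2⟩ := condB_true hf
      rcases le_total h (vl (Nat.div (Nat.add ha hb) 2)) with hm | hm
      · exact ih _ _ _ _ e1 h d h1 hm d1 d2
      · exact ih _ _ _ _ e2 h d hm h2 d1 d2
    · obtain ⟨e1, e2⟩ := condB_true hf
      rcases le_total d (vl (Nat.div (Nat.add da db) 2)) with hm | hm
      · exact ih _ _ _ _ e1 h d h1 h2 d1 hm
      · exact ih _ _ _ _ e2 h d h1 h2 hm d2

/-- certified upper bound for a pair of half-terms -/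
def OKP (t : Tk) (ha hb da db : ℕ) : Prop :=
  ∀ c K h d x y : ℝ, c ≤ 1 + vl t.a → vl t.K ≤ K → vl ha ≤ h → h ≤ vl hb → vl da ≤ d → d ≤ vl db →
    CX t.B t.f2 t.f3 h d x → CX t.B t.f2 t.f3 h d y → 2 ≤ x + y →
    gg c (vl t.lp - vl t.ln) K h d x + gg c (vl t.lp - vl t.ln) K h d y ≤ t.thr h

def OKN (t : Tk) (ha hb da db : ℕ) : Prop :=
  ∀ c K h d x y : ℝ, 1 + vl t.a ≤ c → K ≤ vl t.K → vl ha ≤ h → h ≤ vl hb → vl da ≤ d → d ≤ vl db →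
    0.1715728 ≤ h^2 + d^2 → 0 < x → 0 < y → h^2 + d^2 + x^2 ≤ 5.0294373 → 
    h^2 + d^2 + y^2 ≤ 5.0294373 → x + y ≤ 2.82844 →
    -(gg c (vl t.lp - vl t.ln) K h d x + gg c (vl t.lp - vl t.ln) K h d y) ≤ t.thr h

theorem hg_aux (t : Tk) (ha : ℕ) (e1' : (Nat.mul t.ln 9632109) ≤ (Nat.add (Nat.mul (Nat.add 4294967296 t.a) (Nat.div ha 1000)) (Nat.mul t.lp 9632109))) :
    -(vl t.lp - vl t.ln) * 2.24265 ≤ (1 + vl t.a) * vl ha := by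
  simp only [Nat.mul_eq, Nat.add_eq] at e1'
  have q : ((t.ln * 9632109 : ℕ):ℝ) ≤ (((4294967296 + t.a) * (ha / 1000) + t.lp * 9632109 : ℕ) : ℝ) := Nat.cast_le.mpr e1'
  push_cast at q
  have q2 : ((ha / 1000 : ℕ) : ℝ) ≤ (ha:ℝ) / 1000 := Nat.cast_div_le
  have q3 : (4294967296 + (t.a:ℝ)) * ((ha / 1000 : ℕ) : ℝ) ≤ (4294967296 + (t.a:ℝ)) * ((ha:ℝ) / 1000) := 
    mul_le_mul_of_nonneg_left q2 (by positivity)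
  unfold vl
  rw [show -((t.lp:ℝ) / 4294967296 - (t.ln:ℝ)/4294967296) * 2.24265 = ((t.ln:ℝ) - t.lp) * 2.24265 / 4294967296 by ring,
    show (1 + (t.a:ℝ) / 4294967296) * ((ha:ℝ) / 4294967296) = ((4294967296 + (t.a:ℝ)) * ha / 4294967296) / 4294967296 by ring]
  apply div_le_div_of_nonneg_right _ (by positivity)
  have := Nat.cast_nonneg (α := ℝ) t.ln
  rcases le_total ((t.ln:ℝ) - t.lp) 0 with hs | hs
  · have : 0 ≤ (4294967296 + (t.a:ℝ)) * ha / 4294967296 := by positivity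
    nlinarith
  · rw [le_div_iff₀ (by norm_num)]
    nlinarith

theorem okP (t : Tk) (fuel ha hb da db : ℕ)
    (hgo : cond (Nat.ble (Nat.mul t.ln 9632109) (Nat.add (Nat.mul (Nat.add 4294967296 t.a) (Nat.div ha 1000)) (Nat.mul t.lp 9632109)))
      (cond (Nat.ble 1 ha) (go (leafP t) fuel ha hb da db) false) false = true) : OKP t ha hb da db := by
  obtain ⟨e1, hgo⟩ := condB_true hgo
  obtain ⟨e2, hgo⟩ := condB_true hgo
  have hha : 0 < ha := Nat.le_of_ble_eq_true e2
  have e1' := Nat.le_of_ble_eq_true e1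
  have hg := hg_aux t ha e1'
  intro c K h d x y hc hK h1 h2 d1 d2 hx hy hxy
  have hh : 0 < h := (vl_pos hha).trans_le h1
  have hd : 0 ≤ d := (vl_nonneg _).trans d1
  have hx0 : 0 < x := by linarith [hx.x0]
  have hy0 : 0 < y := by linarith [hy.x0]
  refine (add_le_add (gg_mono_param hh hd hx0 hc le_rfl hK) (gg_mono_param hh hd hy0 hc le_rfl hK)).trans ?_
  have := go_sound (leaf := leafP t) (P := fun h d => ∀ x y, -(vl t.lp - vl t.ln) * 2.24265 ≤ (1 + vl t.a) * h →
     CX t.B t.f2 t.f3 h d x → CX t.B t.f2 t.f3 h d y → 2 ≤ x + y → t.g h d x + t.g h d y ≤ t.thr h)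
     (fun ha hb da db hl h d h1 h2 d1 d2 x y hg hx hy hxy => leafP_sound t hl h1 h2 d1 d2 hg hx hy hxy)
     fuel ha hb da db hgo h d h1 h2 d1 d2 x y
     (hg.trans (mul_le_mul_of_nonneg_left h1 (by linarith [vl_nonneg t.a]))) hx hy hxy
  exact this

theorem okN (t : Tk) (fuel ha hb da db : ℕ)
    (hgo : cond (Nat.ble (Nat.mul t.ln 9632109) (Nat.add (Nat.mul (Nat.add 4294967296 t.a) (Nat.div ha 1000)) (Nat.mul t.lp 9632109)))
      (cond (Nat.ble 1 ha) (go (leafN t) fuel ha hb da db) false) false = true) : OKN t ha hb da db := by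
  obtain ⟨e1, hgo⟩ := condB_true hgo
  obtain ⟨e2, hgo⟩ := condB_true hgo
  have hha : 0 < ha := Nat.le_of_ble_eq_true e2
  have e1' := Nat.le_of_ble_eq_true e1
  have hg := hg_aux t ha e1'
  intro c K h d x y hc hK h1 h2 d1 d2 hw hx hy hxS hyS hxy
  have hh : 0 < h := (vl_pos hha).trans_le h1
  have hd : 0 ≤ d := (vl_nonneg _).trans d1
  refine (neg_le_neg (add_le_add (gg_mono_param hh hd hx hc le_rfl hK) (gg_mono_param hh hd hy hc le_rfl hK))).trans ?_
  have := go_sound (leaf := leafN t) (P := fun h d => ∀ x y, -(vl t.lp - vl t.ln) * 2.24265 ≤ (1 + vl t.a) * h →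
     0.1715728 ≤ h^2 + d^2 → 0 < x → 0 < y → h^2 + d^2 + x^2 ≤ 5.0294373 → 
    h^2 + d^2 + y^2 ≤ 5.0294373 → x + y ≤ 2.82844 → -(t.g h d x + t.g h d y) ≤ t.thr h)
     (fun ha hb da db hl h d h1 h2 d1 d2 x y hg hw hx hy hxS hyS hxy => leafN_sound t hl h1 h2 d1 d2 hg hw hx hy hxS hyS hxy)
     fuel ha hb da db hgo h d h1 h2 d1 d2 x y
     (hg.trans (mul_le_mul_of_nonneg_left h1 (by linarith [vl_nonneg t.a]))) hw hx hy hxS hyS hxy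
  exact this

def tkI2 : Tk := ⟨305233928, 0, 253403070, 1744918510, 54276288, 0, 0, 0, 0, false, false⟩
theorem okI2 : OKP tkI2 2018634629 3435973836 0 8632884264 :=
  okP _ 24 _ _ _ _ (by decide +kernel)

def tkI2b : Tk := ⟨305233928, 0, 790273982, 1046951106, 0, 507933617, 805943334, 0, 0, false, false⟩
theorem okI2b : OKP tkI2b 3435973836 3865470566 0 8632884264 :=
  okP _ 24 _ _ _ _ (by decide +kernel)

def tkI3 : Tk := ⟨305233928, 0, 1374389535, 610721478, 0, 1119617993, 1309657917, 0, 0, false, false⟩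
theorem okI3 : OKP tkI3 3865470566 4294967296 0 8632884264 :=
  okP _ 24 _ _ _ _ (by decide +kernel)

def tkI4a : Tk := ⟨305233928, 0, 2040109466, 0, 0, 3851713780, 4042082898, 0, 0, false, false⟩
theorem okI4a : OKP tkI4a 4294967296 5153960755 0 8632884264 :=
  okP _ 24 _ _ _ _ (by decide +kernel)

def tkI4b : Tk := ⟨305233928, 0, 2040109466, 0, 0, 2341173782, 2453374495, 0, 0, true, false⟩
theorem okI4b : OKP tkI4b 4294967296 5153960755 0 8632884264 :=
  okP _ 24 _ _ _ _ (by decide +kernel)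

def tkI4c : Tk := ⟨305233928, 0, 2040109466, 0, 742612737, 0, 0, 450882390, 0, false, true⟩
theorem okI4c : OKP tkI4c 4294967296 5153960755 0 8632884264 :=
  okP _ 24 _ _ _ _ (by decide +kernel)

def tkI5a : Tk := ⟨305233928, 0, 2040109466, 0, 0, 3238392450, 3528834306, 0, 0, false, false⟩
theorem okI5a : OKP tkI5a 5153960755 5600637353 0 8632884264 :=
  okP _ 24 _ _ _ _ (by decide +kernel)

def tkI5b : Tk := ⟨305233928, 0, 2040109466, 0, 0, 3698383447, 3565771025, 0, 0, true, false⟩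
theorem okI5b : OKP tkI5b 5153960755 5600637353 0 8632884264 :=
  okP _ 24 _ _ _ _ (by decide +kernel)

def tkI5c : Tk := ⟨305233928, 0, 2040109466, 0, 1486501073, 0, 0, 1050030328, 0, false, true⟩
theorem okI5c : OKP tkI5c 5153960755 5600637353 0 8632884264 :=
  okP _ 24 _ _ _ _ (by decide +kernel)

def tkI6a : Tk := ⟨305233928, 0, 2040109466, 0, 0, 214305977, 1206545489, 0, 0, false, false⟩
theorem okI6a : OKP tkI6a 5600637353 5836860555 0 8632884264 :=
  okP _ 24 _ _ _ _ (by decide +kernel)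

def tkI6b : Tk := ⟨305233928, 0, 2040109466, 0, 0, 5755243285, 5145030500, 0, 0, true, false⟩
theorem okI6b : OKP tkI6b 5600637353 5836860555 0 8632884264 :=
  okP _ 24 _ _ _ _ (by decide +kernel)

def tkI6c : Tk := ⟨305233928, 0, 2040109466, 0, 519274438, 0, 0, 307000986, 0, false, true⟩
theorem okI6c : OKP tkI6c 5600637353 5836860555 0 8632884264 :=
  okP _ 24 _ _ _ _ (by decide +kernel)

def tkI7a : Tk := ⟨305233928, 0, 2040109466, 0, 3408069441, 0, 0, 1443878829, 0, false, false⟩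
theorem okI7a : OKP tkI7a 5836860555 5967857057 0 8632884264 :=
  okP _ 24 _ _ _ _ (by decide +kernel)

def tkI7b : Tk := ⟨305233928, 0, 2040109466, 0, 0, 983105123, 1666106990, 0, 0, true, false⟩
theorem okI7b : OKP tkI7b 5836860555 5967857057 0 8632884264 :=
  okP _ 24 _ _ _ _ (by decide +kernel)

def tkI7c : Tk := ⟨305233928, 0, 2040109466, 0, 0, 7875239143, 5822346842, 0, 0, false, true⟩
theorem okI7c : OKP tkI7c 5836860555 5967857057 0 8632884264 :=
  okP _ 24 _ _ _ _ (by decide +kernel)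

def tkO1P : Tk := ⟨305233928, 0, 6442451, 1134197032, 944167136, 0, 0, 14722001, 0, false, false⟩
theorem okO1P : OKP tkO1P 644245094 1546188226 0 8632884264 :=
  okP _ 24 _ _ _ _ (by decide +kernel)

def tkO1N : Tk := ⟨305233927, 0, 6442451, 1134199824, 0, 949655743, 2145045253, 0, 0, false, false⟩
theorem okO1N : OKN tkO1N 644245094 1546188226 0 3560527888 :=
  okN _ 24 _ _ _ _ (by decide +kernel)

def tkO2P : Tk := ⟨305233928, 164067751, 0, 1483180734, 1267121803, 0, 0, 845558310, 0, false, false⟩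
theorem okO2P : OKP tkO2P 1546188226 1975684956 0 8632884264 :=
  okP _ 24 _ _ _ _ (by decide +kernel)

def tkO2N : Tk := ⟨305233927, 164067751, 0, 1483184385, 0, 1059891478, 2597802870, 0, 0, false, false⟩
theorem okO2N : OKN tkO2N 1546188226 1975684956 0 3560527888 :=
  okN _ 24 _ _ _ _ (by decide +kernel)

def tkO3P : Tk := ⟨305233928, 0, 84181359, 1134197032, 654324379, 0, 337894814, 0, 0, false, false⟩
theorem okO3P : OKP tkO3P 1975684956 2276332666 0 8632884264 :=
  okP _ 24 _ _ _ _ (by decide +kernel)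

def tkO3N : Tk := ⟨305233927, 0, 84181359, 1134199824, 0, 614194211, 1439811623, 0, 0, false, false⟩
theorem okO3N : OKN tkO3N 1975684956 2276332666 0 3560527888 :=
  okN _ 24 _ _ _ _ (by decide +kernel)

def tkO4P : Tk := ⟨305233928, 0, 380963599, 785213329, 11877370, 0, 1349463346, 0, 0, false, false⟩
theorem okO4P : OKP tkO4P 2276332666 2576980377 0 8632884264 :=
  okP _ 24 _ _ _ _ (by decide +kernel)

def tkO4N : Tk := ⟨305233927, 0, 380963599, 785215263, 0, 261669097, 625589558, 0, 0, false, false⟩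
theorem okO4N : OKN tkO4N 2276332666 2576980377 0 3560527888 :=
  okN _ 24 _ _ _ _ (by decide +kernel)

def tkO5P : Tk := ⟨305233928, 0, 886910747, 348983702, 0, 1001004216, 2494846044, 0, 0, false, false⟩
theorem okO5P : OKP tkO5P 2576980377 3435973836 0 8632884264 :=
  okP _ 24 _ _ _ _ (by decide +kernel)

def tkO5N : Tk := ⟨305233927, 0, 886910747, 348984562, 174614232, 0, 0, 154032086, 0, false, false⟩
theorem okO5N : OKN tkO5N 2576980377 3435973836 0 3560527888 :=
  okN _ 24 _ _ _ _ (by decide +kernel)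

def tkO6P : Tk := ⟨305233928, 0, 1597727834, 0, 0, 2497934299, 3477595347, 0, 0, false, false⟩
theorem okO6P : OKP tkO6P 3435973836 4037269258 0 8632884264 :=
  okP _ 24 _ _ _ _ (by decide +kernel)

def tkO6N : Tk := ⟨305233927, 0, 1597727834, 0, 935376658, 0, 0, 910615689, 0, false, false⟩
theorem okO6N : OKN tkO6N 3435973836 4037269258 0 3560527888 :=
  okN _ 24 _ _ _ _ (by decide +kernel)

def tkO7P : Tk := ⟨305233928, 0, 1712832958, 0, 0, 2650770257, 3423264010, 0, 0, false, false⟩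
theorem okO7P : OKP tkO7P 4037269258 4294967296 0 8632884264 :=
  okP _ 24 _ _ _ _ (by decide +kernel)

def tkO7N : Tk := ⟨305233927, 0, 1712832958, 0, 879435162, 0, 0, 801953017, 0, false, false⟩
theorem okO7N : OKN tkO7N 4037269258 4294967296 0 3560527888 :=
  okN _ 24 _ _ _ _ (by decide +kernel)

def tkU1P : Tk := ⟨305233928, 0, 1699089062, 0, 0, 2894161620, 3702350985, 0, 0, false, false⟩
theorem okU1P : OKP tkU1P 4294967296 4724464025 0 8632884264 :=
  okP _ 24 _ _ _ _ (by decide +kernel)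

def tkU1Q : Tk := ⟨305233928, 0, 1699089062, 0, 0, 840308259, 1662671016, 0, 18446744073709551616, false, false⟩
theorem okU1Q : OKP tkU1Q 4294967296 4724464025 0 8632884264 :=
  okP _ 24 _ _ _ _ (by decide +kernel)

def tkU1N : Tk := ⟨305233927, 0, 1699089062, 0, 0, 644457750, 679553002, 0, 0, false, false⟩
theorem okU1N : OKN tkU1N 4294967296 4724464025 0 3560527888 :=
  okN _ 24 _ _ _ _ (by decide +kernel)

def tkU2P : Tk := ⟨305233928, 0, 1818489153, 0, 0, 3167373474, 3797269762, 0, 0, false, false⟩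
theorem okU2P : OKP tkU2P 4724464025 5153960755 0 8632884264 :=
  okP _ 24 _ _ _ _ (by decide +kernel)

def tkU2Q : Tk := ⟨305233928, 0, 1818489153, 0, 0, 566770777, 1241764221, 0, 18446744073709551616, false, false⟩
theorem okU2Q : OKP tkU2Q 4724464025 5153960755 0 8632884264 :=
  okP _ 24 _ _ _ _ (by decide +kernel)

def tkU2N : Tk := ⟨305233927, 0, 1818489153, 0, 0, 1019889826, 1005541020, 0, 0, false, false⟩
theorem okU2N : OKN tkU2N 4724464025 5153960755 0 3560527888 :=
  okN _ 24 _ _ _ _ (by decide +kernel)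

def tkU3P : Tk := ⟨305233928, 0, 1851560401, 0, 0, 166752216, 1380062168, 0, 0, false, false⟩
theorem okU3P : OKP tkU3P 5153960755 6012954214 0 8632884264 :=
  okP _ 24 _ _ _ _ (by decide +kernel)

def tkU3Q : Tk := ⟨305233928, 0, 1851560401, 0, 0, 222586791, 897737341, 0, 18446744073709551616, false, false⟩
theorem okU3Q : OKP tkU3Q 5153960755 6012954214 0 8632884264 :=
  okP _ 24 _ _ _ _ (by decide +kernel)

def tkU3N : Tk := ⟨305233927, 0, 1851560401, 0, 0, 4468591460, 3766775495, 0, 0, false, false⟩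
theorem okU3N : OKN tkU3N 5153960755 6012954214 0 3560527888 :=
  okN _ 24 _ _ _ _ (by decide +kernel)

def tkU4P : Tk := ⟨305233928, 0, 1316836973, 0, 4826044594, 0, 0, 1591196207, 0, false, false⟩
theorem okU4P : OKP tkU4P 6012954214 7086696038 0 8632884264 :=
  okP _ 24 _ _ _ _ (by decide +kernel)

def tkU4Q : Tk := ⟨305233928, 0, 1316836973, 0, 2495165843, 0, 0, 162260588, 18446744073709551616, false, false⟩
theorem okU4Q : OKP tkU4Q 6012954214 7086696038 0 8632884264 :=
  okP _ 24 _ _ _ _ (by decide +kernel)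

def tkU4N : Tk := ⟨305233927, 0, 1316836973, 0, 0, 10499257711, 7798031799, 0, 0, false, false⟩
theorem okU4N : OKN tkU4N 6012954214 7086696038 0 3560527888 :=
  okN _ 24 _ _ _ _ (by decide +kernel)

def tkM : Tk := ⟨305233928, 0, 298946045, 1744918510, 5896601, 0, 0, 0, 0, false, false⟩
theorem okM : OKP tkM 1779033436 2018634629 1073741824 3650722201 :=
  okP _ 24 _ _ _ _ (by decide +kernel)

def tkF : Tk := ⟨305233928, 0, 298946045, 1744918510, 0, 36365877, 0, 0, 0, false, false⟩
theorem okF : OKP tkF 1779033436 2018634629 4209067950 8632884264 :=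
  okP _ 24 _ _ _ _ (by decide +kernel)

theorem arctan_le_self' {y : ℝ} (hy : 0 ≤ y) : Real.arctan y ≤ y := by
  have := arctan_lip hy; rw [Real.arctan_zero] at this; linarith

theorem arctan_cubic {y : ℝ} (hy : 0 ≤ y) : y * (1 - y^2/3) ≤ Real.arctan y := by
  have hd : ∀ z : ℝ, HasDerivAt (fun z => Real.arctan z - z * (1 - z^2/3)) (1/(1+z^2) - (1 - z^2)) z := by
    intro z
    have h1 := Real.hasDerivAt_arctan z
    have h2 : HasDerivAt (fun z : ℝ => z * (1 - z^2/3)) (1 - z^2) z := by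
      have := (hasDerivAt_id z).mul (((hasDerivAt_pow 2 z).div_const 3).const_sub 1)
      refine this.congr_deriv ?_
      simp; ring
    exact (h1.sub h2)
  have : MonotoneOn (fun z => Real.arctan z - z * (1 - z^2/3)) (Set.Ici 0) := by
    apply monotoneOn_of_deriv_nonneg (convex_Ici 0)
    · intro z _; exact (hd z).continuousAt.continuousWithinAt
    · intro z _; exact (hd z).differentiableAt.differentiableWithinAt
    · intro z _
      rw [(hd z).deriv, sub_nonneg, le_div_iff₀ (by positivity)]
      nlinarith [sq_nonneg (z^2)]
  have := this (Set.self_mem_Ici) (Set.mem_Ici.mpr hy) hy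
  simp only [Real.arctan_zero] at this
  linarith

theorem gg_z {c K h d x : ℝ} (hh : 0 < h) (hd : 0 < d) (hx : 0 < x) :
    gg c 0 K h d x - (c - 1) * (Real.pi / 2) =
      Real.arctan (h * ((√(h^2 + d^2 + x^2) - x) / (d * √(h^2 + d^2 + x^2) + x * h^2 / d)))
      - (c - 1) * Real.arctan (x * h / (d * √(h^2 + d^2 + x^2))) - h * (K * d * x) := by
  rw [gg_split hh hx]
  have hs : 0 < √(h^2 + d^2 + x^2) := Real.sqrt_pos.mpr (by positivity)
  generalize √(h^2 + d^2 + x^2) = s at *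
  have e1 : (s - x) * (d / h / (x + (d / h) ^ 2 * s)) = h * ((s - x) / (d * s + x * h^2 / d)) := by
    field_simp
    ring
  have e2 := Real.arctan_inv_of_pos (x := d * s / (x * h)) (by positivity)
  rw [inv_div] at e2
  rw [e1, e2]; ring

theorem gg_zU {c K h d x : ℝ} (hc : 1 ≤ c) (hh : 0 < h) (hd : 0 < d) (hx : 0 < x) (hq : (h/d)^2 ≤ 0.153) :
    gg c 0 K h d x - (c - 1) * (Real.pi / 2) ≤
      h * ((1 - x / √(h^2 + d^2 + x^2)) / d - (c - 1) * 0.949 * (x / √(h^2 + d^2 + x^2) / d) - K * d * x) := by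
  rw [gg_z hh hd hx]
  have hs : 0 < √(h^2 + d^2 + x^2) := Real.sqrt_pos.mpr (by positivity)
  have hxs : x ≤ √(h^2 + d^2 + x^2) := Real.le_sqrt_of_sq_le (by nlinarith)
  generalize √(h^2 + d^2 + x^2) = s at *
  have t0 : 0 ≤ (s - x) / (d * s + x * h^2 / d) := div_nonneg (by linarith) (by positivity)
  have a1 := arctan_le_self' (y := h * ((s - x) / (d * s + x * h^2 / d))) (by positivity)
  have a2 : (s - x) / (d * s + x * h^2 / d) ≤ (1 - x / s) / d := by
    rw [show (1 - x/s)/d = (s - x) / (d * s) by field_simp]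
    apply div_le_div_of_nonneg_left (by linarith) (by positivity)
    have : 0 ≤ x * h^2 / d := by positivity
    linarith
  have a3 := arctan_cubic (y := x * h / (d * s)) (by positivity)
  have a4 : (x * h / (d * s))^2 ≤ 0.153 := by
    refine le_trans ?_ hq
    rw [show x * h / (d * s) = (h / d) * (x / s) by field_simp, mul_pow]
    have : x / s ≤ 1 := (div_le_one hs).mpr hxs
    have h0 : 0 ≤ x / s := by positivity
    nlinarith [sq_nonneg (h/d), mul_le_mul this this h0 (by norm_num)]
  have a5 : h * (0.949 * (x / s / d)) ≤ Real.arctan (x * h / (d * s)) := by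
    refine le_trans ?_ a3
    rw [show h * (0.949 * (x / s / d)) = x * h / (d * s) * 0.949 by field_simp]
    apply mul_le_mul_of_nonneg_left (by linarith) (by positivity)
  have a6 := mul_le_mul_of_nonneg_left a5 (by linarith : 0 ≤ c - 1)
  have a7 := mul_le_mul_of_nonneg_left a2 hh.le
  linarith

theorem gg_zL {c K h d x : ℝ} (hc : 1 ≤ c) (hh : 0 < h) (hd : 0 < d) (hx : 1.4142 ≤ x) (h15 : h ≤ 0.151)
   (hd1 : 0.38 ≤ d) (hd2 : d ≤ 0.83) :
    -(gg c 0 K h d x - (c - 1) * (Real.pi / 2)) ≤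
      h * (- 0.999 * ((√(h^2 + d^2 + x^2) - x) / (d * √(h^2 + d^2 + x^2) + x * h^2 / d)) +
        (c - 1) * (x / √(h^2 + d^2 + x^2) / d) + K * d * x) := by
  have hx0 : 0 < x := by linarith
  rw [gg_z hh hd hx0]
  have hs : 0 < √(h^2 + d^2 + x^2) := Real.sqrt_pos.mpr (by positivity)
  have hs2 : √(h^2 + d^2 + x^2)^2 = h^2 + d^2 + x^2 := Real.sq_sqrt (by positivity)
  have hxs : x ≤ √(h^2 + d^2 + x^2) := Real.le_sqrt_of_sq_le (by nlinarith)
  generalize √(h^2 + d^2 + x^2) = s at *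
  have t0 : 0 ≤ (s - x) / (d * s + x * h^2 / d) := div_nonneg (by linarith) (by positivity)
  have t1 : (s - x) / (d * s + x * h^2 / d) ≤ 0.3 := by
    have hp : 0 < d * s + x * h^2 / d := by positivity
    rw [div_le_iff₀ hp]
    have : 0 ≤ x * h^2 / d := by positivity
    have e : (s - x) * (s + x) = h^2 + d^2 := by nlinarith
    have : s - x ≤ 0.3 * (d * s) := by
      have h2 : (s - x) * 2.828 ≤ h^2 + d^2 := by nlinarith
      nlinarith
    nlinarith
  generalize (s - x) / (d * s + x * h^2 / d) = t at *
  have a1 := arctan_cubic (y := h * t) (by positivity)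
  have a3 := arctan_le_self' (y := x * h / (d * s)) (by positivity)
  rw [show x * h / (d * s) = h * (x / s / d) by field_simp] at *
  have a6 := mul_le_mul_of_nonneg_left a3 (by linarith : 0 ≤ c - 1)
  have b : (h * t)^2 ≤ 0.003 := by
    have : h * t ≤ 0.0453 := by nlinarith
    have := mul_nonneg hh.le t0
    nlinarith
  have a7 : h * t * 0.999 ≤ h * t * (1 - (h*t)^2/3) := mul_le_mul_of_nonneg_left (by linarith) (by positivity)
  linarith

def zA (da db x : ℕ) : ℕ :=
  (fun s => dU (dU (Nat.sub s x) s) da) (sqU (Nat.add (Nat.add 415051741788809025 (Nat.mul db db)) (Nat.mul x x)))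
def zB (da db x : ℕ) : ℕ :=
  (fun s => Nat.add (mL 289635000 (dL (dL x s) db)) (mL (mL 1046938000 da) x)) (sqU (Nat.add (Nat.add 415051741788809025 (Nat.mul db db)) (Nat.mul x x)))

theorem zAB {c K h d : ℝ} {da db X : ℕ} (hc : 1.07106 ≤ c) (hK : vl 1046938000 ≤ K) (hh : 0 < h) (h15 : h ≤ 0.15)
    (hda : 0.386 ≤ vl da) (d1 : vl da ≤ d) (d2 : d ≤ vl db) (hX : 0 < X) :
    gg c 0 K h d (vl X) - (c - 1) * (Real.pi / 2) ≤ h * (vl (zA da db X) - vl (zB da db X)) := by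
  have hd : 0 < d := by linarith
  have hXp := vl_pos hX
  have hq : (h/d)^2 ≤ 0.153 := by
    rw [div_pow, div_le_iff₀ (by positivity)]; nlinarith
  refine (gg_zU (by linarith) hh hd hXp hq).trans ?_
  apply mul_le_mul_of_nonneg_left _ hh.le
  have es := sqU_v (Nat.add (Nat.add 415051741788809025 (Nat.mul db db)) (Nat.mul X X))
  unfold zA zB
  have hda0 : 0 < da := by
    rcases Nat.eq_zero_or_pos da with h | h
    · rw [h] at hda; unfold vl at hda; norm_num at hda
    · exact h
  have hdb0 : 0 < db := by
    rcases Nat.eq_zero_or_pos db with h | h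
    · rw [h] at d2; unfold vl at d2; norm_num at d2; linarith
    · exact h
  rw [v2_add, v2_add, v2_mul, v2_mul] at es
  have ehb : (0.0225:ℝ) ≤ v2 415051741788809025 := by unfold v2; norm_num
  generalize sqU _ = S at *
  have hss : √(h^2 + d^2 + vl X^2) ≤ vl S := by
    apply Real.sqrt_le_iff.mpr ⟨vl_nonneg _, _⟩
    nlinarith
  have hs : 0 < √(h^2 + d^2 + vl X^2) := Real.sqrt_pos.mpr (by positivity)
  have hxs : vl X ≤ √(h^2 + d^2 + vl X^2) := Real.le_sqrt_of_sq_le (by nlinarith)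
  generalize √(h^2 + d^2 + vl X^2) = s at *
  have hS : 0 < vl S := hs.trans_le hss
  have hS0 : 0 < S := by
    rcases Nat.eq_zero_or_pos S with h | h
    · rw [h] at hS; unfold vl at hS; norm_num at hS
    · exact h
  have u1 : vl X / vl S ≤ vl X / s := div_le_div_of_nonneg_left hXp.le hs hss
  have u2 : vl X / s ≤ 1 := (div_le_one hs).mpr hxs
  have A : (1 - vl X / s) / d ≤ vl (dU (dU (Nat.sub S X) S) da) := by
    refine le_trans ?_ (le_dU _ _ hda0)
    refine le_trans ?_ (div_le_div_of_nonneg_right (le_dU _ _ hS0) (vl_nonneg da))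
    have v1 : 1 - vl X / s ≤ vl (Nat.sub S X) / vl S := by
      rw [le_div_iff₀ hS]
      have := vl_sub_le S X
      have : vl X / vl S * vl S = vl X := by field_simp
      nlinarith
    exact div_le_div₀ (by linarith) v1 (vl_pos hda0) d1
  have u0 : 0 ≤ vl X / vl S := by positivity
  have B1 : vl (mL 289635000 (dL (dL X S) db)) ≤ (c - 1) * 0.949 * (vl X / s / d) := by
    refine (mL_le _ _).trans ?_
    have : vl (dL (dL X S) db) ≤ vl X / s / d := by
      refine (dL_le _ _).trans ?_
      refine (div_le_div_of_nonneg_right (dL_le _ _) (vl_nonneg db)).trans ?_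
      exact div_le_div₀ (by linarith) u1 hd d2
    apply mul_le_mul _ this (vl_nonneg _) (by nlinarith)
    unfold vl; norm_num; linarith
  have B2 : vl (mL (mL 1046938000 da) X) ≤ K * d * vl X := by
    refine (mL_le _ _).trans ?_
    apply mul_le_mul_of_nonneg_right _ hXp.le
    refine (mL_le _ _).trans ?_
    exact mul_le_mul hK d1 (vl_nonneg _) ((vl_nonneg _).trans hK)
  show _ ≤ vl (dU (dU (Nat.sub S X) S) da) - vl (Nat.add (mL 289635000 (dL (dL X S) db)) (mL (mL 1046938000 da) X))
  rw [vl_add]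
  linarith

def leafZ (_ _ da db : ℕ) : Bool :=
  cond (Nat.ble 1657857377 da)
  ((fun x => cond (Nat.ble 4294967296 x) (Nat.ble (Nat.mul 2 (zA da db x)) (Nat.add (Nat.mul 2 (zB da db x)) 182965606))
   ((fun y => Nat.ble (Nat.add (zA da db x) (zA da db y)) (Nat.add (Nat.add (zB da db x) (zB da db y)) 182965606)) (Nat.sub 8589934592 x)))
   (xLow 0 false false 0 644245095 da db)) false

theorem leafZ_sound {c K h d x y : ℝ} {da db ha hb : ℕ} (hl : leafZ ha hb da db = true) (hc : 1.07106 ≤ c) (hK : vl 1046938000 ≤ K) (hh : 0 < h) (h15 : h ≤ 0.15)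
    (d1 : vl da ≤ d) (d2 : d ≤ vl db) 
    (hx : CX 0 false false h d x) (hy : CX 0 false false h d y) (hxy : 2 ≤ x + y) :
    gg c 0 K h d x + gg c 0 K h d y - (c - 1) * Real.pi ≤ h * 0.0426 := by
  obtain ⟨e1, hl⟩ := condB_true hl
  have hda : 0.386 ≤ vl da := by
    refine le_trans ?_ (vl_mono (Nat.le_of_ble_eq_true e1))
    unfold vl; norm_num
  have hb15 : h ≤ vl 644245095 := h15.trans (by unfold vl; norm_num)
  have hv0 : vl 0 ≤ h := by unfold vl; simp [hh.le]
  have hxl := xLow_le hv0 hb15 d1 d2 hx hy hxy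
  have hyl := xLow_le hv0 hb15 d1 d2 hy hx (by linarith)
  have hxp := xLow_pos 0 false false 0 644245095 da db
  generalize xLow 0 false false 0 644245095 da db = X at *
  have hXp := vl_pos hxp
  have hd : 0 ≤ d := (vl_nonneg da).trans d1
  have hK0 := (vl_nonneg _).trans hK
  have hxS : h^2 + d^2 + x^2 ≤ (2.24265:ℝ)^2 := hx.s2.trans (by norm_num)
  have hyS : h^2 + d^2 + y^2 ≤ (2.24265:ℝ)^2 := hy.s2.trans (by norm_num)
  have m2 : ∀ n, vl (Nat.mul 2 n) = 2 * vl n := by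
    intro n; unfold vl; rw [Nat.mul_eq]; push_cast; ring
  have ethr : vl 182965606 ≤ 0.0426 := by unfold vl; norm_num
  have hg : -(0:ℝ) * 2.24265 ≤ c * h := by nlinarith
  have one : vl 4294967296 = 1 := by unfold vl; norm_num
  rcases condB_elim hl with ⟨hcc, hb'⟩ | ⟨hcc, hb'⟩
  · have hle := vl_mono (Nat.le_of_ble_eq_true hb')
    rw [vl_add, m2, m2] at hle
    have hb1 := zAB hc hK hh h15 hda d1 d2 hxp
    have hm1 := gg_anti (l := 0) (K := K) hh hd hXp hxl (by linarith) hK0 (by norm_num) hxS hg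
    have hm2 := gg_anti (l := 0) (K := K) hh hd hXp hyl (by linarith) hK0 (by norm_num) hyS hg
    nlinarith
  · have hX1 := (not_ble hcc).le
    have hle := vl_mono (Nat.le_of_ble_eq_true hb')
    rw [vl_add, vl_add, vl_add] at hle
    have hXr : vl X ≤ 1 := (vl_mono hX1).trans one.le
    have hY : vl (Nat.sub 8589934592 X) = 2 - vl X := by
      rw [vl_sub (hX1.trans (by norm_num))]
      congr 1
      unfold vl; norm_num
    have hYp : 0 < Nat.sub 8589934592 X := by
      rw [Nat.sub_eq]; omega
    have hb1 := zAB hc hK hh h15 hda d1 d2 hxp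
    have hb2 := zAB hc hK hh h15 hda d1 d2 hYp
    rw [hY] at hb2
    have hm := gg_pair (l := 0) (K := K) (S2 := √(h^2 + d^2 + (2 - vl X)^2)) hh hd hXp hxl hyl hxy
      (by linarith) hK0 (by norm_num) hxS hyS hg hXr (Real.sqrt_nonneg _) (Real.sq_sqrt (by positivity)).ge (by nlinarith)
    nlinarith

def leafY (_ _ da db : ℕ) : Bool :=
  cond (Nat.ble 1657857377 da)
  (cond (Nat.ble db 3560528000)
  ((fun s => cond (Nat.ble 6074028650 s) (Nat.ble (Nat.mul 2 (Nat.add (dU (mU 305235000 (dU 6074028650 s)) da) (mU (mU 1046954000 db) 6074028650)))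
      (Nat.add (Nat.mul 2 (mL 4290672000 (dL (Nat.sub s 6074028650) (Nat.add (mU db s) (dU 136672500 da))))) 2051276000)) false)
   (sqL (Nat.add (Nat.mul da da) 36893824041020822500))) false) false

theorem frac_mono {d X k S s : ℝ} (hd : 0 ≤ d) (hX : 0 ≤ X) (hk : 0 ≤ k) (h : S ≤ s) :
    (S - X) * (d * s + k) ≤ (s - X) * (d * S + k) := by
  have : (s - X) * (d * S + k) - (S - X) * (d * s + k) = (s - S) * (k + d * X) := by ring
  have : 0 ≤ (s - S) * (k + d * X) := mul_nonneg (sub_nonneg.mpr h) (by positivity)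
  linarith

theorem leafY_sound {c K h d x y : ℝ} {da db ha hb : ℕ} (hl : leafY ha hb da db = true) (hc1 : 1.07106 ≤ c)
    (hc : c ≤ 1.0710679) (hK0 : 0 ≤ K) (hK : K ≤ vl 1046954000) (hh : 0 < h) (h15 : h ≤ 0.15)
    (d1 : vl da ≤ d) (d2 : d ≤ vl db) 
    (hx : 0 < x) (hy : 0 < y) (hxS : h^2 + d^2 + x^2 ≤ 5.0294373)
    (hyS : h^2 + d^2 + y^2 ≤ 5.0294373) (hxy : x + y ≤ 2.82844) :
    -(gg c 0 K h d x + gg c 0 K h d y - (c - 1) * Real.pi) ≤ h * 0.4776 := by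
  obtain ⟨e1, hl⟩ := condB_true hl
  obtain ⟨e2, hl⟩ := condB_true hl
  have hda : 0.386 ≤ vl da := by
    refine le_trans ?_ (vl_mono (Nat.le_of_ble_eq_true e1))
    unfold vl; norm_num
  have hdb : vl db ≤ 0.83 := by
    refine le_trans (vl_mono (Nat.le_of_ble_eq_true e2)) ?_
    unfold vl; norm_num
  have hda0 : 0 < da := by
    rcases Nat.eq_zero_or_pos da with h | h
    · rw [h] at hda; unfold vl at hda; norm_num at hda
    · exact h
  have hd : 0 < d := by linarith
  have hg : -(0:ℝ) * 2.24265 ≤ c * h := by nlinarith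
  have hxn : (2.82844:ℝ) ≤ 2 * vl 6074028650 := by unfold vl; norm_num
  have hX1 : 1.4142 ≤ vl 6074028650 := by unfold vl; norm_num
  have hX3 : vl 6074028650 ≤ 1.41423 := by unfold vl; norm_num
  have hm := gg_negpair (l := 0) (K := K) hh hd.le hx hy (hxy.trans hxn)
    (by linarith) hK0 (by norm_num) (hxS.trans (by norm_num : _ ≤ (2.24265:ℝ)^2))
    (hyS.trans (by norm_num)) hg (Real.sqrt_nonneg _) (Real.sq_sqrt (by positivity)).ge (by nlinarith)
  have hz := gg_zL (c := c) (K := K) (x := vl 6074028650) (by linarith) hh hd hX1 (by linarith) (by linarith) (by linarith)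
  have es := sqL_v (Nat.add (Nat.mul da da) 36893824041020822500)
  have hX2 : v2 36893824041020822500 = vl 6074028650 ^ 2 := by unfold v2 vl; norm_num
  rw [v2_add, v2_mul, hX2] at es
  obtain ⟨e3, hl⟩ := condB_true hl
  have hq := Nat.le_of_ble_eq_true e3
  have hle := vl_mono (Nat.le_of_ble_eq_true hl)
  have m2 : ∀ n, vl (Nat.mul 2 n) = 2 * vl n := by
    intro n; unfold vl; rw [Nat.mul_eq]; push_cast; ring
  rw [m2, vl_add, vl_add, m2] at hle
  have ethr : vl 2051276000 ≤ 0.4776 := by unfold vl; norm_num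
  set X := vl 6074028650 with hX
  have hX0 : 0 < X := by linarith
  have hss : vl (sqL (Nat.add (Nat.mul da da) 36893824041020822500)) ≤ √(h^2 + d^2 + X^2) := by
    apply Real.le_sqrt_of_sq_le
    nlinarith
  have hs : 0 < √(h^2 + d^2 + X^2) := Real.sqrt_pos.mpr (by positivity)
  have hxs : X ≤ √(h^2 + d^2 + X^2) := Real.le_sqrt_of_sq_le (by nlinarith)
  generalize √(h^2 + d^2 + X^2) = s at *
  generalize sqL (Nat.add (Nat.mul da da) 36893824041020822500) = S at *
  have aU : c - 1 ≤ vl 305235000 := by refine le_trans (by linarith : c - 1 ≤ 0.0710679) ?_; unfold vl; norm_num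
  have c0 : 0 ≤ c - 1 := by linarith
  have K2 : K * d * X ≤ vl (mU (mU 1046954000 db) 6074028650) := by
    refine le_trans ?_ (le_mU _ _)
    apply mul_le_mul_of_nonneg_right _ hX0.le
    refine le_trans ?_ (le_mU _ _)
    exact mul_le_mul hK d2 hd.le (vl_nonneg _)
  have hSX : X ≤ vl S := vl_mono hq
  have hSp : 0 < vl S := hX0.trans_le hSX
  have hS : 0 < S := lt_of_lt_of_le (by norm_num) hq
  have T2 : (c - 1) * (X / s / d) ≤ vl (dU (mU 305235000 (dU 6074028650 S)) da) := by
    refine le_trans ?_ (le_dU _ _ hda0)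
    rw [show (c - 1) * (X / s / d) = ((c-1) * (X / s)) / d by ring]
    apply div_le_div₀ (vl_nonneg _) _ (vl_pos hda0) d1
    refine le_trans ?_ (le_mU _ _)
    apply mul_le_mul aU _ (by positivity) (vl_nonneg _)
    refine le_trans ?_ (le_dU _ _ hS)
    exact div_le_div_of_nonneg_left hX0.le hSp hss
  have T1 : vl (mL 4290672000 (dL (Nat.sub S 6074028650) (Nat.add (mU db S) (dU 136672500 da)))) ≤ 
     0.999 * ((s - X) / (d * s + X * h^2 / d)) := by
    have t0 : 0 ≤ (s - X) / (d * s + X * h^2 / d) := div_nonneg (by linarith) (by positivity)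
    refine (mL_le _ _).trans ?_
    apply mul_le_mul (by unfold vl; norm_num) _ (vl_nonneg _) (by norm_num)
    refine (dL_le _ _).trans ?_
    rw [vl_sub hq, vl_add, ← hX]
    have k1 : X * h^2 / d ≤ vl (dU 136672500 da) := by
      refine le_trans ?_ (le_dU _ _ hda0)
      apply div_le_div₀ (vl_nonneg _) _ (vl_pos hda0) d1
      refine le_trans (by nlinarith : _ ≤ (0.0318202:ℝ)) ?_
      unfold vl; norm_num
    have k2 : d * vl S ≤ vl (mU db S) := (mul_le_mul_of_nonneg_right d2 hSp.le).trans (le_mU _ _)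
    have k0 : 0 ≤ X * h^2 / d := by positivity
    have k3 : 0 < d * vl S + X * h^2 / d := by positivity
    calc _ ≤ (vl S - X) / (d * vl S + X * h^2 / d) := by
          apply div_le_div_of_nonneg_left (by linarith) k3 (by linarith)
      _ ≤ _ := by
          rw [div_le_div_iff₀ k3 (by positivity)]
          exact frac_mono hd.le hX0.le k0 hss
  have : h * (-0.999 * ((s - X) / (d * s + X * h ^ 2 / d)) + (c - 1) * (X / s / d) + K * d * X) ≤ h * 0.2388 := by
    apply mul_le_mul_of_nonneg_left _ hh.le
    linarith
  linarith

theorem okZ : go leafZ 20 0 0 1657857377 8632884540 = true := by decide +kernel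
theorem okY : go leafY 20 0 0 1657857377 3560527900 = true := by decide +kernel

theorem zP {c K h d x y : ℝ} (hc : 1.07106 ≤ c) (hK : vl 1046938000 ≤ K) (hh : 0 < h) (h15 : h ≤ 0.15)
    (d1 : 0.38609 ≤ d) (d2 : d ≤ 2.01) 
    (hx : CX 0 false false h d x) (hy : CX 0 false false h d y) (hxy : 2 ≤ x + y) :
    gg c 0 K h d x + gg c 0 K h d y - (c - 1) * Real.pi ≤ h * 0.0426 :=
  go_sound (leaf := leafZ) (P := fun _ d => ∀ x y, CX 0 false false h d x → CX 0 false false h d y → 2 ≤ x + y → 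
    gg c 0 K h d x + gg c 0 K h d y - (c - 1) * Real.pi ≤ h * 0.0426)
    (fun _ _ _ _ hl _ _ _ _ d1 d2 _ _ hx hy hxy => leafZ_sound hl hc hK hh h15 d1 d2 hx hy hxy)
    20 0 0 _ _ okZ 0 d (by unfold vl; simp) (by unfold vl; simp)
    (le_trans (by unfold vl; norm_num) d1) (le_trans d2 (by unfold vl; norm_num)) x y hx hy hxy

theorem zN {c K h d x y : ℝ} (hc1 : 1.07106 ≤ c)
    (hc : c ≤ 1.0710679) (hK0 : 0 ≤ K) (hK : K ≤ vl 1046954000) (hh : 0 < h) (h15 : h ≤ 0.15)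
    (d1 : 0.38609 ≤ d) (d2 : d ≤ 0.829) 
    (hx : 0 < x) (hy : 0 < y) (hxS : h^2 + d^2 + x^2 ≤ 5.0294373)
    (hyS : h^2 + d^2 + y^2 ≤ 5.0294373) (hxy : x + y ≤ 2.82844) :
    -(gg c 0 K h d x + gg c 0 K h d y - (c - 1) * Real.pi) ≤ h * 0.4776 :=
  go_sound (leaf := leafY) (P := fun _ d => h^2 + d^2 + x^2 ≤ 5.0294373 →
    h^2 + d^2 + y^2 ≤ 5.0294373 → -(gg c 0 K h d x + gg c 0 K h d y - (c - 1) * Real.pi) ≤ h * 0.4776)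
    (fun _ _ _ _ hl _ _ _ _ d1 d2 h1 h2 => leafY_sound hl hc1 hc hK0 hK hh h15 d1 d2 hx hy h1 h2 hxy)
    20 0 0 _ _ okY 0 d (by unfold vl; simp) (by unfold vl; simp)
    (le_trans (by unfold vl; norm_num) d1) (le_trans d2 (by unfold vl; norm_num)) hxS hyS

noncomputable def cc : ℝ := 5 * √2 - 6
theorem sqrt2_b : 1.414213562 ≤ √2 ∧ √2 ≤ 1.414213563 := by
  constructor
  · apply Real.le_sqrt_of_sq_le; norm_num
  · apply Real.sqrt_le_iff.mpr; norm_num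
theorem sqrt3_b : 1.7320508 ≤ √3 ∧ √3 ≤ 1.7320509 := by
  constructor
  · apply Real.le_sqrt_of_sq_le; norm_num
  · apply Real.sqrt_le_iff.mpr; norm_num
theorem cc_b : 1.07106781 ≤ cc ∧ cc ≤ 1.071067815 := by
  unfold cc; have := sqrt2_b; constructor <;> linarith [this.1, this.2]
theorem ccpi_b : 3.364858759 ≤ cc * Real.pi ∧ cc * Real.pi ≤ 3.36485878 := by
  have h1 := Real.pi_gt_d20
  have h2 := Real.pi_lt_d20
  have h3 := cc_b
  constructor <;> nlinarith [h3.1, h3.2]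

noncomputable def pg (c l K h d x y : ℝ) : ℝ := gg c l K h d x + gg c l K h d y

/-- the planar configuration: feet distances and abscissae on the three edges -/
structure Cfg (h d1 x1 y1 d2 x2 y2 d3 x3 y3 : ℝ) : Prop where
  hp : 0 < h
  at6 : Real.arctan (d1/x1) + Real.arctan (d1/y1) + (Real.arctan (d2/x2) + Real.arctan (d2/y2))
    + (Real.arctan (d3/x3) + Real.arctan (d3/y3)) = Real.pi
  ar : 2 * √3 ≤ d1 * (x1 + y1) + d2 * (x2 + y2) + d3 * (x3 + y3)
  rA : d3^2 + x3^2 = d2^2 + y2^2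
  rB : d1^2 + x1^2 = d3^2 + y3^2
  rC : d2^2 + x2^2 = d1^2 + y1^2
  sA : 2 ≤ h^2 + d3^2 + x3^2
  sB : 2 ≤ h^2 + d1^2 + x1^2
  sC : 2 ≤ h^2 + d2^2 + x2^2
  tA : h^2 + d3^2 + x3^2 ≤ 5.0294373
  tB : h^2 + d1^2 + x1^2 ≤ 5.0294373
  tC : h^2 + d2^2 + x2^2 ≤ 5.0294373
  x1p : 0.265 ≤ x1
  x2p : 0.265 ≤ x2
  x3p : 0.265 ≤ x3
  y1p : 0.265 ≤ y1
  y2p : 0.265 ≤ y2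
  y3p : 0.265 ≤ y3
  L1 : 2 ≤ x1 + y1
  L2 : 2 ≤ x2 + y2
  L3 : 2 ≤ x3 + y3
  M1 : x1 + y1 ≤ 2.82844
  M2 : x2 + y2 ≤ 2.82844
  M3 : x3 + y3 ≤ 2.82844
  nA : d3 * d2 ≤ x3 * y2
  nB : d1 * d3 ≤ x1 * y3
  nC : d2 * d1 ≤ x2 * y1

noncomputable def FF (δ h d1 x1 y1 d2 x2 y2 d3 x3 y3 : ℝ) : ℝ :=
  pg cc 0 (δ/2) h d1 x1 y1 + pg cc 0 (δ/2) h d2 x2 y2 + pg cc 0 (δ/2) h d3 x3 y3 + (1 - cc) * Real.pi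

theorem Cfg.rot {h d1 x1 y1 d2 x2 y2 d3 x3 y3 : ℝ} (C : Cfg h d1 x1 y1 d2 x2 y2 d3 x3 y3) :
    Cfg h d2 x2 y2 d3 x3 y3 d1 x1 y1 where
  hp := C.hp
  at6 := by linarith [C.at6]
  ar := by linarith [C.ar]
  rA := C.rB
  rB := C.rC
  rC := C.rA
  sA := C.sB
  sB := C.sC
  sC := C.sA
  tA := C.tB
  tB := C.tC
  tC := C.tA
  x1p := C.x2p
  x2p := C.x3p
  x3p := C.x1p
  y1p := C.y2p
  y2p := C.y3p
  y3p := C.y1p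
  L1 := C.L2
  L2 := C.L3
  L3 := C.L1
  M1 := C.M2
  M2 := C.M3
  M3 := C.M1
  nA := C.nB
  nB := C.nC
  nC := C.nA

theorem FF_rot {δ h d1 x1 y1 d2 x2 y2 d3 x3 y3 : ℝ} :
    FF δ h d1 x1 y1 d2 x2 y2 d3 x3 y3 = FF δ h d2 x2 y2 d3 x3 y3 d1 x1 y1 := by
  unfold FF; ring

/-- mirror image: exchanges the vertices `A` and `B` -/
theorem Cfg.swap {h d1 x1 y1 d2 x2 y2 d3 x3 y3 : ℝ} (C : Cfg h d1 x1 y1 d2 x2 y2 d3 x3 y3) :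
    Cfg h d2 y2 x2 d1 y1 x1 d3 y3 x3 where
  hp := C.hp
  at6 := by linarith [C.at6]
  ar := by linarith [C.ar]
  rA := C.rB.symm
  rB := C.rA.symm
  rC := C.rC.symm
  sA := by linarith [C.sB, C.rB]
  sB := by linarith [C.sA, C.rA]
  sC := by linarith [C.sC, C.rC]
  tA := by linarith [C.tB, C.rB]
  tB := by linarith [C.tA, C.rA]
  tC := by linarith [C.tC, C.rC]
  x1p := C.y2p
  x2p := C.y1p
  x3p := C.y3p
  y1p := C.x2p
  y2p := C.x1p
  y3p := C.x3p
  L1 := by linarith [C.L2]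
  L2 := by linarith [C.L1]
  L3 := by linarith [C.L3]
  M1 := by linarith [C.M2]
  M2 := by linarith [C.M1]
  M3 := by linarith [C.M3]
  nA := by linarith [C.nB]
  nB := by linarith [C.nA]
  nC := by linarith [C.nC]

theorem FF_swap {δ h d1 x1 y1 d2 x2 y2 d3 x3 y3 : ℝ} :
    FF δ h d1 x1 y1 d2 x2 y2 d3 x3 y3 = FF δ h d2 y2 x2 d1 y1 x1 d3 y3 x3 := by
  unfold FF pg; ring

theorem FF_le {δ h d1 x1 y1 d2 x2 y2 d3 x3 y3 : ℝ} (C : Cfg h d1 x1 y1 d2 x2 y2 d3 x3 y3)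
    (l kf : ℝ) (hkf : 0 ≤ kf) (hδ : 0 ≤ δ) :
    FF δ h d1 x1 y1 d2 x2 y2 d3 x3 y3 ≤
      pg cc l ((1 - kf) * δ / 2) h d1 x1 y1 + pg cc l ((1 - kf) * δ / 2) h d2 x2 y2
      + pg cc l ((1 - kf) * δ / 2) h d3 x3 y3 + Real.pi - cc * Real.pi - l * Real.pi - kf * (δ * √3 * h) := by
  have e : ∀ d x y, pg cc 0 (δ/2) h d x y = pg cc l ((1 - kf) * δ / 2) h d x y
     - l * (Real.arctan (d/x) + Real.arctan (d/y)) - kf * (δ * h / 2) * (d * (x + y)) := by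
    intro d x y; unfold pg gg; ring
  unfold FF
  rw [e d1, e d2, e d3]
  have h1 := C.at6
  have h2 := mul_le_mul_of_nonneg_left C.ar (by have := C.hp; positivity : 0 ≤ kf * (δ * h / 2))
  have h3 : l * (Real.arctan (d1/x1) + Real.arctan (d1/y1)) + l * (Real.arctan (d2/x2) + Real.arctan (d2/y2))
    + l * (Real.arctan (d3/x3) + Real.arctan (d3/y3)) = l * Real.pi := by rw [← h1]; ring
  linarith

theorem d_ub {h d x y : ℝ} (hx : h^2 + d^2 + x^2 ≤ 5.0294373) (hy : h^2 + d^2 + y^2 ≤ 5.0294373) (hxy : 2 ≤ x + y) :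
    d ≤ 2.0099 := by
  by_contra hc
  push Not at hc
  rcases le_total 1 x with h1 | h1
  · nlinarith [sq_nonneg h]
  · have : 1 ≤ y := by linarith
    nlinarith [sq_nonneg h]

theorem CX.mk0 {h d x : ℝ} (x0 : 0.265 ≤ x) (s1 : 2 ≤ h^2 + d^2 + x^2) (s2 : h^2 + d^2 + x^2 ≤ 5.0294373) :
    CX 0 false false h d x :=
  ⟨x0, s1, s2, by unfold v2; simp; positivity, by simp, by simp⟩

theorem Cfg.cx {h d1 x1 y1 d2 x2 y2 d3 x3 y3 : ℝ} (C : Cfg h d1 x1 y1 d2 x2 y2 d3 x3 y3) :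
    CX 0 false false h d1 x1 ∧ CX 0 false false h d1 y1 ∧ CX 0 false false h d2 x2 ∧ CX 0 false false h d2 y2
    ∧ CX 0 false false h d3 x3 ∧ CX 0 false false h d3 y3 ∧ d1 ≤ 2.0099 ∧ d2 ≤ 2.0099 ∧ d3 ≤ 2.0099 :=
  ⟨CX.mk0 C.x1p C.sB C.tB, CX.mk0 C.y1p (by linarith [C.sC, C.rC]) (by linarith [C.tC, C.rC]),
   CX.mk0 C.x2p C.sC C.tC, CX.mk0 C.y2p (by linarith [C.sA, C.rA]) (by linarith [C.tA, C.rA]),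
   CX.mk0 C.x3p C.sA C.tA, CX.mk0 C.y3p (by linarith [C.sB, C.rB]) (by linarith [C.tB, C.rB]),
   d_ub C.tB (by linarith [C.tC, C.rC] : h^2 + d1^2 + y1^2 ≤ _) C.L1,
   d_ub C.tC (by linarith [C.tA, C.rA] : h^2 + d2^2 + y2^2 ≤ _) C.L2,
   d_ub C.tA (by linarith [C.tB, C.rB] : h^2 + d3^2 + y3^2 ≤ _) C.L3⟩

theorem vl0 : vl 0 = 0 := by unfold vl; simp
theorem pg_neg (c l K h d x y : ℝ) : pg c l K h (-d) x y = - pg c l K h d x y := by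
  unfold pg; rw [gg_neg, gg_neg]; ring

/-- inside, uniform thresholds -/
theorem band_in {δ h d1 x1 y1 d2 x2 y2 d3 x3 y3 : ℝ} (C : Cfg h d1 x1 y1 d2 x2 y2 d3 x3 y3)
    (p1 : 0 ≤ d1) (p2 : 0 ≤ d2) (p3 : 0 ≤ d3) {t : Tk} {ha hb : ℕ} (ok : OKP t ha hb 0 8632884264)
    (hB : t.B = 0) (hf2 : t.f2 = false) (hf3 : t.f3 = false)
    (kf : ℝ) (hkf : 0 ≤ kf) (hδ : 0 ≤ δ) (ha' : vl ha ≤ h) (hb' : h ≤ vl hb) (hc : cc ≤ 1 + vl t.a)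
    (hK : vl t.K ≤ (1 - kf) * δ / 2) (hthr : 3 * t.thr h + Real.pi - cc * Real.pi - (vl t.lp - vl t.ln) * Real.pi - kf * (δ * √3 * h) ≤ 0) :
    FF δ h d1 x1 y1 d2 x2 y2 d3 x3 y3 ≤ 0 := by
  obtain ⟨c1, c2, c3, c4, c5, c6, u1, u2, u3⟩ := C.cx
  have hD : (2.0099:ℝ) ≤ vl 8632884264 := by unfold vl; norm_num
  unfold OKP at ok
  rw [hB, hf2, hf3] at ok
  have a1 := ok cc _ h d1 x1 y1 hc hK ha' hb' (by rw [vl0]; exact p1) (u1.trans hD) c1 c2 C.L1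
  have a2 := ok cc _ h d2 x2 y2 hc hK ha' hb' (by rw [vl0]; exact p2) (u2.trans hD) c3 c4 C.L2
  have a3 := ok cc _ h d3 x3 y3 hc hK ha' hb' (by rw [vl0]; exact p3) (u3.trans hD) c5 c6 C.L3
  have := FF_le C (vl t.lp - vl t.ln) kf hkf hδ
  unfold pg at this
  linarith

/-- outside: edge 3 is the negative one; thresholds for the two positive edges possibly different -/
theorem band_out {δ h d1 x1 y1 d2 x2 y2 d3 x3 y3 : ℝ} (C : Cfg h d1 x1 y1 d2 x2 y2 d3 x3 y3)
    (p1 : 0 ≤ d1) (p2 : 0 ≤ d2) (p3 : d3 ≤ 0) (q3 : -d3 ≤ 0.8289) (hw : 0.1715728 ≤ h^2 + d3^2)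
    {t t' n : Tk} {ha hb : ℕ} (ok : OKP t ha hb 0 8632884264) (ok' : OKP t' ha hb 0 8632884264) (okn : OKN n ha hb 0 3560527888)
    (c1 : CX t.B t.f2 t.f3 h d1 x1) (c2 : CX t.B t.f2 t.f3 h d1 y1)
    (c3 : CX t'.B t'.f2 t'.f3 h d2 x2) (c4 : CX t'.B t'.f2 t'.f3 h d2 y2)
    (kf : ℝ) (hkf : 0 ≤ kf) (hδ : 0 ≤ δ) (ha' : vl ha ≤ h) (hb' : h ≤ vl hb) (hc : cc ≤ 1 + vl t.a)
    (hc' : cc ≤ 1 + vl t'.a) (hcn : 1 + vl n.a ≤ cc)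
    (hK : vl t.K ≤ (1 - kf) * δ / 2) (hK' : vl t'.K ≤ (1 - kf) * δ / 2) (hKn : (1 - kf) * δ / 2 ≤ vl n.K)
    (l : ℝ) (hl : vl t.lp - vl t.ln = l) (hl' : vl t'.lp - vl t'.ln = l) (hln : vl n.lp - vl n.ln = l)
    (hthr : t.thr h + t'.thr h + n.thr h + Real.pi - cc * Real.pi - l * Real.pi - kf * (δ * √3 * h) ≤ 0) :
    FF δ h d1 x1 y1 d2 x2 y2 d3 x3 y3 ≤ 0 := by
  obtain ⟨-, -, -, -, c5, c6, u1, u2, u3⟩ := C.cx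
  have hD : (2.0099:ℝ) ≤ vl 8632884264 := by unfold vl; norm_num
  have hE : (0.8289:ℝ) ≤ vl 3560527888 := by unfold vl; norm_num
  unfold OKP at ok ok'
  unfold OKN at okn
  have a1 := ok cc _ h d1 x1 y1 hc hK ha' hb' (by rw [vl0]; exact p1) (u1.trans hD) c1 c2 C.L1
  have a2 := ok' cc _ h d2 x2 y2 hc' hK' ha' hb' (by rw [vl0]; exact p2) (u2.trans hD) c3 c4 C.L2
  have a3 := okn cc _ h (-d3) x3 y3 hcn hKn ha' hb' (by rw [vl0]; linarith) (q3.trans hE) (by rw [neg_sq]; exact hw)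
    (by linarith [C.x3p]) (by linarith [C.y3p]) (by rw [neg_sq]; exact C.tA) (by rw [neg_sq]; linarith [C.tB, C.rB]) C.M3
  have := FF_le C l kf hkf hδ
  rw [gg_neg, gg_neg, hln] at a3
  rw [hl] at a1
  rw [hl'] at a2
  unfold pg at this
  linarith

theorem band_in3 {δ h d1 x1 y1 d2 x2 y2 d3 x3 y3 : ℝ} (C : Cfg h d1 x1 y1 d2 x2 y2 d3 x3 y3)
    (p1 : 0 ≤ d1) (p2 : 0 ≤ d2) (p3 : 0 ≤ d3) 
    {t t' n : Tk} {ha hb : ℕ} (ok : OKP t ha hb 0 8632884264) (ok' : OKP t' ha hb 0 8632884264) (okn : OKP n ha hb 0 8632884264)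
    (c1 : CX n.B n.f2 n.f3 h d1 x1) (c2 : CX n.B n.f2 n.f3 h d1 y1)
    (c3 : CX t'.B t'.f2 t'.f3 h d2 x2) (c4 : CX t'.B t'.f2 t'.f3 h d2 y2)
    (c5 : CX t.B t.f2 t.f3 h d3 x3) (c6 : CX t.B t.f2 t.f3 h d3 y3)
    (kf : ℝ) (hkf : 0 ≤ kf) (hδ : 0 ≤ δ) (ha' : vl ha ≤ h) (hb' : h ≤ vl hb) (hc : cc ≤ 1 + vl t.a)
    (hc' : cc ≤ 1 + vl t'.a) (hcn : cc ≤ 1 + vl n.a)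
    (hK : vl t.K ≤ (1 - kf) * δ / 2) (hK' : vl t'.K ≤ (1 - kf) * δ / 2) (hKn : vl n.K ≤ (1 - kf) * δ / 2)
    (l : ℝ) (hl : vl t.lp - vl t.ln = l) (hl' : vl t'.lp - vl t'.ln = l) (hln : vl n.lp - vl n.ln = l)
    (hthr : t.thr h + t'.thr h + n.thr h + Real.pi - cc * Real.pi - l * Real.pi - kf * (δ * √3 * h) ≤ 0) :
    FF δ h d1 x1 y1 d2 x2 y2 d3 x3 y3 ≤ 0 := by
  obtain ⟨-, -, -, -, -, -, u1, u2, u3⟩ := C.cx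
  have hD : (2.0099:ℝ) ≤ vl 8632884264 := by unfold vl; norm_num
  unfold OKP at ok ok' okn
  have a1 := okn cc _ h d1 x1 y1 hcn hKn ha' hb' (by rw [vl0]; exact p1) (u1.trans hD) c1 c2 C.L1
  have a2 := ok' cc _ h d2 x2 y2 hc' hK' ha' hb' (by rw [vl0]; exact p2) (u2.trans hD) c3 c4 C.L2
  have a3 := ok cc _ h d3 x3 y3 hc hK ha' hb' (by rw [vl0]; exact p3) (u3.trans hD) c5 c6 C.L3
  have := FF_le C l kf hkf hδ
  rw [hln] at a1
  rw [hl'] at a2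
  rw [hl] at a3
  unfold pg at this
  linarith

theorem cc_b2 : 305233927 / 4294967296 ≤ cc - 1 ∧ cc - 1 ≤ 305233928 / 4294967296 := by
  have h1 : 1.4142135623730 ≤ √2 := by apply Real.le_sqrt_of_sq_le; norm_num
  have h2 : √2 ≤ 1.4142135623731 := by apply Real.sqrt_le_iff.mpr; norm_num
  unfold cc; constructor <;> linarith

theorem ds3 {δ h : ℝ} (hδ : 0.812541 ≤ δ) (hh : 0 ≤ h) : 0.812541 * 1.7320508 * h ≤ δ * √3 * h := by
  have := sqrt3_b.1
  gcongr

theorem CX.mkQ {h d x : ℝ} (H : CX 0 false false h d x) (w : 1 ≤ d^2 + x^2) :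
    CX 18446744073709551616 false false h d x :=
  ⟨H.x0, H.s1, H.s2, by unfold v2; norm_num; exact w, by simp, by simp⟩

theorem inI2 {δ h d1 x1 y1 d2 x2 y2 d3 x3 y3 : ℝ} (C : Cfg h d1 x1 y1 d2 x2 y2 d3 x3 y3)
    (p1 : 0 ≤ d1) (p2 : 0 ≤ d2) (p3 : 0 ≤ d3) (hδ : 0.812541 ≤ δ) (ha : vl 2018634629 ≤ h) (hb : h ≤ vl 3435973836) :
    FF δ h d1 x1 y1 d2 x2 y2 d3 x3 y3 ≤ 0 := by
  have h1 := cc_b2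
  have h2 := ccpi_b
  have h3 := Real.pi_gt_d20
  have h4 := Real.pi_lt_d20
  have h5 := ds3 hδ C.hp.le
  have h6 := C.hp
  refine band_in C p1 p2 p3 okI2 rfl rfl rfl 0 (by norm_num) (by linarith) ha hb ?_ ?_ ?_
  · simp only [tkI2, vl]; norm_num; linarith
  · simp only [tkI2, vl]; norm_num; linarith
  · generalize cc * Real.pi = cp at *
    generalize δ * √3 * h = q at *
    simp only [Tk.thr, tkI2, vl] at ha hb ⊢; norm_num at ha hb ⊢; linarith

theorem inI2b {δ h d1 x1 y1 d2 x2 y2 d3 x3 y3 : ℝ} (C : Cfg h d1 x1 y1 d2 x2 y2 d3 x3 y3)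
    (p1 : 0 ≤ d1) (p2 : 0 ≤ d2) (p3 : 0 ≤ d3) (hδ : 0.812541 ≤ δ) (ha : vl 3435973836 ≤ h) (hb : h ≤ vl 3865470566) :
    FF δ h d1 x1 y1 d2 x2 y2 d3 x3 y3 ≤ 0 := by
  have h1 := cc_b2
  have h2 := ccpi_b
  have h3 := Real.pi_gt_d20
  have h4 := Real.pi_lt_d20
  have h5 := ds3 hδ C.hp.le
  have h6 := C.hp
  refine band_in C p1 p2 p3 okI2b rfl rfl rfl 0.4 (by norm_num) (by linarith) ha hb ?_ ?_ ?_
  · simp only [tkI2b, vl]; norm_num; linarith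
  · simp only [tkI2b, vl]; norm_num; linarith
  · generalize cc * Real.pi = cp at *
    generalize δ * √3 * h = q at *
    simp only [Tk.thr, tkI2b, vl] at ha hb ⊢; norm_num at ha hb ⊢; linarith

theorem inI3 {δ h d1 x1 y1 d2 x2 y2 d3 x3 y3 : ℝ} (C : Cfg h d1 x1 y1 d2 x2 y2 d3 x3 y3)
    (p1 : 0 ≤ d1) (p2 : 0 ≤ d2) (p3 : 0 ≤ d3) (hδ : 0.812541 ≤ δ) (ha : vl 3865470566 ≤ h) (hb : h ≤ vl 4294967296) :
    FF δ h d1 x1 y1 d2 x2 y2 d3 x3 y3 ≤ 0 := by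
  have h1 := cc_b2
  have h2 := ccpi_b
  have h3 := Real.pi_gt_d20
  have h4 := Real.pi_lt_d20
  have h5 := ds3 hδ C.hp.le
  have h6 := C.hp
  refine band_in C p1 p2 p3 okI3 rfl rfl rfl 0.65 (by norm_num) (by linarith) ha hb ?_ ?_ ?_
  · simp only [tkI3, vl]; norm_num; linarith
  · simp only [tkI3, vl]; norm_num; linarith
  · generalize cc * Real.pi = cp at *
    generalize δ * √3 * h = q at *
    simp only [Tk.thr, tkI3, vl] at ha hb ⊢; norm_num at ha hb ⊢; linarith

theorem outO1 {δ h d1 x1 y1 d2 x2 y2 d3 x3 y3 : ℝ} (C : Cfg h d1 x1 y1 d2 x2 y2 d3 x3 y3)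
    (p1 : 0 ≤ d1) (p2 : 0 ≤ d2) (p3 : d3 ≤ 0) (q3 : -d3 ≤ 0.8289) (hw : 0.1715728 ≤ h^2 + d3^2) 
    (hδ : 0.812541 ≤ δ) (hδ' : δ ≤ 0.812543) (ha : vl 644245094 ≤ h) (hb : h ≤ vl 1546188226) :
    FF δ h d1 x1 y1 d2 x2 y2 d3 x3 y3 ≤ 0 := by
  have h1 := cc_b2
  have h2 := ccpi_b
  have h3 := Real.pi_gt_d20
  have h4 := Real.pi_lt_d20
  have h5 := ds3 hδ C.hp.le
  have h6 := C.hp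
  refine band_out C p1 p2 p3 q3 hw okO1P okO1P okO1N C.cx.1 C.cx.2.1 C.cx.2.2.1 C.cx.2.2.2.1 0.35 (by norm_num) (by linarith) ha hb ?_ ?_ ?_ ?_ ?_ ?_ _ rfl ?_ ?_ ?_
  · simp only [tkO1P, vl]; norm_num; linarith
  · simp only [tkO1P, vl]; norm_num; linarith
  · simp only [tkO1N, vl]; norm_num; linarith
  · simp only [tkO1P, vl]; norm_num; linarith
  · simp only [tkO1P, vl]; norm_num; linarith
  · simp only [tkO1N, vl]; norm_num; linarith
  · simp only [tkO1P, vl]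
  · simp only [tkO1P, tkO1N, vl]
  · generalize cc * Real.pi = cp at *
    generalize δ * √3 * h = q at *
    simp only [Tk.thr, tkO1P, tkO1N, vl] at ha hb ⊢; norm_num at ha hb ⊢; linarith

theorem outO2 {δ h d1 x1 y1 d2 x2 y2 d3 x3 y3 : ℝ} (C : Cfg h d1 x1 y1 d2 x2 y2 d3 x3 y3)
    (p1 : 0 ≤ d1) (p2 : 0 ≤ d2) (p3 : d3 ≤ 0) (q3 : -d3 ≤ 0.8289) (hw : 0.1715728 ≤ h^2 + d3^2) 
    (hδ : 0.812541 ≤ δ) (hδ' : δ ≤ 0.812543) (ha : vl 1546188226 ≤ h) (hb : h ≤ vl 1975684956) :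
    FF δ h d1 x1 y1 d2 x2 y2 d3 x3 y3 ≤ 0 := by
  have h1 := cc_b2
  have h2 := ccpi_b
  have h3 := Real.pi_gt_d20
  have h4 := Real.pi_lt_d20
  have h5 := ds3 hδ C.hp.le
  have h6 := C.hp
  refine band_out C p1 p2 p3 q3 hw okO2P okO2P okO2N C.cx.1 C.cx.2.1 C.cx.2.2.1 C.cx.2.2.2.1 0.15 (by norm_num) (by linarith) ha hb ?_ ?_ ?_ ?_ ?_ ?_ _ rfl ?_ ?_ ?_
  · simp only [tkO2P, vl]; norm_num; linarith
  · simp only [tkO2P, vl]; norm_num; linarith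
  · simp only [tkO2N, vl]; norm_num; linarith
  · simp only [tkO2P, vl]; norm_num; linarith
  · simp only [tkO2P, vl]; norm_num; linarith
  · simp only [tkO2N, vl]; norm_num; linarith
  · simp only [tkO2P, vl]
  · simp only [tkO2P, tkO2N, vl]
  · generalize cc * Real.pi = cp at *
    generalize δ * √3 * h = q at *
    simp only [Tk.thr, tkO2P, tkO2N, vl] at ha hb ⊢; norm_num at ha hb ⊢; linarith

theorem outO3 {δ h d1 x1 y1 d2 x2 y2 d3 x3 y3 : ℝ} (C : Cfg h d1 x1 y1 d2 x2 y2 d3 x3 y3)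
    (p1 : 0 ≤ d1) (p2 : 0 ≤ d2) (p3 : d3 ≤ 0) (q3 : -d3 ≤ 0.8289) (hw : 0.1715728 ≤ h^2 + d3^2) 
    (hδ : 0.812541 ≤ δ) (hδ' : δ ≤ 0.812543) (ha : vl 1975684956 ≤ h) (hb : h ≤ vl 2276332666) :
    FF δ h d1 x1 y1 d2 x2 y2 d3 x3 y3 ≤ 0 := by
  have h1 := cc_b2
  have h2 := ccpi_b
  have h3 := Real.pi_gt_d20
  have h4 := Real.pi_lt_d20
  have h5 := ds3 hδ C.hp.le
  have h6 := C.hp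
  refine band_out C p1 p2 p3 q3 hw okO3P okO3P okO3N C.cx.1 C.cx.2.1 C.cx.2.2.1 C.cx.2.2.2.1 0.35 (by norm_num) (by linarith) ha hb ?_ ?_ ?_ ?_ ?_ ?_ _ rfl ?_ ?_ ?_
  · simp only [tkO3P, vl]; norm_num; linarith
  · simp only [tkO3P, vl]; norm_num; linarith
  · simp only [tkO3N, vl]; norm_num; linarith
  · simp only [tkO3P, vl]; norm_num; linarith
  · simp only [tkO3P, vl]; norm_num; linarith
  · simp only [tkO3N, vl]; norm_num; linarith
  · simp only [tkO3P, vl]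
  · simp only [tkO3P, tkO3N, vl]
  · generalize cc * Real.pi = cp at *
    generalize δ * √3 * h = q at *
    simp only [Tk.thr, tkO3P, tkO3N, vl] at ha hb ⊢; norm_num at ha hb ⊢; linarith

theorem outO4 {δ h d1 x1 y1 d2 x2 y2 d3 x3 y3 : ℝ} (C : Cfg h d1 x1 y1 d2 x2 y2 d3 x3 y3)
    (p1 : 0 ≤ d1) (p2 : 0 ≤ d2) (p3 : d3 ≤ 0) (q3 : -d3 ≤ 0.8289) (hw : 0.1715728 ≤ h^2 + d3^2) 
    (hδ : 0.812541 ≤ δ) (hδ' : δ ≤ 0.812543) (ha : vl 2276332666 ≤ h) (hb : h ≤ vl 2576980377) :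
    FF δ h d1 x1 y1 d2 x2 y2 d3 x3 y3 ≤ 0 := by
  have h1 := cc_b2
  have h2 := ccpi_b
  have h3 := Real.pi_gt_d20
  have h4 := Real.pi_lt_d20
  have h5 := ds3 hδ C.hp.le
  have h6 := C.hp
  refine band_out C p1 p2 p3 q3 hw okO4P okO4P okO4N C.cx.1 C.cx.2.1 C.cx.2.2.1 C.cx.2.2.2.1 0.55 (by norm_num) (by linarith) ha hb ?_ ?_ ?_ ?_ ?_ ?_ _ rfl ?_ ?_ ?_
  · simp only [tkO4P, vl]; norm_num; linarith
  · simp only [tkO4P, vl]; norm_num; linarith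
  · simp only [tkO4N, vl]; norm_num; linarith
  · simp only [tkO4P, vl]; norm_num; linarith
  · simp only [tkO4P, vl]; norm_num; linarith
  · simp only [tkO4N, vl]; norm_num; linarith
  · simp only [tkO4P, vl]
  · simp only [tkO4P, tkO4N, vl]
  · generalize cc * Real.pi = cp at *
    generalize δ * √3 * h = q at *
    simp only [Tk.thr, tkO4P, tkO4N, vl] at ha hb ⊢; norm_num at ha hb ⊢; linarith

theorem outO5 {δ h d1 x1 y1 d2 x2 y2 d3 x3 y3 : ℝ} (C : Cfg h d1 x1 y1 d2 x2 y2 d3 x3 y3)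
    (p1 : 0 ≤ d1) (p2 : 0 ≤ d2) (p3 : d3 ≤ 0) (q3 : -d3 ≤ 0.8289) (hw : 0.1715728 ≤ h^2 + d3^2) 
    (hδ : 0.812541 ≤ δ) (hδ' : δ ≤ 0.812543) (ha : vl 2576980377 ≤ h) (hb : h ≤ vl 3435973836) :
    FF δ h d1 x1 y1 d2 x2 y2 d3 x3 y3 ≤ 0 := by
  have h1 := cc_b2
  have h2 := ccpi_b
  have h3 := Real.pi_gt_d20
  have h4 := Real.pi_lt_d20
  have h5 := ds3 hδ C.hp.le
  have h6 := C.hp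
  refine band_out C p1 p2 p3 q3 hw okO5P okO5P okO5N C.cx.1 C.cx.2.1 C.cx.2.2.1 C.cx.2.2.2.1 0.8 (by norm_num) (by linarith) ha hb ?_ ?_ ?_ ?_ ?_ ?_ _ rfl ?_ ?_ ?_
  · simp only [tkO5P, vl]; norm_num; linarith
  · simp only [tkO5P, vl]; norm_num; linarith
  · simp only [tkO5N, vl]; norm_num; linarith
  · simp only [tkO5P, vl]; norm_num; linarith
  · simp only [tkO5P, vl]; norm_num; linarith
  · simp only [tkO5N, vl]; norm_num; linarith
  · simp only [tkO5P, vl]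
  · simp only [tkO5P, tkO5N, vl]
  · generalize cc * Real.pi = cp at *
    generalize δ * √3 * h = q at *
    simp only [Tk.thr, tkO5P, tkO5N, vl] at ha hb ⊢; norm_num at ha hb ⊢; linarith

theorem outO6 {δ h d1 x1 y1 d2 x2 y2 d3 x3 y3 : ℝ} (C : Cfg h d1 x1 y1 d2 x2 y2 d3 x3 y3)
    (p1 : 0 ≤ d1) (p2 : 0 ≤ d2) (p3 : d3 ≤ 0) (q3 : -d3 ≤ 0.8289) (hw : 0.1715728 ≤ h^2 + d3^2) 
    (hδ : 0.812541 ≤ δ) (hδ' : δ ≤ 0.812543) (ha : vl 3435973836 ≤ h) (hb : h ≤ vl 4037269258) :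
    FF δ h d1 x1 y1 d2 x2 y2 d3 x3 y3 ≤ 0 := by
  have h1 := cc_b2
  have h2 := ccpi_b
  have h3 := Real.pi_gt_d20
  have h4 := Real.pi_lt_d20
  have h5 := ds3 hδ C.hp.le
  have h6 := C.hp
  refine band_out C p1 p2 p3 q3 hw okO6P okO6P okO6N C.cx.1 C.cx.2.1 C.cx.2.2.1 C.cx.2.2.2.1 1 (by norm_num) (by linarith) ha hb ?_ ?_ ?_ ?_ ?_ ?_ _ rfl ?_ ?_ ?_
  · simp only [tkO6P, vl]; norm_num; linarith
  · simp only [tkO6P, vl]; norm_num; linarith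
  · simp only [tkO6N, vl]; norm_num; linarith
  · simp only [tkO6P, vl]; norm_num; 
  · simp only [tkO6P, vl]; norm_num; 
  · simp only [tkO6N, vl]; norm_num; 
  · simp only [tkO6P, vl]
  · simp only [tkO6P, tkO6N, vl]
  · generalize cc * Real.pi = cp at *
    generalize δ * √3 * h = q at *
    simp only [Tk.thr, tkO6P, tkO6N, vl] at ha hb ⊢; norm_num at ha hb ⊢; linarith

theorem outO7 {δ h d1 x1 y1 d2 x2 y2 d3 x3 y3 : ℝ} (C : Cfg h d1 x1 y1 d2 x2 y2 d3 x3 y3)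
    (p1 : 0 ≤ d1) (p2 : 0 ≤ d2) (p3 : d3 ≤ 0) (q3 : -d3 ≤ 0.8289) (hw : 0.1715728 ≤ h^2 + d3^2) 
    (hδ : 0.812541 ≤ δ) (hδ' : δ ≤ 0.812543) (ha : vl 4037269258 ≤ h) (hb : h ≤ vl 4294967296) :
    FF δ h d1 x1 y1 d2 x2 y2 d3 x3 y3 ≤ 0 := by
  have h1 := cc_b2
  have h2 := ccpi_b
  have h3 := Real.pi_gt_d20
  have h4 := Real.pi_lt_d20
  have h5 := ds3 hδ C.hp.le
  have h6 := C.hp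
  refine band_out C p1 p2 p3 q3 hw okO7P okO7P okO7N C.cx.1 C.cx.2.1 C.cx.2.2.1 C.cx.2.2.2.1 1 (by norm_num) (by linarith) ha hb ?_ ?_ ?_ ?_ ?_ ?_ _ rfl ?_ ?_ ?_
  · simp only [tkO7P, vl]; norm_num; linarith
  · simp only [tkO7P, vl]; norm_num; linarith
  · simp only [tkO7N, vl]; norm_num; linarith
  · simp only [tkO7P, vl]; norm_num; 
  · simp only [tkO7P, vl]; norm_num; 
  · simp only [tkO7N, vl]; norm_num; 
  · simp only [tkO7P, vl]
  · simp only [tkO7P, tkO7N, vl]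
  · generalize cc * Real.pi = cp at *
    generalize δ * √3 * h = q at *
    simp only [Tk.thr, tkO7P, tkO7N, vl] at ha hb ⊢; norm_num at ha hb ⊢; linarith

theorem outU1a {δ h d1 x1 y1 d2 x2 y2 d3 x3 y3 : ℝ} (C : Cfg h d1 x1 y1 d2 x2 y2 d3 x3 y3)
    (p1 : 0 ≤ d1) (p2 : 0 ≤ d2) (p3 : d3 ≤ 0) (q3 : -d3 ≤ 0.8289) (hw : 0.1715728 ≤ h^2 + d3^2) (wQ1 : 1 ≤ d1^2 + x1^2) (wQ2 : 1 ≤ d1^2 + y1^2)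
    (hδ : 0.812541 ≤ δ) (hδ' : δ ≤ 0.812543) (ha : vl 4294967296 ≤ h) (hb : h ≤ vl 4724464025) :
    FF δ h d1 x1 y1 d2 x2 y2 d3 x3 y3 ≤ 0 := by
  have h1 := cc_b2
  have h2 := ccpi_b
  have h3 := Real.pi_gt_d20
  have h4 := Real.pi_lt_d20
  have h5 := ds3 hδ C.hp.le
  have h6 := C.hp
  refine band_out C p1 p2 p3 q3 hw okU1Q okU1P okU1N (CX.mkQ (C.cx.1) wQ1) (CX.mkQ (C.cx.2.1) wQ2) C.cx.2.2.1 C.cx.2.2.2.1 1 (by norm_num) (by linarith) ha hb ?_ ?_ ?_ ?_ ?_ ?_ _ rfl ?_ ?_ ?_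
  · simp only [tkU1Q, vl]; norm_num; linarith
  · simp only [tkU1P, vl]; norm_num; linarith
  · simp only [tkU1N, vl]; norm_num; linarith
  · simp only [tkU1Q, vl]; norm_num; 
  · simp only [tkU1P, vl]; norm_num; 
  · simp only [tkU1N, vl]; norm_num; 
  · simp only [tkU1Q, tkU1P, vl]
  · simp only [tkU1Q, tkU1N, vl]
  · generalize cc * Real.pi = cp at *
    generalize δ * √3 * h = q at *
    simp only [Tk.thr, tkU1Q, tkU1P, tkU1N, vl] at ha hb ⊢; norm_num at ha hb ⊢; linarith

theorem outU1b {δ h d1 x1 y1 d2 x2 y2 d3 x3 y3 : ℝ} (C : Cfg h d1 x1 y1 d2 x2 y2 d3 x3 y3)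
    (p1 : 0 ≤ d1) (p2 : 0 ≤ d2) (p3 : d3 ≤ 0) (q3 : -d3 ≤ 0.8289) (hw : 0.1715728 ≤ h^2 + d3^2) (wQ1 : 1 ≤ d2^2 + x2^2) (wQ2 : 1 ≤ d2^2 + y2^2)
    (hδ : 0.812541 ≤ δ) (hδ' : δ ≤ 0.812543) (ha : vl 4294967296 ≤ h) (hb : h ≤ vl 4724464025) :
    FF δ h d1 x1 y1 d2 x2 y2 d3 x3 y3 ≤ 0 := by
  have h1 := cc_b2
  have h2 := ccpi_b
  have h3 := Real.pi_gt_d20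
  have h4 := Real.pi_lt_d20
  have h5 := ds3 hδ C.hp.le
  have h6 := C.hp
  refine band_out C p1 p2 p3 q3 hw okU1P okU1Q okU1N C.cx.1 C.cx.2.1 (CX.mkQ (C.cx.2.2.1) wQ1) (CX.mkQ (C.cx.2.2.2.1) wQ2) 1 (by norm_num) (by linarith) ha hb ?_ ?_ ?_ ?_ ?_ ?_ _ rfl ?_ ?_ ?_
  · simp only [tkU1P, vl]; norm_num; linarith
  · simp only [tkU1Q, vl]; norm_num; linarith
  · simp only [tkU1N, vl]; norm_num; linarith
  · simp only [tkU1P, vl]; norm_num; 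
  · simp only [tkU1Q, vl]; norm_num; 
  · simp only [tkU1N, vl]; norm_num; 
  · simp only [tkU1P, tkU1Q, vl]
  · simp only [tkU1P, tkU1N, vl]
  · generalize cc * Real.pi = cp at *
    generalize δ * √3 * h = q at *
    simp only [Tk.thr, tkU1P, tkU1Q, tkU1N, vl] at ha hb ⊢; norm_num at ha hb ⊢; linarith

theorem outU2a {δ h d1 x1 y1 d2 x2 y2 d3 x3 y3 : ℝ} (C : Cfg h d1 x1 y1 d2 x2 y2 d3 x3 y3)
    (p1 : 0 ≤ d1) (p2 : 0 ≤ d2) (p3 : d3 ≤ 0) (q3 : -d3 ≤ 0.8289) (hw : 0.1715728 ≤ h^2 + d3^2) (wQ1 : 1 ≤ d1^2 + x1^2) (wQ2 : 1 ≤ d1^2 + y1^2)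
    (hδ : 0.812541 ≤ δ) (hδ' : δ ≤ 0.812543) (ha : vl 4724464025 ≤ h) (hb : h ≤ vl 5153960755) :
    FF δ h d1 x1 y1 d2 x2 y2 d3 x3 y3 ≤ 0 := by
  have h1 := cc_b2
  have h2 := ccpi_b
  have h3 := Real.pi_gt_d20
  have h4 := Real.pi_lt_d20
  have h5 := ds3 hδ C.hp.le
  have h6 := C.hp
  refine band_out C p1 p2 p3 q3 hw okU2Q okU2P okU2N (CX.mkQ (C.cx.1) wQ1) (CX.mkQ (C.cx.2.1) wQ2) C.cx.2.2.1 C.cx.2.2.2.1 1 (by norm_num) (by linarith) ha hb ?_ ?_ ?_ ?_ ?_ ?_ _ rfl ?_ ?_ ?_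
  · simp only [tkU2Q, vl]; norm_num; linarith
  · simp only [tkU2P, vl]; norm_num; linarith
  · simp only [tkU2N, vl]; norm_num; linarith
  · simp only [tkU2Q, vl]; norm_num; 
  · simp only [tkU2P, vl]; norm_num; 
  · simp only [tkU2N, vl]; norm_num; 
  · simp only [tkU2Q, tkU2P, vl]
  · simp only [tkU2Q, tkU2N, vl]
  · generalize cc * Real.pi = cp at *
    generalize δ * √3 * h = q at *
    simp only [Tk.thr, tkU2Q, tkU2P, tkU2N, vl] at ha hb ⊢; norm_num at ha hb ⊢; linarith

theorem outU2b {δ h d1 x1 y1 d2 x2 y2 d3 x3 y3 : ℝ} (C : Cfg h d1 x1 y1 d2 x2 y2 d3 x3 y3)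
    (p1 : 0 ≤ d1) (p2 : 0 ≤ d2) (p3 : d3 ≤ 0) (q3 : -d3 ≤ 0.8289) (hw : 0.1715728 ≤ h^2 + d3^2) (wQ1 : 1 ≤ d2^2 + x2^2) (wQ2 : 1 ≤ d2^2 + y2^2)
    (hδ : 0.812541 ≤ δ) (hδ' : δ ≤ 0.812543) (ha : vl 4724464025 ≤ h) (hb : h ≤ vl 5153960755) :
    FF δ h d1 x1 y1 d2 x2 y2 d3 x3 y3 ≤ 0 := by
  have h1 := cc_b2
  have h2 := ccpi_b
  have h3 := Real.pi_gt_d20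
  have h4 := Real.pi_lt_d20
  have h5 := ds3 hδ C.hp.le
  have h6 := C.hp
  refine band_out C p1 p2 p3 q3 hw okU2P okU2Q okU2N C.cx.1 C.cx.2.1 (CX.mkQ (C.cx.2.2.1) wQ1) (CX.mkQ (C.cx.2.2.2.1) wQ2) 1 (by norm_num) (by linarith) ha hb ?_ ?_ ?_ ?_ ?_ ?_ _ rfl ?_ ?_ ?_
  · simp only [tkU2P, vl]; norm_num; linarith
  · simp only [tkU2Q, vl]; norm_num; linarith
  · simp only [tkU2N, vl]; norm_num; linarith
  · simp only [tkU2P, vl]; norm_num; 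
  · simp only [tkU2Q, vl]; norm_num; 
  · simp only [tkU2N, vl]; norm_num; 
  · simp only [tkU2P, tkU2Q, vl]
  · simp only [tkU2P, tkU2N, vl]
  · generalize cc * Real.pi = cp at *
    generalize δ * √3 * h = q at *
    simp only [Tk.thr, tkU2P, tkU2Q, tkU2N, vl] at ha hb ⊢; norm_num at ha hb ⊢; linarith

theorem outU3a {δ h d1 x1 y1 d2 x2 y2 d3 x3 y3 : ℝ} (C : Cfg h d1 x1 y1 d2 x2 y2 d3 x3 y3)
    (p1 : 0 ≤ d1) (p2 : 0 ≤ d2) (p3 : d3 ≤ 0) (q3 : -d3 ≤ 0.8289) (hw : 0.1715728 ≤ h^2 + d3^2) (wQ1 : 1 ≤ d1^2 + x1^2) (wQ2 : 1 ≤ d1^2 + y1^2)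
    (hδ : 0.812541 ≤ δ) (hδ' : δ ≤ 0.812543) (ha : vl 5153960755 ≤ h) (hb : h ≤ vl 6012954214) :
    FF δ h d1 x1 y1 d2 x2 y2 d3 x3 y3 ≤ 0 := by
  have h1 := cc_b2
  have h2 := ccpi_b
  have h3 := Real.pi_gt_d20
  have h4 := Real.pi_lt_d20
  have h5 := ds3 hδ C.hp.le
  have h6 := C.hp
  refine band_out C p1 p2 p3 q3 hw okU3Q okU3P okU3N (CX.mkQ (C.cx.1) wQ1) (CX.mkQ (C.cx.2.1) wQ2) C.cx.2.2.1 C.cx.2.2.2.1 1 (by norm_num) (by linarith) ha hb ?_ ?_ ?_ ?_ ?_ ?_ _ rfl ?_ ?_ ?_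
  · simp only [tkU3Q, vl]; norm_num; linarith
  · simp only [tkU3P, vl]; norm_num; linarith
  · simp only [tkU3N, vl]; norm_num; linarith
  · simp only [tkU3Q, vl]; norm_num; 
  · simp only [tkU3P, vl]; norm_num; 
  · simp only [tkU3N, vl]; norm_num; 
  · simp only [tkU3Q, tkU3P, vl]
  · simp only [tkU3Q, tkU3N, vl]
  · generalize cc * Real.pi = cp at *
    generalize δ * √3 * h = q at *
    simp only [Tk.thr, tkU3Q, tkU3P, tkU3N, vl] at ha hb ⊢; norm_num at ha hb ⊢; linarith

theorem outU3b {δ h d1 x1 y1 d2 x2 y2 d3 x3 y3 : ℝ} (C : Cfg h d1 x1 y1 d2 x2 y2 d3 x3 y3)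
    (p1 : 0 ≤ d1) (p2 : 0 ≤ d2) (p3 : d3 ≤ 0) (q3 : -d3 ≤ 0.8289) (hw : 0.1715728 ≤ h^2 + d3^2) (wQ1 : 1 ≤ d2^2 + x2^2) (wQ2 : 1 ≤ d2^2 + y2^2)
    (hδ : 0.812541 ≤ δ) (hδ' : δ ≤ 0.812543) (ha : vl 5153960755 ≤ h) (hb : h ≤ vl 6012954214) :
    FF δ h d1 x1 y1 d2 x2 y2 d3 x3 y3 ≤ 0 := by
  have h1 := cc_b2
  have h2 := ccpi_b
  have h3 := Real.pi_gt_d20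
  have h4 := Real.pi_lt_d20
  have h5 := ds3 hδ C.hp.le
  have h6 := C.hp
  refine band_out C p1 p2 p3 q3 hw okU3P okU3Q okU3N C.cx.1 C.cx.2.1 (CX.mkQ (C.cx.2.2.1) wQ1) (CX.mkQ (C.cx.2.2.2.1) wQ2) 1 (by norm_num) (by linarith) ha hb ?_ ?_ ?_ ?_ ?_ ?_ _ rfl ?_ ?_ ?_
  · simp only [tkU3P, vl]; norm_num; linarith
  · simp only [tkU3Q, vl]; norm_num; linarith
  · simp only [tkU3N, vl]; norm_num; linarith
  · simp only [tkU3P, vl]; norm_num; 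
  · simp only [tkU3Q, vl]; norm_num; 
  · simp only [tkU3N, vl]; norm_num; 
  · simp only [tkU3P, tkU3Q, vl]
  · simp only [tkU3P, tkU3N, vl]
  · generalize cc * Real.pi = cp at *
    generalize δ * √3 * h = q at *
    simp only [Tk.thr, tkU3P, tkU3Q, tkU3N, vl] at ha hb ⊢; norm_num at ha hb ⊢; linarith

theorem outU4a {δ h d1 x1 y1 d2 x2 y2 d3 x3 y3 : ℝ} (C : Cfg h d1 x1 y1 d2 x2 y2 d3 x3 y3)
    (p1 : 0 ≤ d1) (p2 : 0 ≤ d2) (p3 : d3 ≤ 0) (q3 : -d3 ≤ 0.8289) (hw : 0.1715728 ≤ h^2 + d3^2) (wQ1 : 1 ≤ d1^2 + x1^2) (wQ2 : 1 ≤ d1^2 + y1^2)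
    (hδ : 0.812541 ≤ δ) (hδ' : δ ≤ 0.812543) (ha : vl 6012954214 ≤ h) (hb : h ≤ vl 7086696038) :
    FF δ h d1 x1 y1 d2 x2 y2 d3 x3 y3 ≤ 0 := by
  have h1 := cc_b2
  have h2 := ccpi_b
  have h3 := Real.pi_gt_d20
  have h4 := Real.pi_lt_d20
  have h5 := ds3 hδ C.hp.le
  have h6 := C.hp
  refine band_out C p1 p2 p3 q3 hw okU4Q okU4P okU4N (CX.mkQ (C.cx.1) wQ1) (CX.mkQ (C.cx.2.1) wQ2) C.cx.2.2.1 C.cx.2.2.2.1 1 (by norm_num) (by linarith) ha hb ?_ ?_ ?_ ?_ ?_ ?_ _ rfl ?_ ?_ ?_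
  · simp only [tkU4Q, vl]; norm_num; linarith
  · simp only [tkU4P, vl]; norm_num; linarith
  · simp only [tkU4N, vl]; norm_num; linarith
  · simp only [tkU4Q, vl]; norm_num; 
  · simp only [tkU4P, vl]; norm_num; 
  · simp only [tkU4N, vl]; norm_num; 
  · simp only [tkU4Q, tkU4P, vl]
  · simp only [tkU4Q, tkU4N, vl]
  · generalize cc * Real.pi = cp at *
    generalize δ * √3 * h = q at *
    simp only [Tk.thr, tkU4Q, tkU4P, tkU4N, vl] at ha hb ⊢; norm_num at ha hb ⊢; linarith

theorem outU4b {δ h d1 x1 y1 d2 x2 y2 d3 x3 y3 : ℝ} (C : Cfg h d1 x1 y1 d2 x2 y2 d3 x3 y3)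
    (p1 : 0 ≤ d1) (p2 : 0 ≤ d2) (p3 : d3 ≤ 0) (q3 : -d3 ≤ 0.8289) (hw : 0.1715728 ≤ h^2 + d3^2) (wQ1 : 1 ≤ d2^2 + x2^2) (wQ2 : 1 ≤ d2^2 + y2^2)
    (hδ : 0.812541 ≤ δ) (hδ' : δ ≤ 0.812543) (ha : vl 6012954214 ≤ h) (hb : h ≤ vl 7086696038) :
    FF δ h d1 x1 y1 d2 x2 y2 d3 x3 y3 ≤ 0 := by
  have h1 := cc_b2
  have h2 := ccpi_b
  have h3 := Real.pi_gt_d20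
  have h4 := Real.pi_lt_d20
  have h5 := ds3 hδ C.hp.le
  have h6 := C.hp
  refine band_out C p1 p2 p3 q3 hw okU4P okU4Q okU4N C.cx.1 C.cx.2.1 (CX.mkQ (C.cx.2.2.1) wQ1) (CX.mkQ (C.cx.2.2.2.1) wQ2) 1 (by norm_num) (by linarith) ha hb ?_ ?_ ?_ ?_ ?_ ?_ _ rfl ?_ ?_ ?_
  · simp only [tkU4P, vl]; norm_num; linarith
  · simp only [tkU4Q, vl]; norm_num; linarith
  · simp only [tkU4N, vl]; norm_num; linarith
  · simp only [tkU4P, vl]; norm_num; 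
  · simp only [tkU4Q, vl]; norm_num; 
  · simp only [tkU4N, vl]; norm_num; 
  · simp only [tkU4P, tkU4Q, vl]
  · simp only [tkU4P, tkU4N, vl]
  · generalize cc * Real.pi = cp at *
    generalize δ * √3 * h = q at *
    simp only [Tk.thr, tkU4P, tkU4Q, tkU4N, vl] at ha hb ⊢; norm_num at ha hb ⊢; linarith

theorem inI4 {δ h d1 x1 y1 d2 x2 y2 d3 x3 y3 : ℝ} (C : Cfg h d1 x1 y1 d2 x2 y2 d3 x3 y3)
    (p1 : 0 ≤ d1) (p2 : 0 ≤ d2) (p3 : 0 ≤ d3) (c1 : CX 0 false true h d1 x1) (c2 : CX 0 false true h d1 y1)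
    (c3 : CX 0 true false h d2 x2) (c4 : CX 0 true false h d2 y2)
    (hδ : 0.812541 ≤ δ) (ha : vl 4294967296 ≤ h) (hb : h ≤ vl 5153960755) :
    FF δ h d1 x1 y1 d2 x2 y2 d3 x3 y3 ≤ 0 := by
  have h1 := cc_b2
  have h2 := ccpi_b
  have h3 := Real.pi_gt_d20
  have h4 := Real.pi_lt_d20
  have h5 := ds3 hδ C.hp.le
  have h6 := C.hp
  refine band_in3 C p1 p2 p3 okI4a okI4b okI4c c1 c2 c3 c4 C.cx.2.2.2.2.1 C.cx.2.2.2.2.2.1 1 (by norm_num) (by linarith) ha hb ?_ ?_ ?_ ?_ ?_ ?_ _ rfl ?_ ?_ ?_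
  · simp only [tkI4a, vl]; norm_num; linarith
  · simp only [tkI4b, vl]; norm_num; linarith
  · simp only [tkI4c, vl]; norm_num; linarith
  · simp only [tkI4a, vl]; norm_num
  · simp only [tkI4b, vl]; norm_num
  · simp only [tkI4c, vl]; norm_num
  · simp only [tkI4a, tkI4b, vl]
  · simp only [tkI4a, tkI4c, vl]
  · generalize cc * Real.pi = cp at *
    generalize δ * √3 * h = q at *
    simp only [Tk.thr, tkI4a, tkI4b, tkI4c, vl] at ha hb ⊢; norm_num at ha hb ⊢; linarith

theorem inI5 {δ h d1 x1 y1 d2 x2 y2 d3 x3 y3 : ℝ} (C : Cfg h d1 x1 y1 d2 x2 y2 d3 x3 y3)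
    (p1 : 0 ≤ d1) (p2 : 0 ≤ d2) (p3 : 0 ≤ d3) (c1 : CX 0 false true h d1 x1) (c2 : CX 0 false true h d1 y1)
    (c3 : CX 0 true false h d2 x2) (c4 : CX 0 true false h d2 y2)
    (hδ : 0.812541 ≤ δ) (ha : vl 5153960755 ≤ h) (hb : h ≤ vl 5600637353) :
    FF δ h d1 x1 y1 d2 x2 y2 d3 x3 y3 ≤ 0 := by
  have h1 := cc_b2
  have h2 := ccpi_b
  have h3 := Real.pi_gt_d20
  have h4 := Real.pi_lt_d20
  have h5 := ds3 hδ C.hp.le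
  have h6 := C.hp
  refine band_in3 C p1 p2 p3 okI5a okI5b okI5c c1 c2 c3 c4 C.cx.2.2.2.2.1 C.cx.2.2.2.2.2.1 1 (by norm_num) (by linarith) ha hb ?_ ?_ ?_ ?_ ?_ ?_ _ rfl ?_ ?_ ?_
  · simp only [tkI5a, vl]; norm_num; linarith
  · simp only [tkI5b, vl]; norm_num; linarith
  · simp only [tkI5c, vl]; norm_num; linarith
  · simp only [tkI5a, vl]; norm_num
  · simp only [tkI5b, vl]; norm_num
  · simp only [tkI5c, vl]; norm_num
  · simp only [tkI5a, tkI5b, vl]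
  · simp only [tkI5a, tkI5c, vl]
  · generalize cc * Real.pi = cp at *
    generalize δ * √3 * h = q at *
    simp only [Tk.thr, tkI5a, tkI5b, tkI5c, vl] at ha hb ⊢; norm_num at ha hb ⊢; linarith

theorem inI6 {δ h d1 x1 y1 d2 x2 y2 d3 x3 y3 : ℝ} (C : Cfg h d1 x1 y1 d2 x2 y2 d3 x3 y3)
    (p1 : 0 ≤ d1) (p2 : 0 ≤ d2) (p3 : 0 ≤ d3) (c1 : CX 0 false true h d1 x1) (c2 : CX 0 false true h d1 y1)
    (c3 : CX 0 true false h d2 x2) (c4 : CX 0 true false h d2 y2)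
    (hδ : 0.812541 ≤ δ) (ha : vl 5600637353 ≤ h) (hb : h ≤ vl 5836860555) :
    FF δ h d1 x1 y1 d2 x2 y2 d3 x3 y3 ≤ 0 := by
  have h1 := cc_b2
  have h2 := ccpi_b
  have h3 := Real.pi_gt_d20
  have h4 := Real.pi_lt_d20
  have h5 := ds3 hδ C.hp.le
  have h6 := C.hp
  refine band_in3 C p1 p2 p3 okI6a okI6b okI6c c1 c2 c3 c4 C.cx.2.2.2.2.1 C.cx.2.2.2.2.2.1 1 (by norm_num) (by linarith) ha hb ?_ ?_ ?_ ?_ ?_ ?_ _ rfl ?_ ?_ ?_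
  · simp only [tkI6a, vl]; norm_num; linarith
  · simp only [tkI6b, vl]; norm_num; linarith
  · simp only [tkI6c, vl]; norm_num; linarith
  · simp only [tkI6a, vl]; norm_num
  · simp only [tkI6b, vl]; norm_num
  · simp only [tkI6c, vl]; norm_num
  · simp only [tkI6a, tkI6b, vl]
  · simp only [tkI6a, tkI6c, vl]
  · generalize cc * Real.pi = cp at *
    generalize δ * √3 * h = q at *
    simp only [Tk.thr, tkI6a, tkI6b, tkI6c, vl] at ha hb ⊢; norm_num at ha hb ⊢; linarith

theorem inI7 {δ h d1 x1 y1 d2 x2 y2 d3 x3 y3 : ℝ} (C : Cfg h d1 x1 y1 d2 x2 y2 d3 x3 y3)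
    (p1 : 0 ≤ d1) (p2 : 0 ≤ d2) (p3 : 0 ≤ d3) (c1 : CX 0 false true h d1 x1) (c2 : CX 0 false true h d1 y1)
    (c3 : CX 0 true false h d2 x2) (c4 : CX 0 true false h d2 y2)
    (hδ : 0.812541 ≤ δ) (ha : vl 5836860555 ≤ h) (hb : h ≤ vl 5967857057) :
    FF δ h d1 x1 y1 d2 x2 y2 d3 x3 y3 ≤ 0 := by
  have h1 := cc_b2
  have h2 := ccpi_b
  have h3 := Real.pi_gt_d20
  have h4 := Real.pi_lt_d20
  have h5 := ds3 hδ C.hp.le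
  have h6 := C.hp
  refine band_in3 C p1 p2 p3 okI7a okI7b okI7c c1 c2 c3 c4 C.cx.2.2.2.2.1 C.cx.2.2.2.2.2.1 1 (by norm_num) (by linarith) ha hb ?_ ?_ ?_ ?_ ?_ ?_ _ rfl ?_ ?_ ?_
  · simp only [tkI7a, vl]; norm_num; linarith
  · simp only [tkI7b, vl]; norm_num; linarith
  · simp only [tkI7c, vl]; norm_num; linarith
  · simp only [tkI7a, vl]; norm_num
  · simp only [tkI7b, vl]; norm_num
  · simp only [tkI7c, vl]; norm_num
  · simp only [tkI7a, tkI7b, vl]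
  · simp only [tkI7a, tkI7c, vl]
  · generalize cc * Real.pi = cp at *
    generalize δ * √3 * h = q at *
    simp only [Tk.thr, tkI7a, tkI7b, tkI7c, vl] at ha hb ⊢; norm_num at ha hb ⊢; linarith

theorem outZ {δ h d1 x1 y1 d2 x2 y2 d3 x3 y3 : ℝ} (C : Cfg h d1 x1 y1 d2 x2 y2 d3 x3 y3)
    (p1 : 0 ≤ d1) (p2 : 0 ≤ d2) (p3 : d3 ≤ 0) (q3 : -d3 ≤ 0.8289) (hw1 : 0.1715728 ≤ h^2 + d1^2)
    (hw2 : 0.1715728 ≤ h^2 + d2^2) (hw : 0.1715728 ≤ h^2 + d3^2)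
    (hδ : 0.812541 ≤ δ) (hδ' : δ ≤ 0.812543) (hb : h ≤ 0.15) :
    FF δ h d1 x1 y1 d2 x2 y2 d3 x3 y3 ≤ 0 := by
  obtain ⟨c1, c2, c3, c4, c5, c6, u1, u2, u3⟩ := C.cx
  have hp := C.hp
  have h1 := cc_b
  have hh : h^2 ≤ 0.0225 := by nlinarith
  have k : ∀ d : ℝ, 0 ≤ d → 0.1715728 ≤ h^2 + d^2 → 0.38609 ≤ d := by
    intro d hd hw; by_contra hc; push Not at hc; nlinarith
  have a1 := zP (c := cc) (K := (1 - 0.4) * δ / 2) (by linarith) (by unfold vl; norm_num; linarith) hp hb (k d1 p1 hw1) (by linarith) c1 c2 C.L1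
  have a2 := zP (c := cc) (K := (1 - 0.4) * δ / 2) (by linarith) (by unfold vl; norm_num; linarith) hp hb (k d2 p2 hw2) (by linarith) c3 c4 C.L2
  have a3 := zN (c := cc) (K := (1 - 0.4) * δ / 2) (by linarith) (by linarith) (by linarith) (by unfold vl; norm_num; linarith) hp hb (k (-d3) (by linarith) (by rw [neg_sq]; exact hw)) (by linarith)
     (by linarith [C.x3p]) (by linarith [C.y3p]) (by rw [neg_sq]; exact C.tA) (by rw [neg_sq]; linarith [C.tB, C.rB]) C.M3
  rw [gg_neg, gg_neg] at a3
  have := FF_le C 0 0.4 (by norm_num) (by linarith : 0 ≤ δ)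
  have h5 := ds3 hδ hp.le
  unfold pg at this
  linarith

theorem out_all {δ h d1 x1 y1 d2 x2 y2 d3 x3 y3 : ℝ} (C : Cfg h d1 x1 y1 d2 x2 y2 d3 x3 y3)
    (p1 : 0 ≤ d1) (p2 : 0 ≤ d2) (p3 : d3 ≤ 0) (q3 : -d3 ≤ 0.8289) (hw1 : 0.1715728 ≤ h^2 + d1^2)
    (hw2 : 0.1715728 ≤ h^2 + d2^2) (hw : 0.1715728 ≤ h^2 + d3^2) (hC : 1 ≤ d2^2 + x2^2)
    (hδ : 0.812541 ≤ δ) (hδ' : δ ≤ 0.812543) (hb : h ≤ 1.6499) :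
    FF δ h d1 x1 y1 d2 x2 y2 d3 x3 y3 ≤ 0 := by
  have v : ∀ n : ℕ, vl n = n / 4294967296 := fun n => rfl
  by_cases b0 : h ≤ 0.15
  · exact outZ C p1 p2 p3 q3 hw1 hw2 hw hδ hδ' b0
  push Not at b0
  by_cases b1 : h ≤ vl 1546188226
  · exact outO1 C p1 p2 p3 q3 hw hδ hδ' (by rw [v]; norm_num; linarith) b1
  by_cases b2 : h ≤ vl 1975684956
  · exact outO2 C p1 p2 p3 q3 hw hδ hδ' (le_of_not_ge b1) b2
  by_cases b3 : h ≤ vl 2276332666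
  · exact outO3 C p1 p2 p3 q3 hw hδ hδ' (le_of_not_ge b2) b3
  by_cases b4 : h ≤ vl 2576980377
  · exact outO4 C p1 p2 p3 q3 hw hδ hδ' (le_of_not_ge b3) b4
  by_cases b5 : h ≤ vl 3435973836
  · exact outO5 C p1 p2 p3 q3 hw hδ hδ' (le_of_not_ge b4) b5
  by_cases b6 : h ≤ vl 4037269258
  · exact outO6 C p1 p2 p3 q3 hw hδ hδ' (le_of_not_ge b5) b6
  by_cases b7 : h ≤ vl 4294967296
  · exact outO7 C p1 p2 p3 q3 hw hδ hδ' (le_of_not_ge b6) b7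
  have e : h ≤ vl 7086696038 := by rw [v]; norm_num; linarith
  by_cases hA : 1 ≤ d3^2 + x3^2
  · have w2 : 1 ≤ d2^2 + y2^2 := by linarith [C.rA]
    by_cases b8 : h ≤ vl 4724464025
    · exact outU1b C p1 p2 p3 q3 hw hC w2 hδ hδ' (le_of_not_ge b7) b8
    by_cases b9 : h ≤ vl 5153960755
    · exact outU2b C p1 p2 p3 q3 hw hC w2 hδ hδ' (le_of_not_ge b8) b9
    by_cases b10 : h ≤ vl 6012954214
    · exact outU3b C p1 p2 p3 q3 hw hC w2 hδ hδ' (le_of_not_ge b9) b10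
    · exact outU4b C p1 p2 p3 q3 hw hC w2 hδ hδ' (le_of_not_ge b10) e
  · push Not at hA
    have w1 : 1 ≤ d1^2 + x1^2 := by
      have : x3 < 1 := by nlinarith [sq_nonneg d3]
      nlinarith [C.rB, C.L3, sq_nonneg d3]
    have w2 : 1 ≤ d1^2 + y1^2 := by linarith [C.rC]
    by_cases b8 : h ≤ vl 4724464025
    · exact outU1a C p1 p2 p3 q3 hw w1 w2 hδ hδ' (le_of_not_ge b7) b8
    by_cases b9 : h ≤ vl 5153960755
    · exact outU2a C p1 p2 p3 q3 hw w1 w2 hδ hδ' (le_of_not_ge b8) b9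
    by_cases b10 : h ≤ vl 6012954214
    · exact outU3a C p1 p2 p3 q3 hw w1 w2 hδ hδ' (le_of_not_ge b9) b10
    · exact outU4a C p1 p2 p3 q3 hw w1 w2 hδ hδ' (le_of_not_ge b10) e

theorem low_ineq {c K d h x y : ℝ} (hc : 1.07106 ≤ c) (hK : 0.4062705 ≤ K) (hx : 0 < x) (hy : 0 < y)
    (hxy : 2 ≤ x + y) (sx : 2 ≤ h^2 + d^2 + x^2) (sy : 2 ≤ h^2 + d^2 + y^2) :
    2 - c * x / √(h^2 + d^2 + x^2) - c * y / √(h^2 + d^2 + y^2) ≤ K * (h^2 + d^2) * (x + y) := by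
  have hw : 0 ≤ h^2 + d^2 := by positivity
  generalize h^2 + d^2 = w at *
  have key : K * w * (x + y) ≥ 0.812541 * w := by
    nlinarith [mul_nonneg (sub_nonneg.mpr hK) hw, mul_nonneg (mul_nonneg (by linarith : 0 ≤ K) hw) (sub_nonneg.mpr hxy)]
  refine le_trans ?_ key
  have n1 : 0 ≤ c * x / √(w + x^2) := by positivity
  have n2 : 0 ≤ c * y / √(w + y^2) := by positivity
  by_cases w1 : 2.4615 ≤ w
  · linarith
  push Not at w1
  by_cases w2 : w ≤ 1.893
  · have hz0 : 0 ≤ 1 - w/2 := by linarith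
    have hz : √(1 - w/2)^2 = 1 - w/2 := Real.sq_sqrt hz0
    have hz2 : 0.2308 ≤ √(1 - w/2) := by apply Real.le_sqrt_of_sq_le; norm_num; linarith
    have hz3 : √(1 - w/2) ≤ 1 := by apply Real.sqrt_le_iff.mpr ⟨by norm_num, by linarith⟩
    have t : ∀ x, 0 < x → 2 ≤ w + x^2 → √(1 - w/2) ≤ c * x / √(w + x^2) := by
      intro x hx sx
      have hs : 0 < √(w + x^2) := Real.sqrt_pos.mpr (by linarith)
      rw [le_div_iff₀ hs, ← Real.sqrt_mul hz0]
      apply Real.sqrt_le_iff.mpr ⟨by positivity, ?_⟩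
      have : x ≤ c * x := by nlinarith
      have : x^2 ≤ (c * x)^2 := by nlinarith
      nlinarith
    have t1 := t x hx sx
    have t2 := t y hy sy
    nlinarith
  push Not at w2
  have t : ∀ x, 1 ≤ x → 0.5756 ≤ c * x / √(w + x^2) := by
    intro x hx 
    have hs : 0 < √(w + x^2) := Real.sqrt_pos.mpr (by positivity)
    rw [le_div_iff₀ hs]
    have : √(w + x^2) ≤ 1.8606 * x := by
      apply Real.sqrt_le_iff.mpr ⟨by positivity, by nlinarith⟩
    nlinarith
  rcases le_total 1 x with h1 | h1
  · have := t x h1; linarith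
  · have := t y (by linarith); linarith

theorem pg_low {c K h h' d x y : ℝ} (hc : 1.07106 ≤ c) (hK : 0.4062705 ≤ K) (hh : 0 < h) (hh' : h ≤ h') (hd : 0 ≤ d) (hx : 0 < x) (hy : 0 < y)
    (hxy : 2 ≤ x + y) (sx : 2 ≤ h^2 + d^2 + x^2) (sy : 2 ≤ h^2 + d^2 + y^2) :
    pg c 0 K h' d x y ≤ pg c 0 K h d x y := by
  have hder : ∀ z, 0 < z → ∀ x, 0 < x → HasDerivAt (fun z => gg c 0 K z d x)
      (d / (z^2+d^2) * (1 - c * x / √(z^2 + d^2 + x^2)) - K * d * x) z := by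
    intro z hz x hx
    refine (hasDerivAt_gg (hasDerivAt_id z) (hasDerivAt_const z d) (hasDerivAt_const z x) 
      rfl rfl rfl hz hx).congr_deriv (by simp)
  have hder2 : ∀ z, 0 < z → HasDerivAt (fun z => pg c 0 K z d x y) _ z := fun z hz => (hder z hz x hx).add (hder z hz y hy)
  have : AntitoneOn (fun z => pg c 0 K z d x y) (Set.Icc h h') := by
    apply antitoneOn_of_deriv_nonpos (convex_Icc h h')
    · intro z hz
      exact (hder2 z (hh.trans_le hz.1)).continuousAt.continuousWithinAt
    · intro z hz
      rw [interior_Icc] at hz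
      exact (hder2 z (hh.trans hz.1)).differentiableAt.differentiableWithinAt
    · intro z hz
      rw [interior_Icc] at hz
      have hz0 := hh.trans hz.1
      rw [(hder2 z hz0).deriv]
      have hzz : h^2 ≤ z^2 := by nlinarith [hz.1]
      have L := low_ineq hc hK hx hy hxy (h := z) (d := d) (by linarith) (by linarith)
      have hw : 0 < z^2 + d^2 := by positivity
      generalize z^2 + d^2 = w at *
      have e : d / w * (1 - c * x / √(w + x^2)) - K * d * x + (d / w * (1 - c * y / √(w + y^2)) - K * d * y) = 
         d / w * ((2 - c * x / √(w + x^2) - c * y / √(w + y^2)) - K * w * (x + y)) := by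
        field_simp; ring
      rw [e]
      apply mul_nonpos_of_nonneg_of_nonpos (by positivity) (by linarith)
  exact this (Set.left_mem_Icc.mpr hh') (Set.right_mem_Icc.mpr hh') hh'

theorem Cfg.low {h m d1 x1 y1 d2 x2 y2 d3 x3 y3 : ℝ} (C : Cfg h d1 x1 y1 d2 x2 y2 d3 x3 y3) (hm : 0 < m) (hmh : m ≤ h)
    (sA : 2 ≤ m^2 + d3^2 + x3^2) (sB : 2 ≤ m^2 + d1^2 + x1^2) (sC : 2 ≤ m^2 + d2^2 + x2^2) :
    Cfg m d1 x1 y1 d2 x2 y2 d3 x3 y3 :=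
  { C with hp := hm, sA := sA, sB := sB, sC := sC, tA := by nlinarith [C.tA], tB := by nlinarith [C.tB], tC := by nlinarith [C.tC] }

theorem FF_low {δ h m d1 x1 y1 d2 x2 y2 d3 x3 y3 : ℝ} (C : Cfg m d1 x1 y1 d2 x2 y2 d3 x3 y3) (hmh : m ≤ h)
    (p1 : 0 ≤ d1) (p2 : 0 ≤ d2) (p3 : 0 ≤ d3) (hδ : 0.812541 ≤ δ) :
    FF δ h d1 x1 y1 d2 x2 y2 d3 x3 y3 ≤ FF δ m d1 x1 y1 d2 x2 y2 d3 x3 y3 := by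
  have hc := cc_b
  obtain ⟨c1, c2, c3, c4, c5, c6, u1, u2, u3⟩ := C.cx
  have k : ∀ d x y, 0 ≤ d → 2 ≤ x + y → CX 0 false false m d x → CX 0 false false m d y → pg cc 0 (δ/2) h d x y ≤ pg cc 0 (δ/2) m d x y := by
    intro d x y hd hxy h1 h2
    exact pg_low (by linarith) (by linarith) C.hp hmh hd (by linarith [h1.x0]) (by linarith [h2.x0]) hxy h1.s1 h2.s1
  have a1 := k d1 x1 y1 p1 C.L1 c1 c2
  have a2 := k d2 x2 y2 p2 C.L2 c3 c4
  have a3 := k d3 x3 y3 p3 C.L3 c5 c6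
  unfold FF; linarith

theorem f3_aux {a d x y : ℝ} (h1 : a ≤ 1) (h2 : x ≤ a) (h3 : 2 ≤ x + y) : (2 - a)^2 ≤ d^2 + y^2 := by
  have : 2 - a ≤ y := by linarith
  nlinarith [sq_nonneg d]

theorem in_mA {δ h d1 x1 y1 d2 x2 y2 d3 x3 y3 : ℝ} (C : Cfg h d1 x1 y1 d2 x2 y2 d3 x3 y3) 
    (p1 : 0 ≤ d1) (p2 : 0 ≤ d2) (p3 : 0 ≤ d3) (hδ : 0.812541 ≤ δ)
    (hm1 : 1 ≤ h) (hA : h^2 + d3^2 + x3^2 = 2) (nC : d3^2 + x3^2 ≤ d2^2 + x2^2)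
    (hyd : d2 ≤ y2) : FF δ h d1 x1 y1 d2 x2 y2 d3 x3 y3 ≤ 0 := by
  have v : ∀ n : ℕ, vl n = n / 4294967296 := fun n => rfl
  obtain ⟨c1, c2, c3, c4, c5, c6, u1, u2, u3⟩ := C.cx
  have x3p := C.x3p
  have y2p := C.y2p
  have hh : h ≤ 1.3892 := by nlinarith
  have q0 : 0 ≤ √(2 - h^2) := Real.sqrt_nonneg _
  have q : √(2 - h^2)^2 = 2 - h^2 := Real.sq_sqrt (by nlinarith [sq_nonneg d3])
  have q1 : √(2 - h^2) ≤ 1 := by apply Real.sqrt_le_iff.mpr ⟨by norm_num, by nlinarith⟩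
  have q2 : x3 ≤ √(2 - h^2) := by apply Real.le_sqrt_of_sq_le; nlinarith [sq_nonneg d3]
  have q3 : y2 ≤ √(2 - h^2) := by apply Real.le_sqrt_of_sq_le; nlinarith [sq_nonneg d2, C.rA]
  have hh2 : h^2 ≤ 2 := by nlinarith [sq_nonneg d3]
  have f1 : (2 - √(2 - h^2))^2 ≤ d1^2 + x1^2 := by
    rw [C.rB]; exact f3_aux q1 q2 C.L3
  have f2 : (2 - √(2 - h^2))^2 ≤ d1^2 + y1^2 := by
    rw [← C.rC]; exact f3_aux q1 q3 (by linarith [C.L2])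
  have x2y2 : y2 ≤ x2 := (sq_le_sq₀ (by linarith) (by linarith [C.x2p])).mp (by linarith [C.rA])
  have C1 : CX 0 false true h d1 x1 := ⟨c1.x0, c1.s1, c1.s2, c1.b, by simp, fun _ => ⟨f1, hh2⟩⟩
  have C2 : CX 0 false true h d1 y1 := ⟨c2.x0, c2.s1, c2.s2, c2.b, by simp, fun _ => ⟨f2, hh2⟩⟩
  have C3 : CX 0 true false h d2 x2 := ⟨c3.x0, c3.s1, c3.s2, c3.b, fun _ => by linarith, by simp⟩
  have C4 : CX 0 true false h d2 y2 := ⟨c4.x0, c4.s1, c4.s2, c4.b, fun _ => by linarith, by simp⟩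
  by_cases b1 : h ≤ vl 5153960755
  · exact inI4 C p1 p2 p3 C1 C2 C3 C4 hδ (by rw [v]; norm_num; exact hm1) b1
  by_cases b2 : h ≤ vl 5600637353
  · exact inI5 C p1 p2 p3 C1 C2 C3 C4 hδ (le_of_not_ge b1) b2
  by_cases b3 : h ≤ vl 5836860555
  · exact inI6 C p1 p2 p3 C1 C2 C3 C4 hδ (le_of_not_ge b2) b3
  · exact inI7 C p1 p2 p3 C1 C2 C3 C4 hδ (le_of_not_ge b3) (by rw [v]; norm_num; linarith)

theorem in_1A {δ h d1 x1 y1 d2 x2 y2 d3 x3 y3 : ℝ} (C : Cfg h d1 x1 y1 d2 x2 y2 d3 x3 y3) 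
    (p1 : 0 ≤ d1) (p2 : 0 ≤ d2) (p3 : 0 ≤ d3) (hδ : 0.812541 ≤ δ)
    (hm1 : 1 ≤ h) (nB : d3^2 + x3^2 ≤ d1^2 + x1^2) (nC : d3^2 + x3^2 ≤ d2^2 + x2^2) :
    FF δ h d1 x1 y1 d2 x2 y2 d3 x3 y3 ≤ 0 := by
  by_cases h1 : 1 ≤ d3^2 + x3^2
  · have C' := C.low (m := 1) (by norm_num) hm1 (by linarith) (by linarith) (by linarith)
    exact (FF_low C' hm1 p1 p2 p3 hδ).trans (inI3 C' p1 p2 p3 hδ (by unfold vl; norm_num) (by unfold vl; norm_num))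
  push Not at h1
  have q0 : 0 ≤ √(2 - (d3^2 + x3^2)) := Real.sqrt_nonneg _
  have q : √(2 - (d3^2 + x3^2))^2 = 2 - (d3^2 + x3^2) := Real.sq_sqrt (by linarith)
  have q1 : 1 ≤ √(2 - (d3^2 + x3^2)) := by apply Real.le_sqrt_of_sq_le; linarith
  have q2 : √(2 - (d3^2 + x3^2)) ≤ h := by
    apply Real.sqrt_le_iff.mpr ⟨by linarith, by linarith [C.sA]⟩
  generalize √(2 - (d3^2 + x3^2)) = m at *
  have C' := C.low (m := m) (by linarith) q2 (by linarith) (by linarith) (by linarith)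
  refine (FF_low C' q2 p1 p2 p3 hδ).trans ?_
  by_cases hyd : d2 ≤ y2
  · exact in_mA C' p1 p2 p3 hδ q1 (by linarith) nC hyd
  · push Not at hyd
    rw [FF_swap, FF_rot]
    have rA := C.rA
    have rB := C.rB
    refine in_mA C'.swap.rot p1 p3 p2 hδ q1 (by linarith) (by linarith) ?_
    by_contra hc
    push Not at hc
    have := C.nA
    nlinarith [C.x3p, C.y2p]

theorem in_hi {δ h d1 x1 y1 d2 x2 y2 d3 x3 y3 : ℝ} (C : Cfg h d1 x1 y1 d2 x2 y2 d3 x3 y3) 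
    (p1 : 0 ≤ d1) (p2 : 0 ≤ d2) (p3 : 0 ≤ d3) (hδ : 0.812541 ≤ δ) (hh : vl 2018634629 ≤ h) :
    FF δ h d1 x1 y1 d2 x2 y2 d3 x3 y3 ≤ 0 := by
  have v : ∀ n : ℕ, vl n = n / 4294967296 := fun n => rfl
  by_cases b1 : h ≤ vl 3435973836
  · exact inI2 C p1 p2 p3 hδ hh b1
  by_cases b2 : h ≤ vl 3865470566
  · exact inI2b C p1 p2 p3 hδ (le_of_not_ge b1) b2
  by_cases b3 : h ≤ vl 4294967296
  · exact inI3 C p1 p2 p3 hδ (le_of_not_ge b2) b3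
  have hm1 : 1 ≤ h := by rw [v] at b3; norm_num at b3; linarith
  rcases le_total (d3^2 + x3^2) (d1^2 + x1^2) with n1 | n1
  · rcases le_total (d3^2 + x3^2) (d2^2 + x2^2) with n2 | n2
    · exact in_1A C p1 p2 p3 hδ hm1 n1 n2
    · rw [FF_rot, FF_rot]
      exact in_1A C.rot.rot p3 p1 p2 hδ hm1 n2 (by linarith)
  · rcases le_total (d1^2 + x1^2) (d2^2 + x2^2) with n2 | n2
    · rw [FF_rot]
      exact in_1A C.rot p2 p3 p1 hδ hm1 n2 n1
    · rw [FF_rot, FF_rot]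
      exact in_1A C.rot.rot p3 p1 p2 hδ hm1 (by linarith) (by linarith)

noncomputable def rr : ℝ := √2 - 1
noncomputable def dt : ℝ := √(2 * rr)
noncomputable def rho : ℝ := √(2 - rr^2)
noncomputable def ds : ℝ := rr^2 / rho
noncomputable def xs : ℝ := 2 * dt / rho

theorem sqrt2_c : 1.414213562373 ≤ √2 ∧ √2 ≤ 1.414213562374 := by
  constructor
  · apply Real.le_sqrt_of_sq_le; norm_num
  · apply Real.sqrt_le_iff.mpr; norm_num
theorem rr_sq : rr^2 = 1 - 2 * rr := by
  have : √2^2 = 2 := Real.sq_sqrt (by norm_num)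
  unfold rr; linarith [this]
theorem rr_b : 0.414213562373 ≤ rr ∧ rr ≤ 0.414213562374 := by
  have := sqrt2_c; unfold rr; constructor <;> linarith [this.1, this.2]
theorem dt_sq : dt^2 = 2 * rr := Real.sq_sqrt (by linarith [rr_b.1])
theorem dt_b : 0.9101797211 ≤ dt ∧ dt ≤ 0.9101797212 := by
  have := rr_b
  unfold dt; constructor
  · apply Real.le_sqrt_of_sq_le; norm_num; linarith
  · apply Real.sqrt_le_iff.mpr; norm_num; linarith
theorem rho_sq : rho^2 = 1 + 2 * rr := by
  have := rr_sq
  unfold rho; rw [Real.sq_sqrt (by rw [rr_sq]; linarith [rr_b.1])]; linarith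
theorem rho_b : 1.3521934494 ≤ rho ∧ rho ≤ 1.3521934495 := by
  have := rr_b
  have h := rr_sq
  unfold rho; constructor
  · apply Real.le_sqrt_of_sq_le; norm_num; linarith
  · apply Real.sqrt_le_iff.mpr; norm_num; linarith
theorem ds_b : 0.12688485 ≤ ds ∧ ds ≤ 0.12688486 := by
  have := rr_b
  have h := rho_b
  unfold ds; rw [le_div_iff₀ (by linarith), div_le_iff₀ (by linarith), rr_sq]
  constructor <;> linarith
theorem xs_b : 1.346227081 ≤ xs ∧ xs ≤ 1.346227084 := by
  have := dt_b
  have h := rho_b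
  unfold xs; rw [le_div_iff₀ (by linarith), div_le_iff₀ (by linarith)]
  constructor <;> linarith
theorem ds_xs : rr^2 + ds^2 + xs^2 = 2 := by
  have h := rho_b
  have h1 := rho_sq
  have h2 := dt_sq
  have h0 := rr_sq
  have h3 : rho ≠ 0 := by linarith
  have h4 : 1 + 2 * rr ≠ 0 := by linarith [rr_b.1]
  have e1 : ds^2 = (1 - 2 * rr)^2 / (1 + 2 * rr) := by unfold ds; rw [div_pow, h1, h0]
  have e2 : xs^2 = 8 * rr / (1 + 2 * rr) := by unfold xs; rw [div_pow, h1, mul_pow, h2]; ring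
  rw [e1, e2, h0]
  field_simp
  ring
theorem dt_1 : rr^2 + dt^2 + 1^2 = 2 := by rw [dt_sq, rr_sq]; ring

theorem arctan_T1 : 0.785398163 ≤ Real.arctan 1 := by rw [Real.arctan_one]; linarith [Real.pi_gt_d20]

theorem a1_eq : ∃ T : ℝ, 7.22587710 ≤ T ∧ T ≤ 7.22587711 ∧ 4 * Real.arctan (dt / rr) = Real.pi + Real.arctan T := by
  have h1 := rr_b
  have h2 := dt_b
  have x1 : 2.1973682268 ≤ dt / rr := by rw [le_div_iff₀ (by linarith)]; linarith
  have x2 : dt / rr ≤ 2.1973682272 := by rw [div_le_iff₀ (by linarith)]; linarith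
  have xq : (dt/rr)^2 = 2 + 2 * √2 := by
    rw [div_pow, dt_sq]; have : rr ≠ 0 := by linarith
    field_simp; have := rr_sq; unfold rr at *; nlinarith [Real.sq_sqrt (by norm_num : (0:ℝ) ≤ 2)]
  have e1 := Real.two_mul_arctan_add_pi (x := dt / rr) (by linarith)
  have hs := sqrt2_c
  have e2 : 2 * (dt/rr) / (1 - (dt/rr)^2) = - (2 * (dt/rr) / (1 + 2 * √2)) := by
    rw [xq]; rw [← div_neg]; congr 1; ring
  rw [e2, Real.arctan_neg] at e1
  generalize dt / rr = x at *
  have u1 : 1.1479 ≤ 2 * x / (1 + 2 * √2) := by rw [le_div_iff₀ (by linarith)]; linarith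
  have uq : (2 * x / (1 + 2 * √2))^2 = 4 * (2 + 2 * √2) / (9 + 4 * √2) := by
    rw [div_pow, mul_pow, xq]; congr 1; norm_num; have := Real.sq_sqrt (by norm_num : (0:ℝ) ≤ 2); nlinarith
  have e3 := Real.two_mul_arctan_add_pi (x := 2 * x / (1 + 2 * √2)) (by linarith)
  have e4 : 2 * (2 * x / (1 + 2 * √2)) / (1 - (2 * x / (1 + 2 * √2))^2) = - (2 * (2 * x / (1 + 2 * √2)) / ((4 * √2 - 1)/(9 + 4*√2))) := by
    rw [uq]; rw [← div_neg]; congr 1; field_simp; ring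
  rw [e4, Real.arctan_neg] at e3
  have e5 : (2 * (2 * x / (1 + 2 * √2)) / ((4 * √2 - 1)/(9 + 4*√2))) = 4 * x * (9 + 4 * √2) / ((1 + 2 * √2) * (4 * √2 - 1)) := by
    field_simp; ring
  rw [e5] at e3
  have e6 : (1 + 2 * √2) * (4 * √2 - 1) = 15 + 2 * √2 := by
    have := Real.sq_sqrt (by norm_num : (0:ℝ) ≤ 2); nlinarith
  rw [e6] at e3
  refine ⟨4 * x * (9 + 4 * √2) / (15 + 2 * √2), ?_, ?_, by linarith⟩
  · rw [le_div_iff₀ (by linarith)]; nlinarith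
  · rw [div_le_iff₀ (by linarith)]; nlinarith

theorem a24_eq : Real.arctan (dt * √2 / (1 * rr)) + Real.arctan (ds * √2 / (xs * rr)) = Real.pi / 2 := by
  have h1 := rr_b
  have h2 := dt_b
  have h3 := rho_b
  have hs := sqrt2_c
  have e : ds * √2 / (xs * rr) = (dt * √2 / (1 * rr))⁻¹ := by
    have a1 : rr ≠ 0 := by linarith
    have a2 : dt ≠ 0 := by linarith
    have a3 : rho ≠ 0 := by linarith
    have a4 : √2 ≠ 0 := by linarith
    have a5 := Real.sq_sqrt (by norm_num : (0:ℝ) ≤ 2)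
    unfold ds xs; field_simp; rw [a5]
  rw [e, Real.arctan_inv_of_pos]
  · ring
  · apply div_pos <;> nlinarith

theorem a3_eq : ∃ T : ℝ, 0.67609672 ≤ T ∧ T ≤ 0.67609673 ∧ 2 * Real.arctan (ds / rr) = Real.arctan T := by
  have h1 := rr_b
  have h3 := rho_b
  have e : ds / rr = rr / rho := by
    have a1 : rr ≠ 0 := by linarith
    have a3 : rho ≠ 0 := by linarith
    unfold ds; field_simp
  have x1 : 0.306327 ≤ rr / rho := by rw [le_div_iff₀ (by linarith)]; linarith
  have x2 : rr / rho ≤ 0.306328 := by rw [div_le_iff₀ (by linarith)]; linarith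
  have xq : (rr/rho)^2 = (1 - 2 * rr) / (1 + 2 * rr) := by rw [div_pow, rho_sq, rr_sq]
  have x1 : 0.3063271475 ≤ rr / rho := by rw [le_div_iff₀ (by linarith)]; linarith
  have x2 : rr / rho ≤ 0.3063271477 := by rw [div_le_iff₀ (by linarith)]; linarith
  have := Real.two_mul_arctan (x := rr / rho) (by linarith) (by linarith)
  have e2 : 2 * (rr / rho) / (1 - (rr / rho)^2) = (rr/rho) * (1 + 2 * rr) / (2 * rr) := by
    rw [xq]
    have : 1 + 2 * rr ≠ 0 := by linarith
    have : rr ≠ 0 := by linarith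
    rw [one_sub_div (by assumption)]
    have e3 : 1 + 2 * rr - (1 - 2 * rr) = 4 * rr := by ring
    rw [e3]
    field_simp; ring
  rw [e, this, e2]
  refine ⟨_, ?_, ?_, rfl⟩
  · rw [le_div_iff₀ (by linarith)]; nlinarith
  · rw [div_le_iff₀ (by linarith)]; nlinarith

theorem a4_eq : ∃ T : ℝ, 0.71793930 ≤ T ∧ T ≤ 0.71793931 ∧ 2 * Real.arctan (ds * √2 / (xs * rr)) = Real.arctan T := by
  have h1 := rr_b
  have h2 := dt_b
  have h3 := rho_b
  have hs := sqrt2_c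
  have e : ds * √2 / (xs * rr) = dt * √2 / 4 := by
    have a1 : rr ≠ 0 := by linarith
    have a2 : dt ≠ 0 := by linarith
    have a3 : rho ≠ 0 := by linarith
    have a4 := dt_sq
    unfold ds xs; field_simp; rw [a4]; ring
  have xq : (dt * √2 / 4)^2 = rr / 4 := by
    rw [div_pow, mul_pow, dt_sq, Real.sq_sqrt (by norm_num)]; ring
  have x1 : 0.32179712 ≤ dt * √2 / 4 := by nlinarith
  have x2 : dt * √2 / 4 ≤ 0.3217971266 := by nlinarith
  have x1 : 0.3217971263 ≤ dt * √2 / 4 := by nlinarith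
  have := Real.two_mul_arctan (x := dt * √2 / 4) (by linarith) (by linarith)
  rw [e, this, xq]
  refine ⟨_, ?_, ?_, rfl⟩
  · rw [le_div_iff₀ (by linarith)]; nlinarith
  · rw [div_le_iff₀ (by linarith)]; nlinarith

theorem T0_eq {δ : ℝ} (h : FF δ rr dt 1 1 dt 1 1 ds xs xs = 0) :
    cc * Real.pi - (4 * Real.arctan (dt/rr) - Real.pi) - 2 * Real.arctan (ds/rr) - cc * (2 * Real.arctan (ds * √2 / (xs * rr)))
      = δ / 2 * rr * (4 * dt + 2 * (ds * xs)) := by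
  unfold FF pg gg at h
  rw [dt_1, ds_xs] at h
  have := a24_eq
  have e : Real.arctan (dt * √2 / (1 * rr)) = Real.pi/2 - Real.arctan (ds * √2 / (xs * rr)) := by linarith
  rw [e] at h
  linarith

theorem delta_b {δ : ℝ} (h : FF δ rr dt 1 1 dt 1 1 ds xs xs = 0) : 0.812541 ≤ δ ∧ δ ≤ 0.812543 := by
  have h0 := T0_eq h
  obtain ⟨T1, l1, u1, e1⟩ := a1_eq
  obtain ⟨T3, l3, u3, e3⟩ := a3_eq
  obtain ⟨T4, l4, u4, e4⟩ := a4_eq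
  have e1' : 4 * Real.arctan (dt/rr) - Real.pi = Real.arctan T1 := by linarith
  rw [e1', e3, e4] at h0
  have v : ∀ n : ℕ, vl n = n / 4294967296 := fun n => rfl
  have L1 := atL_le (u := 31034905820) (t := T1) (by rw [v]; norm_num; linarith)
  have U1 := le_atU (u := 31034905880) (t := T1) (by rw [v]; norm_num; linarith)
  have L3 := atL_le (u := 2903813300) (t := T3) (by rw [v]; norm_num; linarith)
  have U3 := le_atU (u := 2903813345) (t := T3) (by rw [v]; norm_num; linarith)
  have L4 := atL_le (u := 3083525812) (t := T4) (by rw [v]; norm_num; linarith)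
  have U4 := le_atU (u := 3083525857) (t := T4) (by rw [v]; norm_num; linarith)
  have f1 : atL 31034905820 = 6155882929 := by decide +kernel
  have f2 : atU 31034905880 = 6155883990 := by decide +kernel
  have f3 : atL 2903813300 = 2553369207 := by decide +kernel
  have f4 : atU 2903813345 = 2553370298 := by decide +kernel
  have f5 : atL 3083525812 = 2674323452 := by decide +kernel
  have f6 : atU 3083525857 = 2674324541 := by decide +kernel
  rw [f1] at L1; rw [f2] at U1; rw [f3] at L3; rw [f4] at U3; rw [f5] at L4; rw [f6] at U4
  rw [v] at L1 L3 L4 U1 U3 U4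
  generalize Real.arctan T1 = t1 at *
  generalize Real.arctan T3 = t3 at *
  generalize Real.arctan T4 = t4 at *
  norm_num at L1 L3 L4 U1 U3 U4
  have hc := cc_b2
  have hcp : 3.364858768 ≤ cc * Real.pi ∧ cc * Real.pi ≤ 3.36485877 := by
    have p1 := Real.pi_gt_d20
    have p2 := Real.pi_lt_d20
    constructor <;> nlinarith [hc.1, hc.2]
  have hr := rr_b
  have hdt := dt_b
  have hds := ds_b
  have hxs := xs_b
  clear f1 f2 f3 f4 f5 f6 e1 e3 e4 e1' l1 u1 l3 u3 l4 u4 h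
  have w1 : 0.17081582 ≤ ds * xs := by nlinarith
  have w2 : ds * xs ≤ 0.17081585 := by nlinarith
  have w3 : 0.824771 ≤ rr * (4 * dt + 2 * (ds * xs)) / 2 := by nlinarith
  have w3 : 0.8247717 ≤ rr * (4 * dt + 2 * (ds * xs)) / 2 := by nlinarith
  have w4 : rr * (4 * dt + 2 * (ds * xs)) / 2 ≤ 0.8247719 := by nlinarith
  have h0' : cc * Real.pi - t1 - t3 - cc * t4 = δ * (rr * (4 * dt + 2 * (ds * xs)) / 2) := by rw [h0]; ring
  generalize rr * (4 * dt + 2 * (ds * xs)) / 2 = W at *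
  have n1 : 0.6226 ≤ t4 := by linarith
  have v1 : cc * t4 ≤ 1.071067812 * t4 := mul_le_mul_of_nonneg_right (by linarith) (by linarith)
  have v2 : 1.071067811 * t4 ≤ cc * t4 := mul_le_mul_of_nonneg_right (by linarith) (by linarith)
  constructor
  · by_contra hc
    push Not at hc
    have := mul_le_mul_of_nonneg_right hc.le (by linarith : 0 ≤ W)
    linarith
  · by_contra hc
    push Not at hc
    have := mul_le_mul_of_nonneg_right hc.le (by linarith : 0 ≤ W)
    linarith

noncomputable def lam (δ : ℝ) : ℝ := -rr * (cc * √2 - xs) / (2 - xs^2) + δ / 2 * rr * (2 * xs^2 - rho^2)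
noncomputable def kap (δ : ℝ) : ℝ := (1 - cc - lam δ) * Real.pi / 6
noncomputable def et (δ : ℝ) : ℝ := gg cc (lam δ) (δ/2) rr dt 1 + kap δ
noncomputable def es (δ : ℝ) : ℝ := gg cc (lam δ) (δ/2) rr ds xs + kap δ

theorem cs2 : cc * √2 = 10 - 6 * √2 := by
  unfold cc; have := Real.sq_sqrt (by norm_num : (0:ℝ) ≤ 2); linarith

theorem lam_b {δ : ℝ} (h1 : 0.812541 ≤ δ) (h2 : δ ≤ 0.812543) : -0.069605 ≤ lam δ ∧ lam δ ≤ -0.0696039 := by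
  have hx := xs_b
  have hr := rr_b
  have hs := sqrt2_c
  have hxq : 1.812327353 ≤ xs^2 ∧ xs^2 ≤ 1.812327363 := by constructor <;> nlinarith
  have hA : 0.3718788 ≤ rr * (cc * √2 - xs) / (2 - xs^2) ∧ rr * (cc * √2 - xs) / (2 - xs^2) ≤ 0.37187886 := by
    rw [cs2, le_div_iff₀ (by linarith), div_le_iff₀ (by linarith)]
    generalize xs^2 = z at *
    constructor <;> nlinarith
  have hB : 0.3022741 ≤ δ / 2 * rr * (2 * xs^2 - rho^2) ∧ δ / 2 * rr * (2 * xs^2 - rho^2) ≤ 0.3022749 := by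
    rw [rho_sq]
    generalize xs^2 = z at *
    have b1 : 0.16828 ≤ δ / 2 * rr := by nlinarith
    have b2 : δ / 2 * rr ≤ 0.1682831654 := by nlinarith
    have b1 : 0.16828275 ≤ δ / 2 * rr := by nlinarith
    have b3 : 1.7962275 ≤ 2 * z - (1 + 2 * rr) := by linarith
    have b4 : 2 * z - (1 + 2 * rr) ≤ 1.796227603 := by linarith
    generalize δ / 2 * rr = k at *
    generalize 2 * z - (1 + 2 * rr) = q at *
    constructor <;> nlinarith
  have e : lam δ = -(rr * (cc * √2 - xs) / (2 - xs^2)) + δ / 2 * rr * (2 * xs^2 - rho^2) := by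
    unfold lam; ring
  rw [e]
  constructor <;> linarith [hA.1, hA.2, hB.1, hB.2]

theorem at_t0 : 2 * Real.arctan dt + Real.arctan (ds/xs) = Real.pi/2 := by
  have hdt := dt_b
  have hr := rr_b
  have hrho := rho_b
  have e : ds/xs = (2 * dt / (1 - dt^2))⁻¹ := by
    unfold ds xs
    rw [dt_sq, ← rr_sq, inv_div]
    have : rho ≠ 0 := by linarith [hrho.1]
    have : dt ≠ 0 := by linarith [hdt.1]
    field_simp
  rw [Real.two_mul_arctan (by linarith) (by linarith), e, Real.arctan_inv_of_pos]
  · ring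
  · apply div_pos (by linarith); rw [dt_sq]; linarith

theorem et_es {δ : ℝ} (h : FF δ rr dt 1 1 dt 1 1 ds xs xs = 0) : 2 * et δ + es δ = 0 := by
  have a := at_t0
  unfold FF pg gg at h
  unfold et es kap gg
  rw [div_one] at *
  have b : lam δ * (2 * Real.arctan dt + Real.arctan (ds/xs)) = lam δ * (Real.pi/2) := by rw [a]
  linarith

theorem et_b {δ : ℝ} (h1 : 0.812541 ≤ δ) (h2 : δ ≤ 0.812543) : -0.0000785 ≤ et δ ∧ et δ ≤ 0 := by
  obtain ⟨T1, l1, u1, e1⟩ := a1_eq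
  obtain ⟨T4, l4, u4, e4⟩ := a4_eq
  have a24 := a24_eq
  have e1' : Real.arctan (dt/rr) = (Real.pi + Real.arctan T1)/4 := by linarith
  have e2' : Real.arctan (dt * √2 / (1 * rr)) = Real.pi/2 - Real.arctan T4 / 2 := by linarith
  unfold et kap gg
  rw [dt_1, e1', e2', div_one, mul_one]
  have hdt := dt_b
  have v : ∀ n : ℕ, vl n = n / 4294967296 := fun n => rfl
  have L1 := atL_le (u := 31034905820) (t := T1) (by rw [v]; norm_num; linarith)
  have U1 := le_atU (u := 31034905880) (t := T1) (by rw [v]; norm_num; linarith)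
  have L4 := atL_le (u := 3083525812) (t := T4) (by rw [v]; norm_num; linarith)
  have U4 := le_atU (u := 3083525857) (t := T4) (by rw [v]; norm_num; linarith)
  have L3 := atL_le (u := 3909192130) (t := dt) (by rw [v]; norm_num; linarith)
  have U3 := le_atU (u := 3909192140) (t := dt) (by rw [v]; norm_num; linarith)
  have f1 : atL 31034905820 = 6155882929 := by decide +kernel
  have f2 : atU 31034905880 = 6155883990 := by decide +kernel
  have f3 : atL 3909192130 = 3171450023 := by decide +kernel
  have f4 : atU 3909192140 = 3171451088 := by decide +kernel
  have f5 : atL 3083525812 = 2674323452 := by decide +kernel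
  have f6 : atU 3083525857 = 2674324541 := by decide +kernel
  rw [f1] at L1; rw [f2] at U1; rw [f3] at L3; rw [f4] at U3; rw [f5] at L4; rw [f6] at U4
  rw [v] at L1 L3 L4 U1 U3 U4
  generalize Real.arctan T1 = t1 at *
  generalize Real.arctan dt = t3 at *
  generalize Real.arctan T4 = t4 at *
  norm_num at L1 L3 L4 U1 U3 U4
  have hc := cc_b2
  have p1 := Real.pi_gt_d20
  have p2 := Real.pi_lt_d20
  have hcp : 3.364858768 ≤ cc * Real.pi ∧ cc * Real.pi ≤ 3.36485877 := by
    constructor <;> nlinarith [hc.1, hc.2]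
  have hr := rr_b
  have hl := lam_b h1 h2
  clear f1 f2 f3 f4 f5 f6 e1 e4 e1' e2' l1 u1 l4 u4 a24
  have w3 : 0.37700878 ≤ rr * dt := by nlinarith
  have w4 : rr * dt ≤ 0.37700879 := by nlinarith
  generalize lam δ = L at *
  have z : L * t3 - L * Real.pi / 6 = L * (t3 - Real.pi/6) := by ring
  have z1 : L * (t3 - Real.pi/6) ≤ -0.0696039 * (t3 - Real.pi/6) := mul_le_mul_of_nonneg_right (by linarith) (by linarith)
  have z2 : -0.069605 * (t3 - Real.pi/6) ≤ L * (t3 - Real.pi/6) := mul_le_mul_of_nonneg_right (by linarith) (by linarith)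
  have y1 : cc * t4 ≤ 1.071067812 * t4 := mul_le_mul_of_nonneg_right (by linarith) (by linarith)
  have y2 : 1.071067811 * t4 ≤ cc * t4 := mul_le_mul_of_nonneg_right (by linarith) (by linarith)
  have k1 : δ/2 * (rr*dt) ≤ 0.4062715 * (rr * dt) := mul_le_mul_of_nonneg_right (by linarith) (by linarith)
  have k2 : 0.4062705 * (rr*dt) ≤ δ/2 * (rr * dt) := mul_le_mul_of_nonneg_right (by linarith) (by linarith)
  have e : -((Real.pi + t1) / 4) + cc * (Real.pi / 2 - t4 / 2) + L * t3 - δ / 2 * rr * dt + (1 - cc - L) * Real.pi / 6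
    = -((Real.pi + t1) / 4) + (cc * Real.pi) / 2 - cc * t4 / 2 + L * (t3 - Real.pi/6) - δ / 2 * (rr * dt) + Real.pi/6 - (cc * Real.pi)/6 := by ring
  rw [e]
  constructor <;> linarith

theorem hred_ineq {K h x : ℝ} (hK : 0.4062705 ≤ K) (hh : h^2 ≤ 0.2210) (x1 : 1 ≤ x) (hx : x^2 < 2) :
    2 - (10 - 6 * √2) * x ≤ K * x * (2 - 3 * h^2) * (2 - x^2) := by
  have hs := sqrt2_c
  have a1 : 0.4062705 * 1.337 ≤ K * (2 - 3 * h^2) := mul_le_mul hK (by linarith) (by norm_num) (by linarith)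
  have x0 : 0 ≤ x * (2 - x^2) := mul_nonneg (by linarith) (by linarith)
  have a2 : 0.543 * (x * (2 - x^2)) ≤ K * (2 - 3 * h^2) * (x * (2 - x^2)) := mul_le_mul_of_nonneg_right (by linarith) x0
  have a3 : K * x * (2 - 3 * h^2) * (2 - x^2) = K * (2 - 3 * h^2) * (x * (2 - x^2)) := by ring
  rw [a3]
  have a4 : 1.514 * x ≤ (10 - 6 * √2) * x := mul_le_mul_of_nonneg_right (by linarith) (by linarith)
  refine le_trans ?_ a2
  refine le_trans (by linarith : _ ≤ 2 - 1.514 * x) ?_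
  rcases le_or_gt x 1.33 with h | h
  · nlinarith [mul_nonneg (sub_nonneg.2 x1) (sub_nonneg.2 h), mul_nonneg (mul_nonneg (sub_nonneg.2 x1) (sub_nonneg.2 h)) (by linarith : 0 ≤ x)]
  · linarith

/-- reduction of the height along a curve of fixed direction on the sphere of radius `√2` -/
theorem hred {l K h h' s k : ℝ} (hK : 0.4062705 ≤ K) (h0 : 0 < h) (hh : h ≤ h') (hb : h'^2 ≤ 0.2210)
    (sk : s^2 + k^2 = 1) (hs : 0 ≤ s) (hk : 0 < k) (h1 : 1 ≤ √(2 - h'^2) * k) :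
    gg cc l K h' (√(2 - h'^2) * s) (√(2 - h'^2) * k) ≤ gg cc l K h (√(2 - h^2) * s) (√(2 - h^2) * k) := by
  have hr : ∀ z, 0 < z → z^2 < 2 → HasDerivAt (fun z : ℝ => √(2 - z^2)) (-z / √(2 - z^2)) z := by
    intro z _ hz
    have := ((hasDerivAt_pow 2 z).const_sub 2).sqrt (by simp; linarith)
    refine this.congr_deriv ?_
    have : √(2 - z^2) ≠ 0 := (Real.sqrt_pos.mpr (by linarith)).ne'
    field_simp; simp
  have hder : ∀ z, 0 < z → z^2 < 2 → HasDerivAt (fun z => gg cc l K z (√(2 - z^2) * s) (√(2 - z^2) * k))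
      ((√(2 - z^2) * s) / (2 - z^2) * (2 * (1 - cc * (√(2 - z^2) * k) / √2) / (2 - (√(2 - z^2) * k)^2) + K * (√(2 - z^2) * k) * (3 * z^2 - 2))) z := by
    intro z hz hz2
    have hp : 0 < √(2 - z^2) := Real.sqrt_pos.mpr (by linarith)
    have hq : √(2 - z^2)^2 = 2 - z^2 := Real.sq_sqrt (by linarith)
    refine (hasDerivAt_gg (hasDerivAt_id z) ((hr z hz hz2).mul_const s) ((hr z hz hz2).mul_const k)
      rfl rfl rfl hz (by positivity)).congr_deriv ?_
    simp only [id]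
    generalize √(2 - z^2) = p at *
    have e1 : z^2 + (p*s)^2 + (p*k)^2 = 2 := by
      have : z^2 + (p*s)^2 + (p*k)^2 = z^2 + p^2 * (s^2 + k^2) := by ring
      rw [this, sk, hq]; ring
    have e2 : (p*s)^2 + (p*k)^2 = p^2 := by rw [← mul_one (p^2), ← sk]; ring
    have e3 : 2 - (p*k)^2 = z^2 + (p*s)^2 := by linarith
    rw [e1, e2, e3, ← hq]
    have h3 : z^2 = 2 - p^2 := by linarith
    have hw : 0 < z^2 + (p*s)^2 := by positivity
    generalize hW : z^2 + (p*s)^2 = w at *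
    generalize cc * (p * k) / √2 = Y
    generalize cc * z / √2 = Z
    have h4 : K * (p*k) * (3 * z^2 - 2) = K * (p * k) * (2 * z^2 - p^2) := by rw [h3]; ring
    rw [h4]
    field_simp
    have h5 : (2:ℝ) = z^2 + p^2 := by linarith
    linear_combination (p * s * (1 - Y)) * h3
  have : AntitoneOn (fun z => gg cc l K z (√(2 - z^2) * s) (√(2 - z^2) * k)) (Set.Icc h h') := by
    have hz2 : ∀ z, h ≤ z → z ≤ h' → z^2 ≤ h'^2 := fun z a b => pow_le_pow_left₀ (by linarith) b 2
    apply antitoneOn_of_deriv_nonpos (convex_Icc h h')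
    · intro z hz
      exact (hder z (h0.trans_le hz.1) (by linarith [hz2 z hz.1 hz.2])).continuousAt.continuousWithinAt
    · intro z hz
      rw [interior_Icc] at hz
      exact (hder z (h0.trans hz.1) (by linarith [hz2 z hz.1.le hz.2.le])).differentiableAt.differentiableWithinAt
    · intro z hz
      rw [interior_Icc] at hz
      have hz0 := h0.trans hz.1
      have hzz := hz2 z hz.1.le hz.2.le
      have hp : 0 < √(2 - z^2) := Real.sqrt_pos.mpr (by linarith)
      have hq : √(2 - z^2)^2 = 2 - z^2 := Real.sq_sqrt (by linarith)
      rw [(hder z hz0 (by linarith)).deriv]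
      have hx1 : 1 ≤ √(2 - z^2) * k := h1.trans (mul_le_mul_of_nonneg_right (Real.sqrt_le_sqrt (by linarith)) hk.le)
      have hx2 : (√(2 - z^2) * k)^2 < 2 := by
        rw [mul_pow, hq]; nlinarith [sq_nonneg s, sq_pos_of_pos hz0]
      generalize √(2 - z^2) * k = x at *
      apply mul_nonpos_of_nonneg_of_nonpos (div_nonneg (by positivity) (by linarith))
      have := hred_ineq hK (by linarith : z^2 ≤ 0.2210) hx1 hx2
      rw [← cs2] at this
      have hd : 0 < 2 - x^2 := by linarith
      have e : 2 * (1 - cc * x / √2) = 2 - cc * √2 * x := by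
        have q := Real.sq_sqrt (by norm_num : (0:ℝ) ≤ 2)
        have q0 : √2 ≠ 0 := by positivity
        field_simp
        linear_combination (cc * x) * q
      rw [e]
      have : (2 - cc * √2 * x) / (2 - x^2) ≤ K * x * (2 - 3 * z^2) := by
        rw [div_le_iff₀ hd]; exact this
      linarith
  exact this (Set.left_mem_Icc.mpr hh) (Set.right_mem_Icc.mpr hh) hh

set_option linter.unusedVariables false
noncomputable def Dx (δ x : ℝ) : ℝ := rr * (cc * √2 - x) / (2 - x^2) + lam δ - δ / 2 * rr * (2 * x^2 - rho^2)

theorem Dx_eq {δ x : ℝ} (hx : x^2 < 2) : Dx δ x = (x - xs) * (rr * ((cc * √2 * (x + xs) - 2 - x * xs) / ((2 - x^2) * (2 - xs^2)) - δ * (x + xs))) := by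
  have h := xs_b
  have h1 : 0 < 2 - xs^2 := by nlinarith
  have h2 : 0 < 2 - x^2 := by linarith
  unfold Dx lam
  field_simp
  ring

theorem Dx_fac {δ x : ℝ} (hδ : 0.812541 ≤ δ) (hδ' : δ ≤ 0.812543) (h1 : 1.3249 ≤ x) (h2 : x ≤ 1.3522) :
    0 ≤ rr * ((cc * √2 * (x + xs) - 2 - x * xs) / ((2 - x^2) * (2 - xs^2)) - δ * (x + xs)) := by
  have h := xs_b
  have hs := sqrt2_c
  have hr := rr_b
  apply mul_nonneg (by linarith)
  rw [cs2]
  have u1 : 0 < 2 - xs^2 := by nlinarith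
  have u2 : 0 < 2 - x^2 := by nlinarith
  have u3 : 2 - xs^2 ≤ 0.1877 := by nlinarith
  have u4 : 2 - x^2 ≤ 0.2447 := by nlinarith
  have u5 : (2 - x^2) * (2 - xs^2) ≤ 0.2447 * 0.1877 := mul_le_mul u4 u3 u1.le (by norm_num)
  have n1 : 0.258 ≤ (10 - 6 * √2) * (x + xs) - 2 - x * xs := by
    have : 1.5147 * (x + xs) ≤ (10 - 6 * √2) * (x + xs) := mul_le_mul_of_nonneg_right (by linarith) (by linarith)
    nlinarith
  have n2 : δ * (x + xs) ≤ 0.812543 * 2.7 := mul_le_mul hδ' (by linarith) (by linarith) (by norm_num)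
  have : 0.258 / (0.2447 * 0.1877) ≤ ((10 - 6 * √2) * (x + xs) - 2 - x * xs) / ((2 - x^2) * (2 - xs^2)) :=
    div_le_div₀ (by linarith) n1 (by positivity) u5
  norm_num at this
  linarith

theorem Dx_t {δ x : ℝ} (hδ : 0.812541 ≤ δ) (hδ' : δ ≤ 0.812543) (h1 : 1 ≤ x) (h2 : x ≤ 1.0517) : 0 ≤ Dx δ x := by
  unfold Dx
  have hs := sqrt2_c
  have hr := rr_b
  have hl := lam_b hδ hδ'
  rw [cs2, rho_sq]
  have h3 : x^2 ≤ 1.10608 := by nlinarith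
  have h4 : 1 ≤ x^2 := by nlinarith
  have a1 : 0.19 / 1 ≤ rr * (10 - 6 * √2 - x) / (2 - x^2) := by
    apply div_le_div₀ _ _ (by linarith) (by linarith)
    · apply mul_nonneg <;> linarith
    · have : 0.4142 * 0.462 ≤ rr * (10 - 6 * √2 - x) := mul_le_mul (by linarith) (by linarith) (by norm_num) (by linarith)
      linarith
  have a2 : δ / 2 * rr * (2 * x^2 - (1 + 2 * rr)) ≤ (0.812543/2 * 0.4143) * 0.384 :=
    mul_le_mul (mul_le_mul (by linarith) (by linarith) (by linarith) (by norm_num)) (by linarith) (by linarith) (by norm_num)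
  linarith

theorem psi_der {δ p : ℝ} (hp : 0 < Real.cos p) :
    HasDerivAt (fun p => gg cc (lam δ) (δ/2) rr (rho * Real.sin p) (rho * Real.cos p)) (Dx δ (rho * Real.cos p)) p := by
  have hr := rr_b
  have hrho := rho_b
  have h0 : 0 < rr := by linarith
  refine (hasDerivAt_gg (hasDerivAt_const p rr) ((Real.hasDerivAt_sin p).const_mul rho) ((Real.hasDerivAt_cos p).const_mul rho)
    rfl rfl rfl h0 (mul_pos (by linarith) hp)).congr_deriv ?_
  unfold Dx
  have sc := Real.sin_sq_add_cos_sq p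
  have e2 : (rho * Real.sin p)^2 + (rho * Real.cos p)^2 = rho^2 := by rw [← mul_one (rho^2), ← sc]; ring
  have e1 : rr^2 + (rho * Real.sin p)^2 + (rho * Real.cos p)^2 = 2 := by
    have : rr^2 + rho^2 = 2 := by rw [rr_sq, rho_sq]; ring
    linarith
  have e4 : rho * -Real.sin p = -(rho * Real.sin p) := by ring
  rw [e1, e2, e4]
  generalize rho * Real.sin p = d at *
  have hx : 0 < rho * Real.cos p := mul_pos (by linarith) hp
  generalize rho * Real.cos p = x at *
  have e3 : 2 - x^2 = rr^2 + d^2 := by linarith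
  have q := Real.sq_sqrt (by norm_num : (0:ℝ) ≤ 2)
  have q0 : 0 < √2 := by positivity
  have w0 : 0 < rr^2 + d^2 := by positivity
  have e5 : cc * √2 = 2 * (cc / √2) := by field_simp; linear_combination cc * q
  rw [e3, e5]
  have e6 : cc * x / √2 = (cc / √2) * x := by ring
  have e7 : cc * rr / √2 = (cc / √2) * rr := by ring
  rw [e6, e7]
  generalize cc / √2 = m
  have e8 : rho ≠ 0 := by linarith
  have e9 : rr * (2 * m - x) / (rr^2 + d^2) = rr * m + rr * (m * x^2 - x) / (rr^2+d^2) := by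
    field_simp
    linear_combination (-m) * e1
  rw [e9]
  have e10 : x / rho^2 * (m * rr + lam δ) * x + -(d / rho^2) * (m * rr + lam δ) * -d = m * rr + lam δ := by
    field_simp
    linear_combination (m * rr + lam δ) * e2
  have e11 : δ / 2 * rr * (2 * x^2 - rho^2) = δ / 2 * rr * (x^2 - d^2) := by rw [← e2]; ring
  rw [e11]
  have e12 : rr * (m * x^2 - x) / (rr^2+d^2) = -(rr / (rr^2+d^2)) * (1 - m * x) * x := by ring
  rw [e12]
  linear_combination e10

theorem psi_mono {δ p q : ℝ} (hp : 0 ≤ p) (hpq : p ≤ q) (hq : q < Real.pi/2)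
    (H : ∀ x, rho * Real.cos q ≤ x → x ≤ rho * Real.cos p → 0 ≤ Dx δ x) :
    gg cc (lam δ) (δ/2) rr (rho * Real.sin p) (rho * Real.cos p) ≤ gg cc (lam δ) (δ/2) rr (rho * Real.sin q) (rho * Real.cos q) := by
  have hc : ∀ z, p ≤ z → z ≤ q → 0 < Real.cos z := fun z a b => Real.cos_pos_of_mem_Ioo ⟨by linarith [Real.pi_pos], by linarith⟩
  have : MonotoneOn (fun p => gg cc (lam δ) (δ/2) rr (rho * Real.sin p) (rho * Real.cos p)) (Set.Icc p q) := by
    apply monotoneOn_of_deriv_nonneg (convex_Icc p q)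
    · intro z hz
      exact (psi_der (hc z hz.1 hz.2)).continuousAt.continuousWithinAt
    · intro z hz
      rw [interior_Icc] at hz
      exact (psi_der (hc z hz.1.le hz.2.le)).differentiableAt.differentiableWithinAt
    · intro z hz
      rw [interior_Icc] at hz
      rw [(psi_der (hc z hz.1.le hz.2.le)).deriv]
      have h0 : 0 ≤ rho := by linarith [rho_b.1]
      apply H
      · exact mul_le_mul_of_nonneg_left (Real.cos_le_cos_of_nonneg_of_le_pi (by linarith [hz.1]) (by linarith [Real.pi_pos]) hz.2.le) h0
      · exact mul_le_mul_of_nonneg_left (Real.cos_le_cos_of_nonneg_of_le_pi hp (by linarith [Real.pi_pos, hz.2]) hz.1.le) h0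
  exact this (Set.left_mem_Icc.mpr hpq) (Set.right_mem_Icc.mpr hpq) hpq

theorem psi_anti {δ p q : ℝ} (hp : 0 ≤ p) (hpq : p ≤ q) (hq : q < Real.pi/2)
    (H : ∀ x, rho * Real.cos q ≤ x → x ≤ rho * Real.cos p → Dx δ x ≤ 0) :
    gg cc (lam δ) (δ/2) rr (rho * Real.sin q) (rho * Real.cos q) ≤ gg cc (lam δ) (δ/2) rr (rho * Real.sin p) (rho * Real.cos p) := by
  have hc : ∀ z, p ≤ z → z ≤ q → 0 < Real.cos z := fun z a b => Real.cos_pos_of_mem_Ioo ⟨by linarith [Real.pi_pos], by linarith⟩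
  have : AntitoneOn (fun p => gg cc (lam δ) (δ/2) rr (rho * Real.sin p) (rho * Real.cos p)) (Set.Icc p q) := by
    apply antitoneOn_of_deriv_nonpos (convex_Icc p q)
    · intro z hz
      exact (psi_der (hc z hz.1 hz.2)).continuousAt.continuousWithinAt
    · intro z hz
      rw [interior_Icc] at hz
      exact (psi_der (hc z hz.1.le hz.2.le)).differentiableAt.differentiableWithinAt
    · intro z hz
      rw [interior_Icc] at hz
      rw [(psi_der (hc z hz.1.le hz.2.le)).deriv]
      have h0 : 0 ≤ rho := by linarith [rho_b.1]
      apply H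
      · exact mul_le_mul_of_nonneg_left (Real.cos_le_cos_of_nonneg_of_le_pi (by linarith [hz.1]) (by linarith [Real.pi_pos]) hz.2.le) h0
      · exact mul_le_mul_of_nonneg_left (Real.cos_le_cos_of_nonneg_of_le_pi hp (by linarith [Real.pi_pos, hz.2]) hz.1.le) h0
  exact this (Set.left_mem_Icc.mpr hpq) (Set.right_mem_Icc.mpr hpq) hpq

theorem psi_par {d x : ℝ} (hd : 0 ≤ d) (hx : 0 < x) (h : d^2 + x^2 = rho^2) :
    ∃ p, 0 ≤ p ∧ p < Real.pi/2 ∧ d = rho * Real.sin p ∧ x = rho * Real.cos p := by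
  have hr : 0 < rho := by linarith [rho_b.1]
  refine ⟨Real.arctan (d/x), Real.arctan_nonneg.mpr (by positivity), Real.arctan_lt_pi_div_two _, ?_, ?_⟩
  · rw [Real.sin_arctan]
    have : √(1 + (d/x)^2) = rho / x := by
      rw [Real.sqrt_eq_iff_mul_self_eq_of_pos (by positivity)]
      field_simp; linarith
    rw [this]; field_simp
  · rw [Real.cos_arctan]
    have : √(1 + (d/x)^2) = rho / x := by
      rw [Real.sqrt_eq_iff_mul_self_eq_of_pos (by positivity)]
      field_simp; linarith
    rw [this]; field_simp

theorem psi_le {d x p q : ℝ} (hp : 0 ≤ p) (hq : q < Real.pi/2) (hq0 : 0 ≤ q) (hp2 : p < Real.pi/2)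
   (h : rho * Real.cos q ≤ rho * Real.cos p) : p ≤ q := by
  have hr : 0 < rho := by linarith [rho_b.1]
  by_contra hc
  push Not at hc
  have := Real.cos_lt_cos_of_nonneg_of_le_pi_div_two hq0 hp2.le hc
  have := mul_lt_mul_of_pos_left this hr
  linarith

theorem E_s {δ d x : ℝ} (hδ : 0.812541 ≤ δ) (hδ' : δ ≤ 0.812543) (hd : 0 ≤ d) (h : d^2 + x^2 = rho^2) (hx : 1.3249 ≤ x) :
    gg cc (lam δ) (δ/2) rr d x ≤ gg cc (lam δ) (δ/2) rr ds xs := by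
  obtain ⟨p, p0, p1, rfl, rfl⟩ := psi_par hd (by linarith) h
  have hb := xs_b
  have hr := rho_b
  obtain ⟨q, q0, q1, e1, e2⟩ := psi_par (d := ds) (x := xs) (by linarith [ds_b.1]) (by linarith [xs_b.1])
    (by have := ds_xs; rw [rho_sq]; linarith [rr_sq])
  have e : gg cc (lam δ) (δ/2) rr ds xs = gg cc (lam δ) (δ/2) rr (rho * Real.sin q) (rho * Real.cos q) := by rw [← e1, ← e2]
  rw [e]
  have up : ∀ t : ℝ, rho * Real.cos t ≤ 1.3522 := by
    intro t
    have := mul_le_mul_of_nonneg_left (Real.cos_le_one t) (by linarith : 0 ≤ rho)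
    linarith
  rcases le_total xs (rho * Real.cos p) with hc | hc
  · have := psi_le (d := 0) (x := 0) p0 q1 q0 p1 (by rw [← e2]; exact hc)
    apply psi_mono p0 this q1
    intro x h1 h2
    rw [← e2] at h1
    have h3 := h2.trans (up p)
    rw [Dx_eq (by nlinarith)]
    exact mul_nonneg (by linarith) (Dx_fac hδ hδ' (by linarith) h3)
  · have := psi_le (d := 0) (x := 0) q0 p1 p0 q1 (by rw [← e2]; exact hc)
    apply psi_anti q0 this p1
    intro x h1 h2
    rw [← e2] at h2
    rw [Dx_eq (by nlinarith)]
    exact mul_nonpos_of_nonpos_of_nonneg (by linarith) (Dx_fac hδ hδ' (by linarith) (by linarith))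

theorem E_t {δ d x : ℝ} (hδ : 0.812541 ≤ δ) (hδ' : δ ≤ 0.812543) (hd : 0 ≤ d) (h : d^2 + x^2 = rho^2) (hx : 1 ≤ x) (hx' : x ≤ 1.0517) :
    gg cc (lam δ) (δ/2) rr d x ≤ gg cc (lam δ) (δ/2) rr dt 1 := by
  obtain ⟨p, p0, p1, rfl, rfl⟩ := psi_par hd (by linarith) h
  obtain ⟨q, q0, q1, e1, e2⟩ := psi_par (d := dt) (x := 1) (by linarith [dt_b.1]) (by norm_num)
    (by have := dt_1; rw [rho_sq]; linarith [rr_sq])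
  have e : gg cc (lam δ) (δ/2) rr dt 1 = gg cc (lam δ) (δ/2) rr (rho * Real.sin q) (rho * Real.cos q) := by rw [← e1, ← e2]
  rw [e]
  have := psi_le (d := 0) (x := 0) p0 q1 q0 p1 (by rw [← e2]; exact hx)
  apply psi_mono p0 this q1
  intro x h1 h2
  rw [← e2] at h1
  exact Dx_t hδ hδ' h1 (by linarith)

theorem gd_bound {l K h w v u t : ℝ} (hK : 0.4062705 ≤ K) (hl : l ≤ -0.0696039)
    (h1 : 0.4142 ≤ h) (h2 : h ≤ 0.47) (w0 : 0 < w) (w1 : w ≤ 1.1814) (hv : 2 - h^2 ≤ v) (hu : 0.9048 ≤ u) 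
    (ht : √2 ≤ t) (hut : u ≤ 0.71 * t) :
    -(h / w) * (1 - cc * u / t) + u / v * (cc * h / t + l) - K * h * u ≤ -0.11 := by
  have hc := cc_b
  have hs := sqrt2_c
  have t0 : 0 < t := by linarith
  have a1 : cc * u / t ≤ 0.76046 := by
    rw [div_le_iff₀ t0]
    have := mul_le_mul_of_nonneg_right hc.2 (by linarith : 0 ≤ u)
    linarith
  have a2 : 0.3506 ≤ h / w := by rw [le_div_iff₀ w0]; linarith
  have a3 : 0.3506 * 0.23954 ≤ (h / w) * (1 - cc * u / t) := mul_le_mul a2 (by linarith) (by norm_num) (by linarith)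
  have hh : h^2 ≤ 0.2209 := by nlinarith
  have v0 : 0 < v := by linarith
  have b1 : cc * h / t ≤ 0.75738 * h := by
    rw [div_le_iff₀ t0]
    have e1 : cc * h ≤ 1.071067815 * h := mul_le_mul_of_nonneg_right hc.2 (by linarith)
    have e2 : 0.75738 * h * 1.414213562 ≤ 0.75738 * h * t := mul_le_mul_of_nonneg_left (by linarith) (by linarith)
    linarith
  have b2 : (cc * h / t + l) ≤ (0.4062705 * h - 0.029) * v := by
    have e1 : (0.4062705 * h - 0.029) * (2 - h^2) ≤ (0.4062705 * h - 0.029) * v := mul_le_mul_of_nonneg_left hv (by linarith)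
    have e2 : 0.75738 * h - 0.0696039 ≤ (0.4062705 * h - 0.029) * (2 - h^2) := by
      nlinarith [mul_nonneg (sub_nonneg.2 h1) (sub_nonneg.2 h2), mul_nonneg (mul_nonneg (sub_nonneg.2 h1) (sub_nonneg.2 h2)) (by linarith : 0 ≤ h)]
    linarith
  have b3 : u / v * (cc * h / t + l) ≤ u * (0.4062705 * h - 0.029) := by
    have : (cc * h / t + l) / v ≤ 0.4062705 * h - 0.029 := by rw [div_le_iff₀ v0]; exact b2
    have := mul_le_mul_of_nonneg_left this (by linarith : 0 ≤ u)
    calc _ = u * ((cc * h / t + l) / v) := by ring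
      _ ≤ _ := this
  have b4 : 0.4062705 * (h * u) ≤ K * (h * u) := mul_le_mul_of_nonneg_right hK (mul_nonneg (by linarith) (by linarith))
  linarith

theorem P_alg {l K h z d : ℝ} (hK : 0.4062705 ≤ K) (hl0 : -0.07 ≤ l) (hl : l ≤ -0.0696039) (h1 : 0.4142 ≤ h) (h2 : h ≤ 0.47)
    (z1 : 0.9048 ≤ z) (z2 : z ≤ 1) (hp : 0 < d) (hdd : d ≤ 0.98) (e1 : h^2 + d^2 + z^2 = 2) :
    0 ≤ (-(h / (h^2 + d^2)) * (1 - cc * z / √(h^2 + d^2 + z^2)) + z / (d^2 + z^2) * (cc * h / √(h^2 + d^2 + z^2) + l) - K * h * z) * (-z / d)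
      + (-(d / (d^2 + z^2)) * (cc * h / √(h^2 + d^2 + z^2) + l) - K * h * d)
      + ((-(h / (h^2 + d^2)) * (1 - cc * (2 - z) / √(h^2 + d^2 + (2-z)^2)) + (2 - z) / (d^2 + (2-z)^2) * (cc * h / √(h^2 + d^2 + (2-z)^2) + l) - K * h * (2 - z)) * (-z/d)
      - (-(d / (d^2 + (2-z)^2)) * (cc * h / √(h^2 + d^2 + (2-z)^2) + l) - K * h * d)) := by
  have hy : h^2 + d^2 + (2 - z)^2 = 6 - 4 * z := by nlinarith
  have s2 := sqrt2_c
  have hh : h^2 ≤ 0.2209 := by nlinarith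
  have z3 : 0.8186 ≤ z^2 := by nlinarith
  have ht2 : √(6 - 4 * z)^2 = 6 - 4 * z := Real.sq_sqrt (by linarith)
  have ht : √2 ≤ √(6 - 4 * z) := Real.sqrt_le_sqrt (by linarith)
  rw [e1, hy]
  generalize √(6 - 4 * z) = t at *
  have zt : 2 - z ≤ 0.71 * t := by
    refine (sq_le_sq₀ (by linarith) (by linarith)).mp ?_
    rw [mul_pow, ht2]; nlinarith
  have w0 : 0 < h^2 + d^2 := by positivity
  have v2 : 2 - h^2 ≤ d^2 + (2-z)^2 := by linarith
  have v20 : 0 < d^2 + (2-z)^2 := by linarith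
  have v1 : 2 - h^2 ≤ d^2 + z^2 := by linarith
  have w1 : h^2 + d^2 ≤ 1.1814 := by linarith
  have g1 := gd_bound (l := l) (w := h^2 + d^2) (v := d^2 + z^2) (u := z) (t := √2) hK hl h1 h2 w0 w1 v1 z1 le_rfl (by linarith)
  have g2 := gd_bound (l := l) (w := h^2 + d^2) (v := d^2 + (2-z)^2) (u := 2-z) (t := t) hK hl h1 h2 w0 w1 v2 (by linarith) ht zt
  generalize -(h / (h^2 + d^2)) * (1 - cc * z / √2) + z / (d^2 + z^2) * (cc * h / √2 + l) - K * h * z = G1 at *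
  generalize -(h / (h^2 + d^2)) * (1 - cc * (2 - z) / t) + (2 - z) / (d^2 + (2-z)^2) * (cc * h / t + l) - K * h * (2 - z) = G2 at *
  have hc := cc_b
  have k1 : 0.923 ≤ z / d := by rw [le_div_iff₀ hp]; linarith
  have ch : 1 * 0.4142 ≤ cc * h := mul_le_mul (by linarith) h1 (by linarith) (by linarith)
  have k2 : d / (d^2 + z^2) * (cc * h / √2 + l) ≤ 0.16 := by
    have m1 : cc * h / √2 ≤ 0.3563 := by
      rw [div_le_iff₀ (by linarith)]
      have : cc * h ≤ 1.071067815 * 0.47 := mul_le_mul hc.2 h2 (by linarith) (by norm_num)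
      linarith
    have m0 : 0 ≤ cc * h / √2 + l := by
      have : 0.07 ≤ cc * h / √2 := by
        rw [le_div_iff₀ (by linarith)]
        linarith
      linarith
    have m2 : d / (d^2 + z^2) ≤ 0.551 := by rw [div_le_iff₀ (by linarith)]; linarith
    have : d / (d^2 + z^2) * (cc * h / √2 + l) ≤ 0.551 * 0.2867 := mul_le_mul m2 (by linarith) m0 (by norm_num)
    linarith
  have k3 : 0 ≤ d / (d^2 + (2-z)^2) * (cc * h / t + l) := by
    apply mul_nonneg (div_nonneg hp.le v20.le)
    have t3 : t ≤ 2 := by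
      refine (sq_le_sq₀ (by linarith) (by linarith)).mp ?_
      rw [ht2]; linarith
    have : 0.1 ≤ cc * h / t := by
      rw [le_div_iff₀ (by linarith)]
      linarith
    linarith
  have k4 : 0.923 * 0.22 ≤ (z / d) * (-G1 - G2) := mul_le_mul k1 (by linarith) (by norm_num) (by linarith)
  have e : -z / d = -(z / d) := by ring
  rw [e]
  generalize z / d = Q at *
  generalize cc * h / t + l = X at *
  generalize cc * h / √2 + l = Y at *
  have k5 : -(d / (d^2 + z^2)) * Y = -(d / (d^2 + z^2) * Y) := by ring
  have k6 : -(d / (d^2 + (2-z)^2)) * X = -(d / (d^2 + (2-z)^2) * X) := by ring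
  rw [k5, k6]
  generalize d / (d^2 + z^2) * Y = Y' at *
  generalize d / (d^2 + (2-z)^2) * X = X' at *
  linarith

theorem P_mono {l K h a d0 : ℝ} (hK : 0.4062705 ≤ K) (hl0 : -0.07 ≤ l) (hl : l ≤ -0.0696039) (h1 : 0.4142 ≤ h) (h2 : h ≤ 0.47)
    (ha : 0.9048 ≤ a) (ha1 : a ≤ 1) (hd0 : 0 ≤ d0) (hd : d0 ≤ 0.98) (hs : h^2 + d0^2 + a^2 = 2) :
    gg cc l K h d0 a + gg cc l K h d0 (2 - a) ≤ 2 * gg cc l K h √(2 - h^2 - 1^2) 1 := by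
  have hh : h^2 ≤ 0.2209 := by nlinarith
  have hh' : 0.1715 ≤ h^2 := by nlinarith
  have hr : ∀ z : ℝ, a ≤ z → z ≤ 1 → HasDerivAt (fun z : ℝ => √(2 - h^2 - z^2)) (-z / √(2 - h^2 - z^2)) z := by
    intro z _ hz
    have hz2 : z^2 ≤ 1 := by nlinarith
    have := ((hasDerivAt_pow 2 z).const_sub (2 - h^2)).sqrt (by simp; linarith)
    refine this.congr_deriv ?_
    have : √(2 - h^2 - z^2) ≠ 0 := (Real.sqrt_pos.mpr (by linarith)).ne'
    field_simp; simp
  have hder : ∀ z, a ≤ z → z ≤ 1 → HasDerivAt (fun z => gg cc l K h √(2 - h^2 - z^2) z + gg cc l K h √(2 - h^2 - z^2) (2 - z)) _ z :=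
    fun z z1 z2 => (hasDerivAt_gg (hasDerivAt_const z h) (hr z z1 z2) (hasDerivAt_id z) rfl rfl rfl (by linarith) (by simp; linarith)).add 
      (hasDerivAt_gg (hasDerivAt_const z h) (hr z z1 z2) ((hasDerivAt_id z).const_sub 2) rfl rfl rfl (by linarith) (by simp; linarith))
  have : MonotoneOn (fun z => gg cc l K h √(2 - h^2 - z^2) z + gg cc l K h √(2 - h^2 - z^2) (2 - z)) (Set.Icc a 1) := by
    apply monotoneOn_of_deriv_nonneg (convex_Icc a 1)
    · intro z hz
      exact (hder z hz.1 hz.2).continuousAt.continuousWithinAt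
    · intro z hz
      rw [interior_Icc] at hz
      exact (hder z hz.1.le hz.2.le).differentiableAt.differentiableWithinAt
    · intro z hz
      rw [interior_Icc] at hz
      rw [(hder z hz.1.le hz.2.le).deriv]
      obtain ⟨z1, z2⟩ := hz
      simp only [id]
      have hz2 : z^2 ≤ 1 := by nlinarith
      have hz3 : a^2 ≤ z^2 := by nlinarith
      have hz4 : 0.8186 ≤ a^2 := by nlinarith
      have hq : √(2 - h^2 - z^2)^2 = 2 - h^2 - z^2 := Real.sq_sqrt (by linarith)
      have hp : 0 < √(2 - h^2 - z^2) := Real.sqrt_pos.mpr (by linarith)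
      have hdd : √(2 - h^2 - z^2) ≤ 0.98 := (Real.sqrt_le_left (by norm_num)).mpr (by nlinarith)
      generalize √(2 - h^2 - z^2) = d at *
      have e1 : h^2 + d^2 + z^2 = 2 := by linarith
      have := P_alg hK hl0 hl h1 h2 (by linarith : 0.9048 ≤ z) z2.le hp hdd e1
      linarith
  have := this (Set.left_mem_Icc.mpr ha1) (Set.right_mem_Icc.mpr ha1) ha1
  have e : √(2 - h^2 - a^2) = d0 := by rw [show 2 - h^2 - a^2 = d0^2 by linarith]; exact Real.sqrt_sq hd0
  simp only [e] at this
  have e2 : (2:ℝ) - 1 = 1 := by norm_num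
  rw [e2] at this
  linarith

theorem Ered {δ h d x : ℝ} (hδ : 0.812541 ≤ δ) (h1 : rr ≤ h) (h2 : h ≤ 0.47) (hd : 0 ≤ d) (hx : 1 ≤ x) (hs : h^2 + d^2 + x^2 = 2) :
    ∃ d' x', gg cc (lam δ) (δ/2) h d x ≤ gg cc (lam δ) (δ/2) rr d' x' ∧ d'^2 + x'^2 = rho^2 ∧ d ≤ d' ∧ x ≤ x' ∧ d'^2 * (2 - h^2) = d^2 * rho^2
      ∧ x'^2 * (2 - h^2) = x^2 * rho^2 := by
  have hh : h^2 ≤ 0.2209 := by nlinarith [rr_b.1]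
  have hr := rr_b
  have p0 : 0 < √(2 - h^2) := Real.sqrt_pos.mpr (by linarith)
  have hp : √(2 - h^2)^2 = 2 - h^2 := Real.sq_sqrt (by linarith)
  have q : √(2 - rr^2) = rho := rfl
  have hr2 : rr^2 ≤ h^2 := by nlinarith
  have hpq : √(2 - h^2) ≤ rho := by rw [← q]; exact Real.sqrt_le_sqrt (by linarith)
  have ed : √(2 - h^2) * (d / √(2 - h^2)) = d := by field_simp
  have ex : √(2 - h^2) * (x / √(2 - h^2)) = x := by field_simp
  have sk : (d / √(2 - h^2))^2 + (x / √(2 - h^2))^2 = 1 := by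
    rw [div_pow, div_pow, hp]
    have : 2 - h^2 ≠ 0 := by linarith
    field_simp; linarith
  have := hred (l := lam δ) (K := δ/2) (h := rr) (h' := h) (s := d / √(2 - h^2)) (k := x / √(2 - h^2)) (by linarith) (by linarith) h1 (by linarith) sk (by positivity) (by positivity) (by rw [ex]; exact hx)
  rw [ed, ex, q] at this
  refine ⟨_, _, this, ?_, ?_, ?_, ?_, ?_⟩
  · rw [mul_pow, mul_pow, ← mul_add, sk, mul_one]
  · nth_rw 1 [← ed]; exact mul_le_mul_of_nonneg_right hpq (by positivity)
  · nth_rw 1 [← ex]; exact mul_le_mul_of_nonneg_right hpq (by positivity)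
  · rw [mul_pow, div_pow, hp]
    have : 2 - h^2 ≠ 0 := by linarith
    field_simp
  · rw [mul_pow, div_pow, hp]
    have : 2 - h^2 ≠ 0 := by linarith
    field_simp

theorem at_self {x : ℝ} (hx : 0 ≤ x) : Real.arctan x ≤ x := by
  have h1 := Real.arctan_nonneg.mpr hx
  have h2 := Real.le_tan h1 (Real.arctan_lt_pi_div_two x)
  rwa [Real.tan_arctan] at h2

theorem lamS {δ h : ℝ} (hδ : 0.812541 ≤ δ) (hδ' : δ ≤ 0.812543) (h1 : rr ≤ h) : -lam δ * 2.24265 ≤ cc * h := by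
  have := lam_b hδ hδ'
  have hr := rr_b
  have hc := cc_b
  have : 1 * 0.41 ≤ cc * h := mul_le_mul (by linarith) (by linarith) (by linarith) (by linarith)
  linarith

/-- replace `x` by the abscissa on the sphere of radius `√2` -/
theorem toE {δ h d x : ℝ} (hδ : 0.812541 ≤ δ) (hδ' : δ ≤ 0.812543) (h1 : rr ≤ h) (hd : 0 ≤ d) (hx : 0 < x)
    (s1 : 2 ≤ h^2 + d^2 + x^2) (s2 : h^2 + d^2 + x^2 ≤ 5.0294373) (hp : 0 < 2 - h^2 - d^2) :
    gg cc (lam δ) (δ/2) h d x ≤ gg cc (lam δ) (δ/2) h d √(2 - h^2 - d^2) := by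
  have hr := rr_b
  have hc := cc_b
  exact gg_anti (S := 2.24265) (by linarith) hd (Real.sqrt_pos.mpr hp) (Real.sqrt_le_left hx.le |>.mpr (by linarith))
    (by linarith) (by linarith) (by norm_num) (by linarith) (lamS hδ hδ' h1)

theorem case_S {δ h d x : ℝ} (hδ : 0.812541 ≤ δ) (hδ' : δ ≤ 0.812543) (h1 : rr ≤ h) (h2 : h ≤ 0.47) (hd : 0 ≤ d) (hd2 : d ≤ 0.25) (hx : 0 < x)
    (s1 : 2 ≤ h^2 + d^2 + x^2) (s2 : h^2 + d^2 + x^2 ≤ 5.0294373) :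
    gg cc (lam δ) (δ/2) h d x + kap δ ≤ es δ := by
  have hr := rr_b
  have hh : h^2 ≤ 0.2209 := by nlinarith
  have hdd : d^2 ≤ 0.0625 := by nlinarith
  have hq := Real.sq_sqrt (by linarith : 0 ≤ 2 - h^2 - d^2)
  have hx1 : 1 ≤ √(2 - h^2 - d^2) := Real.one_le_sqrt.mpr (by linarith)
  obtain ⟨d', x', g, e, dl, xl, ed, ex⟩ := Ered hδ h1 h2 hd hx1 (by linarith)
  have a := toE hδ hδ' h1 hd hx s1 s2 (by linarith)
  have x13 : 1.3249 ≤ x' := by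
    rw [rho_sq] at e ed
    have : d'^2 * 1.7791 ≤ d^2 * (1 + 2 * rr) := by
      rw [← ed]; exact mul_le_mul_of_nonneg_left (by linarith) (sq_nonneg _)
    have t2 : d^2 * (1 + 2 * rr) ≤ 0.0625 * 1.8285 := mul_le_mul hdd (by linarith) (by linarith) (by norm_num)
    refine (sq_le_sq₀ (by norm_num) (by linarith)).mp ?_
    linarith
  have b := E_s hδ hδ' (by linarith) e x13
  unfold es
  linarith

theorem case_C {δ h d x y : ℝ} (hδ : 0.812541 ≤ δ) (hδ' : δ ≤ 0.812543) (h1 : rr ≤ h) (h2 : h ≤ 0.47) (hd : 0.84999 ≤ d) (hd2 : d ≤ 0.98) (hx : 0 < x) (hy : 0 < y)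
    (hxy : 2 ≤ x + y)
    (s1 : 2 ≤ h^2 + d^2 + x^2) (s2 : h^2 + d^2 + x^2 ≤ 5.0294373)
    (t1 : 2 ≤ h^2 + d^2 + y^2) (t2 : h^2 + d^2 + y^2 ≤ 5.0294373) :
    pg cc (lam δ) (δ/2) h d x y + 2 * kap δ ≤ 2 * et δ := by
  have hr := rr_b
  have hh : h^2 ≤ 0.2209 := by nlinarith
  have hdd : d^2 ≤ 0.9604 := by nlinarith
  have hdl : 0.7224 ≤ d^2 := by nlinarith
  have hq := Real.sq_sqrt (by linarith : 0 ≤ 2 - h^2 - d^2)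
  have hrho := rho_sq
  unfold pg et
  rcases le_total 1 √(2 - h^2 - d^2) with hx1 | hx1
  · obtain ⟨d', x', g, e, dl, xl, ed, ex⟩ := Ered (d := d) hδ h1 h2 (by linarith) hx1 (by linarith)
    have a := toE hδ hδ' h1 (by linarith : 0 ≤ d) hx s1 s2 (by linarith)
    have a' := toE hδ hδ' h1 (by linarith : 0 ≤ d) hy t1 t2 (by linarith)
    have d2 : d^2 ≤ d'^2 := pow_le_pow_left₀ (by linarith) dl 2
    have b := E_t hδ hδ' (by linarith) e (by linarith) ((sq_le_sq₀ (by linarith) (by norm_num)).mp (by linarith))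
    linarith
  · have hl := lam_b hδ hδ'
    have hc := cc_b
    have x0 : 0.9048 ≤ √(2 - h^2 - d^2) := Real.le_sqrt_of_sq_le (by linarith)
    have p := gg_pair (c := cc) (l := lam δ) (K := δ/2) (h := h) (d := d) (S := 2.24265) (S2 := 2.24265) (xl := √(2 - h^2 - d^2)) (x := x) (y := y)
      (by linarith) (by linarith) (by linarith) ((Real.sqrt_le_left hx.le).mpr (by linarith)) ((Real.sqrt_le_left hy.le).mpr (by linarith)) hxy
      (by linarith) (by linarith) (by norm_num) (by linarith) (by linarith) (lamS hδ hδ' h1) hx1 (by norm_num) (by rw [sub_sq, hq]; linarith) (lamS hδ hδ' h1)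
    have m := P_mono (l := lam δ) (K := δ/2) (h := h) (a := √(2 - h^2 - d^2)) (d0 := d) (by linarith) (by linarith) (by linarith) (by linarith) h2 x0 hx1 (by linarith) hd2 (by linarith)
    have q2 := Real.sq_sqrt (by linarith : 0 ≤ 2 - h^2 - 1^2)
    obtain ⟨d', x', g, e, dl, xl, ed, ex⟩ := Ered (x := 1) (d := √(2 - h^2 - 1^2)) hδ h1 h2 (Real.sqrt_nonneg _) le_rfl (by linarith)
    have hx2 : x'^2 * 1.7791 ≤ x'^2 * (2 - h^2) := mul_le_mul_of_nonneg_left (by linarith) (sq_nonneg _)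
    have b := E_t hδ hδ' (le_trans (Real.sqrt_nonneg _) dl) e xl ((sq_le_sq₀ (by linarith) (by norm_num)).mp (by linarith))
    linarith

theorem kap_b {δ : ℝ} (hδ : 0.812541 ≤ δ) (hδ' : δ ≤ 0.812543) : 2 * kap δ ≤ -0.00153 := by
  have hl := lam_b hδ hδ'
  have hc := cc_b
  have p1 := Real.pi_gt_d4
  unfold kap
  have : (1 - cc - lam δ) * Real.pi ≤ (-0.001462) * Real.pi := mul_le_mul_of_nonneg_right (by linarith) (by linarith)
  linarith

theorem case_M {δ h d x y : ℝ} (hδ : 0.812541 ≤ δ) (hδ' : δ ≤ 0.812543) (h1 : rr ≤ h) (h2 : h ≤ vl 2018634629) (hd : 0.25 ≤ d) (hd2 : d ≤ vl 3650722201)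
    (cx : CX 0 false false h d x) (cy : CX 0 false false h d y) (hx : 0 < x) (hy : 0 < y)
    (hxy : 2 ≤ x + y) :
    pg cc (lam δ) (δ/2) h d x y + 2 * kap δ ≤ 2 * et δ := by
  have hr := rr_b
  have v : ∀ n : ℕ, vl n = n / 4294967296 := fun n => rfl
  have hl := lam_b hδ hδ'
  have hc := cc_b2
  have k := kap_b hδ hδ'
  have e := et_b hδ hδ'
  have := okM cc (δ/2) h d x y (by show cc ≤ 1 + vl 305233928; rw [v]; norm_num; linarith) (by show vl 1744918510 ≤ _; rw [v]; norm_num; linarith) 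
    (by rw [v]; norm_num; linarith) h2 (by rw [v]; norm_num; linarith) hd2 cx cy hxy
  have th : tkM.thr h ≤ 0.001373 := by
    show vl 5896601 - vl 0 + (vl 0 - vl 0) * h ≤ _
    rw [v, v]; norm_num
  have ll : lam δ ≤ vl tkM.lp - vl tkM.ln := by
    show _ ≤ vl 0 - vl 298946045
    rw [v, v]; norm_num; linarith
  have m1 := gg_mono_param (c := cc) (K := δ/2) (h := h) (d := d) (by linarith) (by linarith) hx le_rfl ll le_rfl
  have m2 := gg_mono_param (c := cc) (K := δ/2) (h := h) (d := d) (by linarith) (by linarith) hy le_rfl ll le_rfl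
  unfold pg
  linarith

theorem case_F {δ h d x y : ℝ} (hδ : 0.812541 ≤ δ) (hδ' : δ ≤ 0.812543) (h1 : rr ≤ h) (h2 : h ≤ vl 2018634629) (hd : vl 4209067950 ≤ d) (hd2 : d ≤ 2.0099)
    (cx : CX 0 false false h d x) (cy : CX 0 false false h d y) (hx : 0 < x) (hy : 0 < y)
    (hxy : 2 ≤ x + y) :
    pg cc (lam δ) (δ/2) h d x y + 2 * kap δ ≤ -0.008 := by
  have hr := rr_b
  have v : ∀ n : ℕ, vl n = n / 4294967296 := fun n => rfl
  have hl := lam_b hδ hδ'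
  have hc := cc_b2
  have k := kap_b hδ hδ'
  have := okF cc (δ/2) h d x y (by show cc ≤ 1 + vl 305233928; rw [v]; norm_num; linarith) (by show vl 1744918510 ≤ _; rw [v]; norm_num; linarith) 
    (by rw [v]; norm_num; linarith) h2 hd (by rw [v]; norm_num; linarith) cx cy hxy
  have th : tkF.thr h ≤ -0.008 := by
    show vl 0 - vl 36365877 + (vl 0 - vl 0) * h ≤ _
    rw [v, v]; norm_num
  have ll : lam δ ≤ vl tkF.lp - vl tkF.ln := by
    show _ ≤ vl 0 - vl 298946045
    rw [v, v]; norm_num; linarith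
  have d0 : 0 ≤ d := by rw [v] at hd; norm_num at hd; linarith
  have m1 := gg_mono_param (c := cc) (K := δ/2) (h := h) (d := d) (by linarith) d0 hx le_rfl ll le_rfl
  have m2 := gg_mono_param (c := cc) (K := δ/2) (h := h) (d := d) (by linarith) d0 hy le_rfl ll le_rfl
  unfold pg
  linarith

theorem case_big {δ h d x y : ℝ} (hδ : 0.812541 ≤ δ) (hδ' : δ ≤ 0.812543) (h1 : rr ≤ h) (h2 : h ≤ vl 2018634629) (hd : 0.25 ≤ d) (hd2 : d ≤ 2.0099)
    (cx : CX 0 false false h d x) (cy : CX 0 false false h d y) (hx : 0 < x) (hy : 0 < y)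
    (hxy : 2 ≤ x + y)
    (s1 : 2 ≤ h^2 + d^2 + x^2) (s2 : h^2 + d^2 + x^2 ≤ 5.0294373)
    (t1 : 2 ≤ h^2 + d^2 + y^2) (t2 : h^2 + d^2 + y^2 ≤ 5.0294373) :
    pg cc (lam δ) (δ/2) h d x y + 2 * kap δ ≤ 2 * et δ := by
  have v : ∀ n : ℕ, vl n = n / 4294967296 := fun n => rfl
  have e := et_b hδ hδ'
  rcases le_total d (vl 3650722201) with h3 | h3
  · exact case_M hδ hδ' h1 h2 hd h3 cx cy hx hy hxy
  · rcases le_total d (vl 4209067950) with h4 | h4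
    · rw [v] at h2 h3 h4
      norm_num at h2 h3 h4
      exact case_C hδ hδ' h1 (by linarith) (by linarith) (by linarith) hx hy hxy s1 s2 t1 t2
    · have := case_F hδ hδ' h1 h2 h4 hd2 cx cy hx hy hxy
      linarith

theorem small_at {h d x : ℝ} (h2 : h^2 ≤ 0.2209) (hd : 0 ≤ d) (hd2 : d ≤ 0.25) (hx : 0 < x) (s1 : 2 ≤ h^2 + d^2 + x^2) :
    Real.arctan (d/x) ≤ 0.191 := by
  have h1 : d / x ≤ 0.191 := by
    have : 1.3100 ≤ x := by
      refine (sq_le_sq₀ (by norm_num) hx.le).mp ?_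
      nlinarith
    rw [div_le_iff₀ hx]; linarith
  exact (at_self (by positivity)).trans h1

theorem two_small {δ h d1 x1 y1 d2 x2 y2 d3 x3 y3 : ℝ} (C : Cfg h d1 x1 y1 d2 x2 y2 d3 x3 y3)
    (h2 : h ≤ vl 2018634629) (p1 : 0 ≤ d1) (p2 : 0 ≤ d2) (p3 : 0 ≤ d3) (q1 : d1 ≤ 0.25) (q2 : d2 ≤ 0.25) : vl 4209067950 ≤ d3 := by
  have v : ∀ n : ℕ, vl n = n / 4294967296 := fun n => rfl
  by_contra hc
  push Not at hc
  rw [v] at h2 hc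
  norm_num at h2 hc
  have hp := C.hp
  have hh : h^2 ≤ 0.2209 := by nlinarith
  have hdd : d3^2 ≤ 0.9604 := by nlinarith
  have a1 := small_at hh p1 q1 (by linarith [C.x1p]) C.sB
  have a2 := small_at hh p1 q1 (by linarith [C.y1p] : 0 < y1) (by linarith [C.sC, C.rC])
  have a3 := small_at hh p2 q2 (by linarith [C.x2p]) C.sC
  have a4 := small_at hh p2 q2 (by linarith [C.y2p] : 0 < y2) (by linarith [C.sA, C.rA])
  have big : ∀ x, 0 < x → 2 ≤ h^2 + d3^2 + x^2 → Real.arctan (d3/x) ≤ 0.8273 := by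
    intro x hx hs
    have hx2 : 0.9048 ≤ x := by
      refine (sq_le_sq₀ (by norm_num) hx.le).mp ?_
      linarith
    have t : d3/x ≤ 1.0832 := by rw [div_le_iff₀ hx]; linarith
    have t2 : Real.arctan (d3/x) ≤ Real.arctan 1.0832 := Real.arctan_strictMono.monotone t
    have t3 : Real.arctan 1.0832 = Real.pi/4 + Real.arctan (0.0832/2.0832) := by
      rw [← Real.arctan_one, Real.arctan_add (by norm_num)]
      congr 1; norm_num
    have t4 := at_self (by norm_num : (0:ℝ) ≤ 0.0832/2.0832)
    have := Real.pi_lt_d4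
    norm_num at t4
    linarith
  have b1 := big x3 (by linarith [C.x3p]) C.sA
  have b2 := big y3 (by linarith [C.y3p]) (by linarith [C.sB, C.rB])
  have := C.at6
  have := Real.pi_gt_d4
  linarith

theorem in_lo {δ h d1 x1 y1 d2 x2 y2 d3 x3 y3 : ℝ} (C : Cfg h d1 x1 y1 d2 x2 y2 d3 x3 y3)
    (h0 : FF δ rr dt 1 1 dt 1 1 ds xs xs = 0) (h1 : rr ≤ h)
    (h2 : h ≤ vl 2018634629) (p1 : 0 ≤ d1) (p2 : 0 ≤ d2) (p3 : 0 ≤ d3) :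
    FF δ h d1 x1 y1 d2 x2 y2 d3 x3 y3 ≤ 0 := by
  obtain ⟨hδ, hδ'⟩ := delta_b h0
  have v : ∀ n : ℕ, vl n = n / 4294967296 := fun n => rfl
  have h2' : h ≤ 0.47 := by rw [v] at h2; norm_num at h2; linarith
  obtain ⟨c1, c2, c3, c4, c5, c6, u1, u2, u3⟩ := C.cx
  have e := et_b hδ hδ'
  have ee := et_es h0
  have T := FF_le (δ := δ) C (lam δ) 0 le_rfl (by linarith)
  have ek : (1 - 0) * δ / 2 = δ / 2 := by ring
  rw [ek] at T
  have kk : 6 * kap δ = Real.pi - cc * Real.pi - lam δ * Real.pi := by unfold kap; ring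
  have i1 : 0 < x1 := by linarith [C.x1p]
  have i2 : 0 < x2 := by linarith [C.x2p]
  have i3 : 0 < x3 := by linarith [C.x3p]
  have j1 : 0 < y1 := by linarith [C.y1p]
  have j2 : 0 < y2 := by linarith [C.y2p]
  have j3 : 0 < y3 := by linarith [C.y3p]
  have sA' : 2 ≤ h^2 + d2^2 + y2^2 := by linarith [C.sA, C.rA]
  have tA' : h^2 + d2^2 + y2^2 ≤ 5.0294373 := by linarith [C.tA, C.rA]
  have sB' : 2 ≤ h^2 + d3^2 + y3^2 := by linarith [C.sB, C.rB]
  have tB' : h^2 + d3^2 + y3^2 ≤ 5.0294373 := by linarith [C.tB, C.rB]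
  have sC' : 2 ≤ h^2 + d1^2 + y1^2 := by linarith [C.sC, C.rC]
  have tC' : h^2 + d1^2 + y1^2 ≤ 5.0294373 := by linarith [C.tC, C.rC]
  have B1 : 0.25 ≤ d1 → pg cc (lam δ) (δ/2) h d1 x1 y1 + 2 * kap δ ≤ 2 * et δ := fun hd => case_big hδ hδ' h1 h2 hd u1 c1 c2 i1 j1 C.L1 C.sB C.tB sC' tC'
  have B2 : 0.25 ≤ d2 → pg cc (lam δ) (δ/2) h d2 x2 y2 + 2 * kap δ ≤ 2 * et δ := fun hd => case_big hδ hδ' h1 h2 hd u2 c3 c4 i2 j2 C.L2 C.sC C.tC sA' tA'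
  have B3 : 0.25 ≤ d3 → pg cc (lam δ) (δ/2) h d3 x3 y3 + 2 * kap δ ≤ 2 * et δ := fun hd => case_big hδ hδ' h1 h2 hd u3 c5 c6 i3 j3 C.L3 C.sA C.tA sB' tB'
  have S1 : d1 ≤ 0.25 → pg cc (lam δ) (δ/2) h d1 x1 y1 + 2 * kap δ ≤ 2 * es δ := fun hd => by
    have a := case_S hδ hδ' h1 h2' p1 hd i1 C.sB C.tB
    have b := case_S hδ hδ' h1 h2' p1 hd j1 sC' tC'
    unfold pg; linarith
  have S2 : d2 ≤ 0.25 → pg cc (lam δ) (δ/2) h d2 x2 y2 + 2 * kap δ ≤ 2 * es δ := fun hd => by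
    have a := case_S hδ hδ' h1 h2' p2 hd i2 C.sC C.tC
    have b := case_S hδ hδ' h1 h2' p2 hd j2 sA' tA'
    unfold pg; linarith
  have S3 : d3 ≤ 0.25 → pg cc (lam δ) (δ/2) h d3 x3 y3 + 2 * kap δ ≤ 2 * es δ := fun hd => by
    have a := case_S hδ hδ' h1 h2' p3 hd i3 C.sA C.tA
    have b := case_S hδ hδ' h1 h2' p3 hd j3 sB' tB'
    unfold pg; linarith
  have F1 : vl 4209067950 ≤ d1 → _ := fun hd => case_F hδ hδ' h1 h2 hd u1 c1 c2 i1 j1 C.L1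
  have F2 : vl 4209067950 ≤ d2 → _ := fun hd => case_F hδ hδ' h1 h2 hd u2 c3 c4 i2 j2 C.L2
  have F3 : vl 4209067950 ≤ d3 → _ := fun hd => case_F hδ hδ' h1 h2 hd u3 c5 c6 i3 j3 C.L3
  have fin : ∀ a b c : ℝ, a = pg cc (lam δ) (δ/2) h d1 x1 y1 + 2 * kap δ → b = pg cc (lam δ) (δ/2) h d2 x2 y2 + 2 * kap δ
    → c = pg cc (lam δ) (δ/2) h d3 x3 y3 + 2 * kap δ → a + b + c ≤ 0 → FF δ h d1 x1 y1 d2 x2 y2 d3 x3 y3 ≤ 0 := by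
    intro a b c ha hb hc habc
    linarith
  refine fin _ _ _ rfl rfl rfl ?_
  generalize pg cc (lam δ) (δ/2) h d1 x1 y1 + 2 * kap δ = a at *
  generalize pg cc (lam δ) (δ/2) h d2 x2 y2 + 2 * kap δ = b at *
  generalize pg cc (lam δ) (δ/2) h d3 x3 y3 + 2 * kap δ = c at *
  clear fin T
  rcases le_total d1 0.25 with z1 | z1
  · have := S1 z1
    rcases le_total d2 0.25 with z2 | z2
    · have := S2 z2
      have := F3 (two_small (δ := 0) C h2 p1 p2 p3 z1 z2)
      linarith
    · have := B2 z2
      rcases le_total d3 0.25 with z3 | z3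
      · have := S3 z3
        have := F2 (two_small (δ := 0) C.rot.rot h2 p3 p1 p2 z3 z1)
        linarith
      · have := B3 z3
        linarith
  · have := B1 z1
    rcases le_total d2 0.25 with z2 | z2
    · have := S2 z2
      rcases le_total d3 0.25 with z3 | z3
      · have := S3 z3
        have := F1 (two_small (δ := 0) C.rot h2 p2 p3 p1 z2 z3)
        linarith
      · have := B3 z3
        linarith
    · have := B2 z2
      rcases le_total d3 0.25 with z3 | z3
      · have := S3 z3
        linarith
      · have := B3 z3
        linarith

/-- the analytic inequality, foot of the altitude inside the base -/
theorem in_all {δ h d1 x1 y1 d2 x2 y2 d3 x3 y3 : ℝ} (C : Cfg h d1 x1 y1 d2 x2 y2 d3 x3 y3)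
    (h0 : FF δ rr dt 1 1 dt 1 1 ds xs xs = 0) (h1 : rr ≤ h)
    (p1 : 0 ≤ d1) (p2 : 0 ≤ d2) (p3 : 0 ≤ d3) :
    FF δ h d1 x1 y1 d2 x2 y2 d3 x3 y3 ≤ 0 := by
  rcases le_total h (vl 2018634629) with h2 | h2
  · exact in_lo C h0 h1 h2 p1 p2 p3
  · exact in_hi C p1 p2 p3 (delta_b h0).1 h2

noncomputable def Len (p1 p2 q1 q2 : ℝ) : ℝ := √((p1 - q1)^2 + (p2 - q2)^2)
noncomputable def dE (p1 p2 q1 q2 : ℝ) : ℝ := (p1 * q2 - p2 * q1) / Len p1 p2 q1 q2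
noncomputable def xE (p1 p2 q1 q2 : ℝ) : ℝ := (p1 * (p1 - q1) + p2 * (p2 - q2)) / Len p1 p2 q1 q2

theorem Len_symm (p1 p2 q1 q2 : ℝ) : Len p1 p2 q1 q2 = Len q1 q2 p1 p2 := by
  unfold Len; congr 1; ring
theorem Len_sq (p1 p2 q1 q2 : ℝ) : Len p1 p2 q1 q2 ^ 2 = (p1 - q1)^2 + (p2 - q2)^2 := Real.sq_sqrt (by positivity)
theorem Len_pos {p1 p2 q1 q2 : ℝ} (h : 4 ≤ (p1 - q1)^2 + (p2 - q2)^2) : 2 ≤ Len p1 p2 q1 q2 :=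
  Real.le_sqrt_of_sq_le (by linarith)
theorem xE_add {p1 p2 q1 q2 : ℝ} (h : 4 ≤ (p1 - q1)^2 + (p2 - q2)^2) :
    xE p1 p2 q1 q2 + xE q1 q2 p1 p2 = Len p1 p2 q1 q2 := by
  have h1 := Len_pos h
  have h2 := Len_sq p1 p2 q1 q2
  unfold xE
  rw [Len_symm q1 q2 p1 p2]
  have : Len p1 p2 q1 q2 ≠ 0 := by linarith
  field_simp
  linarith
theorem dx_sq {p1 p2 q1 q2 : ℝ} (h : 4 ≤ (p1 - q1)^2 + (p2 - q2)^2) :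
    dE p1 p2 q1 q2 ^ 2 + xE p1 p2 q1 q2 ^ 2 = p1^2 + p2^2 := by
  have h1 := Len_pos h
  have h2 := Len_sq p1 p2 q1 q2
  unfold dE xE
  rw [div_pow, div_pow, h2]
  have : (p1 - q1)^2 + (p2 - q2)^2 ≠ 0 := by linarith
  field_simp
  ring
theorem dx_sq' {p1 p2 q1 q2 : ℝ} (h : 4 ≤ (p1 - q1)^2 + (p2 - q2)^2) :
    dE p1 p2 q1 q2 ^ 2 + xE q1 q2 p1 p2 ^ 2 = q1^2 + q2^2 := by
  have := dx_sq (p1 := q1) (p2 := q2) (q1 := p1) (q2 := p2) (by linarith [h, sq_nonneg (p1 - q1)] )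
  rw [← this]; unfold dE; rw [Len_symm q1 q2 p1 p2]; ring

/-- the lower bound on the abscissa -/
theorem x_alg {x m k R : ℝ} (hR : 0 < R) (hR' : R ≤ 0.414213563) (hm : 1 ≤ m) (hk : 2 ≤ k)
    (h : 0.28 * k ≤ (0.414213563 + R)^2 - (1+R)^2 + (1+R)^2/0.72 + 2*x*m - m^2/0.72 - 0.72*x^2) : 0.265 ≤ x := by
  by_contra hc
  push Not at hc
  have a1 : (0.414213563 + R)^2 ≤ 0.6863 + 0.0001 := by nlinarith
  have a2 : (1 + R)^2 ≤ 2.00001 := by nlinarith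
  have a3 : 0.8092^2 ≤ (m - 0.72*x)^2 := pow_le_pow_left₀ (by norm_num) (by linarith) 2
  have a4 : 2*x*m - m^2/0.72 - 0.72*x^2 = -(m - 0.72*x)^2/0.72 := by ring
  have a5 : (1+R)^2/0.72 - (1+R)^2 = (1+R)^2 * (0.28/0.72) := by ring
  have a6 : 0.28 * k ≤ (0.414213563 + R)^2 + (1+R)^2 * (0.28/0.72) + -(m - 0.72*x)^2/0.72 := by
    rw [← a4, ← a5]; linarith
  norm_num at a6 a3
  linarith

theorem cs2d (a b c d : ℝ) : 2 * (a * c + b * d) ≤ 0.72 * (a^2 + b^2) + (c^2 + d^2) / 0.72 := by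
  have h1 : 0 ≤ (0.72 * a - c)^2 := sq_nonneg _
  have h2 : 0 ≤ (0.72 * b - d)^2 := sq_nonneg _
  norm_num
  nlinarith

structure Conf (a1 a2 b1 b2 c1 c2 h o1 o2 o3 R : ℝ) : Prop where
  hp : 0 < h
  K : 0 < (a1*b2 - a2*b1) + (b1*c2 - b2*c1) + (c1*a2 - c2*a1)
  eab : 4 ≤ (a1-b1)^2 + (a2-b2)^2
  ebc : 4 ≤ (b1-c1)^2 + (b2-c2)^2
  eca : 4 ≤ (c1-a1)^2 + (c2-a2)^2
  sa : 2 ≤ a1^2 + a2^2 + h^2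
  sb : 2 ≤ b1^2 + b2^2 + h^2
  sc : 2 ≤ c1^2 + c2^2 + h^2
  oa : (a1-o1)^2 + (a2-o2)^2 + o3^2 = (1+R)^2
  ob : (b1-o1)^2 + (b2-o2)^2 + o3^2 = (1+R)^2
  oc : (c1-o1)^2 + (c2-o2)^2 + o3^2 = (1+R)^2
  od : o1^2 + o2^2 + (h-o3)^2 = (rr+R)^2
  R0 : 0 < R
  R1 : R ≤ rr

theorem Conf.rot {a1 a2 b1 b2 c1 c2 h o1 o2 o3 R : ℝ} (H : Conf a1 a2 b1 b2 c1 c2 h o1 o2 o3 R) :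
    Conf b1 b2 c1 c2 a1 a2 h o1 o2 o3 R :=
  ⟨H.hp, by linarith [H.K], H.ebc, H.eca, H.eab, H.sb, H.sc, H.sa, H.ob, H.oc, H.oa, H.od, H.R0, H.R1⟩

theorem R2 {R : ℝ} (h0 : 0 < R) (h1 : R ≤ rr) : (1+R)^2 ≤ 2 := by
  have h := rr_sq
  have := pow_le_pow_left₀ (by linarith) (add_le_add_right h1 1) 2
  linarith [show (1+rr)^2 = 1 + 2*rr+rr^2 by ring]
theorem R3 {R : ℝ} (h0 : 0 < R) (h1 : R ≤ rr) : 2 - 8*rr ≤ (rr+R)^2 - (1+R)^2 := by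
  have h := rr_sq
  have h2 := rr_b
  nlinarith
theorem edge_le {a1 a2 b1 b2 o1 o2 o3 R : ℝ} (oa : (a1-o1)^2 + (a2-o2)^2 + o3^2 = (1+R)^2)
    (ob : (b1-o1)^2 + (b2-o2)^2 + o3^2 = (1+R)^2) (h0 : 0 < R) (h1 : R ≤ rr) :
    (a1-b1)^2 + (a2-b2)^2 ≤ 8 := by
  have := R2 h0 h1
  linarith [sq_nonneg o3, sq_nonneg (a1 - o1 + (b1 - o1)), sq_nonneg (a2 - o2 + (b2 - o2)),
    show (a1-b1)^2 + (a2-b2)^2 + (a1 - o1 + (b1 - o1))^2 + (a2 - o2 + (b2 - o2))^2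
      = 2*((a1-o1)^2 + (a2-o2)^2) + 2*((b1-o1)^2 + (b2-o2)^2) by ring]
theorem tA_le {a1 a2 h o1 o2 o3 R : ℝ} (oa : (a1-o1)^2 + (a2-o2)^2 + o3^2 = (1+R)^2)
    (od : o1^2 + o2^2 + (h-o3)^2 = (rr+R)^2) (h0 : 0 < R) (h1 : R ≤ rr) :
    a1^2 + a2^2 + h^2 ≤ 5.0294373 := by
  have hr := rr_b
  set s := 1 + R with hs
  set t := rr + R with ht
  have s0 : 0 < s := by linarith
  have t0 : 0 < t := by linarith
  -- |u+v|² ≤ (s+t)²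
  have h2 : s * t * (a1^2 + a2^2 + h^2) ≤ s * t * (s + t)^2 := by
    have e : s * t * (s+t)^2 - s * t * (a1^2 + a2^2 + h^2)
      = (t*(a1-o1) - s*o1)^2 + (t*(a2-o2) - s*o2)^2 + (t*(-o3) - s*(o3-h))^2 := by
      linear_combination (-s*t - t^2) * oa + (-s*t - s^2)*od
    nlinarith [sq_nonneg (t*(a1-o1) - s*o1), sq_nonneg (t*(a2-o2) - s*o2), sq_nonneg (t*(-o3) - s*(o3-h))]
  have h3 := le_of_mul_le_mul_left h2 (by positivity)
  have h4 : s + t ≤ 2.24264069 := by linarith [hr.2]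
  have := pow_le_pow_left₀ (by linarith) h4 2
  norm_num at this
  linarith
theorem frame {p1 p2 q1 q2 : ℝ} (u1 u2 : ℝ) (h : 4 ≤ (p1 - q1)^2 + (p2 - q2)^2) :
    ∃ m n, m * Len p1 p2 q1 q2 = u1 * (q1-p1) + u2 * (q2-p2) ∧ m^2 + n^2 = u1^2+u2^2 ∧
      xE p1 p2 q1 q2 * m + dE p1 p2 q1 q2 * n = -(u1*p1 + u2*p2) := by
  have h1 := Len_pos h
  have h2 := Len_sq p1 p2 q1 q2
  have h3 : Len p1 p2 q1 q2 ≠ 0 := by linarith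
  refine ⟨(u1 * (q1-p1) + u2 * (q2-p2))/Len p1 p2 q1 q2, (u2*(q1-p1) - u1*(q2-p2))/Len p1 p2 q1 q2, by field_simp, ?_, ?_⟩
  · rw [div_pow, div_pow, h2]
    have : (p1 - q1)^2 + (p2 - q2)^2 ≠ 0 := by linarith
    field_simp; ring
  · unfold xE dE
    rw [div_mul_div_comm, div_mul_div_comm, ← sq, h2]
    have : (p1 - q1)^2 + (p2 - q2)^2 ≠ 0 := by linarith
    field_simp; ring
theorem frame2 {p1 p2 q1 q2 o1 o2 o3 R : ℝ} (h : 4 ≤ (p1 - q1)^2 + (p2 - q2)^2)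
    (oa : (p1-o1)^2 + (p2-o2)^2 + o3^2 = (1+R)^2) (ob : (q1-o1)^2 + (q2-o2)^2 + o3^2 = (1+R)^2) :
    ∃ n, (Len p1 p2 q1 q2/2)^2 + n^2 + o3^2 = (1+R)^2 ∧
      xE p1 p2 q1 q2 * (Len p1 p2 q1 q2/2) + dE p1 p2 q1 q2 * n = -((o1-p1)*p1 + (o2-p2)*p2) := by
  obtain ⟨m, n, h1, h2, h3⟩ := frame (o1-p1) (o2-p2) h
  have hl := Len_pos h
  have hl2 := Len_sq p1 p2 q1 q2
  have hm : m = Len p1 p2 q1 q2 / 2 := by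
    have : m * Len p1 p2 q1 q2 = (Len p1 p2 q1 q2 / 2) * Len p1 p2 q1 q2 := by
      rw [h1]; linear_combination (1/2) * oa - (1/2)*ob - (1/2)*hl2
    exact mul_right_cancel₀ (by linarith) this
  rw [hm] at h2 h3
  exact ⟨n, by linarith, h3⟩
theorem x_low {p1 p2 q1 q2 h o1 o2 o3 R : ℝ} (e : 4 ≤ (p1 - q1)^2 + (p2 - q2)^2)
    (oa : (p1-o1)^2 + (p2-o2)^2 + o3^2 = (1+R)^2) (ob : (q1-o1)^2 + (q2-o2)^2 + o3^2 = (1+R)^2)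
    (od : o1^2 + o2^2 + (h-o3)^2 = (rr+R)^2) (sa : 2 ≤ p1^2 + p2^2 + h^2)
    (h0 : 0 < R) (h1 : R ≤ rr) : 0.265 ≤ xE p1 p2 q1 q2 := by
  obtain ⟨n, hn, hx⟩ := frame2 e oa ob
  have hr := rr_b
  have hl := Len_pos e
  have hd := dx_sq e
  have hc := cs2d (dE p1 p2 q1 q2) h n o3
  refine x_alg (m := Len p1 p2 q1 q2 / 2) (k := p1^2+p2^2+h^2) h0 (by linarith [hr.2]) (by linarith) sa ?_
  have h5 : (rr+R)^2 ≤ (0.414213563 + R)^2 := pow_le_pow_left₀ (by linarith [hr.1]) (by linarith [hr.2]) 2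
  rw [show n^2+o3^2 = (1+R)^2 - (Len p1 p2 q1 q2/2)^2 by linarith,
    show dE p1 p2 q1 q2^2 + h^2 = p1^2+p2^2+h^2 - xE p1 p2 q1 q2^2 by linarith, sub_div] at hc
  linarith
theorem w_low {p1 p2 q1 q2 h o1 o2 o3 R : ℝ} (e : 4 ≤ (p1 - q1)^2 + (p2 - q2)^2)
    (oa : (p1-o1)^2 + (p2-o2)^2 + o3^2 = (1+R)^2) (ob : (q1-o1)^2 + (q2-o2)^2 + o3^2 = (1+R)^2)
    (od : o1^2 + o2^2 + (h-o3)^2 = (rr+R)^2) (sa : 2 ≤ p1^2 + p2^2 + h^2) (sb : 2 ≤ q1^2 + q2^2 + h^2)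
    (h0 : 0 < R) (h1 : R ≤ rr) : rr^2 ≤ h^2 + dE p1 p2 q1 q2^2 := by
  by_contra hcon
  push Not at hcon
  have hx := x_low e oa ob od sa h0 h1
  have hy := x_low (by linarith [e]) ob oa od sb h0 h1 (p1 := q1) (p2 := q2) (q1 := p1) (q2 := p2)
  obtain ⟨n, hn, hv⟩ := frame2 e oa ob
  have hxy := xE_add e
  have hd := dx_sq e
  have hd' := dx_sq' e
  have r2 := R2 h0 h1
  have r3 := R3 h0 h1
  have rs := rr_sq
  have rb := rr_b
  generalize xE p1 p2 q1 q2 = x at *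
  generalize xE q1 q2 p1 p2 = y at *
  generalize dE p1 p2 q1 q2 = d at *
  generalize Len p1 p2 q1 q2 = L at *
  have hm : 2 - (h^2+d^2) ≤ x * y := by
    refine (sq_le_sq₀ (by linarith [rb.1]) (by positivity)).mp ?_
    have z : 0 ≤ 2 - (h^2+d^2) := by linarith [rb.1]
    calc (2 - (h^2+d^2))^2 = (2 - (h^2+d^2)) * (2 - (h^2+d^2)) := by ring
      _ ≤ x^2 * y^2 := mul_le_mul (by linarith) (by linarith) z (by positivity)
      _ = (x*y)^2 := by ring
  have hL : x * y ≤ (L/2)^2 := by rw [← hxy]; linarith [sq_nonneg (x-y), show ((x+y)/2)^2 - x*y = (x-y)^2/4 by ring]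
  have c1 : -(2*(d*n + h*o3)) ≤ d^2 + n^2 + h^2 + o3^2 := by
    linarith [sq_nonneg (d+n), sq_nonneg (h+o3), show (d+n)^2 = d^2+2*(d*n)+n^2 by ring, show (h+o3)^2 = h^2+2*(h*o3)+o3^2 by ring]
  have key : (rr+R)^2 = (L/2)^2 - x*y + d^2 + h^2 - 2*(d*n+h*o3) + (n^2+o3^2) := by
    rw [← hxy] at hv ⊢
    rw [← hxy] at hn
    linear_combination (-1)*od + oa - hn + 2*hv + (-1) * hd
  linarith
theorem Conf.h_low {a1 a2 b1 b2 c1 c2 h o1 o2 o3 R : ℝ} (H : Conf a1 a2 b1 b2 c1 c2 h o1 o2 o3 R)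
    (p1 : 0 ≤ b1*c2-b2*c1) (p2 : 0 ≤ c1*a2-c2*a1) (p3 : 0 ≤ a1*b2-a2*b1) : rr ≤ h := by
  obtain ⟨hp, K, -, -, -, sa, sb, sc, oa, ob, oc, od, h0, h1⟩ := H
  have r2 := R2 h0 h1
  have r3 := R3 h0 h1
  have rs := rr_sq
  have rb := rr_b
  have e : (b1*c2-b2*c1) * (a1^2+a2^2+h^2) + (c1*a2-c2*a1)*(b1^2+b2^2+h^2) + (a1*b2-a2*b1)*(c1^2+c2^2+h^2)
     = ((a1*b2 - a2*b1) + (b1*c2 - b2*c1) + (c1*a2 - c2*a1)) * ((1+R)^2 - o3^2 - (o1^2+o2^2) + h^2) := by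
    linear_combination (b1*c2-b2*c1) * oa + (c1*a2-c2*a1) * ob + (a1*b2-a2*b1) * oc
  have f1 := mul_le_mul_of_nonneg_left sa p1
  have f2 := mul_le_mul_of_nonneg_left sb p2
  have f3 := mul_le_mul_of_nonneg_left sc p3
  have g : 2 ≤ (1+R)^2 - o3^2 - (o1^2+o2^2) + h^2 := by
    refine le_of_mul_le_mul_left (a := (a1*b2 - a2*b1) + (b1*c2 - b2*c1) + (c1*a2 - c2*a1)) ?_ K
    rw [← e]; linarith
  have : rr^2 ≤ h^2 := by
    linarith [sq_nonneg (h + o3), sq_nonneg o1, sq_nonneg o2, show (h+o3)^2 + (h-o3)^2 = 2*h^2+2*o3^2 by ring]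
  exact (sq_le_sq₀ (by linarith [rb.1]) hp.le).mp this
theorem two_K {p q r : ℝ} (p4 : 4 ≤ p) (p8 : p ≤ 8) (q4 : 4 ≤ q) (q8 : q ≤ 8) (r4 : 4 ≤ r) (r8 : r ≤ 8) :
    48 ≤ 4*q*r - (q+r-p)^2 := by
  obtain ⟨x, rfl⟩ : ∃ x, p = 4 + x := ⟨p-4, by ring⟩
  obtain ⟨y, rfl⟩ : ∃ x, q = 4 + x := ⟨q-4, by ring⟩
  obtain ⟨z, rfl⟩ : ∃ x, r = 4 + x := ⟨r-4, by ring⟩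
  have hx : 0 ≤ x := by linarith
  have hy : 0 ≤ y := by linarith
  have hz : 0 ≤ z := by linarith
  have g1 := mul_nonneg hx hy
  have g2 := mul_nonneg hy hz
  have g3 := mul_nonneg hx hz
  have k1 : 0 ≤ x * (4 - x) := mul_nonneg hx (by linarith)
  have k2 : 0 ≤ y * (4 - y) := mul_nonneg hy (by linarith)
  have k3 : 0 ≤ z * (4 - z) := mul_nonneg hz (by linarith)
  linarith [show 4*(4+y)*(4+z) - (4+y+(4+z)-(4+x))^2 = 48 + 4*x+4*y+4*z + 2*(x*y)+2*(y*z)+2*(x*z) + x*(4-x)+y*(4-y)+z*(4-z) by ring]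
theorem Conf.K2 {a1 a2 b1 b2 c1 c2 h o1 o2 o3 R : ℝ} (H : Conf a1 a2 b1 b2 c1 c2 h o1 o2 o3 R) :
    2*√3 ≤ (a1*b2 - a2*b1) + (b1*c2 - b2*c1) + (c1*a2 - c2*a1) := by
  refine (sq_le_sq₀ (by positivity) H.K.le).mp ?_
  rw [mul_pow, Real.sq_sqrt (by norm_num)]
  have := two_K H.eab (edge_le H.oa H.ob H.R0 H.R1) H.ebc (edge_le H.ob H.oc H.R0 H.R1) H.eca (edge_le H.oc H.oa H.R0 H.R1)
  linarith [show 4*((b1-c1)^2 + (b2-c2)^2)*((c1-a1)^2 + (c2-a2)^2) - ((b1-c1)^2 + (b2-c2)^2 + ((c1-a1)^2 + (c2-a2)^2) - ((a1-b1)^2 + (a2-b2)^2))^2 = 4 * ((a1*b2 - a2*b1) + (b1*c2 - b2*c1) + (c1*a2 - c2*a1))^2 by ring]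
theorem Conf.nob {a1 a2 b1 b2 c1 c2 h o1 o2 o3 R : ℝ} (H : Conf a1 a2 b1 b2 c1 c2 h o1 o2 o3 R) :
    0 ≤ (a1-b1)*(a1-c1) + (a2-b2)*(a2-c2) := by
  have := edge_le H.ob H.oc H.R0 H.R1
  linarith [H.eab, H.eca, show (b1-c1)^2+(b2-c2)^2 + 2*((a1-b1)*(a1-c1) + (a2-b2)*(a2-c2)) = ((a1-b1)^2 + (a2-b2)^2) + ((c1-a1)^2 + (c2-a2)^2) by ring]

theorem at_sum {x d y e m : ℝ} (hx : 0 < x) (hy : 0 < y) (h1 : d^2+x^2 = m) (h2 : e^2+y^2=m)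
    (hs : 0 < d*y+e*x) : Real.arctan (d/x) + Real.arctan (e/y) = Real.arccos ((x*y-d*e)/m) := by
  have hm : 0 < m := by rw [← h1]; positivity
  have s1 : ∀ {d x : ℝ}, 0 < x → d^2+x^2=m → √(1+(d/x)^2) = √m/x := by
    intro d x hx h
    rw [← Real.sqrt_sq hx.le, ← Real.sqrt_div' _ (sq_nonneg x), Real.sqrt_sq hx.le, ← h]
    congr 1; field_simp; ring
  have hq : √m * √m = m := Real.mul_self_sqrt hm.le
  have hq0 : √m ≠ 0 := (Real.sqrt_pos.mpr hm).ne'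
  have hc : Real.cos (Real.arctan (d/x) + Real.arctan (e/y)) = (x*y-d*e)/m := by
    rw [Real.cos_add, Real.cos_arctan, Real.cos_arctan, Real.sin_arctan, Real.sin_arctan, s1 hx h1, s1 hy h2]
    clear hs h1 h2
    generalize √m = Q at *
    subst hq; field_simp
  have hsn : 0 < Real.sin (Real.arctan (d/x) + Real.arctan (e/y)) := by
    have : Real.sin (Real.arctan (d/x) + Real.arctan (e/y)) = (d*y+e*x)/m := by
      rw [Real.sin_add, Real.cos_arctan, Real.cos_arctan, Real.sin_arctan, Real.sin_arctan, s1 hx h1, s1 hy h2]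
      clear hs h1 h2
      generalize √m = Q at *
      subst hq; field_simp
    rw [this]; positivity
  have b1 := Real.arctan_lt_pi_div_two (d/x)
  have b2 := Real.arctan_lt_pi_div_two (e/y)
  have b3 := Real.neg_pi_div_two_lt_arctan (d/x)
  have b4 := Real.neg_pi_div_two_lt_arctan (e/y)
  have hpos : 0 ≤ Real.arctan (d/x) + Real.arctan (e/y) := by
    by_contra hc
    push Not at hc
    linarith [Real.sin_neg_of_neg_of_neg_pi_lt hc (by linarith)]
  rw [← hc, Real.arccos_cos hpos (by linarith)]
theorem dE_L {p1 p2 q1 q2 : ℝ} (h : 4 ≤ (p1 - q1)^2 + (p2 - q2)^2) :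
    dE p1 p2 q1 q2 * Len p1 p2 q1 q2 = p1*q2-p2*q1 := by
  have := Len_pos h
  unfold dE; field_simp
theorem vtx {a1 a2 b1 b2 c1 c2 : ℝ} (e1 : 4 ≤ (a1-b1)^2+(a2-b2)^2) (e2 : 4 ≤ (c1-a1)^2+(c2-a2)^2) :
    xE a1 a2 b1 b2 * xE a1 a2 c1 c2 - dE a1 a2 b1 b2 * dE c1 c2 a1 a2 =
      (a1^2+a2^2) * (((a1-b1)*(a1-c1)+(a2-b2)*(a2-c2)) / (Len a1 a2 b1 b2 * Len c1 c2 a1 a2)) ∧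
    dE a1 a2 b1 b2 * xE a1 a2 c1 c2 + dE c1 c2 a1 a2 * xE a1 a2 b1 b2 =
      (a1^2+a2^2) * (((a1*b2 - a2*b1) + (b1*c2 - b2*c1) + (c1*a2 - c2*a1)) / (Len a1 a2 b1 b2 * Len c1 c2 a1 a2)) := by
  have h1 := Len_pos e1
  have h2 := Len_pos e2
  unfold xE dE
  rw [Len_symm a1 a2 c1 c2]
  constructor <;> (field_simp; ring)
theorem ang_sum {a1 a2 b1 b2 c1 c2 : ℝ} (e1 : 4 ≤ (a1-b1)^2+(a2-b2)^2) :
    Real.arccos (((a1-b1)*(a1-c1)+(a2-b2)*(a2-c2)) / (Len a1 a2 b1 b2 * Len c1 c2 a1 a2)) +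
    Real.arccos (((b1-c1)*(b1-a1)+(b2-c2)*(b2-a2)) / (Len b1 b2 c1 c2 * Len a1 a2 b1 b2)) +
    Real.arccos (((c1-a1)*(c1-b1)+(c2-a2)*(c2-b2)) / (Len c1 c2 a1 a2 * Len b1 b2 c1 c2)) = Real.pi := by
  have key : ∀ p1 p2 q1 q2 s1 s2 : ℝ, EuclideanGeometry.angle (!₂[p1,p2] : EuclideanSpace ℝ (Fin 2)) !₂[q1,q2] !₂[s1,s2]
     = Real.arccos (((q1-p1)*(q1-s1)+(q2-p2)*(q2-s2)) / (Len q1 q2 p1 p2 * Len s1 s2 q1 q2)) := by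
    intro p1 p2 q1 q2 s1 s2
    unfold EuclideanGeometry.angle InnerProductGeometry.angle Len
    simp only [vsub_eq_sub, EuclideanSpace.norm_eq, Fin.sum_univ_two, PiLp.inner_apply, PiLp.sub_apply]
    simp
    congr 1
    have : (p1-q1)^2 + (p2-q2)^2 = (q1-p1)^2+(q2-p2)^2 := by ring
    rw [this]
    congr 1; ring
  have hne : (!₂[a1,a2] : EuclideanSpace ℝ (Fin 2)) ≠ !₂[b1,b2] := by
    intro h
    have h0 := congrArg (fun v => v 0) h
    have h1 := congrArg (fun v => v 1) h
    simp at h0 h1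
    rw [h0, h1] at e1; norm_num at e1
  have := EuclideanGeometry.angle_add_angle_add_angle_eq_pi (!₂[c1,c2] : EuclideanSpace ℝ (Fin 2)) hne
  rw [key, key, key] at this
  linarith

theorem Conf.cfg {a1 a2 b1 b2 c1 c2 h o1 o2 o3 R : ℝ} (H : Conf a1 a2 b1 b2 c1 c2 h o1 o2 o3 R) :
    Cfg h (dE b1 b2 c1 c2) (xE b1 b2 c1 c2) (xE c1 c2 b1 b2) (dE c1 c2 a1 a2) (xE c1 c2 a1 a2) (xE a1 a2 c1 c2)
      (dE a1 a2 b1 b2) (xE a1 a2 b1 b2) (xE b1 b2 a1 a2) := by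
  have lm : ∀ {p1 p2 q1 q2 : ℝ}, (p1 - q1)^2 + (p2 - q2)^2 ≤ 8 → Len p1 p2 q1 q2 ≤ 2.82844 := by
    intro p1 p2 q1 q2 h
    refine (sq_le_sq₀ (Real.sqrt_nonneg _) (by norm_num)).mp ?_
    have e := Len_sq p1 p2 q1 q2
    unfold Len at e; rw [e]; norm_num; linarith
  have sy : ∀ {p1 p2 q1 q2 : ℝ}, 4 ≤ (p1 - q1)^2 + (p2 - q2)^2 → 4 ≤ (q1 - p1)^2 + (q2 - p2)^2 := by
    intro p1 p2 q1 q2 h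
    linarith
  have X1 := x_low H.ebc H.ob H.oc H.od H.sb H.R0 H.R1
  have Y1 := x_low (sy H.ebc) H.oc H.ob H.od H.sc H.R0 H.R1
  have X2 := x_low H.eca H.oc H.oa H.od H.sc H.R0 H.R1
  have Y2 := x_low (sy H.eca) H.oa H.oc H.od H.sa H.R0 H.R1
  have X3 := x_low H.eab H.oa H.ob H.od H.sa H.R0 H.R1
  have Y3 := x_low (sy H.eab) H.ob H.oa H.od H.sb H.R0 H.R1
  have D1 := dx_sq H.ebc
  have D1' := dx_sq' H.ebc
  have D2 := dx_sq H.eca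
  have D2' := dx_sq' H.eca
  have D3 := dx_sq H.eab
  have D3' := dx_sq' H.eab
  have S1 := xE_add H.ebc
  have S2 := xE_add H.eca
  have S3 := xE_add H.eab
  have l1 := Len_pos H.ebc
  have l2 := Len_pos H.eca
  have l3 := Len_pos H.eab
  obtain ⟨vA, wA⟩ := vtx H.eab H.eca
  obtain ⟨vB, wB⟩ := vtx H.ebc H.eab
  obtain ⟨vC, wC⟩ := vtx H.eca H.ebc
  have K := H.K
  have mA : 0 < a1^2+a2^2 := by rw [← D3]; positivity
  have mB : 0 < b1^2+b2^2 := by rw [← D1]; positivity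
  have mC : 0 < c1^2+c2^2 := by rw [← D2]; positivity
  refine ⟨H.hp, ?_, ?_, by linarith, by linarith, by linarith, by linarith [H.sa], by linarith [H.sb], by linarith [H.sc],
    by linarith [tA_le H.oa H.od H.R0 H.R1], by linarith [tA_le H.ob H.od H.R0 H.R1], by linarith [tA_le H.oc H.od H.R0 H.R1],
    X1, X2, X3, Y1, Y2, Y3, by linarith, by linarith, by linarith,
    by rw [S1]; exact lm (edge_le H.ob H.oc H.R0 H.R1), by rw [S2]; exact lm (edge_le H.oc H.oa H.R0 H.R1),
    by rw [S3]; exact lm (edge_le H.oa H.ob H.R0 H.R1), ?_, ?_, ?_⟩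
  · have A := at_sum (m := a1^2+a2^2) (by linarith) (by linarith) D3 D2' (by rw [wA]; positivity)
    have B := at_sum (m := b1^2+b2^2) (by linarith) (by linarith) D1 D3' (by rw [wB]; have := H.rot.K; positivity)
    have C := at_sum (m := c1^2+c2^2) (by linarith) (by linarith) D2 D1' (by rw [wC]; have := H.rot.rot.K; positivity)
    rw [vA, mul_div_cancel_left₀ _ mA.ne'] at A
    rw [vB, mul_div_cancel_left₀ _ mB.ne'] at B
    rw [vC, mul_div_cancel_left₀ _ mC.ne'] at C
    have := ang_sum (c1 := c1) (c2 := c2) H.eab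
    linarith
  · rw [S1, S2, S3, dE_L H.ebc, dE_L H.eca, dE_L H.eab]
    linarith [H.K2]
  · have : 0 ≤ xE a1 a2 b1 b2 * xE a1 a2 c1 c2 - dE a1 a2 b1 b2 * dE c1 c2 a1 a2 := by
      rw [vA]; have := H.nob; positivity
    linarith
  · have : 0 ≤ xE b1 b2 c1 c2 * xE b1 b2 a1 a2 - dE b1 b2 c1 c2 * dE a1 a2 b1 b2 := by
      rw [vB]; have := H.rot.nob; positivity
    linarith
  · have : 0 ≤ xE c1 c2 a1 a2 * xE c1 c2 b1 b2 - dE c1 c2 a1 a2 * dE b1 b2 c1 c2 := by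
      rw [vC]; have := H.rot.rot.nob; positivity
    linarith
theorem Conf.out {δ a1 a2 b1 b2 c1 c2 h o1 o2 o3 R : ℝ} (H : Conf a1 a2 b1 b2 c1 c2 h o1 o2 o3 R)
    (hδ : 0.812541 ≤ δ) (hδ' : δ ≤ 0.812543) (p3 : dE a1 a2 b1 b2 ≤ 0) :
    FF δ h (dE b1 b2 c1 c2) (xE b1 b2 c1 c2) (xE c1 c2 b1 b2) (dE c1 c2 a1 a2) (xE c1 c2 a1 a2) (xE a1 a2 c1 c2)
      (dE a1 a2 b1 b2) (xE a1 a2 b1 b2) (xE b1 b2 a1 a2) ≤ 0 := by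
  have C := H.cfg
  have rb := rr_b
  have w1 := w_low H.ebc H.ob H.oc H.od H.sb H.sc H.R0 H.R1
  have w2 := w_low H.eca H.oc H.oa H.od H.sc H.sa H.R0 H.R1
  have w3 := w_low H.eab H.oa H.ob H.od H.sa H.sb H.R0 H.R1
  have rs : 0.1715728 ≤ rr^2 := by rw [rr_sq]; linarith [rb.2]
  have l1 := Len_pos H.ebc
  have l2 := Len_pos H.eca
  have l3 := Len_pos H.eab
  obtain ⟨-, wA⟩ := vtx H.eab H.eca
  obtain ⟨-, wB⟩ := vtx H.ebc H.eab
  have K := H.K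
  have K' := H.rot.K
  have ra : 0 ≤ dE a1 a2 b1 b2 * xE a1 a2 c1 c2 + dE c1 c2 a1 a2 * xE a1 a2 b1 b2 := by rw [wA]; positivity
  have rb' : 0 ≤ dE b1 b2 c1 c2 * xE b1 b2 a1 a2 + dE a1 a2 b1 b2 * xE b1 b2 c1 c2 := by rw [wB]; positivity
  have eA := dE_L H.eab
  have lsq := Len_sq a1 a2 b1 b2
  have R4 : o1^2+o2^2 + (h-o3)^2 ≤ (0.82845)^2 := by
    rw [H.od]; exact pow_le_pow_left₀ (by linarith [H.R0, rb.1]) (by linarith [H.R1, rb.2]) 2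
  have r2 := R2 H.R0 H.R1
  refine out_all C ?_ ?_ p3 ?_ (by linarith) (by linarith) (by linarith) ?_ hδ hδ' ?_
  · have := C.x1p; have := C.y3p
    by_contra hc; push Not at hc
    have u1 := mul_neg_of_neg_of_pos hc (show 0 < xE b1 b2 a1 a2 by linarith)
    have u2 := mul_nonpos_of_nonpos_of_nonneg p3 (show 0 ≤ xE b1 b2 c1 c2 by linarith)
    linarith
  · have := C.y2p; have := C.x3p
    by_contra hc; push Not at hc
    have u1 := mul_neg_of_neg_of_pos hc (show 0 < xE a1 a2 b1 b2 by linarith)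
    have u2 := mul_nonpos_of_nonpos_of_nonneg p3 (show 0 ≤ xE a1 a2 c1 c2 by linarith)
    linarith
  · have nob := H.rot.rot.nob
    have hf : 0 ≤ (a1-o1)*(b2-o2) - (a2-o2)*(b1-o1) := by
      have id : ((a1*b2 - a2*b1) + (b1*c2 - b2*c1) + (c1*a2 - c2*a1)) * ((a1-o1)*(b2-o2) - (a2-o2)*(b1-o1))
          = ((c1-a1)*(c1-b1) + (c2-a2)*(c2-b2)) * ((a1-b1)^2+(a2-b2)^2)/2 := by
        have hu : (o1-c1)*(a1-c1)+(o2-c2)*(a2-c2) - ((a1-c1)^2+(a2-c2)^2)/2 = 0 := by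
          linear_combination (-1/2)*H.oa + (1/2)*H.oc
        have hv : (o1-c1)*(b1-c1)+(o2-c2)*(b2-c2) - ((b1-c1)^2+(b2-c2)^2)/2 = 0 := by
          linear_combination (-1/2)*H.ob + (1/2)*H.oc
        linear_combination ((a1-c1)*(b1-c1)+(a2-c2)*(b2-c2) - ((b1-c1)^2+(b2-c2)^2)) * hu
          + ((a1-c1)*(b1-c1)+(a2-c2)*(b2-c2) - ((a1-c1)^2+(a2-c2)^2)) * hv
      have : 0 ≤ ((a1*b2 - a2*b1) + (b1*c2 - b2*c1) + (c1*a2 - c2*a1)) * ((a1-o1)*(b2-o2) - (a2-o2)*(b1-o1)) := by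
        rw [id]; have := H.eab; positivity
      exact nonneg_of_mul_nonneg_right this K
    have e0 : 0 ≤ -(a1*b2-a2*b1) := by
      rw [← eA]; exact neg_nonneg.mpr (mul_nonpos_of_nonpos_of_nonneg p3 (by linarith))
    have sq1 : (-(a1*b2-a2*b1))^2 ≤ ((a1-o1)*(b2-o2) - (a2-o2)*(b1-o1) - (a1*b2-a2*b1))^2 :=
      pow_le_pow_left₀ e0 (by linarith) 2
    have sq2 : ((a1-o1)*(b2-o2) - (a2-o2)*(b1-o1) - (a1*b2-a2*b1))^2 ≤ (o1^2+o2^2) * Len a1 a2 b1 b2^2 := by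
      rw [lsq]
      linarith [sq_nonneg (o1*(a1-b1)+o2*(a2-b2)), show (o1^2+o2^2) * ((a1-b1)^2+(a2-b2)^2) - ((a1-o1)*(b2-o2) - (a2-o2)*(b1-o1) - (a1*b2-a2*b1))^2 = (o1*(a1-b1)+o2*(a2-b2))^2 by ring]
    rw [← eA] at sq1
    have sq3 : dE a1 a2 b1 b2^2 ≤ o1^2+o2^2 := by
      refine le_of_mul_le_mul_right (a := Len a1 a2 b1 b2^2) ?_ (by positivity)
      calc _ = (-(dE a1 a2 b1 b2 * Len a1 a2 b1 b2))^2 := by ring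
        _ ≤ _ := sq1
        _ ≤ _ := by rw [eA]; exact sq2
    refine (sq_le_sq₀ (by linarith) (by norm_num)).mp ?_
    rw [neg_sq]
    norm_num at R4 ⊢
    linarith [sq_nonneg (h-o3)]
  · rw [dx_sq H.eca]
    have e8 := edge_le H.oa H.ob H.R0 H.R1
    have k2 := H.K2
    have s3 : (2*√3)^2 = 12 := by rw [mul_pow, Real.sq_sqrt (by norm_num)]; norm_num
    have e0 : 0 ≤ -(a1*b2-a2*b1) := by
      rw [← eA]; exact neg_nonneg.mpr (mul_nonpos_of_nonpos_of_nonneg p3 (by linarith))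
    have := pow_le_pow_left₀ (by positivity) (show 2*√3 ≤ (b1*c2 - b2*c1) + (c1*a2 - c2*a1) by linarith) 2
    rw [s3] at this
    have cs : ((b1*c2 - b2*c1) + (c1*a2 - c2*a1))^2 ≤ (c1^2+c2^2) * ((a1-b1)^2+(a2-b2)^2) := by
      linarith [sq_nonneg (c1*(a1-b1)+c2*(a2-b2)), show (c1^2+c2^2) * ((a1-b1)^2+(a2-b2)^2) - ((b1*c2 - b2*c1) + (c1*a2 - c2*a1))^2 = (c1*(a1-b1)+c2*(a2-b2))^2 by ring]
    have := mul_le_mul_of_nonneg_left e8 (by positivity : 0 ≤ c1^2+c2^2)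
    linarith
  · have N : 12 ≤ 9 * ((1+R)^2 - o3^2) := by
      have := H.eab; have := H.ebc; have := H.eca
      linarith [sq_nonneg ((a1-o1)+(b1-o1)+(c1-o1)), sq_nonneg ((a2-o2)+(b2-o2)+(c2-o2)), H.oa, H.ob, H.oc,
        show (a1-b1)^2 + (a2-b2)^2 + ((b1-c1)^2 + (b2-c2)^2) + ((c1-a1)^2 + (c2-a2)^2) + ((a1-o1)+(b1-o1)+(c1-o1))^2 + ((a2-o2)+(b2-o2)+(c2-o2))^2
         = 3 * ((a1-o1)^2 + (a2-o2)^2) + 3 * ((b1-o1)^2 + (b2-o2)^2) + 3 * ((c1-o1)^2 + (c2-o2)^2) by ring]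
    have o3b : o3 ≤ 0.8166 := by
      refine le_trans (le_abs_self _) (abs_le_of_sq_le_sq ?_ (by norm_num))
      norm_num; linarith
    have : h - o3 ≤ 0.82845 := by
      refine le_trans (le_abs_self _) (abs_le_of_sq_le_sq ?_ (by norm_num))
      linarith [sq_nonneg o1, sq_nonneg o2]
    linarith
theorem Conf.final {δ a1 a2 b1 b2 c1 c2 h o1 o2 o3 R : ℝ} (H : Conf a1 a2 b1 b2 c1 c2 h o1 o2 o3 R)
    (h0 : FF δ rr dt 1 1 dt 1 1 ds xs xs = 0) :
    FF δ h (dE b1 b2 c1 c2) (xE b1 b2 c1 c2) (xE c1 c2 b1 b2) (dE c1 c2 a1 a2) (xE c1 c2 a1 a2) (xE a1 a2 c1 c2)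
      (dE a1 a2 b1 b2) (xE a1 a2 b1 b2) (xE b1 b2 a1 a2) ≤ 0 := by
  obtain ⟨q1, q2⟩ := delta_b h0
  rcases le_total (dE a1 a2 b1 b2) 0 with p3 | p3
  · exact H.out q1 q2 p3
  rcases le_total (dE b1 b2 c1 c2) 0 with p1 | p1
  · have := H.rot.out q1 q2 p1
    rwa [FF_rot, FF_rot] at this
  rcases le_total (dE c1 c2 a1 a2) 0 with p2 | p2
  · have := H.rot.rot.out q1 q2 p2
    rwa [FF_rot] at this
  have l1 := Len_pos H.ebc
  have l2 := Len_pos H.eca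
  have l3 := Len_pos H.eab
  refine in_all H.cfg h0 (H.h_low ?_ ?_ ?_) p1 p2 p3
  · rw [← dE_L H.ebc]; positivity
  · rw [← dE_L H.eca]; positivity
  · rw [← dE_L H.eab]; positivity

abbrev E3 := EuclideanSpace ℝ (Fin 3)

theorem mpPhi : MeasurePreserving (fun y : E3 => (y 2, (y 0, y 1))) volume volume := by
  have m1 := PiLp.volume_preserving_ofLp (Fin 3)
  have m2 := volume_preserving_piFinSuccAbove (fun _ : Fin 3 => ℝ) 2
  have m3 := (MeasurePreserving.id (volume : Measure ℝ)).prod (volume_preserving_finTwoArrow ℝ)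
  exact (m3.comp (m2.comp m1))

noncomputable def GG (s : ℝ) : ENNReal := volume {z : ℝ | z^2 + s ≤ 1}
noncomputable def JJ : ENNReal := ∫⁻ ρ in Set.Ioi (0:ℝ), ENNReal.ofReal ρ * GG (ρ^2)

theorem lune_gen (S : Set (ℝ × ℝ)) (hS : MeasurableSet S) (T : Set ℝ) (hT : MeasurableSet T)
    (h : ∀ ρ θ : ℝ, 0 < ρ → θ ∈ Set.Ioo (-Real.pi) Real.pi → ((ρ * Real.cos θ, ρ * Real.sin θ) ∈ S ↔ θ ∈ T)) :
    volume {y : E3 | (y 0)^2 + (y 1)^2 + (y 2)^2 ≤ 1 ∧ (y 0, y 1) ∈ S} = JJ * volume (T ∩ Set.Ioo (-Real.pi) Real.pi) := by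
  have hU : MeasurableSet {q : ℝ × (ℝ × ℝ) | q.1^2 + (q.2.1^2 + q.2.2^2) ≤ 1 ∧ q.2 ∈ S} := by
    have h1 : MeasurableSet {q : ℝ × (ℝ × ℝ) | q.1^2 + (q.2.1^2 + q.2.2^2) ≤ 1} :=
      measurableSet_le (by fun_prop) (by fun_prop)
    exact h1.inter (measurable_snd hS)
  have e1 : {y : E3 | (y 0)^2 + (y 1)^2 + (y 2)^2 ≤ 1 ∧ (y 0, y 1) ∈ S} =
      (fun y : E3 => (y 2, (y 0, y 1))) ⁻¹' {q : ℝ × (ℝ × ℝ) | q.1^2 + (q.2.1^2 + q.2.2^2) ≤ 1 ∧ q.2 ∈ S} := by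
    ext y; simp only [Set.mem_ofPred_eq, Set.mem_preimage]
    rw [show y 0^2+y 1^2+y 2^2 = y 2^2 + (y 0^2+y 1^2) by ring]
  rw [e1, mpPhi.measure_preimage hU.nullMeasurableSet, Measure.volume_eq_prod, Measure.prod_apply_symm hU]
  have hG : Measurable GG := by
    have : MeasurableSet {q : ℝ × ℝ | q.2^2 + q.1 ≤ 1} := measurableSet_le (by fun_prop) (by fun_prop)
    exact measurable_measure_prodMk_left this
  have e2 : ∀ p : ℝ × ℝ, volume ((fun x => (x, p)) ⁻¹' {q : ℝ × (ℝ × ℝ) | q.1^2 + (q.2.1^2 + q.2.2^2) ≤ 1 ∧ q.2 ∈ S})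
      = S.indicator (fun p => GG (p.1^2+p.2^2)) p := by
    intro p
    by_cases hp : p ∈ S
    · simp [hp, GG]
    · simp [hp]
  simp_rw [e2]
  rw [← lintegral_comp_polarCoord_symm, polarCoord_target, Measure.volume_eq_prod, ← Measure.prod_restrict]
  have e3 : ∫⁻ p : ℝ × ℝ, ENNReal.ofReal p.1 • S.indicator (fun p => GG (p.1^2+p.2^2)) (polarCoord.symm p)
      ∂((volume.restrict (Set.Ioi 0)).prod (volume.restrict (Set.Ioo (-Real.pi) Real.pi)))
     = ∫⁻ p : ℝ × ℝ, (ENNReal.ofReal p.1 * GG (p.1^2)) * (T.indicator 1 p.2)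
      ∂((volume.restrict (Set.Ioi 0)).prod (volume.restrict (Set.Ioo (-Real.pi) Real.pi))) := by
    rw [Measure.prod_restrict]
    refine setLIntegral_congr_fun (measurableSet_Ioi.prod measurableSet_Ioo) ?_
    rintro ⟨ρ, θ⟩ ⟨h1, h2⟩
    have := h ρ θ h1 h2
    simp only [polarCoord_symm_apply, smul_eq_mul]
    by_cases ht : θ ∈ T
    · rw [Set.indicator_of_mem (this.mpr ht), Set.indicator_of_mem ht, Pi.one_apply, mul_one]
      congr 2
      linear_combination ρ^2 * Real.sin_sq_add_cos_sq θ
    · rw [Set.indicator_of_notMem (fun k => ht (this.mp k)), Set.indicator_of_notMem ht]; simp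
  rw [e3, lintegral_prod_mul (f := fun x => ENNReal.ofReal x * GG (x^2)) (g := T.indicator 1) (by fun_prop) (by fun_prop (disch := assumption)), lintegral_indicator_one hT, Measure.restrict_apply hT]
  rfl

theorem JJ_val : JJ = ENNReal.ofReal (2/3) := by
  have h := lune_gen Set.univ MeasurableSet.univ Set.univ MeasurableSet.univ (by simp)
  have h2 : {y : E3 | (y 0)^2 + (y 1)^2 + (y 2)^2 ≤ 1 ∧ (y 0, y 1) ∈ Set.univ} = closedBall 0 1 := by
    ext y
    simp [EuclideanSpace.norm_eq, Fin.sum_univ_three]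
  rw [h2, EuclideanSpace.volume_closedBall_fin_three] at h
  simp only [Set.univ_inter, Real.volume_Ioo] at h
  have hp := Real.pi_pos
  rw [← ENNReal.ofReal_pow zero_le_one, ← ENNReal.ofReal_mul (by norm_num)] at h
  have h3 : ENNReal.ofReal (1^3 * (Real.pi*4/3)) = ENNReal.ofReal (2/3) * ENNReal.ofReal (Real.pi - -Real.pi) := by
    rw [← ENNReal.ofReal_mul (by norm_num)]; congr 1; ring
  rw [h3] at h
  refine ((ENNReal.mul_left_inj ?_ ENNReal.ofReal_ne_top).mp h).symm
  simp; linarith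

theorem lune_unit (a b : E3) (ha : ‖a‖ = 1) (hb : ‖b‖ = 1) (hab : (inner ℝ a b)^2 < 1) :
    volume (closedBall 0 1 ∩ ({x : E3 | 0 ≤ inner ℝ a x} ∩ {x : E3 | 0 ≤ inner ℝ b x})) =
      ENNReal.ofReal (2/3 * (Real.pi - InnerProductGeometry.angle a b)) := by
  set β := Real.pi - InnerProductGeometry.angle a b with hβ
  have hc : inner ℝ a b = -Real.cos β := by
    have := InnerProductGeometry.cos_angle a b
    rw [ha, hb] at this
    rw [hβ, Real.cos_pi_sub, this]; simp
  have hβ0 : 0 ≤ β := by have := InnerProductGeometry.angle_le_pi a b; linarith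
  have hβ1 : β ≤ Real.pi := by have := InnerProductGeometry.angle_nonneg a b; linarith
  have hs2 : 0 < Real.sin β ^2 := by
    rw [hc] at hab
    have := Real.sin_sq_add_cos_sq β
    linarith [show (-Real.cos β)^2 = Real.cos β^2 by ring]
  have hs : 0 < Real.sin β := by
    rcases (Real.sin_nonneg_of_nonneg_of_le_pi hβ0 hβ1).lt_or_eq with h | h
    · exact h
    · rw [← h] at hs2; norm_num at hs2
  have hβ0' : 0 < β := by
    rcases hβ0.lt_or_eq with h | h
    · exact h
    · rw [← h] at hs; simp at hs
  have hβ1' : β < Real.pi := by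
    rcases hβ1.lt_or_eq with h | h
    · exact h
    · rw [h] at hs; simp at hs
  have haa : inner ℝ a a = (1:ℝ) := by rw [real_inner_self_eq_norm_sq, ha]; norm_num
  have hbb : inner ℝ b b = (1:ℝ) := by rw [real_inner_self_eq_norm_sq, hb]; norm_num
  have hba : inner ℝ b a = -Real.cos β := by rw [real_inner_comm, hc]
  set e0 : E3 := (Real.sin β)⁻¹ • (b + Real.cos β • a) with he0
  have h0a : inner ℝ e0 a = (0:ℝ) := by
    rw [he0, real_inner_smul_left, inner_add_left, real_inner_smul_left, haa, hba]; ring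
  have h00 : inner ℝ e0 e0 = (1:ℝ) := by
    rw [he0, real_inner_smul_left, real_inner_smul_right, inner_add_left, inner_add_right, inner_add_right]
    simp only [real_inner_smul_left, real_inner_smul_right, haa, hba, hbb, hc]
    field_simp
    linarith [Real.sin_sq_add_cos_sq β]
  have hbe : b = Real.sin β • e0 - Real.cos β • a := by
    rw [he0, smul_smul, mul_inv_cancel₀ hs.ne']; simp
  have hn0 : ‖e0‖ = 1 := by
    rw [real_inner_self_eq_norm_sq] at h00
    exact (pow_eq_one_iff_of_nonneg (norm_nonneg _) two_ne_zero).mp h00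
  have horth : Orthonormal ℝ (Set.domRestrict ({0,1} : Set (Fin 3)) ![e0, a, 0]) := by
    constructor
    · rintro ⟨i, hi⟩
      rcases hi with rfl | rfl
      · simpa using hn0
      · simpa using ha
    · rintro ⟨i, hi⟩ ⟨j, hj⟩ hij
      rcases hi with rfl | rfl <;> rcases hj with rfl | rfl
      · exact absurd rfl hij
      · simpa using h0a
      · simpa [real_inner_comm] using h0a
      · exact absurd rfl hij
  obtain ⟨B, hB⟩ := horth.exists_orthonormalBasis_extension_of_card_eq (by simp)
  have B0 : B 0 = e0 := by simpa using hB 0 (by simp)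
  have B1 : B 1 = a := by simpa using hB 1 (by simp)
  have hmeas : MeasurableSet {p : ℝ × ℝ | 0 ≤ p.2 ∧ 0 ≤ Real.sin β * p.1 - Real.cos β * p.2} := by
    have h1 : MeasurableSet {p : ℝ × ℝ | 0 ≤ p.2} := measurableSet_le (by fun_prop) (by fun_prop)
    have h2 : MeasurableSet {p : ℝ × ℝ | 0 ≤ Real.sin β * p.1 - Real.cos β * p.2} := measurableSet_le (by fun_prop) (by fun_prop)
    exact h1.inter h2
  have key := lune_gen _ hmeas (Set.Icc 0 β) measurableSet_Icc (by
    intro ρ θ hρ hθ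
    simp only [Set.mem_ofPred_eq, Set.mem_Icc]
    rw [show Real.sin β * (ρ * Real.cos θ) - Real.cos β * (ρ * Real.sin θ) = ρ * Real.sin (β - θ) by
      rw [Real.sin_sub β θ]; ring, mul_nonneg_iff_of_pos_left hρ, mul_nonneg_iff_of_pos_left hρ]
    constructor
    · rintro ⟨h1, h2⟩
      have t0 : 0 ≤ θ := by
        by_contra hn; push Not at hn
        linarith [Real.sin_neg_of_neg_of_neg_pi_lt hn hθ.1]
      refine ⟨t0, ?_⟩
      by_contra hn; push Not at hn
      linarith [Real.sin_neg_of_neg_of_neg_pi_lt (show β - θ < 0 by linarith) (by linarith [hθ.2])]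
    · rintro ⟨h1, h2⟩
      exact ⟨Real.sin_nonneg_of_nonneg_of_le_pi h1 hθ.2.le,
        Real.sin_nonneg_of_nonneg_of_le_pi (by linarith) (by linarith)⟩)
  have hT : Set.Icc 0 β ∩ Set.Ioo (-Real.pi) Real.pi = Set.Icc 0 β := by
    refine Set.inter_eq_left.mpr fun t ht => ⟨by linarith [ht.1, Real.pi_pos], by linarith [ht.2]⟩
  rw [hT, JJ_val, Real.volume_Icc, ← ENNReal.ofReal_mul (by norm_num), sub_zero] at key
  have hpre := B.measurePreserving_repr.measure_preimage_emb B.repr.toHomeomorph.measurableEmbedding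
    {y : E3 | (y 0)^2 + (y 1)^2 + (y 2)^2 ≤ 1 ∧ (y 0, y 1) ∈ {p : ℝ × ℝ | 0 ≤ p.2 ∧ 0 ≤ Real.sin β * p.1 - Real.cos β * p.2}}
  rw [← key, ← hpre]
  clear_value e0
  congr 1
  ext x
  have n1 : ‖x‖ = ‖B.repr x‖ := (B.repr.norm_map x).symm
  have i1 : inner ℝ a x = B.repr x 1 := by rw [B.repr_apply_apply, B1]
  have i0 : inner ℝ e0 x = B.repr x 0 := by rw [B.repr_apply_apply, B0]
  have ib : inner ℝ b x = Real.sin β * B.repr x 0 - Real.cos β * B.repr x 1 := by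
    rw [hbe, inner_sub_left, real_inner_smul_left, real_inner_smul_left, i0, i1]
  simp only [Set.mem_inter_iff, mem_closedBall, dist_zero_right, Set.mem_ofPred_eq, Set.mem_preimage]
  rw [ib, i1, n1, EuclideanSpace.norm_eq, Real.sqrt_le_one, Fin.sum_univ_three]
  simp [and_assoc]

section
open scoped Pointwise

def HH (n : E3) : Set E3 := {x : E3 | 0 ≤ inner ℝ n x}
def npar (a b : E3) : Prop := (inner ℝ a b)^2 < ‖a‖^2 * ‖b‖^2

theorem HH_meas (n : E3) : MeasurableSet (HH n) := measurableSet_le (by fun_prop) (by fun_prop)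
theorem npar.ne {a b : E3} (h : npar a b) : a ≠ 0 ∧ b ≠ 0 := by
  constructor <;> (rintro rfl; simp [npar] at h)
theorem HH_smul {n : E3} {c : ℝ} (hc : 0 < c) : HH (c • n) = HH n := by
  ext x; simp [HH, real_inner_smul_left, mul_nonneg_iff_of_pos_left hc]

noncomputable def mu : Measure E3 := volume.restrict (closedBall 0 1)
instance : IsFiniteMeasure mu := ⟨by
  rw [mu, Measure.restrict_apply_univ]; exact measure_closedBall_lt_top⟩

theorem mu_univ : mu.real Set.univ = 4*Real.pi/3 := by
  rw [measureReal_def, mu, Measure.restrict_apply_univ, EuclideanSpace.volume_closedBall_fin_three,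
    ← ENNReal.ofReal_pow zero_le_one, ← ENNReal.ofReal_mul (by norm_num), ENNReal.toReal_ofReal (by positivity)]
  ring

theorem lune (a b : E3) (h : npar a b) :
    mu.real (HH a ∩ HH b) = 2/3 * (Real.pi - InnerProductGeometry.angle a b) := by
  obtain ⟨ha, hb⟩ := h.ne
  have ha' : 0 < ‖a‖⁻¹ := inv_pos.mpr (norm_pos_iff.mpr ha)
  have hb' : 0 < ‖b‖⁻¹ := inv_pos.mpr (norm_pos_iff.mpr hb)
  have na : ‖‖a‖⁻¹ • a‖ = 1 := norm_smul_inv_norm ha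
  have nb : ‖‖b‖⁻¹ • b‖ = 1 := norm_smul_inv_norm hb
  have := lune_unit _ _ na nb (by
    rw [real_inner_smul_left, real_inner_smul_right]
    have h1 : 0 < ‖a‖ := norm_pos_iff.mpr ha
    have h2 : 0 < ‖b‖ := norm_pos_iff.mpr hb
    unfold npar at h
    rw [mul_pow, mul_pow, inv_pow, inv_pow, ← mul_assoc, ← mul_inv, inv_mul_lt_iff₀ (by positivity)]
    linarith)
  rw [InnerProductGeometry.angle_smul_left_of_pos _ _ ha', InnerProductGeometry.angle_smul_right_of_pos _ _ hb'] at this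
  rw [measureReal_def, ← HH_smul ha', ← HH_smul (n := b) hb', mu, Measure.restrict_apply ((HH_meas _).inter (HH_meas _)), Set.inter_comm]
  unfold HH
  rw [this, ENNReal.toReal_ofReal]
  have := InnerProductGeometry.angle_le_pi a b
  linarith

theorem plane_null {n : E3} (hn : n ≠ 0) : volume {x : E3 | inner ℝ n x = 0} = 0 := by
  have := Measure.addHaar_submodule (volume : Measure E3) (LinearMap.ker (innerₛₗ ℝ n)) (by
    intro h
    have : n ∈ LinearMap.ker (innerₛₗ ℝ n) := by rw [h]; trivial
    simp at this
    exact hn this)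
  convert this using 2
  ext x; simp

theorem mu_neg (S : Set E3) : mu ((fun x => -x) ⁻¹' S) = mu S := by
  have h : (fun x : E3 => -x) ⁻¹' (S ∩ closedBall 0 1) = ((fun x : E3 => -x) ⁻¹' S) ∩ closedBall 0 1 := by
    ext x; simp
  rw [mu, Measure.restrict_apply' measurableSet_closedBall, Measure.restrict_apply' measurableSet_closedBall, ← h]
  exact Measure.measure_preimage_neg volume _

theorem compl_neg (n : E3) (hn : n ≠ 0) : ((HH n)ᶜ : Set E3) =ᵐ[mu] ((fun x => -x) ⁻¹' HH n : Set E3) := by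
  have h0 : mu {x : E3 | inner ℝ n x = 0} = 0 :=
    le_antisymm ((Measure.restrict_apply_le _ _).trans (plane_null hn).le) (by simp)
  have : ∀ᵐ x ∂mu, inner ℝ n x ≠ 0 := by
    rw [ae_iff]; simpa using h0
  filter_upwards [this] with x hx
  have hx' : inner ℝ n x ≠ (0:ℝ) := hx
  refine propext ?_
  show x ∈ (HH n)ᶜ ↔ -x ∈ HH n
  simp only [HH, Set.mem_compl_iff, Set.mem_ofPred_eq, inner_neg_right, not_le]
  constructor
  · intro h; linarith
  · intro h; exact lt_of_le_of_ne (by linarith) hx'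

theorem mu_half (n : E3) (hn : n ≠ 0) : mu.real (HH n) = 2*Real.pi/3 := by
  have h1 : mu.real (HH n)ᶜ = mu.real (HH n) := by
    rw [measureReal_def, measureReal_def, measure_congr (compl_neg n hn), mu_neg]
  rw [measureReal_compl (HH_meas n), mu_univ] at h1
  linarith

theorem tri (a b c : E3) (hab : npar a b) (hac : npar a c) (hbc : npar b c) :
    mu.real (HH a ∩ (HH b ∩ HH c)) = (2*Real.pi - InnerProductGeometry.angle a b - InnerProductGeometry.angle a c
      - InnerProductGeometry.angle b c)/3 := by
  have ma := HH_meas a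
  have mb := HH_meas b
  have mc := HH_meas c
  have h1 : mu.real (HH a ∪ (HH b ∪ HH c))ᶜ = mu.real (HH a ∩ (HH b ∩ HH c)) := by
    rw [measureReal_def, measureReal_def]
    congr 1
    rw [← mu_neg (HH a ∩ (HH b ∩ HH c)), Set.compl_union, Set.compl_union]
    exact measure_congr ((compl_neg a hab.ne.1).inter ((compl_neg b hab.ne.2).inter (compl_neg c hac.ne.2)))
  rw [measureReal_compl (ma.union (mb.union mc)), mu_univ] at h1
  have u1 := measureReal_union_add_inter (μ := mu) (s := HH a) (mb.union mc)
  have u2 := measureReal_union_add_inter (μ := mu) (s := HH b) mc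
  have u3 := measureReal_union_add_inter (μ := mu) (s := HH a ∩ HH b) (ma.inter mc)
  rw [← Set.inter_union_distrib_left] at u3
  have e : HH a ∩ HH b ∩ (HH a ∩ HH c) = HH a ∩ (HH b ∩ HH c) := by
    ext x; simp only [Set.mem_inter_iff]; tauto
  rw [e, lune a b hab, lune a c hac] at u3
  rw [lune b c hbc, mu_half b hbc.ne.1, mu_half c hbc.ne.2] at u2
  rw [mu_half a hab.ne.1] at u1
  linarith

theorem tri_scaled (X : E3) (ρ : ℝ) (hρ : 0 < ρ) (a b c : E3) (hab : npar a b) (hac : npar a c) (hbc : npar b c) :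
    volume.real (closedBall X ρ ∩ {x : E3 | 0 ≤ inner ℝ a (x - X) ∧ 0 ≤ inner ℝ b (x - X) ∧ 0 ≤ inner ℝ c (x - X)})
      = ρ^3 * ((2*Real.pi - InnerProductGeometry.angle a b - InnerProductGeometry.angle a c
      - InnerProductGeometry.angle b c)/3) := by
  rw [← tri a b c hab hac hbc]
  have e : closedBall X ρ ∩ {x : E3 | 0 ≤ inner ℝ a (x - X) ∧ 0 ≤ inner ℝ b (x - X) ∧ 0 ≤ inner ℝ c (x - X)}
     = (fun x => x + (-X)) ⁻¹' (ρ • ((HH a ∩ (HH b ∩ HH c)) ∩ closedBall 0 1)) := by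
    ext x
    simp only [Set.mem_inter_iff, Set.mem_preimage, Set.mem_smul_set_iff_inv_smul_mem₀ hρ.ne', mem_closedBall, dist_zero_right,
      HH, Set.mem_ofPred_eq, real_inner_smul_right, norm_smul, norm_inv, Real.norm_eq_abs, abs_of_pos hρ, ← sub_eq_add_neg, dist_eq_norm, sub_zero]
    rw [mul_nonneg_iff_of_pos_left (inv_pos.mpr hρ), mul_nonneg_iff_of_pos_left (inv_pos.mpr hρ), mul_nonneg_iff_of_pos_left (inv_pos.mpr hρ),
      inv_mul_le_iff₀ hρ, mul_one]
    tauto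
  rw [measureReal_def, e, measure_preimage_add_right, Measure.addHaar_smul, ENNReal.toReal_mul, measureReal_def, mu,
    Measure.restrict_apply' measurableSet_closedBall]
  congr 1
  simp [abs_of_pos hρ, hρ.le]

end

noncomputable def stdT : Set E3 := convexHull ℝ {!₂[1,0,0], !₂[0,1,0], !₂[0,0,1], 0}
noncomputable def kT : ℝ := volume.real stdT

noncomputable def LTt (a1 a2 b1 b2 c1 c2 h : ℝ) : E3 →ₗ[ℝ] E3 :=
  Matrix.toLin (EuclideanSpace.basisFun (Fin 3) ℝ).toBasis (EuclideanSpace.basisFun (Fin 3) ℝ).toBasis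
    !![a1,b1,c1;a2,b2,c2;-h,-h,-h]

theorem LTt_apply (a1 a2 b1 b2 c1 c2 h : ℝ) (x : E3) : LTt a1 a2 b1 b2 c1 c2 h x =
    !₂[a1*x 0+b1*x 1+c1*x 2, a2*x 0+b2*x 1+c2*x 2, -h*x 0-h*x 1-h*x 2] := by
  unfold LTt
  rw [Matrix.toLin_apply]
  ext i
  fin_cases i <;> simp [Fin.sum_univ_three, Matrix.mulVec, dotProduct] <;> ring

theorem vol_tetra (a1 a2 b1 b2 c1 c2 h : ℝ) :
    volume.real (convexHull ℝ {(!₂[a1,a2,0] : E3), !₂[b1,b2,0], !₂[c1,c2,0], !₂[0,0,h]}) =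
      |h*((a1*b2-a2*b1)+(b1*c2-b2*c1)+(c1*a2-c2*a1))| * kT := by
  have h1 : convexHull ℝ {(!₂[a1,a2,0] : E3), !₂[b1,b2,0], !₂[c1,c2,0], !₂[0,0,h]}
      = (fun x => (!₂[0,0,h] : E3) + x) '' (LTt a1 a2 b1 b2 c1 c2 h '' stdT) := by
    unfold stdT
    rw [LinearMap.image_convexHull]
    have : (fun x => (!₂[0,0,h] : E3) + x) = (AffineEquiv.constVAdd ℝ E3 (!₂[0,0,h] : E3)).toAffineMap := by
      ext x; simp
    rw [this, AffineMap.image_convexHull]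
    congr 1
    simp only [Set.image_insert_eq, Set.image_singleton, LTt_apply]
    congr 1
    · ext i; fin_cases i <;> simp
    congr 1
    · ext i; fin_cases i <;> simp
    congr 1
    · ext i; fin_cases i <;> simp
    congr 1
    · ext i; fin_cases i <;> simp
  rw [h1]
  unfold kT
  rw [measureReal_def, Set.image_add_left, measure_preimage_add, Measure.addHaar_image_linearMap, ENNReal.toReal_mul,
    ENNReal.toReal_ofReal (abs_nonneg _), ← measureReal_def]
  congr 1
  unfold LTt
  rw [LinearMap.det_toLin, Matrix.det_fin_three, ← abs_neg]
  congr 1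
  simp
  ring

noncomputable def nf (p1 p2 q1 q2 h : ℝ) : E3 := !₂[h*(p2-q2), -(h*(p1-q1)), -(p1*q2-p2*q1)]
noncomputable def nz : E3 := !₂[0,0,1]
noncomputable def eta (h d x : ℝ) : ℝ := Real.arctan (d * √(h^2 + d^2 + x^2) / (x * h))

theorem inner3 (x1 x2 x3 y1 y2 y3 : ℝ) : inner ℝ (!₂[x1,x2,x3] : E3) !₂[y1,y2,y3] = x1*y1+x2*y2+x3*y3 := by
  rw [EuclideanSpace.inner_eq_star_dotProduct]
  simp [dotProduct, Fin.sum_univ_three]; ring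
theorem norm3 (x1 x2 x3 : ℝ) : ‖(!₂[x1,x2,x3] : E3)‖ = √(x1^2+x2^2+x3^2) := by
  rw [EuclideanSpace.norm_eq]; simp [Fin.sum_univ_three]
theorem norm3_sq (x1 x2 x3 : ℝ) : ‖(!₂[x1,x2,x3] : E3)‖^2 = x1^2+x2^2+x3^2 := by
  rw [norm3, Real.sq_sqrt (by positivity)]

theorem at_sum2 {x d y e m n : ℝ} (hx : 0 < x) (hy : 0 < y) (hm : 0 < m) (hn : 0 < n) (h1 : d^2+x^2 = m^2) (h2 : e^2+y^2=n^2)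
    (hs : 0 < d*y+e*x) : Real.arctan (d/x) + Real.arctan (e/y) = Real.arccos ((x*y-d*e)/(m*n)) := by
  have := at_sum (x := x/m) (d := d/m) (y := y/n) (e := e/n) (m := 1) (by positivity) (by positivity)
    (by rw [div_pow, div_pow, ← add_div, h1]; field_simp) (by rw [div_pow, div_pow, ← add_div, h2]; field_simp)
    (by have : d/m*(y/n)+e/n*(x/m) = (d*y+e*x)/(m*n) := by field_simp
        rw [this]; positivity)
  rw [div_div_div_cancel_right₀ hm.ne', div_div_div_cancel_right₀ hn.ne'] at this
  rw [this]; congr 1; field_simp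

theorem nf_norm {p1 p2 q1 q2 h : ℝ} (e : 4 ≤ (p1 - q1)^2 + (p2 - q2)^2) :
    ‖nf p1 p2 q1 q2 h‖ = Len p1 p2 q1 q2 * √(h^2 + dE p1 p2 q1 q2^2) := by
  have h1 := Len_pos e
  unfold nf
  rw [norm3, ← Real.sqrt_sq (show 0 ≤ Len p1 p2 q1 q2 by linarith), ← Real.sqrt_mul (by positivity)]
  congr 1
  rw [← dE_L e]
  linear_combination (-h^2) * Len_sq p1 p2 q1 q2

theorem npar_z {p1 p2 q1 q2 h : ℝ} (hh : 0 < h) (e : 4 ≤ (p1 - q1)^2 + (p2 - q2)^2) : npar (nf p1 p2 q1 q2 h) nz := by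
  unfold npar nf nz
  rw [inner3, norm3_sq, norm3_sq]
  have : 0 < h^2*((p1-q1)^2+(p2-q2)^2) := by positivity
  linarith

theorem npar_e {a1 a2 b1 b2 c1 c2 h : ℝ} (hh : 0 < h) (S : 0 < (a1*b2-a2*b1)+(b1*c2-b2*c1)+(c1*a2-c2*a1)) :
    npar (nf c1 c2 a1 a2 h) (nf a1 a2 b1 b2 h) := by
  unfold npar nf
  rw [inner3, norm3_sq, norm3_sq]
  have : 0 < h^2*((a1*b2-a2*b1)+(b1*c2-b2*c1)+(c1*a2-c2*a1))^2*(a1^2+a2^2+h^2) := by positivity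
  linarith

theorem ang_z {p1 p2 q1 q2 h : ℝ} (hh : 0 < h) (e : 4 ≤ (p1 - q1)^2 + (p2 - q2)^2) :
    InnerProductGeometry.angle (nf p1 p2 q1 q2 h) nz = Real.pi/2 + Real.arctan (dE p1 p2 q1 q2 / h) := by
  have h1 := Len_pos e
  unfold InnerProductGeometry.angle
  rw [nf_norm e]
  have : inner ℝ (nf p1 p2 q1 q2 h) nz = -(dE p1 p2 q1 q2 * Len p1 p2 q1 q2) := by
    unfold nf nz; rw [inner3, dE_L e]; ring
  rw [this]
  have : ‖nz‖ = 1 := by unfold nz; rw [norm3]; simp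
  rw [this, Real.arctan_eq_arcsin]
  have w : √(1 + (dE p1 p2 q1 q2/h)^2) = √(h^2+dE p1 p2 q1 q2^2)/h := by
    nth_rewrite 3 [← Real.sqrt_sq hh.le]
    rw [← Real.sqrt_div' _ (sq_nonneg h)]
    congr 1; field_simp
  rw [w]
  have w0 : 0 < √(h^2+dE p1 p2 q1 q2^2) := by positivity
  have : -(dE p1 p2 q1 q2 * Len p1 p2 q1 q2) / (Len p1 p2 q1 q2 * √(h^2 + dE p1 p2 q1 q2^2) * 1)
    = -(dE p1 p2 q1 q2/h/(√(h^2+dE p1 p2 q1 q2^2)/h)) := by field_simp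
  rw [this, Real.arccos_neg, Real.arccos]; ring

theorem ang_e {a1 a2 b1 b2 c1 c2 h : ℝ} (hh : 0 < h) (S : 0 < (a1*b2-a2*b1)+(b1*c2-b2*c1)+(c1*a2-c2*a1))
    (e1 : 4 ≤ (a1-b1)^2+(a2-b2)^2) (e2 : 4 ≤ (c1-a1)^2+(c2-a2)^2) (x1 : 0 < xE a1 a2 b1 b2) (x2 : 0 < xE a1 a2 c1 c2) :
    InnerProductGeometry.angle (nf c1 c2 a1 a2 h) (nf a1 a2 b1 b2 h) =
      Real.pi - (eta h (dE a1 a2 b1 b2) (xE a1 a2 b1 b2) + eta h (dE c1 c2 a1 a2) (xE a1 a2 c1 c2)) := by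
  have l1 := Len_pos e1
  have l2 := Len_pos e2
  obtain ⟨v1, v2⟩ := vtx e1 e2
  have s1 := dx_sq e1
  have s2 := dx_sq' e2
  have N0 : 0 < a1^2+a2^2 := by rw [← s1]; positivity
  have dd : 0 < dE a1 a2 b1 b2 * xE a1 a2 c1 c2 + dE c1 c2 a1 a2 * xE a1 a2 b1 b2 := by rw [v2]; positivity
  have f1 := dE_L e1
  have f2 := dE_L e2
  have I : inner ℝ (nf c1 c2 a1 a2 h) (nf a1 a2 b1 b2 h) = -(h^2*((a1-b1)*(a1-c1)+(a2-b2)*(a2-c2)))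
      + (dE c1 c2 a1 a2 * Len c1 c2 a1 a2) * (dE a1 a2 b1 b2 * Len a1 a2 b1 b2) := by
    unfold nf; rw [inner3, f1, f2]; ring
  unfold InnerProductGeometry.angle
  rw [nf_norm e1, nf_norm e2, I]
  unfold eta
  rw [show h^2+dE a1 a2 b1 b2^2+xE a1 a2 b1 b2^2 = h^2+(a1^2+a2^2) by rw [← s1]; ring,
    show h^2+dE c1 c2 a1 a2^2+xE a1 a2 c1 c2^2 = h^2+(a1^2+a2^2) by rw [← s2]; ring]
  clear f1 f2 I
  have v3 : ((a1-b1)*(a1-c1)+(a2-b2)*(a2-c2)) = (xE a1 a2 b1 b2 * xE a1 a2 c1 c2 - dE a1 a2 b1 b2 * dE c1 c2 a1 a2)/(a1^2+a2^2)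
     * (Len a1 a2 b1 b2 * Len c1 c2 a1 a2) := by rw [v1]; field_simp
  rw [v3]
  clear v3 v1 v2 S e1 e2
  generalize dE a1 a2 b1 b2 = d at *
  generalize dE c1 c2 a1 a2 = e at *
  generalize xE a1 a2 b1 b2 = x at *
  generalize xE a1 a2 c1 c2 = y at *
  generalize Len a1 a2 b1 b2 = L at *
  generalize Len c1 c2 a1 a2 = M at *
  generalize a1^2+a2^2 = N at *
  have hs : √(h^2+N)^2 = h^2+N := Real.sq_sqrt (by positivity)
  have hs0 : 0 < √(h^2+N) := by positivity
  have w1 : √(h^2+d^2)^2 = h^2+d^2 := Real.sq_sqrt (by positivity)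
  have w2 : √(h^2+e^2)^2 = h^2+e^2 := Real.sq_sqrt (by positivity)
  have w10 : 0 < √(h^2+d^2) := by positivity
  have w20 : 0 < √(h^2+e^2) := by positivity
  have n1 : √N^2 = N := Real.sq_sqrt N0.le
  have n0 : 0 < √N := by positivity
  rw [at_sum2 (m := √N*√(h^2+d^2)) (n := √N*√(h^2+e^2)) (by positivity) (by positivity) (by positivity) (by positivity)
    (by rw [mul_pow, mul_pow, mul_pow, w1, hs, n1, ← s1]; ring) (by rw [mul_pow, mul_pow, mul_pow, w2, hs, n1, ← s2]; ring)
    (by have : 0 < h*√(h^2+N)*(d*y+e*x) := by positivity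
        linarith), ← Real.arccos_neg]
  congr 1
  rw [← neg_div, div_eq_div_iff (by positivity) (by positivity)]
  have k : x*h*(y*h) - d*√(h^2+N)*(e*√(h^2+N)) = h^2*(x*y-d*e) - N*d*e := by
    have : d*√(h^2+N)*(e*√(h^2+N)) = d*e*√(h^2+N)^2 := by ring
    rw [this, hs]; ring
  rw [k]
  have : √N*√(h^2+d^2)*(√N*√(h^2+e^2)) = N*√(h^2+d^2)*√(h^2+e^2) := by
    rw [show √N*√(h^2+d^2)*(√N*√(h^2+e^2)) = √N^2*√(h^2+d^2)*√(h^2+e^2) by ring, n1]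
  rw [this]
  field_simp
  ring

structure Pos (a1 a2 b1 b2 c1 c2 h : ℝ) : Prop where
  hp : 0 < h
  K : 0 < (a1*b2-a2*b1)+(b1*c2-b2*c1)+(c1*a2-c2*a1)
  eab : 4 ≤ (a1-b1)^2+(a2-b2)^2
  ebc : 4 ≤ (b1-c1)^2+(b2-c2)^2
  eca : 4 ≤ (c1-a1)^2+(c2-a2)^2
  xab : 0 < xE a1 a2 b1 b2
  xba : 0 < xE b1 b2 a1 a2
  xbc : 0 < xE b1 b2 c1 c2
  xcb : 0 < xE c1 c2 b1 b2
  xca : 0 < xE c1 c2 a1 a2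
  xac : 0 < xE a1 a2 c1 c2

theorem Pos.rot {a1 a2 b1 b2 c1 c2 h : ℝ} (H : Pos a1 a2 b1 b2 c1 c2 h) : Pos b1 b2 c1 c2 a1 a2 h where
  hp := H.hp
  K := by linarith [H.K]
  eab := H.ebc
  ebc := H.eca
  eca := H.eab
  xab := H.xbc
  xba := H.xcb
  xbc := H.xca
  xcb := H.xac
  xca := H.xab
  xac := H.xba

noncomputable def coneV (a1 a2 b1 b2 c1 c2 h : ℝ) : Set E3 :=
  {x : E3 | 0 ≤ inner ℝ (nf c1 c2 a1 a2 h) (x - !₂[a1,a2,0]) ∧ 0 ≤ inner ℝ (nf a1 a2 b1 b2 h) (x - !₂[a1,a2,0])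
    ∧ 0 ≤ inner ℝ nz (x - !₂[a1,a2,0])}
noncomputable def coneD (a1 a2 b1 b2 c1 c2 h : ℝ) : Set E3 :=
  {x : E3 | 0 ≤ inner ℝ (nf a1 a2 b1 b2 h) (x - !₂[0,0,h]) ∧ 0 ≤ inner ℝ (nf b1 b2 c1 c2 h) (x - !₂[0,0,h])
    ∧ 0 ≤ inner ℝ (nf c1 c2 a1 a2 h) (x - !₂[0,0,h])}

theorem Pos.vA {a1 a2 b1 b2 c1 c2 h : ℝ} (H : Pos a1 a2 b1 b2 c1 c2 h) :
    volume.real (closedBall (!₂[a1,a2,0] : E3) 1 ∩ coneV a1 a2 b1 b2 c1 c2 h) =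
     (eta h (dE a1 a2 b1 b2) (xE a1 a2 b1 b2) + eta h (dE c1 c2 a1 a2) (xE a1 a2 c1 c2)
      - Real.arctan (dE a1 a2 b1 b2 / h) - Real.arctan (dE c1 c2 a1 a2 / h))/3 := by
  unfold coneV
  rw [tri_scaled _ 1 one_pos _ _ _ (npar_e H.hp H.K) (npar_z H.hp H.eca) (npar_z H.hp H.eab), ang_e H.hp H.K H.eab H.eca H.xab H.xac,
    ang_z H.hp H.eca, ang_z H.hp H.eab]
  ring

theorem npar_comm {a b : E3} (h : npar a b) : npar b a := by
  unfold npar at *; rw [real_inner_comm, mul_comm]; exact h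

theorem Pos.vD {a1 a2 b1 b2 c1 c2 h : ℝ} (H : Pos a1 a2 b1 b2 c1 c2 h) :
    volume.real (closedBall (!₂[0,0,h] : E3) rr ∩ coneD a1 a2 b1 b2 c1 c2 h) =
     rr^3*((eta h (dE a1 a2 b1 b2) (xE a1 a2 b1 b2) + eta h (dE c1 c2 a1 a2) (xE a1 a2 c1 c2)
      + eta h (dE b1 b2 c1 c2) (xE b1 b2 c1 c2) + eta h (dE a1 a2 b1 b2) (xE b1 b2 a1 a2)
      + eta h (dE c1 c2 a1 a2) (xE c1 c2 a1 a2) + eta h (dE b1 b2 c1 c2) (xE c1 c2 b1 b2) - Real.pi)/3) := by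
  unfold coneD
  have HB := H.rot
  have HC := H.rot.rot
  rw [tri_scaled _ rr (by linarith [rr_b.1]) _ _ _ (npar_e HB.hp HB.K) (npar_comm (npar_e H.hp H.K)) (npar_e HC.hp HC.K),
    InnerProductGeometry.angle_comm (nf a1 a2 b1 b2 h) (nf c1 c2 a1 a2 h),
    ang_e H.hp H.K H.eab H.eca H.xab H.xac, ang_e HB.hp HB.K HB.eab HB.eca HB.xab HB.xac, ang_e HC.hp HC.K HC.eab HC.eca HC.xab HC.xac]
  ring

noncomputable def SV (a1 a2 b1 b2 c1 c2 h : ℝ) : ℝ :=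
  volume.real (closedBall (!₂[a1,a2,0] : E3) 1 ∩ coneV a1 a2 b1 b2 c1 c2 h)
  + volume.real (closedBall (!₂[b1,b2,0] : E3) 1 ∩ coneV b1 b2 c1 c2 a1 a2 h)
  + volume.real (closedBall (!₂[c1,c2,0] : E3) 1 ∩ coneV c1 c2 a1 a2 b1 b2 h)
  + volume.real (closedBall (!₂[0,0,h] : E3) rr ∩ coneD a1 a2 b1 b2 c1 c2 h)

theorem cc_rr : cc = 1 + rr^3 := by
  have : rr^3 = rr * (1 - 2*rr) := by rw [← rr_sq]; ring
  rw [this]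
  have h := rr_sq
  have e : rr = √2 - 1 := rfl
  have : rr*(1-2*rr) = rr - 2*rr^2 := by ring
  rw [this, h, e]; unfold cc; ring

theorem Pos.sum {a1 a2 b1 b2 c1 c2 h : ℝ} (H : Pos a1 a2 b1 b2 c1 c2 h) (δ : ℝ) :
    3 * SV a1 a2 b1 b2 c1 c2 h = FF δ h (dE b1 b2 c1 c2) (xE b1 b2 c1 c2) (xE c1 c2 b1 b2) (dE c1 c2 a1 a2) (xE c1 c2 a1 a2) (xE a1 a2 c1 c2)
      (dE a1 a2 b1 b2) (xE a1 a2 b1 b2) (xE b1 b2 a1 a2) + δ/2*(h*((a1*b2-a2*b1)+(b1*c2-b2*c1)+(c1*a2-c2*a1))) := by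
  unfold SV
  rw [H.vA, H.rot.vA, H.rot.rot.vA, H.vD]
  rw [← dE_L H.eab, ← dE_L H.ebc, ← dE_L H.eca, ← xE_add H.eab, ← xE_add H.ebc, ← xE_add H.eca]
  unfold FF pg gg
  rw [cc_rr]
  unfold eta
  ring

noncomputable def TT (a1 a2 b1 b2 c1 c2 h : ℝ) : Set E3 :=
  convexHull ℝ {(!₂[a1,a2,0] : E3), !₂[b1,b2,0], !₂[c1,c2,0], !₂[0,0,h]}
theorem TT_rot (a1 a2 b1 b2 c1 c2 h : ℝ) : TT a1 a2 b1 b2 c1 c2 h = TT b1 b2 c1 c2 a1 a2 h := by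
  unfold TT
  rw [Set.insert_comm (!₂[a1,a2,0] : E3), Set.insert_comm (!₂[a1,a2,0] : E3)]
theorem hs_convex (n X : E3) : Convex ℝ {x : E3 | 0 ≤ inner ℝ n (x - X)} := by
  intro x hx y hy s t hs ht hst
  simp only [Set.mem_ofPred_eq] at *
  have : s • x + t • y - X = s • (x - X) + t • (y - X) := by
    rw [smul_sub, smul_sub, sub_add_sub_comm, ← add_smul, hst, one_smul]
  rw [this, inner_add_right, inner_smul_right, inner_smul_right]
  positivity
theorem sub3 (x1 x2 x3 y1 y2 y3 : ℝ) : (!₂[x1,x2,x3] : E3) - !₂[y1,y2,y3] = !₂[x1-y1,x2-y2,x3-y3] := by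
  ext i; fin_cases i <;> simp

theorem TT_sub {a1 a2 b1 b2 c1 c2 h : ℝ} {s : Set E3} (hs : Convex ℝ s) (hA : !₂[a1,a2,0] ∈ s) (hB : !₂[b1,b2,0] ∈ s)
    (hC : !₂[c1,c2,0] ∈ s) (hD : !₂[0,0,h] ∈ s) : TT a1 a2 b1 b2 c1 c2 h ⊆ s := by
  apply convexHull_min _ hs
  intro x hx
  simp only [Set.mem_insert_iff, Set.mem_singleton_iff] at hx
  rcases hx with rfl | rfl | rfl | rfl <;> assumption

theorem TT_coneV {a1 a2 b1 b2 c1 c2 h : ℝ} (hp : 0 < h) (K : 0 < (a1*b2-a2*b1)+(b1*c2-b2*c1)+(c1*a2-c2*a1)) :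
    TT a1 a2 b1 b2 c1 c2 h ⊆ coneV a1 a2 b1 b2 c1 c2 h := by
  have k := mul_pos hp K
  apply TT_sub ((hs_convex _ _).inter ((hs_convex _ _).inter (hs_convex _ _)))
  all_goals
    simp only [Set.mem_inter_iff, Set.mem_ofPred_eq, sub3, nf, nz, inner3]
    refine ⟨?_, ?_, ?_⟩ <;> linarith

theorem TT_coneD {a1 a2 b1 b2 c1 c2 h : ℝ} (hp : 0 < h) (K : 0 < (a1*b2-a2*b1)+(b1*c2-b2*c1)+(c1*a2-c2*a1)) :
    TT a1 a2 b1 b2 c1 c2 h ⊆ coneD a1 a2 b1 b2 c1 c2 h := by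
  have k := mul_pos hp K
  apply TT_sub ((hs_convex _ _).inter ((hs_convex _ _).inter (hs_convex _ _)))
  all_goals
    simp only [Set.mem_inter_iff, Set.mem_ofPred_eq, sub3, nf, inner3]
    refine ⟨?_, ?_, ?_⟩ <;> linarith

noncomputable def UU (a1 a2 b1 b2 c1 c2 h : ℝ) : Set E3 :=
  closedBall !₂[a1,a2,0] 1 ∪ closedBall !₂[b1,b2,0] 1 ∪ closedBall !₂[c1,c2,0] 1 ∪ closedBall !₂[0,0,h] rr

theorem vol_upper {a1 a2 b1 b2 c1 c2 h : ℝ} (hp : 0 < h) (K : 0 < (a1*b2-a2*b1)+(b1*c2-b2*c1)+(c1*a2-c2*a1)) :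
    volume.real (TT a1 a2 b1 b2 c1 c2 h ∩ UU a1 a2 b1 b2 c1 c2 h) ≤ SV a1 a2 b1 b2 c1 c2 h := by
  have hA := TT_coneV hp K
  have hB := TT_coneV (a1 := b1) (a2 := b2) (b1 := c1) (b2 := c2) (c1 := a1) (c2 := a2) hp (by linarith)
  have hC := TT_coneV (a1 := c1) (a2 := c2) (b1 := a1) (b2 := a2) (c1 := b1) (c2 := b2) hp (by linarith)
  rw [← TT_rot] at hB
  rw [TT_rot] at hC
  have hD := TT_coneD hp K
  have e : TT a1 a2 b1 b2 c1 c2 h ∩ UU a1 a2 b1 b2 c1 c2 h ⊆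
      (closedBall (!₂[a1,a2,0] : E3) 1 ∩ coneV a1 a2 b1 b2 c1 c2 h)
  ∪ (closedBall (!₂[b1,b2,0] : E3) 1 ∩ coneV b1 b2 c1 c2 a1 a2 h)
  ∪ (closedBall (!₂[c1,c2,0] : E3) 1 ∩ coneV c1 c2 a1 a2 b1 b2 h)
  ∪ (closedBall (!₂[0,0,h] : E3) rr ∩ coneD a1 a2 b1 b2 c1 c2 h) := by
    rintro x ⟨h1, ((h2 | h2) | h2) | h2⟩
    · exact Or.inl (Or.inl (Or.inl ⟨h2, hA h1⟩))
    · exact Or.inl (Or.inl (Or.inr ⟨h2, hB h1⟩))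
    · exact Or.inl (Or.inr ⟨h2, hC h1⟩)
    · exact Or.inr ⟨h2, hD h1⟩
  have fin : ∀ (X : E3) (r : ℝ) (s : Set E3), volume (closedBall X r ∩ s) ≠ ⊤ := fun X r s =>
    ((measure_mono Set.inter_subset_left).trans_lt measure_closedBall_lt_top).ne
  refine (measureReal_mono e ?_).trans ?_
  · exact measure_union_ne_top (measure_union_ne_top (measure_union_ne_top (fin _ _ _) (fin _ _ _)) (fin _ _ _)) (fin _ _ _)
  · unfold SV
    have h1 := measureReal_union_le (μ := volume) (closedBall (!₂[a1,a2,0] : E3) 1 ∩ coneV a1 a2 b1 b2 c1 c2 h) (closedBall (!₂[b1,b2,0] : E3) 1 ∩ coneV b1 b2 c1 c2 a1 a2 h)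
    have h2 := measureReal_union_le (μ := volume) ((closedBall (!₂[a1,a2,0] : E3) 1 ∩ coneV a1 a2 b1 b2 c1 c2 h) ∪ (closedBall (!₂[b1,b2,0] : E3) 1 ∩ coneV b1 b2 c1 c2 a1 a2 h)) (closedBall (!₂[c1,c2,0] : E3) 1 ∩ coneV c1 c2 a1 a2 b1 b2 h)
    refine (measureReal_union_le _ _).trans ?_
    linarith

theorem mem_TT {a1 a2 b1 b2 c1 c2 h : ℝ} {w0 w1 w2 w3 : ℝ} {x : E3} (h0 : 0 ≤ w0) (h1 : 0 ≤ w1) (h2 : 0 ≤ w2) (h3 : 0 ≤ w3)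
    (hw : w0 + w1 + w2 + w3 = 1) (e0 : x 0 = w0*a1+w1*b1+w2*c1) (e1 : x 1 = w0*a2+w1*b2+w2*c2) (e2 : x 2 = w3*h) :
    x ∈ TT a1 a2 b1 b2 c1 c2 h := by
  have hx : x = w0 • !₂[a1,a2,0] + (w1 • !₂[b1,b2,0] + (w2 • !₂[c1,c2,0] + w3 • !₂[0,0,h])) := by
    ext i; fin_cases i
    · simp [e0]; ring
    · simp [e1]; ring
    · simp [e2]
  have := (convex_convexHull ℝ {(!₂[a1,a2,0] : E3), !₂[b1,b2,0], !₂[c1,c2,0], !₂[0,0,h]}).sum_mem (t := Finset.univ)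
    (w := ![w0,w1,w2,w3]) (z := ![!₂[a1,a2,0], !₂[b1,b2,0], !₂[c1,c2,0], !₂[0,0,h]])
    (by intro i _; fin_cases i <;> simpa) (by simp [Fin.sum_univ_succ]; linarith)
    (by intro i _; apply subset_convexHull; fin_cases i <;> simp)
  simp only [Fin.sum_univ_succ] at this
  rw [hx]
  simpa [TT] using this

theorem gram3 {p11 p22 p33 p12 p13 p23 x y z : ℝ} (hx : 0 ≤ x) (hy : 0 ≤ y) (hz : 0 ≤ z) (h11 : 4 ≤ p11) (h22 : 4 ≤ p22) (h33 : 1 ≤ p33)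
    (h12 : 0 ≤ p12) (h13 : 1 ≤ p13) (h23 : 1 ≤ p23)
    (h : x^2*p11+y^2*p22+z^2*p33+2*x*y*p12+2*x*z*p13+2*y*z*p23 ≤ 1) : x+y+z ≤ 1 := by
  have k1 : x^2*4 ≤ x^2*p11 := by gcongr
  have k2 : y^2*4 ≤ y^2*p22 := by gcongr
  have k3 : z^2*1 ≤ z^2*p33 := by gcongr
  have k4 : 2*x*y*0 ≤ 2*x*y*p12 := by gcongr
  have k5 : 2*x*z*1 ≤ 2*x*z*p13 := by gcongr
  have k6 : 2*y*z*1 ≤ 2*y*z*p23 := by gcongr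
  by_contra hc
  push Not at hc
  nlinarith [sq_nonneg (x-y), sq_nonneg x, sq_nonneg y]

theorem vtx_sub {a1 a2 b1 b2 c1 c2 h : ℝ} (hp : 0 < h) (K : 0 < (a1*b2-a2*b1)+(b1*c2-b2*c1)+(c1*a2-c2*a1))
    (eab : 4 ≤ (a1-b1)^2+(a2-b2)^2) (eca : 4 ≤ (c1-a1)^2+(c2-a2)^2)
    (ebc : (b1-c1)^2+(b2-c2)^2 ≤ (a1-b1)^2+(a2-b2)^2+((c1-a1)^2+(c2-a2)^2))
    (na : a1^2+a2^2+h^2=2) (nb : b1^2+b2^2+h^2=2) (nc : c1^2+c2^2+h^2=2) :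
    closedBall (!₂[a1,a2,0] : E3) 1 ∩ coneV a1 a2 b1 b2 c1 c2 h ⊆ TT a1 a2 b1 b2 c1 c2 h := by
  rintro x ⟨h1, h2, h3, h4⟩
  have hx : x = !₂[x 0, x 1, x 2] := by ext i; fin_cases i <;> simp
  rw [hx] at h1 h2 h3 h4
  rw [mem_closedBall, dist_eq_norm, sub3] at h1
  rw [sub3, nf, inner3] at h2 h3
  rw [sub3, nz, inner3] at h4
  have h1' := pow_le_pow_left₀ (norm_nonneg _) h1 2
  rw [norm3_sq] at h1'
  clear h1 hx
  have hk := mul_pos hp K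
  obtain ⟨β, hβ⟩ : ∃ β, β = (h*(c2-a2)*(x 0-a1)+ -(h*(c1-a1))*(x 1-a2)+ -(c1*a2-c2*a1)*(x 2-0))/(h*((a1*b2-a2*b1)+(b1*c2-b2*c1)+(c1*a2-c2*a1))) := ⟨_, rfl⟩
  obtain ⟨γ, hγ⟩ : ∃ γ, γ = (h*(a2-b2)*(x 0-a1)+ -(h*(a1-b1))*(x 1-a2)+ -(a1*b2-a2*b1)*(x 2-0))/(h*((a1*b2-a2*b1)+(b1*c2-b2*c1)+(c1*a2-c2*a1))) := ⟨_, rfl⟩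
  obtain ⟨δ, hδ⟩ : ∃ δ, δ = x 2 / h := ⟨_, rfl⟩
  have β0 : 0 ≤ β := by rw [hβ]; exact div_nonneg h2 hk.le
  have γ0 : 0 ≤ γ := by rw [hγ]; exact div_nonneg h3 hk.le
  have δ0 : 0 ≤ δ := by rw [hδ]; exact div_nonneg (by linarith) hp.le
  rw [eq_div_iff hk.ne'] at hβ hγ
  rw [eq_div_iff hp.ne'] at hδ
  have e0 : x 0 - a1 = β*(b1-a1)+γ*(c1-a1)+δ*(-a1) := by
    apply mul_left_cancel₀ hk.ne'
    linear_combination (-(b1-a1))*hβ - (c1-a1)*hγ + (a1*((a1*b2-a2*b1)+(b1*c2-b2*c1)+(c1*a2-c2*a1)))*hδ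
  have e1 : x 1 - a2 = β*(b2-a2)+γ*(c2-a2)+δ*(-a2) := by
    apply mul_left_cancel₀ hk.ne'
    linear_combination (-(b2-a2))*hβ - (c2-a2)*hγ + (a2*((a1*b2-a2*b1)+(b1*c2-b2*c1)+(c1*a2-c2*a1)))*hδ
  clear hβ hγ h2 h3 h4
  rw [e0, e1, ← hδ, one_pow] at h1'
  have s := gram3 β0 γ0 δ0 eab eca (p33 := 2) (by norm_num) (p12 := (b1-a1)*(c1-a1)+(b2-a2)*(c2-a2)) (by linarith)
    (p13 := -(b1-a1)*a1-(b2-a2)*a2) (by linarith) (p23 := -(c1-a1)*a1-(c2-a2)*a2) (by linarith)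
    (by refine le_of_eq_of_le ?_ h1'
        linear_combination (-δ^2)*na)
  refine mem_TT (w0 := 1-β-γ-δ) (w1 := β) (w2 := γ) (w3 := δ) (by linarith) β0 γ0 δ0 (by ring) ?_ ?_ ?_
  · linarith
  · linarith
  · linarith

theorem D_sub {a1 a2 b1 b2 c1 c2 : ℝ} (K : 0 < (a1*b2-a2*b1)+(b1*c2-b2*c1)+(c1*a2-c2*a1)) :
    closedBall (!₂[0,0,rr] : E3) rr ∩ coneD a1 a2 b1 b2 c1 c2 rr ⊆ TT a1 a2 b1 b2 c1 c2 rr := by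
  rintro x ⟨h1, h2, h3, h4⟩
  have hx : x = !₂[x 0, x 1, x 2] := by ext i; fin_cases i <;> simp
  have hp : 0 < rr := by linarith [rr_b.1]
  rw [hx] at h1 h2 h3 h4
  rw [mem_closedBall, dist_eq_norm, sub3] at h1
  rw [sub3, nf, inner3] at h2 h3 h4
  have h1' := pow_le_pow_left₀ (norm_nonneg _) h1 2
  rw [norm3_sq] at h1'
  clear h1 hx
  have z0 : 0 ≤ x 2 := by
    have := abs_le_of_sq_le_sq (a := x 2 - rr) (b := rr) (by linarith [sq_nonneg (x 0 - 0), sq_nonneg (x 1 - 0)]) hp.le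
    linarith [(abs_le.mp this).1]
  have hk := mul_pos hp K
  generalize rr = h at *
  obtain ⟨α, hα⟩ : ∃ α, α = (h*(b2-c2)*(x 0-0)+ -(h*(b1-c1))*(x 1-0)+ -(b1*c2-b2*c1)*(x 2-h))/(h*((a1*b2-a2*b1)+(b1*c2-b2*c1)+(c1*a2-c2*a1))) := ⟨_, rfl⟩
  obtain ⟨β, hβ⟩ : ∃ β, β = (h*(c2-a2)*(x 0-0)+ -(h*(c1-a1))*(x 1-0)+ -(c1*a2-c2*a1)*(x 2-h))/(h*((a1*b2-a2*b1)+(b1*c2-b2*c1)+(c1*a2-c2*a1))) := ⟨_, rfl⟩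
  obtain ⟨γ, hγ⟩ : ∃ γ, γ = (h*(a2-b2)*(x 0-0)+ -(h*(a1-b1))*(x 1-0)+ -(a1*b2-a2*b1)*(x 2-h))/(h*((a1*b2-a2*b1)+(b1*c2-b2*c1)+(c1*a2-c2*a1))) := ⟨_, rfl⟩
  obtain ⟨δ, hδ⟩ : ∃ δ, δ = x 2 / h := ⟨_, rfl⟩
  have α0 : 0 ≤ α := by rw [hα]; exact div_nonneg h3 hk.le
  have β0 : 0 ≤ β := by rw [hβ]; exact div_nonneg h4 hk.le
  have γ0 : 0 ≤ γ := by rw [hγ]; exact div_nonneg h2 hk.le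
  have δ0 : 0 ≤ δ := by rw [hδ]; exact div_nonneg z0 hp.le
  rw [eq_div_iff hk.ne'] at hα hβ hγ
  rw [eq_div_iff hp.ne'] at hδ
  refine mem_TT (w0 := α) (w1 := β) (w2 := γ) (w3 := δ) α0 β0 γ0 δ0 ?_ ?_ ?_ ?_
  · apply mul_left_cancel₀ hk.ne'
    linear_combination hα + hβ + hγ + ((a1*b2-a2*b1)+(b1*c2-b2*c1)+(c1*a2-c2*a1))*hδ
  · apply mul_left_cancel₀ hk.ne'
    linear_combination (-a1)*hα - b1*hβ - c1*hγ
  · apply mul_left_cancel₀ hk.ne'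
    linear_combination (-a2)*hα - b2*hβ - c2*hγ
  · linarith

theorem aed {X Y : E3} {r s : ℝ} (hr : r ≠ 0) (h : r + s ≤ dist X Y) (U V : Set E3) :
    AEDisjoint volume (closedBall X r ∩ U) (closedBall Y s ∩ V) := by
  apply measure_mono_null (t := sphere X r) _ (Measure.addHaar_sphere_of_ne_zero _ _ hr)
  rintro x ⟨⟨h1, _⟩, ⟨h2, _⟩⟩
  rw [mem_closedBall] at h1 h2
  have := dist_triangle_left X Y x
  rw [mem_sphere]; linarith

theorem vol_lower {a1 a2 b1 b2 c1 c2 : ℝ} (K : 0 < (a1*b2-a2*b1)+(b1*c2-b2*c1)+(c1*a2-c2*a1))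
    (eab : 4 ≤ (a1-b1)^2+(a2-b2)^2) (eca : (c1-a1)^2+(c2-a2)^2 = 4) (ebc : (b1-c1)^2+(b2-c2)^2 = 4)
    (eab' : (a1-b1)^2+(a2-b2)^2 ≤ 8)
    (na : a1^2+a2^2+rr^2=2) (nb : b1^2+b2^2+rr^2=2) (nc : c1^2+c2^2+rr^2=2) :
    SV a1 a2 b1 b2 c1 c2 rr ≤ volume.real (TT a1 a2 b1 b2 c1 c2 rr ∩ UU a1 a2 b1 b2 c1 c2 rr) := by
  have hp : 0 < rr := by linarith [rr_b.1]
  have hA := vtx_sub hp K (by linarith) (by linarith) (by linarith) na nb nc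
  have hB := vtx_sub (a1 := b1) (a2 := b2) (b1 := c1) (b2 := c2) (c1 := a1) (c2 := a2) hp (by linarith)
    (by linarith) (by linarith) (by linarith) nb nc na
  have hC := vtx_sub (a1 := c1) (a2 := c2) (b1 := a1) (b2 := a2) (c1 := b1) (c2 := b2) hp (by linarith)
    (by linarith) (by linarith) (by linarith) nc na nb
  rw [← TT_rot] at hB
  rw [TT_rot] at hC
  have hD := D_sub K
  have fin : ∀ (X : E3) (r : ℝ) (s : Set E3), volume (closedBall X r ∩ s) ≠ ⊤ := fun X r s =>
    ((measure_mono Set.inter_subset_left).trans_lt measure_closedBall_lt_top).ne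
  have hsm : ∀ n X : E3, MeasurableSet {x : E3 | 0 ≤ inner ℝ n (x - X)} := fun n X =>
    measurableSet_le (by fun_prop) (by fun_prop)
  have cV : ∀ a1 a2 b1 b2 c1 c2 h : ℝ, MeasurableSet (coneV a1 a2 b1 b2 c1 c2 h) := fun a1 a2 b1 b2 c1 c2 h =>
    (hsm _ _).inter ((hsm _ _).inter (hsm _ _))
  have cD : ∀ a1 a2 b1 b2 c1 c2 h : ℝ, MeasurableSet (coneD a1 a2 b1 b2 c1 c2 h) := fun a1 a2 b1 b2 c1 c2 h =>
    (hsm _ _).inter ((hsm _ _).inter (hsm _ _))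
  have rs : rr^2+2*rr = 1 := by linarith [rr_sq]
  have dd : ∀ {x1 x2 x3 y1 y2 y3 t : ℝ}, t^2 ≤ (x1-y1)^2+(x2-y2)^2+(x3-y3)^2 → t ≤ dist (!₂[x1,x2,x3] : E3) !₂[y1,y2,y3] := by
    intro x1 x2 x3 y1 y2 y3 t ht
    rw [dist_eq_norm, sub3, norm3]
    exact Real.le_sqrt_of_sq_le ht
  have e : (closedBall (!₂[a1,a2,0] : E3) 1 ∩ coneV a1 a2 b1 b2 c1 c2 rr)
  ∪ (closedBall (!₂[b1,b2,0] : E3) 1 ∩ coneV b1 b2 c1 c2 a1 a2 rr)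
  ∪ (closedBall (!₂[c1,c2,0] : E3) 1 ∩ coneV c1 c2 a1 a2 b1 b2 rr)
  ∪ (closedBall (!₂[0,0,rr] : E3) rr ∩ coneD a1 a2 b1 b2 c1 c2 rr) ⊆ TT a1 a2 b1 b2 c1 c2 rr ∩ UU a1 a2 b1 b2 c1 c2 rr := by
    rintro x (((h2 | h2) | h2) | h2)
    · exact ⟨hA h2, Or.inl (Or.inl (Or.inl h2.1))⟩
    · exact ⟨hB h2, Or.inl (Or.inl (Or.inr h2.1))⟩
    · exact ⟨hC h2, Or.inl (Or.inr h2.1)⟩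
    · exact ⟨hD h2, Or.inr h2.1⟩
  refine le_trans (le_of_eq ?_) (measureReal_mono e ?_)
  · unfold SV
    have dAB := aed (X := !₂[a1,a2,0]) (Y := !₂[b1,b2,0]) one_ne_zero (s := 1) (dd (by linarith)) (coneV a1 a2 b1 b2 c1 c2 rr) (coneV b1 b2 c1 c2 a1 a2 rr)
    have dAC := aed (X := !₂[a1,a2,0]) (Y := !₂[c1,c2,0]) one_ne_zero (s := 1) (dd (by linarith)) (coneV a1 a2 b1 b2 c1 c2 rr) (coneV c1 c2 a1 a2 b1 b2 rr)
    have dBC := aed (X := !₂[b1,b2,0]) (Y := !₂[c1,c2,0]) one_ne_zero (s := 1) (dd (by linarith)) (coneV b1 b2 c1 c2 a1 a2 rr) (coneV c1 c2 a1 a2 b1 b2 rr)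
    have dAD := aed (X := !₂[a1,a2,0]) (Y := !₂[0,0,rr]) one_ne_zero (s := rr) (dd (by linarith)) (coneV a1 a2 b1 b2 c1 c2 rr) (coneD a1 a2 b1 b2 c1 c2 rr)
    have dBD := aed (X := !₂[b1,b2,0]) (Y := !₂[0,0,rr]) one_ne_zero (s := rr) (dd (by linarith)) (coneV b1 b2 c1 c2 a1 a2 rr) (coneD a1 a2 b1 b2 c1 c2 rr)
    have dCD := aed (X := !₂[c1,c2,0]) (Y := !₂[0,0,rr]) one_ne_zero (s := rr) (dd (by linarith)) (coneV c1 c2 a1 a2 b1 b2 rr) (coneD a1 a2 b1 b2 c1 c2 rr)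
    rw [measureReal_union₀ (measurableSet_closedBall.inter (cD _ _ _ _ _ _ _)).nullMeasurableSet ((dAD.union_left dBD).union_left dCD)
        (measure_union_ne_top (measure_union_ne_top (fin _ _ _) (fin _ _ _)) (fin _ _ _)) (fin _ _ _),
      measureReal_union₀ (measurableSet_closedBall.inter (cV _ _ _ _ _ _ _)).nullMeasurableSet (dAC.union_left dBC)
        (measure_union_ne_top (fin _ _ _) (fin _ _ _)) (fin _ _ _),
      measureReal_union₀ (measurableSet_closedBall.inter (cV _ _ _ _ _ _ _)).nullMeasurableSet dAB (fin _ _ _) (fin _ _ _)]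
  · unfold UU
    refine ((measure_mono Set.inter_subset_right).trans_lt ?_).ne
    have f : ∀ (X : E3) (r : ℝ), volume (closedBall X r) ≠ ⊤ := fun X r => measure_closedBall_lt_top.ne
    exact (measure_union_ne_top (measure_union_ne_top (measure_union_ne_top (f _ _) (f _ _)) (f _ _)) (f _ _)).lt_top

theorem Len_of {p1 p2 q1 q2 t : ℝ} (ht : 0 ≤ t) (h : (p1-q1)^2+(p2-q2)^2 = t^2) : Len p1 p2 q1 q2 = t := by
  unfold Len; rw [h, Real.sqrt_sq ht]

theorem xs_sq : xs^2 * rho^2 = 4 * dt^2 := by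
  have : rho ≠ 0 := by linarith [rho_b.1]
  unfold xs; field_simp; ring

structure T0c (a1 a2 b1 b2 c1 c2 h : ℝ) : Prop where
  hp : 0 < h
  K : 0 < (a1*b2-a2*b1)+(b1*c2-b2*c1)+(c1*a2-c2*a1)
  eab : (a1-b1)^2+(a2-b2)^2 = (2*xs)^2
  ebc : (b1-c1)^2+(b2-c2)^2 = 4
  eca : (c1-a1)^2+(c2-a2)^2 = 4
  na : a1^2+a2^2+h^2 = 2
  nb : b1^2+b2^2+h^2 = 2
  nc : c1^2+c2^2+h^2 = 2

theorem T0c.par {a1 a2 b1 b2 c1 c2 h : ℝ} (H : T0c a1 a2 b1 b2 c1 c2 h) :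
    h = rr ∧ b1*c2-b2*c1 = 2*dt ∧ c1*a2-c2*a1 = 2*dt ∧ a1*b2-a2*b1 = 2*xs*ds := by
  obtain ⟨hp, K, eab, ebc, eca, na, nb, nc⟩ := H
  obtain ⟨N, hN⟩ : ∃ N, N = a1^2+a2^2 := ⟨_, rfl⟩
  have Nb : b1^2+b2^2 = N := by linarith
  have Nc : c1^2+c2^2 = N := by linarith
  have iab : a1*b1+a2*b2 = N - 2*xs^2 := by linarith
  have ibc : b1*c1+b2*c2 = N - 2 := by linarith
  have ica : a1*c1+a2*c2 = N - 2 := by linarith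
  obtain ⟨q1, hq1⟩ : ∃ q, q = b1*c2-b2*c1 := ⟨_, rfl⟩
  obtain ⟨q2, hq2⟩ : ∃ q, q = c1*a2-c2*a1 := ⟨_, rfl⟩
  obtain ⟨p, hpp⟩ : ∃ q, q = a1*b2-a2*b1 := ⟨_, rfl⟩
  have r1 : q1*N+q2*(N-2*xs^2)+p*(N-2) = 0 := by
    rw [← iab, ← ica, hN, hq1, hq2, hpp]; ring
  have r2 : q1*(N-2*xs^2)+q2*N+p*(N-2) = 0 := by
    rw [← iab, ← ibc, ← Nb, hq1, hq2, hpp]; ring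
  have r3 : q1*(N-2)+q2*(N-2)+p*N = 0 := by
    have : q1*(a1*c1+a2*c2)+q2*(b1*c1+b2*c2)+p*(c1^2+c2^2) = 0 := by rw [hq1, hq2, hpp]; ring
    rw [ica, ibc, Nc] at this; exact this
  have r4 : q1^2 = 4*N-4 := by
    have : q1^2 = (b1^2+b2^2)*(c1^2+c2^2)-(b1*c1+b2*c2)^2 := by rw [hq1]; ring
    rw [this, Nb, Nc, ibc]; ring
  rw [← hq1, ← hq2, ← hpp] at K ⊢
  have hh : h^2 = 2 - N := by linarith
  clear hq1 hq2 hpp iab ibc ica Nb Nc na nb nc eab ebc eca hN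
  have x0 : 0 < xs := by linarith [xs_b.1]
  have e : q2 = q1 := by
    have : (q1-q2)*(2*xs^2) = 0 := by linear_combination r1 - r2
    rcases mul_eq_zero.mp this with h | h
    · linarith
    · exact absurd h (by positivity)
  subst e
  have k : q2*(N*(4-xs^2)-4) = 0 := by linear_combination (N/2)*r1 - ((N-2)/2)*r3
  have N2 : N < 2 := by have : 0 < h^2 := by positivity
                        linarith
  have hq : q2 ≠ 0 := by
    rintro rfl
    have : 0 < p := by linarith
    have : p*(2-N) = 0 := by linarith
    rcases mul_eq_zero.mp this with h | h <;> linarith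
  have k2 : N*(4-xs^2) = 4 := by
    rcases mul_eq_zero.mp k with h | h
    · exact absurd h hq
    · linarith
  have rho0 : 0 < rho := by linarith [rho_b.1]
  have hN : N = rho^2 := by
    have h1 := xs_sq
    have h2 : rho^2*(4-xs^2) = 4 := by rw [mul_sub, mul_comm _ (xs^2), h1, rho_sq, dt_sq]; ring
    have h3 : (N-rho^2)*(4-xs^2) = 0 := by linear_combination k2 - h2
    rcases mul_eq_zero.mp h3 with h | h
    · linarith
    · rw [h] at h2; norm_num at h2
  have hr : h = rr := by
    have : h^2 = rr^2 := by rw [hh, hN, rho_sq, rr_sq]; ring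
    exact (sq_eq_sq₀ hp.le (by linarith [rr_b.1])).mp this
  have d0 : 0 < dt := by linarith [dt_b.1]
  have N0 : 0 < N := by rw [hN]; positivity
  have q0 : 0 < q2 := by
    have : q2*4 = N*(q2+p+q2) := by linear_combination (-1)*r3
    have : 0 < q2*4 := by rw [this]; apply mul_pos N0; linarith
    linarith
  have qe : q2 = 2*dt := by
    have : q2^2 = (2*dt)^2 := by rw [r4, hN, mul_pow, dt_sq, rho_sq]; ring
    exact (sq_eq_sq₀ q0.le (by positivity)).mp this
  refine ⟨hr, qe, qe, ?_⟩
  have : p*N = 2*q2*h^2 := by rw [hh]; linear_combination r3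
  rw [hN, hr, qe] at this
  apply mul_right_cancel₀ (b := rho^2) (by positivity)
  rw [this]; unfold xs ds; field_simp

theorem T0c.edge {p1 p2 q1 q2 h t u : ℝ} (ht : 0 < t) (e : (p1-q1)^2+(p2-q2)^2 = (2*t)^2) (hp : p1^2+p2^2+h^2 = 2)
    (hq : q1^2+q2^2+h^2 = 2) (hu : p1*q2-p2*q1 = 2*t*u) : dE p1 p2 q1 q2 = u ∧ xE p1 p2 q1 q2 = t ∧ xE q1 q2 p1 p2 = t := by
  have l := Len_of (by positivity : 0 ≤ 2*t) e
  refine ⟨?_, ?_, ?_⟩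
  · unfold dE; rw [l, hu]; field_simp
  · unfold xE; rw [l, div_eq_iff (by positivity)]; linarith
  · unfold xE; rw [Len_symm, l, div_eq_iff (by positivity)]; linarith

theorem coord_main {a1 a2 b1 b2 c1 c2 h o1 o2 o3 R : ℝ} (H : Conf a1 a2 b1 b2 c1 c2 h o1 o2 o3 R)
    {a1' a2' b1' b2' c1' c2' h' : ℝ} (H' : T0c a1' a2' b1' b2' c1' c2' h') :
    volume.real (TT a1 a2 b1 b2 c1 c2 h ∩ UU a1 a2 b1 b2 c1 c2 h) / volume.real (TT a1 a2 b1 b2 c1 c2 h) ≤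
    volume.real (TT a1' a2' b1' b2' c1' c2' h' ∩ UU a1' a2' b1' b2' c1' c2' h') / volume.real (TT a1' a2' b1' b2' c1' c2' h') := by
  obtain ⟨rfl, u1, u2, u3⟩ := H'.par
  have x0 : 0 < xs := by linarith [xs_b.1]
  obtain ⟨d3, x3, y3⟩ := T0c.edge x0 H'.eab H'.na H'.nb u3
  obtain ⟨d1, x1, y1⟩ := T0c.edge (t := 1) one_pos (by rw [H'.ebc]; norm_num) H'.nb H'.nc (by rw [u1]; ring : _ = 2*1*dt)
  obtain ⟨d2, x2, y2⟩ := T0c.edge (t := 1) one_pos (by rw [H'.eca]; norm_num) H'.nc H'.na (by rw [u2]; ring : _ = 2*1*dt)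
  have xq : 4 ≤ (2*xs)^2 ∧ (2*xs)^2 ≤ 8 := by
    have := xs_b
    constructor <;> nlinarith
  have P' : Pos a1' a2' b1' b2' c1' c2' rr := ⟨H'.hp, H'.K, by rw [H'.eab]; exact xq.1, H'.ebc.ge, H'.eca.ge,
    by rw [x3]; exact x0, by rw [y3]; exact x0, by rw [x1]; exact one_pos, by rw [y1]; exact one_pos,
    by rw [x2]; exact one_pos, by rw [y2]; exact one_pos⟩
  have C := H.cfg
  have P : Pos a1 a2 b1 b2 c1 c2 h := ⟨H.hp, H.K, H.eab, H.ebc, H.eca, by linarith [C.x3p], by linarith [C.y3p],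
    by linarith [C.x1p], by linarith [C.y1p], by linarith [C.x2p], by linarith [C.y2p]⟩
  have up := vol_upper H.hp H.K
  have lo := vol_lower H'.K (by rw [H'.eab]; exact xq.1) H'.eca H'.ebc (by rw [H'.eab]; exact xq.2) H'.na H'.nb H'.nc
  have k := mul_pos H.hp H.K
  have k' := mul_pos H'.hp H'.K
  have fin := fun δ (h0 : FF δ rr dt 1 1 dt 1 1 ds xs xs = 0) => H.final h0
  have s := P.sum
  have s' := P'.sum
  rw [d1, x1, y1, d2, x2, y2, d3, x3, y3] at s'
  rw [show volume.real (TT a1 a2 b1 b2 c1 c2 h) = _ from vol_tetra a1 a2 b1 b2 c1 c2 h,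
    show volume.real (TT a1' a2' b1' b2' c1' c2' rr) = _ from vol_tetra a1' a2' b1' b2' c1' c2' rr, abs_of_pos k, abs_of_pos k']
  generalize h*((a1*b2-a2*b1)+(b1*c2-b2*c1)+(c1*a2-c2*a1)) = W at *
  generalize rr*((a1'*b2'-a2'*b1')+(b1'*c2'-b2'*c1')+(c1'*a2'-c2'*a1')) = W' at *
  have f0 : FF (6 * SV a1' a2' b1' b2' c1' c2' rr / W') rr dt 1 1 dt 1 1 ds xs xs = 0 := by
    have := s' (6 * SV a1' a2' b1' b2' c1' c2' rr / W')
    have e : 6 * SV a1' a2' b1' b2' c1' c2' rr / W'/2*W' = 3*SV a1' a2' b1' b2' c1' c2' rr := by field_simp; ring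
    rw [e] at this; linarith
  have f1 := fin _ f0
  have f2 := s (6 * SV a1' a2' b1' b2' c1' c2' rr / W')
  have kk : 0 ≤ kT := measureReal_nonneg
  rw [← div_div, ← div_div]
  apply div_le_div_of_nonneg_right _ kk
  calc _ ≤ SV a1 a2 b1 b2 c1 c2 h / W := by gcongr
    _ ≤ SV a1' a2' b1' b2' c1' c2' rr / W' := by
      rw [div_le_iff₀ k]
      have e : 6 * SV a1' a2' b1' b2' c1' c2' rr / W'/2*W = 3*(SV a1' a2' b1' b2' c1' c2' rr / W' * W) := by ring
      rw [e] at f2; linarith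
    _ ≤ _ := by gcongr

theorem li3 {A B C D : E3} (h : AffineIndependent ℝ ![A, B, C, D]) {x y z w : ℝ} (hs : x + y + z + w = 0)
    (e : x • A + y • B + z • C + w • D = 0) : x = 0 ∧ y = 0 ∧ z = 0 ∧ w = 0 := by
  have := affineIndependent_iff.mp h Finset.univ ![x,y,z,w] (by simp [Fin.sum_univ_four, hs]) (by simpa [Fin.sum_univ_four] using e)
  have h0 := this 0 (by simp)
  have h1 := this 1 (by simp)
  have h2 := this 2 (by simp)
  have h3 := this 3 (by simp)
  simp at h0 h1 h2 h3
  exact ⟨h0, h1, h2, h3⟩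

theorem exists_u {A B C D : E3} (h : AffineIndependent ℝ ![A, B, C, D]) :
    ∃ u : E3, ‖u‖ = 1 ∧ inner ℝ u (B - A) = 0 ∧ inner ℝ u (C - A) = 0 ∧ 0 < inner ℝ u (D - A) := by
  let U : Submodule ℝ E3 := Submodule.span ℝ {B - A, C - A}
  have hD : D - A ∉ U := by
    intro hh
    obtain ⟨s, t, e⟩ := Submodule.mem_span_pair.mp hh
    have := li3 h (x := 1-s-t) (y := s) (z := t) (w := -1) (by ring) (by
      have : (1-s-t) • A + s • B + t • C + (-1:ℝ) • D = (s • (B - A) + t • (C - A)) - (D - A) := by module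
      rw [this, e, sub_self])
    linarith [this.2.2.2]
  let u0 := (D - A) - U.starProjection (D - A)
  have hu : u0 ∈ Uᗮ := U.sub_starProjection_mem_orthogonal (D - A)
  have hne : u0 ≠ 0 := by
    intro h0
    apply hD
    rw [sub_eq_zero.mp h0]
    exact U.starProjection_apply_mem _
  have i0 : ∀ v ∈ U, inner ℝ u0 v = 0 := fun v hv => by
    rw [real_inner_comm]; exact hu v hv
  have i1 : inner ℝ u0 (D - A) = ‖u0‖^2 := by
    have : D - A = u0 + U.starProjection (D - A) := by simp [u0]
    rw [this, inner_add_right, i0 _ (U.starProjection_apply_mem _), add_zero, real_inner_self_eq_norm_sq]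
  have n0 : 0 < ‖u0‖ := norm_pos_iff.mpr hne
  refine ⟨‖u0‖⁻¹ • u0, ?_, ?_, ?_, ?_⟩
  · rw [norm_smul, norm_inv, norm_norm, inv_mul_cancel₀ n0.ne']
  · rw [real_inner_smul_left, i0 _ (Submodule.subset_span (by simp)), mul_zero]
  · rw [real_inner_smul_left, i0 _ (Submodule.subset_span (by simp)), mul_zero]
  · rw [real_inner_smul_left, i1]; positivity

theorem eta3 (x : E3) : x = !₂[x 0, x 1, x 2] := by ext i; fin_cases i <;> simp

theorem frame0 {A B C D : E3} (H : AffineIndependent ℝ ![A, B, C, D]) :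
    ∃ (f : E3 ≃ₗᵢ[ℝ] E3) (P : E3) (a1 a2 b1 b2 c1 c2 h : ℝ), 0 < h ∧ f (A - P) = !₂[a1,a2,0] ∧ f (B - P) = !₂[b1,b2,0] ∧
      f (C - P) = !₂[c1,c2,0] ∧ f (D - P) = !₂[0,0,h] := by
  obtain ⟨u, hu, hB, hC, hD⟩ := exists_u H
  have horth : Orthonormal ℝ (Set.domRestrict ({2} : Set (Fin 3)) ![0, 0, u]) := by
    constructor
    · rintro ⟨i, hi⟩
      rcases hi with rfl
      simpa using hu
    · rintro ⟨i, hi⟩ ⟨j, hj⟩ hij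
      rcases hi with rfl
      rcases hj with rfl
      exact absurd rfl hij
  obtain ⟨e, he⟩ := horth.exists_orthonormalBasis_extension_of_card_eq (by simp)
  have e2 : e 2 = u := by simpa using he 2 (by simp)
  have uu : inner ℝ u u = 1 := by rw [real_inner_self_eq_norm_sq, hu, one_pow]
  have z : ∀ x : E3, inner ℝ u (x - A) = 0 → e.repr (x - (D - inner ℝ u (D - A) • u)) =
      !₂[e.repr (x - (D - inner ℝ u (D - A) • u)) 0, e.repr (x - (D - inner ℝ u (D - A) • u)) 1, 0] := by
    intro x hx
    have : e.repr (x - (D - inner ℝ u (D - A) • u)) 2 = 0 := by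
      rw [e.repr_apply_apply, e2]
      have : x - (D - inner ℝ u (D - A) • u) = (x - A) - (D - A) + inner ℝ u (D - A) • u := by abel
      rw [this, inner_add_right, inner_sub_right, inner_smul_right, uu, hx]; ring
    nth_rewrite 1 [eta3 (e.repr (x - (D - inner ℝ u (D - A) • u)))]
    rw [this]
  refine ⟨e.repr, D - inner ℝ u (D - A) • u, _, _, _, _, _, _, inner ℝ u (D - A), hD, z A (by simp), z B hB, z C hC, ?_⟩
  rw [sub_sub_cancel, map_smul, ← e2, e.repr_self]
  ext i; fin_cases i <;> simp

theorem frame3 {A B C D : E3} (H : AffineIndependent ℝ ![A, B, C, D]) :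
    ∃ (f : E3 ≃ₗᵢ[ℝ] E3) (P : E3) (a1 a2 b1 b2 c1 c2 h : ℝ), 0 < h ∧ 0 < (a1*b2-a2*b1)+(b1*c2-b2*c1)+(c1*a2-c2*a1) ∧
      f (A - P) = !₂[a1,a2,0] ∧ f (B - P) = !₂[b1,b2,0] ∧ f (C - P) = !₂[c1,c2,0] ∧ f (D - P) = !₂[0,0,h] := by
  obtain ⟨f, P, a1, a2, b1, b2, c1, c2, h, hp, hA, hB, hC, hD⟩ := frame0 H
  have key : (a1*b2-a2*b1)+(b1*c2-b2*c1)+(c1*a2-c2*a1) ≠ 0 := by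
    intro hS
    have dep : ∀ x y z : ℝ, x + y + z = 0 → x*a1+y*b1+z*c1 = 0 → x*a2+y*b2+z*c2 = 0 → x = 0 ∧ y = 0 ∧ z = 0 := by
      intro x y z h1 h2 h3
      have := li3 H (x := x) (y := y) (z := z) (w := 0) (by linarith) (by
        have e : x • A + y • B + z • C + (0:ℝ) • D = x • (A - P) + y • (B - P) + z • (C - P) := by
          have : x • (A - P) + y • (B - P) + z • (C - P) = x • A + y • B + z • C - (x+y+z) • P := by module
          rw [this, h1]; simp
        rw [e]
        apply f.injective
        rw [map_add, map_add, map_smul, map_smul, map_smul, hA, hB, hC, map_zero]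
        ext i; fin_cases i <;> simp [h2, h3])
      exact ⟨this.1, this.2.1, this.2.2.1⟩
    have k1 := dep (b1-c1) (c1-a1) (a1-b1) (by ring) (by ring) (by linear_combination (-1)*hS)
    have k2 := dep (b2-c2) (c2-a2) (a2-b2) (by ring) (by linear_combination hS) (by ring)
    have k3 := dep 1 (-1) 0 (by ring) (by linarith [k1.2.2]) (by linarith [k2.2.2])
    exact one_ne_zero k3.1
  rcases lt_or_gt_of_ne key with hS | hS
  · let g : E3 ≃ₗᵢ[ℝ] E3 := LinearIsometryEquiv.piLpCongrLeft 2 ℝ ℝ (Equiv.swap (0 : Fin 3) 1)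
    have hg : ∀ x y z : ℝ, g !₂[x,y,z] = !₂[y,x,z] := by
      intro x y z
      ext i; fin_cases i <;> simp [g, LinearIsometryEquiv.piLpCongrLeft_apply, Equiv.piCongrLeft', Equiv.swap_apply_of_ne_of_ne]
    refine ⟨f.trans g, P, a2, a1, b2, b1, c2, c1, h, hp, by linarith, ?_, ?_, ?_, ?_⟩
    · rw [LinearIsometryEquiv.trans_apply, hA, hg]
    · rw [LinearIsometryEquiv.trans_apply, hB, hg]
    · rw [LinearIsometryEquiv.trans_apply, hC, hg]
    · rw [LinearIsometryEquiv.trans_apply, hD, hg]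
  · exact ⟨f, P, a1, a2, b1, b2, c1, c2, h, hp, hS, hA, hB, hC, hD⟩

theorem vol_frame (f : E3 ≃ₗᵢ[ℝ] E3) (P : E3) (s : Set E3) : volume.real ((fun x => f (x - P)) '' s) = volume.real s := by
  have e : (fun x => f (x - P)) '' s = f.symm ⁻¹' ((fun x => x + P) ⁻¹' s) := by
    ext y
    constructor
    · rintro ⟨x, hx, rfl⟩; simpa using hx
    · intro hy
      exact ⟨_, hy, by simp⟩
  rw [e, measureReal_def, f.symm.measurePreserving.measure_preimage_emb f.symm.toHomeomorph.measurableEmbedding,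
    measure_preimage_add_right, ← measureReal_def]

theorem density_frame {A B C D P : E3} {f : E3 ≃ₗᵢ[ℝ] E3} {a1 a2 b1 b2 c1 c2 h : ℝ} (hA : f (A - P) = !₂[a1,a2,0])
    (hB : f (B - P) = !₂[b1,b2,0]) (hC : f (C - P) = !₂[c1,c2,0]) (hD : f (D - P) = !₂[0,0,h]) :
    density A B C D 1 1 1 rr =
      volume.real (TT a1 a2 b1 b2 c1 c2 h ∩ UU a1 a2 b1 b2 c1 c2 h) / volume.real (TT a1 a2 b1 b2 c1 c2 h) := by
  have hT : (fun x => f (x - P)) '' (tetra A B C D) = TT a1 a2 b1 b2 c1 c2 h := by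
    have e : (fun x => f (x - P)) = (f.toLinearEquiv.toLinearMap.toAffineMap).comp (AffineEquiv.constVAdd ℝ E3 (-P)).toAffineMap := by
      ext x; simp [sub_eq_neg_add]
    rw [tetra, e, AffineMap.image_convexHull, ← e, TT]
    simp only [Set.image_insert_eq, Set.image_singleton, hA, hB, hC, hD]
  have hb : ∀ (X : E3) (r : ℝ), (fun x => f (x - P)) '' closedBall X r = closedBall (f (X - P)) r := by
    intro X r
    exact ((IsometryEquiv.subRight P).trans f.toIsometryEquiv).image_closedBall X r
  have inj : Function.Injective (fun x => f (x - P)) := fun x y hxy => by simpa using hxy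
  have hU : (fun x => f (x - P)) '' (tetra A B C D ∩ (closedBall A 1 ∪ closedBall B 1 ∪ closedBall C 1 ∪ closedBall D rr)) =
      TT a1 a2 b1 b2 c1 c2 h ∩ UU a1 a2 b1 b2 c1 c2 h := by
    rw [Set.image_inter inj, hT, Set.image_union, Set.image_union, Set.image_union, hb, hb, hb, hb, hA, hB, hC, hD, UU]
  rw [← hU, ← hT, vol_frame, vol_frame]
  rfl

theorem dist_frame {f : E3 ≃ₗᵢ[ℝ] E3} {X Y P : E3} {x1 x2 x3 y1 y2 y3 : ℝ} (hX : f (X - P) = !₂[x1,x2,x3])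
    (hY : f (Y - P) = !₂[y1,y2,y3]) : dist X Y ^ 2 = (x1-y1)^2+(x2-y2)^2+(x3-y3)^2 := by
  rw [← dist_sub_right X Y P, ← f.dist_map, hX, hY, dist_eq_norm, sub3, norm3_sq]

theorem two_xs : 4 * √(2 * (√2 - 1) / (1 + 2 * (√2 - 1))) = 2 * xs := by
  have h : √(2 * (√2 - 1) / (1 + 2 * (√2 - 1))) = dt / rho := by
    rw [show (2 * (√2 - 1) / (1 + 2 * (√2 - 1))) = (dt/rho)^2 by rw [div_pow, dt_sq, rho_sq]; rfl]
    apply Real.sqrt_sq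
    have := dt_b.1
    have := rho_b.1
    positivity
  rw [h]; unfold xs; ring

/-- The densest FM-tetrahedron of type 111r has five tight edges and one stretched
11-edge of length L' = 4·√(2r/(1+2r)). -/
theorem densest_111r
    (A B C D A₀ B₀ C₀ D₀ : EuclideanSpace ℝ (Fin 3))
    (haff : AffineIndependent ℝ ![A, B, C, D])
    (hAB : 2 ≤ dist A B) (hAC : 2 ≤ dist A C) (hBC : 2 ≤ dist B C)
    (hAD : 1 + (Real.sqrt 2 - 1) ≤ dist A D) (hBD : 1 + (Real.sqrt 2 - 1) ≤ dist B D)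
    (hCD : 1 + (Real.sqrt 2 - 1) ≤ dist C D)
    (hsupp : ∃ O : EuclideanSpace ℝ (Fin 3), ∃ R : ℝ, 0 < R ∧ R ≤ Real.sqrt 2 - 1 ∧
      dist O A = 1 + R ∧ dist O B = 1 + R ∧ dist O C = 1 + R ∧
      dist O D = (Real.sqrt 2 - 1) + R)
    (haff₀ : AffineIndependent ℝ ![A₀, B₀, C₀, D₀])
    (hAB₀ : dist A₀ B₀ =
      4 * Real.sqrt (2 * (Real.sqrt 2 - 1) / (1 + 2 * (Real.sqrt 2 - 1))))
    (hAC₀ : dist A₀ C₀ = 2) (hBC₀ : dist B₀ C₀ = 2)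
    (hAD₀ : dist A₀ D₀ = 1 + (Real.sqrt 2 - 1)) (hBD₀ : dist B₀ D₀ = 1 + (Real.sqrt 2 - 1))
    (hCD₀ : dist C₀ D₀ = 1 + (Real.sqrt 2 - 1)) :
    density A B C D 1 1 1 (Real.sqrt 2 - 1) ≤
      density A₀ B₀ C₀ D₀ 1 1 1 (Real.sqrt 2 - 1) := by
  obtain ⟨O, R, hR, hR', oA, oB, oC, oD⟩ := hsupp
  obtain ⟨f, P, a1, a2, b1, b2, c1, c2, h, hp, K, hA, hB, hC, hD⟩ := frame3 haff
  obtain ⟨f', P', a1', a2', b1', b2', c1', c2', h', hp', K', hA', hB', hC', hD'⟩ := frame3 haff₀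
  have d1 : density A B C D 1 1 1 (√2 - 1) = _ := density_frame hA hB hC hD
  have d2 : density A₀ B₀ C₀ D₀ 1 1 1 (√2 - 1) = _ := density_frame hA' hB' hC' hD'
  rw [d1, d2]
  have hO := eta3 (f (O - P))
  have rs : (1 + (√2 - 1))^2 = 2 := by
    rw [add_sub_cancel]; exact Real.sq_sqrt (by norm_num)
  rw [two_xs] at hAB₀
  have sq4 : ∀ {t : ℝ}, 2 ≤ t → 4 ≤ t^2 := fun ht => by
    have := pow_le_pow_left₀ (by norm_num) ht 2
    linarith
  have sq2 : ∀ {t : ℝ}, 1 + (√2 - 1) ≤ t → 2 ≤ t^2 := fun ht => by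
    have := pow_le_pow_left₀ (by rw [add_sub_cancel]; positivity) ht 2
    linarith
  apply coord_main (o1 := f (O - P) 0) (o2 := f (O - P) 1) (o3 := f (O - P) 2) (R := R)
  · have mAB := dist_frame hA hB
    have mBC := dist_frame hB hC
    have mAC := dist_frame hA hC
    have mAD := dist_frame hA hD
    have mBD := dist_frame hB hD
    have mCD := dist_frame hC hD
    have mA := dist_frame hO hA
    have mB := dist_frame hO hB
    have mC := dist_frame hO hC
    have mD := dist_frame hO hD
    rw [oA] at mA
    rw [oB] at mB
    rw [oC] at mC
    rw [oD] at mD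
    have qAB := sq4 hAB
    have qBC := sq4 hBC
    have qAC := sq4 hAC
    have qAD := sq2 hAD
    have qBD := sq2 hBD
    have qCD := sq2 hCD
    exact {
      hp := hp
      K := K
      eab := by linarith
      ebc := by linarith
      eca := by linarith
      sa := by linarith
      sb := by linarith
      sc := by linarith
      oa := by linarith
      ob := by linarith
      oc := by linarith
      od := by unfold rr; linarith
      R0 := hR
      R1 := hR' }
  · have mAB := dist_frame hA' hB'
    have mBC := dist_frame hB' hC'
    have mAC := dist_frame hA' hC'
    have mAD := dist_frame hA' hD'
    have mBD := dist_frame hB' hD'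
    have mCD := dist_frame hC' hD'
    rw [hAB₀] at mAB
    rw [hBC₀] at mBC
    rw [hAC₀] at mAC
    rw [hAD₀, rs] at mAD
    rw [hBD₀, rs] at mBD
    rw [hCD₀, rs] at mCD
    exact {
      hp := hp'
      K := K'
      eab := by linarith
      ebc := by linarith
      eca := by linarith
      na := by linarith
      nb := by linarith
      nc := by linarith }
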